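/- Let u = (u_j)_{j≥0} and v = (v_j)_{j≥0} be strictly increasing real sequences such that the collection { −(u_0,u_j] − [v_j,v_{j+1}) : j ≥ 1 } can be split into a finite number of subcollections whose intervals are pairwise disjoint, and assume in addition that the sequence (v_j) is Littlewood–Paley. Then for every triple of exponents with 1 < p₁, p₂ < ∞, 2 ≤ p₃ < ∞ and 1/p₁ + 1/p₂ + 1/p₃ = 1, there exists a finite constant C = C(p₁,p₂,u,v) such that ‖B_{m̃_{u,v}}(f,g)‖_{L^{p₃'}(ℝ)} ≤ C ‖f‖_{L^{p₁}(ℝ)} ‖g‖_{L^{p₂}(ℝ)} for all Schwartz functions f, g on ℝ. -/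

import Mathlib

open MeasureTheory Set
open scoped ENNReal NNReal

noncomputable section

/-- The character `e^{2π i t x}`. -/
def eChar (t x : ℝ) : ℂ := Complex.exp (2 * Real.pi * Complex.I * t * x)

/-- The Fourier transform `f̂(ξ) = ∫ f(x) e^{-2π i ξ x} dx`. -/
def fourierT (f : ℝ → ℂ) (ξ : ℝ) : ℂ := ∫ x : ℝ, f x * eChar (-ξ) x

/-- The bilinear multiplier operator `B_m` with symbol `m`. -/
def Bm (m : ℝ → ℝ → ℂ) (f g : ℝ → ℂ) (x : ℝ) : ℂ :=
  ∫ ξ : ℝ, ∫ η : ℝ, m ξ η * fourierT f ξ * fourierT g η * eChar (ξ + η) x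

/-- Complex-valued indicator function of a set of reals. -/
def indC (s : Set ℝ) (x : ℝ) : ℂ := s.indicator 1 x

/-- The set `-A - B = {-x-y : x ∈ A, y ∈ B}`. -/
def mink2 (A B : Set ℝ) : Set ℝ := Set.image2 (fun x y => -x - y) A B

/-- The paraproduct symbol `m_{a,b}(ξ,η) = Σ_{j≥1} 1_{[a_{j+1},a_j)}(ξ) 1_{[b_j,b_0)}(η)`. -/
def mab (a b : ℕ → ℝ) (ξ η : ℝ) : ℂ :=
  ∑' j : ℕ, indC (Ico (a (j + 2)) (a (j + 1))) ξ * indC (Ico (b (j + 1)) (b 0)) η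

/-- The interval `-[a_{j+1},a_j) - [b_j, b_0)` from the collection `I_{a,b}`. -/
def Iab (a b : ℕ → ℝ) (j : ℕ) : Set ℝ := mink2 (Ico (a (j + 1)) (a j)) (Ico (b j) (b 0))

/-- The interval `-[a_{j+1},a_j) - (b_∞, b_j)` from the collection `J_{a,b}`. -/
def Jab (a b : ℕ → ℝ) (binf : ℝ) (j : ℕ) : Set ℝ :=
  mink2 (Ico (a (j + 1)) (a j)) (Ioo binf (b j))

/-- The symbol `m̃_{u,v}(ξ,η) = Σ_{j≥1} 1_{(u_0,u_j]}(ξ) 1_{[v_j,v_{j+1})}(η)`. -/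
def muv (u v : ℕ → ℝ) (ξ η : ℝ) : ℂ :=
  ∑' j : ℕ, indC (Ioc (u 0) (u (j + 1))) ξ * indC (Ico (v (j + 1)) (v (j + 2))) η

/-- The interval `-(u_0,u_j] - [v_j, v_{j+1})`. -/
def Iuv (u v : ℕ → ℝ) (j : ℕ) : Set ℝ :=
  mink2 (Ioc (u 0) (u j)) (Ico (v j) (v (j + 1)))

/-- The frequency projection `(1_S f̂)^∨`. -/
def fproj (S : Set ℝ) (f : ℝ → ℂ) (x : ℝ) : ℂ := ∫ ξ in S, fourierT f ξ * eChar ξ x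

/-- The `L^p(ℓ²)` norm of the family of frequency projections onto the sets `T i`. -/
def sqNormLp {ι : Type*} (T : ι → Set ℝ) (f : ℝ → ℂ) (p : ℝ) : ℝ≥0∞ :=
  (∫⁻ x : ℝ, (∑' i, ((‖fproj (T i) f x‖₊ : ℝ≥0∞)) ^ 2) ^ (p / 2)) ^ (1 / p)

/-- The collection of connected components of a set `U ⊆ ℝ`. -/
def componentsOf (U : Set ℝ) : Set (Set ℝ) := {S | ∃ x ∈ U, S = connectedComponentIn U x}

/-- A closed Lebesgue-null set `E ⊆ ℝ` is Littlewood–Paley if for every `1 < p < ∞` the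
square function associated with the connected components of `ℝ \ E` is comparable with the
`L^p` norm (stated on the dense class of Schwartz functions). -/
def IsLPSet (E : Set ℝ) : Prop :=
  IsClosed E ∧ volume E = 0 ∧
    ∀ p : ℝ, 1 < p → ∃ c : ℝ, 0 < c ∧ ∃ C : ℝ, 0 < C ∧
      ∀ f : SchwartzMap ℝ ℂ,
        ENNReal.ofReal c * eLpNorm (⇑f) (ENNReal.ofReal p) volume ≤
            sqNormLp (fun ω : componentsOf Eᶜ => (ω : Set ℝ)) (⇑f) p ∧
          sqNormLp (fun ω : componentsOf Eᶜ => (ω : Set ℝ)) (⇑f) p ≤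
            ENNReal.ofReal C * eLpNorm (⇑f) (ENNReal.ofReal p) volume

/-- A strictly monotone real sequence is Littlewood–Paley if the closure of its range is a
Littlewood–Paley set. -/
def IsLPSeq (a : ℕ → ℝ) : Prop := IsLPSet (closure (Set.range a))

/-- A family of (pairwise disjoint) intervals is Littlewood–Paley if for every `1 < p < ∞`
the associated square function is bounded by the `L^p` norm. -/
def IsLPFamily {ι : Type*} (T : ι → Set ℝ) : Prop :=
  ∀ p : ℝ, 1 < p → ∃ C : ℝ, 0 < C ∧ ∀ f : SchwartzMap ℝ ℂ,
    sqNormLp T (⇑f) p ≤ ENNReal.ofReal C * eLpNorm (⇑f) (ENNReal.ofReal p) volume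

/-- Slope of the `j`-th segment of the piecewise linear curve with vertices `(a_j, b_j)`. -/
def pslope (a b : ℕ → ℝ) (j : ℕ) : ℝ := (b j - b (j + 1)) / (a j - a (j + 1))

/-- The epigraph of the piecewise linear curve with vertices `(a_j, b_j)`. -/
def polyEpi (a b : ℕ → ℝ) : Set (ℝ × ℝ) :=
  ⋃ j : ℕ, {p : ℝ × ℝ | a (j + 1) ≤ p.1 ∧ p.1 ≤ a j ∧
    b (j + 1) + pslope a b j * (p.1 - a (j + 1)) ≤ p.2}

end

/-- Complex-valued indicator function of a set in the plane, as a bilinear symbol. -/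
noncomputable def indC2 (S : Set (ℝ × ℝ)) (ξ η : ℝ) : ℂ := S.indicator 1 (ξ, η)

/-- The weight `(1 + |u|/s)⁻¹`. -/
noncomputable def wt (s u : ℝ) : ℝ := s / (s + |u|)

section wt
variable {s t u v : ℝ}

lemma wt_pos (hs : 0 < s) : 0 < wt s u := by unfold wt; positivity

lemma wt_nonneg (hs : 0 < s) : 0 ≤ wt s u := (wt_pos hs).le

lemma wt_le_one (hs : 0 < s) : wt s u ≤ 1 := by
  unfold wt; rw [div_le_one (by positivity)]; linarith [abs_nonneg u]

lemma wt_mono (hs : 0 < s) (hst : s ≤ t) : wt s u ≤ wt t u := by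
  unfold wt; rw [div_le_div_iff₀ (by positivity) (by have := hs.trans_le hst; positivity)]
  nlinarith [abs_nonneg u]

lemma wt_neg : wt s (-u) = wt s u := by simp [wt]

lemma wt_sub_comm : wt s (u - v) = wt s (v - u) := by rw [← wt_neg, neg_sub]

lemma wt_mul_wt_le (hs : 0 < s) : wt s u * wt s v ≤ wt s (u - v) := by
  unfold wt
  rw [div_mul_div_comm, div_le_div_iff₀ (by positivity) (by positivity)]
  have := abs_sub u v
  have h2 : s * (s + |u - v|) ≤ (s + |u|) * (s + |v|) := by
    nlinarith [mul_nonneg (abs_nonneg u) (abs_nonneg v)]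
  nlinarith

lemma wt_comp {K : ℝ} (hs : 0 < s) (h : s + |v| ≤ K * (s + |u|)) : wt s u ≤ K * wt s v := by
  unfold wt
  rw [mul_div_assoc', div_le_div_iff₀ (by positivity) (by positivity)]
  nlinarith

lemma wt_le_div {r : ℝ} (hs : 0 < s) (hr : 0 < r) (h : r ≤ s + |u|) : wt s u ≤ s / r :=
  div_le_div_of_nonneg_left hs.le hr h

lemma wt_pow_le {m n : ℕ} (hs : 0 < s) (h : m ≤ n) : wt s u ^ n ≤ wt s u ^ m :=
  pow_le_pow_of_le_one (wt_nonneg hs) (wt_le_one hs) h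

lemma wt_pow_le_one {n : ℕ} (hs : 0 < s) : wt s u ^ n ≤ 1 :=
  pow_le_one₀ (wt_nonneg hs) (wt_le_one hs)

lemma continuous_wt (hs : 0 < s) : Continuous (wt s) := by
  unfold wt
  exact continuous_const.div (by fun_prop) (fun x => by positivity)

lemma wt_sq_le (hs : 0 < s) : wt s u ^ 2 ≤ (1 + (u / s) ^ 2)⁻¹ := by
  unfold wt
  rw [← one_div, div_pow, div_le_div_iff₀ (by positivity) (by positivity)]
  have : s ^ 2 * (1 + (u / s) ^ 2) = s ^ 2 + |u| ^ 2 := by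
    rw [sq_abs]; field_simp
  rw [this]; nlinarith [abs_nonneg u]

lemma integrable_wt_sq (hs : 0 < s) (c : ℝ) : Integrable (fun x => wt s (x - c) ^ 2) := by
  have h1 : Integrable (fun x : ℝ => (1 + (x / s) ^ 2)⁻¹) :=
    integrable_inv_one_add_sq.comp_div hs.ne'
  refine Integrable.comp_sub_right (f := fun x => wt s x ^ 2) ?_ c
  refine h1.mono' ((continuous_wt hs).pow 2).aestronglyMeasurable (.of_forall fun x => ?_)
  rw [Real.norm_of_nonneg (by positivity)]; exact wt_sq_le hs

lemma integral_wt_sq_le (hs : 0 < s) (c : ℝ) : ∫ x, wt s (x - c) ^ 2 ≤ 4 * s := by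
  rw [integral_sub_right_eq_self (fun x => wt s x ^ 2) c]
  have h0 := integrable_wt_sq hs 0
  simp only [sub_zero] at h0
  calc ∫ x, wt s x ^ 2 ≤ ∫ x : ℝ, (1 + (x / s) ^ 2)⁻¹ :=
        integral_mono h0 (integrable_inv_one_add_sq.comp_div hs.ne') fun x => wt_sq_le hs
    _ = s * Real.pi := by
        rw [Measure.integral_comp_div (fun x : ℝ => (1 + x ^ 2)⁻¹) s, integral_univ_inv_one_add_sq,
          abs_of_pos hs, smul_eq_mul]
    _ ≤ 4 * s := by nlinarith [Real.pi_lt_four]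

lemma integrable_wt_pow (hs : 0 < s) (c : ℝ) {n : ℕ} (hn : 2 ≤ n) :
    Integrable (fun x => wt s (x - c) ^ n) :=
  (integrable_wt_sq hs c).mono'
    (((continuous_wt hs).comp (continuous_sub_right c)).pow n).aestronglyMeasurable
    (.of_forall fun x => by
      rw [Real.norm_of_nonneg (pow_nonneg (wt_nonneg hs) _)]; exact wt_pow_le hs hn)

lemma integral_wt_pow_le (hs : 0 < s) (c : ℝ) {n : ℕ} (hn : 2 ≤ n) :
    ∫ x, wt s (x - c) ^ n ≤ 4 * s :=
  (integral_mono (integrable_wt_pow hs c hn) (integrable_wt_sq hs c)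
    fun _ => wt_pow_le hs hn).trans (integral_wt_sq_le hs c)

/-- Riemann-sum comparison for the weight. -/
lemma sum_wt_pow_le {ι : Type*} {n : ℕ} (hn : 2 ≤ n) (J : Finset ι) (B : ι → Set ℝ) (c ℓ : ι → ℝ)
    (S : Set ℝ) (hB : ∀ i ∈ J, MeasurableSet (B i)) (hBS : ∀ i ∈ J, B i ⊆ S)
    (hd : (J : Set ι).PairwiseDisjoint B) (hℓ : ∀ i ∈ J, volume.real (B i) = ℓ i)
    (hs : 0 < s) (hc : ∀ i ∈ J, ∀ y ∈ B i, |y - c i| ≤ s) (x : ℝ) :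
    ∑ i ∈ J, ℓ i * wt s (x - c i) ^ n ≤ 2 ^ n * ∫ y in S, wt s (y - x) ^ n := by
  have hInt := integrable_wt_pow hs x hn
  have hnn : ∀ y, 0 ≤ 2 ^ n * wt s (y - x) ^ n := fun y =>
    mul_nonneg (by positivity) (pow_nonneg (wt_nonneg hs) _)
  have key : ∀ i ∈ J, ℓ i * wt s (x - c i) ^ n ≤ ∫ y in B i, 2 ^ n * wt s (y - x) ^ n := by
    intro i hi
    rw [← hℓ i hi]
    by_cases hfin : volume (B i) = ⊤
    · simp only [Measure.real, hfin, ENNReal.toReal_top, zero_mul]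
      exact integral_nonneg hnn
    rw [← smul_eq_mul, ← setIntegral_const]
    refine setIntegral_mono_on (integrableOn_const hfin) (hInt.const_mul _).integrableOn (hB i hi)
        ?_
    intro y hy
    rw [← mul_pow]
    refine pow_le_pow_left₀ (wt_nonneg hs) (wt_comp hs ?_) n
    have h2 := hc i hi y hy
    have h3 : |y - x| ≤ |y - c i| + |x - c i| := by
      rw [abs_sub_comm x (c i)]; exact abs_sub_le _ _ _
    linarith [abs_nonneg (x - c i)]
  calc _ ≤ ∑ i ∈ J, ∫ y in B i, 2 ^ n * wt s (y - x) ^ n := Finset.sum_le_sum key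
    _ = ∫ y in ⋃ i ∈ J, B i, 2 ^ n * wt s (y - x) ^ n :=
        (integral_biUnion_finset J hB hd fun i _ => (hInt.const_mul _).integrableOn).symm
    _ ≤ ∫ y in S, 2 ^ n * wt s (y - x) ^ n :=
        setIntegral_mono_set (hInt.const_mul _).integrableOn
          (.of_forall hnn) ((iUnion₂_subset hBS).eventuallyLE)
    _ = _ := integral_const_mul _ _

lemma sum_wt_le {ι : Type*} (J : Finset ι) (B : ι → Set ℝ) (c ℓ : ι → ℝ) (S : Set ℝ)
    (hB : ∀ i ∈ J, MeasurableSet (B i)) (hBS : ∀ i ∈ J, B i ⊆ S)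
    (hd : (J : Set ι).PairwiseDisjoint B) (hℓ : ∀ i ∈ J, volume.real (B i) = ℓ i)
    (hs : 0 < s) (hc : ∀ i ∈ J, ∀ y ∈ B i, |y - c i| ≤ s) (x : ℝ) :
    ∑ i ∈ J, ℓ i * wt s (x - c i) ^ 2 ≤ 4 * ∫ y in S, wt s (y - x) ^ 2 :=
  (sum_wt_pow_le le_rfl J B c ℓ S hB hBS hd hℓ hs hc x).trans_eq (by norm_num)

end wt

lemma wt_pow_four_le_sum {s : ℝ} (hs : 0 < s) (u : ℝ) (J : ℕ) :
    wt s u ^ 4 ≤ ∑ j ∈ Finset.range J, 16 * (1 / 16) ^ j * {u | |u| ≤ 2 ^ j * s}.indicator 1 u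
      + 16 * (1 / 16) ^ J := by
  induction J with
  | zero => simpa using (wt_pow_le_one hs).trans (by norm_num)
  | succ J ih =>
    rw [Finset.sum_range_succ]
    have h0 : 0 ≤ ∑ j ∈ Finset.range J,
        16 * (1 / 16 : ℝ) ^ j * {u : ℝ | |u| ≤ 2 ^ j * s}.indicator 1 u :=
      Finset.sum_nonneg fun j _ => mul_nonneg (by positivity) (indicator_nonneg (by simp) _)
    by_cases h : |u| ≤ 2 ^ J * s
    · have : {u : ℝ | |u| ≤ 2 ^ J * s}.indicator (1 : ℝ → ℝ) u = 1 :=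
        indicator_of_mem (s := {u : ℝ | |u| ≤ 2 ^ J * s}) h _
      rw [this]
      have : (0 : ℝ) ≤ 16 * (1 / 16) ^ (J + 1) := by positivity
      linarith
    · push Not at h
      have h1 : wt s u ≤ (1 / 2) ^ J := by
        refine (wt_le_div hs (r := 2 ^ J * s) (by positivity) (by linarith)).trans (le_of_eq ?_)
        rw [one_div, inv_pow]; field_simp
      have h2 : wt s u ^ 4 ≤ ((1 / 2) ^ J) ^ 4 := pow_le_pow_left₀ (wt_nonneg hs) h1 4
      have h3 : (((1 : ℝ) / 2) ^ J) ^ 4 = 16 * (1 / 16) ^ (J + 1) := by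
        rw [← pow_mul, mul_comm, pow_mul, pow_succ]; norm_num; ring
      have h4 : (0 : ℝ) ≤ {u : ℝ | |u| ≤ 2 ^ J * s}.indicator (1 : ℝ → ℝ) u :=
        indicator_nonneg (by simp) _
      have h5 : (0 : ℝ) ≤ 16 * (1 / 16) ^ J * {u : ℝ | |u| ≤ 2 ^ J * s}.indicator (1 : ℝ → ℝ)
          u := by
        positivity
      linarith

/-- Layer-cake bound: polynomial growth of the masses of dyadic balls controls weighted integrals.
-/
lemma integral_mul_wt_le {g : ℝ → ℝ} (hg : ∀ x, 0 ≤ g x) (hgi : Integrable g)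
    {s M : ℝ} (hs : 0 < s) (hM : 0 ≤ M) (c : ℝ)
    (h : ∀ j : ℕ, ∫ x in {x | |x - c| ≤ 2 ^ j * s}, g x ≤ M * 8 ^ j) :
    ∫ x, g x * wt s (x - c) ^ 4 ≤ 32 * M := by
  have hcont : Continuous fun x => wt s (x - c) ^ 4 :=
    ((continuous_wt hs).comp (continuous_sub_right c)).pow 4
  have hms : ∀ j : ℕ, MeasurableSet {x : ℝ | |x - c| ≤ 2 ^ j * s} := fun j =>
    (isClosed_le (by fun_prop) continuous_const).measurableSet
  have hI : Integrable fun x => g x * wt s (x - c) ^ 4 := by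
    refine hgi.mono' (hgi.aestronglyMeasurable.mul hcont.aestronglyMeasurable)
      (.of_forall fun x => ?_)
    rw [Real.norm_of_nonneg (mul_nonneg (hg x) (pow_nonneg (wt_nonneg hs) _))]
    exact mul_le_of_le_one_right (hg x) (wt_pow_le_one hs)
  have key : ∀ J : ℕ, ∫ x, g x * wt s (x - c) ^ 4 ≤ 32 * M + 16 * (1 / 16) ^ J * ∫ x, g x := by
    intro J
    have hIj : ∀ j ∈ Finset.range J, Integrable fun x =>
        16 * (1 / 16) ^ j * {x | |x - c| ≤ 2 ^ j * s}.indicator g x := fun j _ =>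
      (hgi.indicator (hms j)).const_mul _
    calc _ ≤ ∫ x, (∑ j ∈ Finset.range J, 16 * (1 / 16) ^ j *
            {x | |x - c| ≤ 2 ^ j * s}.indicator g x + 16 * (1 / 16) ^ J * g x) := by
          refine integral_mono hI ((integrable_finsetSum _ hIj).add (hgi.const_mul _)) fun x => ?_
          have h1 := mul_le_mul_of_nonneg_left (wt_pow_four_le_sum hs (x - c) J) (hg x)
          refine h1.trans (le_of_eq ?_)
          rw [mul_add, Finset.mul_sum]
          congr 1
          · refine Finset.sum_congr rfl fun j _ => ?_
            by_cases hx : |x - c| ≤ 2 ^ j * s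
            · simp [indicator, hx]; ring
            · simp [indicator, hx]
          · ring
      _ = ∑ j ∈ Finset.range J, 16 * (1 / 16) ^ j * (∫ x in {x | |x - c| ≤ 2 ^ j * s}, g x)
            + 16 * (1 / 16) ^ J * ∫ x, g x := by
          rw [integral_add (integrable_finsetSum _ hIj) (hgi.const_mul _),
            integral_finsetSum _ hIj, integral_const_mul]
          simp_rw [integral_const_mul, integral_indicator (hms _)]
      _ ≤ ∑ j ∈ Finset.range J, 16 * M * (1 / 2) ^ j + 16 * (1 / 16) ^ J * ∫ x, g x := by
          refine add_le_add_left (Finset.sum_le_sum fun j _ => ?_) _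
          calc _ ≤ 16 * (1 / 16) ^ j * (M * 8 ^ j) :=
                mul_le_mul_of_nonneg_left (h j) (by positivity)
            _ = 16 * M * ((1 / 16) * 8) ^ j := by rw [mul_pow]; ring
            _ = _ := by norm_num
      _ ≤ _ := by
          rw [← Finset.mul_sum]
          have h2 : ∑ j ∈ Finset.range J, ((1 : ℝ) / 2) ^ j ≤ 2 := sum_geometric_two_le J
          nlinarith
  have hlim : Filter.Tendsto (fun J : ℕ => 32 * M + 16 * (1 / 16 : ℝ) ^ J * ∫ x, g x) Filter.atTop
      (nhds (32 * M + 16 * 0 * ∫ x, g x)) :=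
    (((tendsto_pow_atTop_nhds_zero_of_lt_one (by norm_num) (by norm_num)).const_mul 16).mul_const
      _).const_add _
  simpa using ge_of_tendsto' hlim key

/-- The dyadic interval `[m 2^k, (m+1) 2^k)`. -/
def dy (k m : ℤ) : Set ℝ := {x | ⌊x / 2 ^ k⌋ = m}

section dyadic
variable {k k' m m' : ℤ} {x : ℝ}

lemma two_zpow_pos (k : ℤ) : (0 : ℝ) < 2 ^ k := by positivity

lemma mem_dy : x ∈ dy k m ↔ ⌊x / 2 ^ k⌋ = m := Iff.rfl

lemma mem_dy' : x ∈ dy k m ↔ m * 2 ^ k ≤ x ∧ x < (m + 1) * 2 ^ k := by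
  rw [mem_dy, Int.floor_eq_iff, le_div_iff₀ (two_zpow_pos k), div_lt_iff₀ (two_zpow_pos k)]

lemma dy_eq_Ico (k m : ℤ) : dy k m = Ico (m * 2 ^ k : ℝ) ((m + 1) * 2 ^ k) := by
  ext x; rw [mem_dy', mem_Ico]

lemma mem_dy_floor (k : ℤ) (x : ℝ) : x ∈ dy k ⌊x / 2 ^ k⌋ := rfl

lemma left_mem_dy (k m : ℤ) : (m * 2 ^ k : ℝ) ∈ dy k m := by
  rw [mem_dy']; exact ⟨le_rfl, by nlinarith [two_zpow_pos k]⟩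

lemma measurableSet_dy (k m : ℤ) : MeasurableSet (dy k m) := by
  rw [dy_eq_Ico]; exact measurableSet_Ico

lemma volume_dy (k m : ℤ) : volume (dy k m) = ENNReal.ofReal (2 ^ k) := by
  rw [dy_eq_Ico, Real.volume_Ico]; ring_nf

lemma volume_real_dy (k m : ℤ) : volume.real (dy k m) = 2 ^ k := by
  rw [Measure.real, volume_dy, ENNReal.toReal_ofReal (two_zpow_pos k).le]

lemma dy_subset (h : k ≤ k') (hx : x ∈ dy k m) (hx' : x ∈ dy k' m') : dy k m ⊆ dy k' m' := by
  obtain ⟨d, rfl⟩ := Int.le.dest h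
  have key : ∀ y : ℝ, ⌊y / 2 ^ (k + d : ℤ)⌋ = ⌊y / 2 ^ k⌋ / 2 ^ d := by
    intro y
    have h2 : y / 2 ^ (k + d : ℤ) = y / 2 ^ k / ((2 ^ d : ℕ) : ℝ) := by
      rw [zpow_add₀ two_ne_zero, zpow_natCast, div_div]; norm_num
    rw [h2, Int.floor_div_natCast]; norm_num
  intro y hy
  rw [mem_dy] at *
  rw [key] at *
  rw [hy, ← hx']; rw [hx]

lemma le_of_dy_subset (h : dy k m ⊆ dy k' m') : k ≤ k' := by
  have h1 := measure_mono (μ := volume) h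
  rw [volume_dy, volume_dy, ENNReal.ofReal_le_ofReal_iff (two_zpow_pos _).le] at h1
  exact (zpow_le_zpow_iff_right₀ one_lt_two).1 h1

end dyadic

/-- A tile `(k, n, l)`: the rectangle `[n 2^k, (n+1) 2^k) × [l 2^{-k}, (l+1) 2^{-k})`. -/
abbrev Tile := ℤ × ℤ × ℤ

/-- Length of the time interval of a tile. -/
noncomputable def tlen (P : Tile) : ℝ := 2 ^ P.1
/-- Centre of the time interval of a tile. -/
noncomputable def tctr (P : Tile) : ℝ := (P.2.1 + 1 / 2) * 2 ^ P.1
/-- Time interval of a tile. -/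
def tI (P : Tile) : Set ℝ := dy P.1 P.2.1
/-- Frequency interval of a tile. -/
def tW (P : Tile) : Set ℝ := dy (-P.1) P.2.2
/-- Lower half of the frequency interval. -/
def tL (P : Tile) : Set ℝ := dy (-P.1 - 1) (2 * P.2.2)
/-- Upper half of the frequency interval. -/
def tU (P : Tile) : Set ℝ := dy (-P.1 - 1) (2 * P.2.2 + 1)

section tiles
variable {P Q : Tile} {x ξ : ℝ}

lemma tlen_pos (P : Tile) : 0 < tlen P := two_zpow_pos _

lemma tlen_le_iff : tlen P ≤ tlen Q ↔ P.1 ≤ Q.1 := zpow_le_zpow_iff_right₀ one_lt_two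

lemma volume_real_tI (P : Tile) : volume.real (tI P) = tlen P := volume_real_dy _ _

lemma measurableSet_tI (P : Tile) : MeasurableSet (tI P) := measurableSet_dy _ _

lemma measurableSet_tU (P : Tile) : MeasurableSet (tU P) := measurableSet_dy _ _

lemma measurableSet_tW (P : Tile) : MeasurableSet (tW P) := measurableSet_dy _ _

lemma abs_sub_dy_ctr_le {k m : ℤ} (h : x ∈ dy k m) : |x - (m + 1 / 2) * 2 ^ k| ≤ 2 ^ k / 2 := by
  rw [mem_dy'] at h; rw [abs_le]; constructor <;> linarith

lemma abs_sub_tctr_le (h : x ∈ tI P) : |x - tctr P| ≤ tlen P / 2 := abs_sub_dy_ctr_le h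

lemma dy_ctr_mem (k m : ℤ) : ((m + 1 / 2) * 2 ^ k : ℝ) ∈ dy k m := by
  rw [mem_dy']; constructor <;> nlinarith [two_zpow_pos k]

lemma tctr_mem (P : Tile) : tctr P ∈ tI P := dy_ctr_mem _ _

lemma tL_subset_tW (P : Tile) : tL P ⊆ tW P := by
  have h : ((2 * P.2.2 : ℤ) * 2 ^ (-P.1 - 1) : ℝ) ∈ dy (-P.1) P.2.2 := by
    rw [mem_dy', zpow_sub₀ two_ne_zero]
    have := two_zpow_pos (-P.1)
    push_cast
    constructor <;> linarith
  exact dy_subset (by lia) (left_mem_dy _ _) h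

lemma tU_subset_tW (P : Tile) : tU P ⊆ tW P := by
  have h : ((2 * P.2.2 + 1 : ℤ) * 2 ^ (-P.1 - 1) : ℝ) ∈ dy (-P.1) P.2.2 := by
    rw [mem_dy', zpow_sub₀ two_ne_zero]
    have := two_zpow_pos (-P.1)
    push_cast
    constructor <;> linarith
  exact dy_subset (by lia) (left_mem_dy _ _) h

lemma tL_or_tU (h : ξ ∈ tW P) : ξ ∈ tL P ∨ ξ ∈ tU P := by
  have h2 : (2 : ℝ) ^ (-P.1) = 2 * 2 ^ (-P.1 - 1) := by
    rw [zpow_sub₀ two_ne_zero]; ring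
  unfold tW at h
  rw [mem_dy', h2] at h
  unfold tL tU
  rw [mem_dy', mem_dy']
  push_cast
  rcases lt_or_ge ξ ((2 * P.2.2 + 1) * 2 ^ (-P.1 - 1)) with h3 | h3
  · left; constructor <;> linarith
  · right; constructor <;> linarith

lemma lt_of_mem_tL_of_mem_tU {η : ℝ} (h : ξ ∈ tL P) (h' : η ∈ tU P) : ξ < η := by
  unfold tL at h; unfold tU at h'
  rw [mem_dy'] at h h'; push_cast at h h'
  linarith [h.2, h'.1]

lemma disjoint_tL_tU (P : Tile) : Disjoint (tL P) (tU P) :=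
  Set.disjoint_left.2 fun _ h h' => lt_irrefl _ (lt_of_mem_tL_of_mem_tU h h')

lemma tile_ext (h : P.1 = Q.1) (hx : x ∈ tI P) (hx' : x ∈ tI Q) (hξ : ξ ∈ tW P) (hξ' : ξ ∈ tW Q) :
    P = Q := by
  obtain ⟨k, n, l⟩ := P; obtain ⟨k', n', l'⟩ := Q
  dsimp only at h; subst h
  unfold tI at hx hx'; unfold tW at hξ hξ'
  rw [mem_dy] at hx hx' hξ hξ'
  dsimp only at *
  rw [← hx, ← hx', ← hξ, ← hξ']

lemma tW_subset_tL (h : Q.1 < P.1) (hξ : ξ ∈ tW P) (hξ' : ξ ∈ tL Q) : tW P ⊆ tL Q :=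
  dy_subset (by lia) hξ hξ'

lemma tW_subset_tU (h : Q.1 < P.1) (hξ : ξ ∈ tW P) (hξ' : ξ ∈ tU Q) : tW P ⊆ tU Q :=
  dy_subset (by lia) hξ hξ'

lemma tW_subset_tW (h : Q.1 ≤ P.1) (hξ : ξ ∈ tW P) (hξ' : ξ ∈ tW Q) : tW P ⊆ tW Q :=
  dy_subset (by lia) hξ hξ'

lemma disjoint_tI (h : P.1 = Q.1) (hξ : ξ ∈ tW P) (hξ' : ξ ∈ tW Q) (hne : P ≠ Q) :
    Disjoint (tI P) (tI Q) :=
  Set.disjoint_left.2 fun _ hx hx' => hne (tile_ext h hx hx' hξ hξ')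

/-- Sum of weights over tiles of one scale. -/
lemma sum_wt_scale_le {T : Finset Tile} {k : ℤ} (hk : ∀ P ∈ T, P.1 = k)
    (hd : (T : Set Tile).PairwiseDisjoint tI) (x : ℝ) :
    ∑ P ∈ T, wt (2 ^ k) (x - tctr P) ^ 2 ≤ 16 := by
  have hk0 := two_zpow_pos k
  have h := sum_wt_le T tI tctr (fun _ => 2 ^ k) univ (fun P _ => measurableSet_tI P)
    (fun P _ => subset_univ _) hd (fun P hP => by rw [volume_real_tI, tlen, hk P hP]) hk0
    (fun P hP y hy => by
      have := abs_sub_tctr_le hy; rw [tlen, hk P hP] at this; linarith) x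
  rw [← Finset.mul_sum, setIntegral_univ] at h
  have h2 := integral_wt_sq_le hk0 x
  have h3 : (2 : ℝ) ^ k * ∑ P ∈ T, wt (2 ^ k) (x - tctr P) ^ 2 ≤ 2 ^ k * 16 := by linarith
  exact le_of_mul_le_mul_left h3 hk0

end tiles

section geometric

lemma sum_two_zpow_le' (S : Finset ℤ) : ∀ K : ℤ, (∀ k ∈ S, k ≤ K) →
    ∑ k ∈ S, (2 : ℝ) ^ k ≤ 2 * 2 ^ K := by
  induction S using Finset.induction_on_max with
  | empty => intro K _; simp; positivity
  | insert a S ha ih =>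
    intro K hK
    rw [Finset.sum_insert (fun h => lt_irrefl _ (ha a h))]
    have h1 := ih (a - 1) fun k hk => by have := ha k hk; lia
    rw [zpow_sub_one₀ two_ne_zero] at h1
    have h2 : (2 : ℝ) ^ a ≤ 2 ^ K := zpow_le_zpow_right₀ one_le_two (hK a (by simp))
    linarith

lemma sum_two_zpow_le {S : Finset ℤ} {r : ℝ} (hr : 0 ≤ r) (h : ∀ k ∈ S, (2 : ℝ) ^ k ≤ r) :
    ∑ k ∈ S, (2 : ℝ) ^ k ≤ 2 * r := by
  rcases S.eq_empty_or_nonempty with rfl | hS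
  · simpa using hr
  refine (sum_two_zpow_le' S (S.max' hS) fun k hk => S.le_max' k hk).trans ?_
  have := h _ (S.max'_mem hS)
  linarith

lemma sum_two_zpow_inv_le {S : Finset ℤ} {r : ℝ} (hr : 0 < r) (h : ∀ k ∈ S, r ≤ (2 : ℝ) ^ k) :
    ∑ k ∈ S, ((2 : ℝ) ^ k)⁻¹ ≤ 2 * r⁻¹ := by
  have h1 : ∑ k ∈ S, ((2 : ℝ) ^ k)⁻¹ = ∑ k ∈ S.image (fun k => -k), (2 : ℝ) ^ k := by
    rw [Finset.sum_image (fun a _ b _ hab => neg_injective hab)]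
    simp [zpow_neg]
  rw [h1]
  refine sum_two_zpow_le (by positivity) fun k hk => ?_
  obtain ⟨k', hk', rfl⟩ := Finset.mem_image.1 hk
  rw [zpow_neg]
  exact inv_anti₀ hr (h k' hk')

lemma sum_min_mul_min_le (S : Finset ℤ) {r : ℝ} (hr : 0 < r) :
    ∑ k ∈ S, min (r / 2 ^ k) 1 * min 1 (2 ^ k / r) ≤ 4 := by
  rw [← Finset.sum_filter_add_sum_filter_not S (fun k => (2 : ℝ) ^ k ≤ r)]
  have h1 : ∑ k ∈ S with (2 : ℝ) ^ k ≤ r, min (r / 2 ^ k) 1 * min 1 (2 ^ k / r) ≤ 2 := by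
    calc _ ≤ ∑ k ∈ S with (2 : ℝ) ^ k ≤ r, (2 : ℝ) ^ k * r⁻¹ := by
          refine Finset.sum_le_sum fun k _ => ?_
          have := two_zpow_pos k
          calc _ ≤ 1 * (2 ^ k / r) :=
                mul_le_mul (min_le_right _ _) (min_le_right _ _) (by positivity) zero_le_one
            _ = _ := by rw [one_mul, div_eq_mul_inv]
      _ ≤ 2 * r * r⁻¹ := by
          rw [← Finset.sum_mul]
          exact mul_le_mul_of_nonneg_right
            (sum_two_zpow_le hr.le fun k hk => (Finset.mem_filter.1 hk).2) (by positivity)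
      _ = 2 := by field_simp
  have h2 : ∑ k ∈ S with ¬ (2 : ℝ) ^ k ≤ r, min (r / 2 ^ k) 1 * min 1 (2 ^ k / r) ≤ 2 := by
    calc _ ≤ ∑ k ∈ S with ¬ (2 : ℝ) ^ k ≤ r, r * ((2 : ℝ) ^ k)⁻¹ := by
          refine Finset.sum_le_sum fun k _ => ?_
          have := two_zpow_pos k
          calc _ ≤ (r / 2 ^ k) * 1 :=
                mul_le_mul (min_le_left _ _) (min_le_left _ _) (by positivity) (by positivity)
            _ = _ := by rw [mul_one, div_eq_mul_inv]
      _ ≤ r * (2 * r⁻¹) := by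
          rw [← Finset.mul_sum]
          exact mul_le_mul_of_nonneg_left (sum_two_zpow_inv_le hr fun k hk =>
            (not_le.1 (Finset.mem_filter.1 hk).2).le) hr.le
      _ = 2 := by field_simp
  linarith

end geometric

open scoped ComplexConjugate

/-- Cauchy–Schwarz for square-integrable functions. -/
lemma integral_norm_mul_norm_sq_le {f g : ℝ → ℂ} (hf : MemLp f 2) (hg : MemLp g 2) :
    (∫ x, ‖f x‖ * ‖g x‖) ^ 2 ≤ (∫ x, ‖f x‖ ^ 2) * ∫ x, ‖g x‖ ^ 2 := by
  have h := integral_mul_norm_le_Lp_mul_Lq (μ := volume) (f := f) (g := g)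
    Real.HolderConjugate.two_two (by simpa using hf) (by simpa using hg)
  simp only [Real.rpow_two, ← Real.sqrt_eq_rpow] at h
  have h1 : 0 ≤ ∫ x, ‖f x‖ ^ 2 := integral_nonneg fun x => by positivity
  have h2 : 0 ≤ ∫ x, ‖g x‖ ^ 2 := integral_nonneg fun x => by positivity
  have h0 : 0 ≤ ∫ x, ‖f x‖ * ‖g x‖ := integral_nonneg fun x => by positivity
  calc _ ≤ (√(∫ x, ‖f x‖ ^ 2) * √(∫ x, ‖g x‖ ^ 2)) ^ 2 := pow_le_pow_left₀ h0 h 2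
    _ = _ := by rw [mul_pow, Real.sq_sqrt h1, Real.sq_sqrt h2]

/-- A family of wave packets adapted to tiles, together with modulations `md` that demodulate the
packets of an upper tree and kernels `ker` reproducing the coarse scales of an upper tree. -/
structure Packets (A : ℝ) (φ : Tile → ℝ → ℂ) (md : ℝ → ℝ → ℂ) (ker : ℤ → ℝ → ℝ → ℂ) : Prop where
  one_le : 1 ≤ A
  cont : ∀ P, Continuous (φ P)
  decay : ∀ P x, ‖φ P x‖ ≤ A * wt (tlen P) (x - tctr P) ^ 10
  orth : ∀ P Q, Disjoint (tL P) (tL Q) → ∫ x, φ P x * conj (φ Q x) = 0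
  md_cont : ∀ ξ, Continuous (md ξ)
  md_norm : ∀ ξ x, ‖md ξ x‖ = 1
  lip : ∀ P ξ, ξ ∈ tU P → ∀ x z, |x - z| ≤ tlen P →
    ‖md ξ x * φ P x - md ξ z * φ P z‖ ≤ A * (|x - z| / tlen P) * wt (tlen P) (z - tctr P) ^ 10
  ker_cont : ∀ j ξ, Continuous (ker j ξ)
  ker_decay : ∀ j ξ x, ‖ker j ξ x‖ ≤ A * (2 ^ j)⁻¹ * wt (2 ^ j) x ^ 4
  repro : ∀ P ξ, ξ ∈ tU P → ∀ j, j ≤ P.1 → ∀ x, ∫ y, φ P y * ker j ξ (x - y) = φ P x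
  repro_zero : ∀ P ξ, ξ ∈ tU P → ∀ j, P.1 ≤ j - 4 → ∀ x, ∫ y, φ P y * ker j ξ (x - y) = 0

section packets
variable {A : ℝ} {φ : Tile → ℝ → ℂ} {md : ℝ → ℝ → ℂ} {ker : ℤ → ℝ → ℝ → ℂ}

lemma Packets.integrable_sq (h : Packets A φ md ker) (P : Tile) :
    Integrable fun x => ‖φ P x‖ ^ 2 := by
  refine ((integrable_wt_pow (tlen_pos P) (tctr P) (n := 20) (by norm_num)).const_mul (A ^ 2)).mono'
    ((h.cont P).norm.pow 2).aestronglyMeasurable (.of_forall fun x => ?_)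
  rw [Real.norm_of_nonneg (by positivity)]
  calc _ ≤ (A * wt (tlen P) (x - tctr P) ^ 10) ^ 2 := pow_le_pow_left₀ (norm_nonneg _) (h.decay P x) 2
    _ = _ := by ring

lemma Packets.memLp (h : Packets A φ md ker) (P : Tile) : MemLp (φ P) 2 :=
  (memLp_two_iff_integrable_sq_norm (h.cont P).aestronglyMeasurable).2 (h.integrable_sq P)

lemma Packets.integrable (h : Packets A φ md ker) (P : Tile) : Integrable (φ P) :=
  ((integrable_wt_pow (tlen_pos P) (tctr P) (n := 10) (by norm_num)).const_mul A).mono'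
    (h.cont P).aestronglyMeasurable (.of_forall (h.decay P))

lemma Packets.norm_le (h : Packets A φ md ker) (P : Tile) (x : ℝ) : ‖φ P x‖ ≤ A :=
  (h.decay P x).trans (mul_le_of_le_one_right (by linarith [h.one_le])
    (wt_pow_le_one (tlen_pos P)))

/-- Modulus of the inner product of two packets. -/
noncomputable def ipn (φ : Tile → ℝ → ℂ) (P Q : Tile) : ℝ := ‖∫ x, φ P x * conj (φ Q x)‖

lemma ipn_comm (P Q : Tile) : ipn φ P Q = ipn φ Q P := by
  unfold ipn
  rw [← Complex.norm_conj, ← integral_conj]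
  simp [mul_comm]

lemma ipn_nonneg (P Q : Tile) : 0 ≤ ipn φ P Q := norm_nonneg _

lemma Packets.ipn_le (h : Packets A φ md ker) {P Q : Tile} (hPQ : Q.1 ≤ P.1) :
    ipn φ P Q ≤ 4 * A ^ 2 * (tlen Q * wt (tlen P) (tctr P - tctr Q) ^ 8) := by
  have hP := tlen_pos P
  have hQ := tlen_pos Q
  have hInt := integrable_wt_sq hQ (tctr Q)
  calc ipn φ P Q ≤ ∫ x, A ^ 2 * wt (tlen P) (tctr P - tctr Q) ^ 8 * wt (tlen Q) (x - tctr Q)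
      ^ 2 := by
        refine norm_integral_le_of_norm_le (hInt.const_mul _) (.of_forall fun x => ?_)
        rw [norm_mul, RCLike.norm_conj]
        have h1 : wt (tlen P) (x - tctr P) * wt (tlen P) (x - tctr Q) ≤
            wt (tlen P) (tctr P - tctr Q) := by
          refine (wt_mul_wt_le hP).trans_eq ?_
          rw [sub_sub_sub_cancel_left, wt_sub_comm]
        have h2 : wt (tlen Q) (x - tctr Q) ≤ wt (tlen P) (x - tctr Q) :=
          wt_mono hQ (tlen_le_iff.2 hPQ)
        have p1 := wt_nonneg (u := x - tctr P) hP
        have p2 := wt_nonneg (u := x - tctr Q) hQ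
        have p3 := wt_nonneg (u := x - tctr Q) hP
        calc _ ≤ (A * wt (tlen P) (x - tctr P) ^ 10) * (A * wt (tlen Q) (x - tctr Q) ^ 10) :=
              mul_le_mul (h.decay P x) (h.decay Q x) (norm_nonneg _)
                (mul_nonneg (by linarith [h.one_le]) (pow_nonneg p1 _))
          _ = A ^ 2 * (wt (tlen P) (x - tctr P) ^ 10 * wt (tlen Q) (x - tctr Q) ^ 8) *
                wt (tlen Q) (x - tctr Q) ^ 2 := by ring
          _ ≤ A ^ 2 * (wt (tlen P) (x - tctr P) ^ 8 * wt (tlen P) (x - tctr Q) ^ 8) *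
                wt (tlen Q) (x - tctr Q) ^ 2 := by
              gcongr ?_ * (?_ * ?_) * ?_
              · exact wt_pow_le hP (by norm_num)
              · exact pow_le_pow_left₀ (wt_nonneg hQ) h2 8
          _ = A ^ 2 * (wt (tlen P) (x - tctr P) * wt (tlen P) (x - tctr Q)) ^ 8 *
                wt (tlen Q) (x - tctr Q) ^ 2 := by ring
          _ ≤ A ^ 2 * wt (tlen P) (tctr P - tctr Q) ^ 8 * wt (tlen Q) (x - tctr Q) ^ 2 := by gcongr
    _ = A ^ 2 * wt (tlen P) (tctr P - tctr Q) ^ 8 * ∫ x, wt (tlen Q) (x - tctr Q) ^ 2 :=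
        integral_const_mul _ _
    _ ≤ A ^ 2 * wt (tlen P) (tctr P - tctr Q) ^ 8 * (4 * tlen Q) := by
        have := wt_nonneg (u := tctr P - tctr Q) hP
        exact mul_le_mul_of_nonneg_left (integral_wt_sq_le hQ _) (by positivity)
    _ = _ := by ring

lemma Packets.sum_ipn_same_le (h : Packets A φ md ker) (T : Finset Tile) (P : Tile) :
    ∑ Q ∈ T with Q.1 = P.1 ∧ Q.2.2 = P.2.2, ipn φ P Q ≤ 64 * A ^ 2 * tlen P := by
  have hd : ((T.filter fun Q => Q.1 = P.1 ∧ Q.2.2 = P.2.2 : Finset Tile)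
      : Set Tile).PairwiseDisjoint
      tI := by
    intro Q hQ R hR hne
    simp only [Finset.coe_filter, mem_ofPred_eq] at hQ hR
    have hξ : ((Q.2.2 : ℝ) * 2 ^ (-Q.1)) ∈ tW Q := left_mem_dy _ _
    refine disjoint_tI (by rw [hQ.2.1, hR.2.1]) hξ ?_ hne
    unfold tW
    rw [hR.2.1, hR.2.2, ← hQ.2.1, ← hQ.2.2]
    exact hξ
  have h2 := sum_wt_scale_le (k := P.1) (T := T.filter fun Q => Q.1 = P.1 ∧ Q.2.2 = P.2.2)
    (fun Q hQ => (Finset.mem_filter.1 hQ).2.1) hd (tctr P)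
  calc _ ≤ ∑ Q ∈ T with Q.1 = P.1 ∧ Q.2.2 = P.2.2,
        4 * A ^ 2 * tlen P * wt (2 ^ P.1) (tctr P - tctr Q) ^ 2 := by
        refine Finset.sum_le_sum fun Q hQ => ?_
        have hQ' := (Finset.mem_filter.1 hQ).2
        refine (h.ipn_le hQ'.1.le).trans ?_
        have : tlen Q = tlen P := by rw [tlen, tlen, hQ'.1]
        rw [this, mul_assoc (4 * A ^ 2) (tlen P)]
        have hp := tlen_pos P
        gcongr 4 * A ^ 2 * (tlen P * ?_)
        exact wt_pow_le hp (by norm_num)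
    _ ≤ 4 * A ^ 2 * tlen P * 16 := by
        rw [← Finset.mul_sum]
        have := tlen_pos P
        gcongr
    _ = _ := by ring

lemma Packets.memLp_sum (h : Packets A φ md ker) (c : Tile → ℂ) (T : Finset Tile) :
    MemLp (fun x => ∑ P ∈ T, c P * φ P x) 2 :=
  memLp_finsetSum T fun P _ => (h.memLp P).const_mul (c P)

lemma Packets.integral_norm_sq_sum_le' (h : Packets A φ md ker) (c : Tile → ℂ) (T : Finset Tile) :
    ∫ x, ‖∑ P ∈ T, c P * φ P x‖ ^ 2 ≤ ∑ P ∈ T, ∑ Q ∈ T, ‖c P‖ * ‖c Q‖ * ipn φ P Q := by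
  have hInt : ∀ P Q, Integrable fun x => φ P x * conj (φ Q x) := fun P Q =>
    MemLp.integrable_mul (h.memLp P) (h.memLp Q).star
  have h1 : ((∫ x, ‖∑ P ∈ T, c P * φ P x‖ ^ 2 : ℝ) : ℂ) =
      ∑ P ∈ T, ∑ Q ∈ T, c P * conj (c Q) * ∫ x, φ P x * conj (φ Q x) := by
    rw [← integral_complex_ofReal]
    have h2 : ∀ x, ((‖∑ P ∈ T, c P * φ P x‖ ^ 2 : ℝ) : ℂ) =
        ∑ P ∈ T, ∑ Q ∈ T, c P * conj (c Q) * (φ P x * conj (φ Q x)) := by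
      intro x
      rw [Complex.ofReal_pow, ← Complex.mul_conj', map_sum, Finset.sum_mul_sum]
      refine Finset.sum_congr rfl fun P _ => Finset.sum_congr rfl fun Q _ => ?_
      rw [map_mul]; ring
    simp_rw [h2]
    rw [integral_finsetSum]
    · refine Finset.sum_congr rfl fun P _ => ?_
      rw [integral_finsetSum _ fun Q _ => (hInt P Q).const_mul _]
      simp_rw [integral_const_mul]
    · exact fun P _ => integrable_finsetSum _ fun Q _ => (hInt P Q).const_mul _
  calc _ ≤ ‖((∫ x, ‖∑ P ∈ T, c P * φ P x‖ ^ 2 : ℝ) : ℂ)‖ := by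
        rw [Complex.norm_real]; exact le_abs_self _
    _ ≤ _ := by
        rw [h1]
        refine (norm_sum_le _ _).trans (Finset.sum_le_sum fun P _ => (norm_sum_le _ _).trans
          (Finset.sum_le_sum fun Q _ => ?_))
        rw [norm_mul, norm_mul, RCLike.norm_conj]; rfl

open Classical in
/-- Almost orthogonality: diagonal part plus the contribution of nested frequency intervals. -/
lemma Packets.integral_norm_sq_sum_le (h : Packets A φ md ker) (c : Tile → ℂ) (T : Finset Tile) :
    ∫ x, ‖∑ P ∈ T, c P * φ P x‖ ^ 2 ≤ 64 * A ^ 2 * ∑ P ∈ T, tlen P * ‖c P‖ ^ 2 +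
      2 * ∑ P ∈ T, ∑ Q ∈ T with Q.1 < P.1 ∧ tW P ⊆ tL Q, ‖c P‖ * ‖c Q‖ * ipn φ P Q := by
  set a : Tile → Tile → ℝ := fun P Q => ‖c P‖ * ‖c Q‖ * ipn φ P Q with ha
  have ha0 : ∀ P Q, 0 ≤ a P Q := fun P Q =>
    mul_nonneg (by positivity) (ipn_nonneg P Q)
  have hsymm : ∀ P Q, a P Q = a Q P := fun P Q => by simp only [ha]; rw [ipn_comm]; ring
  let s : Tile → Tile → Prop := fun P Q => Q.1 = P.1 ∧ Q.2.2 = P.2.2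
  let o : Tile → Tile → Prop := fun P Q => Q.1 < P.1 ∧ tW P ⊆ tL Q
  have hsplit : ∀ P Q, a P Q ≤ (if s P Q then a P Q else 0) + (if o P Q then a P Q else 0) +
      (if o Q P then a P Q else 0) := by
    intro P Q
    by_cases hz : Disjoint (tL P) (tL Q)
    · have : a P Q = 0 := by simp [ha, ipn, h.orth P Q hz]
      simp [this]
    · obtain ⟨ξ, hξP, hξQ⟩ := Set.not_disjoint_iff.1 hz
      have q1 : 0 ≤ (if s P Q then a P Q else 0) := by split_ifs <;> simp [ha0]
      have q2 : 0 ≤ (if o P Q then a P Q else 0) := by split_ifs <;> simp [ha0]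
      have q3 : 0 ≤ (if o Q P then a P Q else 0) := by split_ifs <;> simp [ha0]
      rcases lt_trichotomy Q.1 P.1 with hlt | heq | hlt
      · have : o P Q := ⟨hlt, tW_subset_tL hlt (tL_subset_tW _ hξP) hξQ⟩
        rw [if_pos this] at q2 ⊢; linarith
      · have : s P Q := by
          refine ⟨heq, ?_⟩
          have e1 := tL_subset_tW _ hξP
          have e2 := tL_subset_tW _ hξQ
          unfold tW at e1 e2
          rw [mem_dy] at e1 e2
          rw [← e1, ← e2, heq]
        rw [if_pos this] at q1 ⊢; linarith
      · have : o Q P := ⟨hlt, tW_subset_tL hlt (tL_subset_tW _ hξQ) hξP⟩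
        rw [if_pos this] at q3 ⊢; linarith
  have hdiag : ∑ P ∈ T, ∑ Q ∈ T, (if s P Q then a P Q else 0) ≤
      64 * A ^ 2 * ∑ P ∈ T, tlen P * ‖c P‖ ^ 2 := by
    have e1 : ∀ P Q, (if s P Q then a P Q else 0) ≤
        (if s P Q then ‖c P‖ ^ 2 * ipn φ P Q else 0) / 2 +
        (if s Q P then ‖c Q‖ ^ 2 * ipn φ Q P else 0) / 2 := by
      intro P Q
      by_cases hs : s P Q
      · have hs' : s Q P := ⟨hs.1.symm, hs.2.symm⟩
        rw [if_pos hs, if_pos hs, if_pos hs', ipn_comm Q P]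
        simp only [ha]
        nlinarith [mul_nonneg (sq_nonneg (‖c P‖ - ‖c Q‖)) (ipn_nonneg (φ := φ) P Q)]
      · have hs' : ¬ s Q P := fun hs' => hs ⟨hs'.1.symm, hs'.2.symm⟩
        simp [hs, hs']
    have e2 : ∑ P ∈ T, ∑ Q ∈ T, (if s P Q then ‖c P‖ ^ 2 * ipn φ P Q else 0) ≤
        64 * A ^ 2 * ∑ P ∈ T, tlen P * ‖c P‖ ^ 2 := by
      rw [Finset.mul_sum]
      refine Finset.sum_le_sum fun P _ => ?_
      rw [← Finset.sum_filter, ← Finset.mul_sum]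
      have := h.sum_ipn_same_le T P
      calc _ ≤ ‖c P‖ ^ 2 * (64 * A ^ 2 * tlen P) := by gcongr
        _ = _ := by ring
    calc _ ≤ ∑ P ∈ T, ∑ Q ∈ T, ((if s P Q then ‖c P‖ ^ 2 * ipn φ P Q else 0) / 2 +
          (if s Q P then ‖c Q‖ ^ 2 * ipn φ Q P else 0) / 2) :=
          Finset.sum_le_sum fun P _ => Finset.sum_le_sum fun Q _ => e1 P Q
      _ = ∑ P ∈ T, ∑ Q ∈ T, (if s P Q then ‖c P‖ ^ 2 * ipn φ P Q else 0) := by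
          simp_rw [Finset.sum_add_distrib, ← Finset.sum_div]
          rw [Finset.sum_comm (f := fun P Q => if s Q P then ‖c Q‖ ^ 2 * ipn φ Q P else 0)]
          ring
      _ ≤ _ := e2
  calc _ ≤ ∑ P ∈ T, ∑ Q ∈ T, a P Q := h.integral_norm_sq_sum_le' c T
    _ ≤ ∑ P ∈ T, ∑ Q ∈ T, ((if s P Q then a P Q else 0) + (if o P Q then a P Q else 0) +
      (if o Q P then a P Q else 0)) :=
        Finset.sum_le_sum fun P _ => Finset.sum_le_sum fun Q _ => hsplit P Q
    _ = ∑ P ∈ T, ∑ Q ∈ T, (if s P Q then a P Q else 0) +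
        2 * ∑ P ∈ T, ∑ Q ∈ T, (if o P Q then a P Q else 0) := by
        simp_rw [Finset.sum_add_distrib]
        rw [Finset.sum_comm (f := fun P Q => if o Q P then a P Q else 0)]
        simp_rw [hsymm]
        ring_nf
    _ ≤ _ := by
        simp_rw [Finset.sum_filter]
        linarith

/-- Bessel inequality for an upper tree. -/
lemma Packets.bessel (h : Packets A φ md ker) (c : Tile → ℂ) {T : Finset Tile} {ξ : ℝ}
    (hT : ∀ P ∈ T, ξ ∈ tU P) :
    ∫ x, ‖∑ P ∈ T, c P * φ P x‖ ^ 2 ≤ 64 * A ^ 2 * ∑ P ∈ T, tlen P * ‖c P‖ ^ 2 := by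
  classical
  refine (h.integral_norm_sq_sum_le c T).trans (le_of_eq ?_)
  rw [add_eq_left]
  simp only [mul_eq_zero, OfNat.ofNat_ne_zero, false_or]
  refine Finset.sum_eq_zero fun P hP => ?_
  rw [Finset.filter_false_of_mem, Finset.sum_empty]
  rintro Q hQ ⟨_, h2⟩
  exact Set.disjoint_left.1 (disjoint_tL_tU Q) (h2 (tU_subset_tW _ (hT P hP))) (hT Q hQ)

/-- Normalised packet coefficient. -/
noncomputable def pcoef (φ : Tile → ℝ → ℂ) (f : ℝ → ℂ) (P : Tile) : ℂ :=
  (tlen P : ℂ)⁻¹ * ∫ x, f x * conj (φ P x)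

lemma Packets.sq_sum_pcoef_le (h : Packets A φ md ker) {f : ℝ → ℂ} (hf : MemLp f 2)
    (T : Finset Tile) :
    (∑ P ∈ T, tlen P * ‖pcoef φ f P‖ ^ 2) ^ 2 ≤
      (∫ x, ‖f x‖ ^ 2) * ∫ x, ‖∑ P ∈ T, pcoef φ f P * φ P x‖ ^ 2 := by
  have hInt : ∀ P, Integrable fun x => f x * conj (φ P x) := fun P =>
    MemLp.integrable_mul hf (h.memLp P).star
  have h1 : ((∑ P ∈ T, tlen P * ‖pcoef φ f P‖ ^ 2 : ℝ) : ℂ) =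
      ∫ x, f x * conj (∑ P ∈ T, pcoef φ f P * φ P x) := by
    have e : ∀ x, f x * conj (∑ P ∈ T, pcoef φ f P * φ P x) =
        ∑ P ∈ T, conj (pcoef φ f P) * (f x * conj (φ P x)) := fun x => by
      rw [map_sum, Finset.mul_sum]
      exact Finset.sum_congr rfl fun P _ => by rw [map_mul]; ring
    simp_rw [e]
    rw [integral_finsetSum _ fun P _ => (hInt P).const_mul _]
    simp_rw [integral_const_mul]
    push_cast
    refine Finset.sum_congr rfl fun P _ => ?_
    have hl : (tlen P : ℂ) ≠ 0 := by exact_mod_cast (tlen_pos P).ne'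
    have e2 : ∫ x, f x * conj (φ P x) = tlen P * pcoef φ f P := by
      rw [pcoef, mul_inv_cancel_left₀ hl]
    rw [e2, ← Complex.mul_conj']; ring
  have h0 : 0 ≤ ∑ P ∈ T, tlen P * ‖pcoef φ f P‖ ^ 2 :=
    Finset.sum_nonneg fun P _ => mul_nonneg (tlen_pos P).le (by positivity)
  have h2 : ∑ P ∈ T, tlen P * ‖pcoef φ f P‖ ^ 2 ≤
      ∫ x, ‖f x‖ * ‖∑ P ∈ T, pcoef φ f P * φ P x‖ := by
    have : ∑ P ∈ T, tlen P * ‖pcoef φ f P‖ ^ 2 =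
        ‖((∑ P ∈ T, tlen P * ‖pcoef φ f P‖ ^ 2 : ℝ) : ℂ)‖ := by
      rw [Complex.norm_real, Real.norm_of_nonneg h0]
    rw [this, h1]
    refine (norm_integral_le_integral_norm _).trans_eq ?_
    simp only [norm_mul, RCLike.norm_conj]
  exact (pow_le_pow_left₀ h0 h2 2).trans (integral_norm_mul_norm_sq_le hf (h.memLp_sum _ T))

/-- Dual Bessel inequality for an upper tree. -/
lemma Packets.bessel_dual (h : Packets A φ md ker) {f : ℝ → ℂ} (hf : MemLp f 2) {T : Finset Tile}
    {ξ : ℝ} (hT : ∀ P ∈ T, ξ ∈ tU P) :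
    ∑ P ∈ T, tlen P * ‖pcoef φ f P‖ ^ 2 ≤ 64 * A ^ 2 * ∫ x, ‖f x‖ ^ 2 := by
  have h1 := h.sq_sum_pcoef_le hf T
  have h2 := h.bessel (pcoef φ f) hT
  set S := ∑ P ∈ T, tlen P * ‖pcoef φ f P‖ ^ 2
  have h0 : 0 ≤ S := Finset.sum_nonneg fun P _ => mul_nonneg (tlen_pos P).le (by positivity)
  have hf0 : 0 ≤ ∫ x, ‖f x‖ ^ 2 := integral_nonneg fun x => by positivity
  rcases h0.eq_or_lt with hS | hS
  · rw [← hS]; positivity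
  have h3 : S * S ≤ (64 * A ^ 2 * ∫ x, ‖f x‖ ^ 2) * S := by
    calc S * S = S ^ 2 := by ring
      _ ≤ _ := h1
      _ ≤ (∫ x, ‖f x‖ ^ 2) * (64 * A ^ 2 * S) := by gcongr
      _ = _ := by ring
  exact le_of_mul_le_mul_right h3 hS

end packets

/-- A tree top: a dyadic interval `dy K m` and a frequency. -/
abbrev TreeTop := ℤ × ℤ × ℝ

section size
open Classical

/-- The tiles of `T` whose upper half lies in the tree with a given top. -/
noncomputable def upTree (T : Finset Tile) (t : TreeTop) : Finset Tile :=
  T.filter fun P => tI P ⊆ dy t.1 t.2.1 ∧ t.2.2 ∈ tU P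

/-- The tiles of `T` lying in the tree with a given top. -/
noncomputable def fullTree (T : Finset Tile) (t : TreeTop) : Finset Tile :=
  T.filter fun P => tI P ⊆ dy t.1 t.2.1 ∧ t.2.2 ∈ tW P

lemma mem_upTree {T : Finset Tile} {t : TreeTop} {P : Tile} :
    P ∈ upTree T t ↔ P ∈ T ∧ tI P ⊆ dy t.1 t.2.1 ∧ t.2.2 ∈ tU P := Finset.mem_filter

lemma mem_fullTree {T : Finset Tile} {t : TreeTop} {P : Tile} :
    P ∈ fullTree T t ↔ P ∈ T ∧ tI P ⊆ dy t.1 t.2.1 ∧ t.2.2 ∈ tW P := Finset.mem_filter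

/-- Energy of a set of tiles. -/
noncomputable def energy (α : Tile → ℂ) (T : Finset Tile) : ℝ := ∑ P ∈ T, tlen P * ‖α P‖ ^ 2

lemma energy_mono {α : Tile → ℂ} {T T' : Finset Tile} (h : T ⊆ T') : energy α T ≤ energy α T' :=
  Finset.sum_le_sum_of_subset_of_nonneg h fun P _ _ => mul_nonneg (tlen_pos P).le (by positivity)

lemma energy_nonneg {α : Tile → ℂ} {T : Finset Tile} : 0 ≤ energy α T :=
  Finset.sum_nonneg fun P _ => mul_nonneg (tlen_pos P).le (by positivity)

/-- The size of `T` is at most `σ`. -/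
def SizeLe (α : Tile → ℂ) (T : Finset Tile) (σ : ℝ) : Prop :=
  ∀ t : TreeTop, energy α (upTree T t) ≤ σ ^ 2 * 2 ^ t.1

lemma SizeLe.subset {α : Tile → ℂ} {T T' : Finset Tile} {σ : ℝ} (h : SizeLe α T σ) (hT : T' ⊆ T) :
    SizeLe α T' σ := fun t => (energy_mono (Finset.filter_subset_filter _ hT)).trans (h t)

lemma SizeLe.norm_le {α : Tile → ℂ} {T : Finset Tile} {σ : ℝ} (h : SizeLe α T σ) (hσ : 0 ≤ σ)
    {P : Tile} (hP : P ∈ T) : ‖α P‖ ≤ σ := by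
  have h1 := h (P.1, P.2.1, ((2 * P.2.2 + 1 : ℤ) : ℝ) * 2 ^ (-P.1 - 1))
  have h2 : P ∈ upTree T (P.1, P.2.1, ((2 * P.2.2 + 1 : ℤ) : ℝ) * 2 ^ (-P.1 - 1)) :=
    mem_upTree.2 ⟨hP, subset_rfl, left_mem_dy _ _⟩
  have h3 : tlen P * ‖α P‖ ^ 2 ≤ σ ^ 2 * tlen P := (Finset.single_le_sum
    (f := fun P => tlen P * ‖α P‖ ^ 2)
    (fun Q _ => mul_nonneg (tlen_pos Q).le (by positivity)) h2).trans h1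
  have h4 : ‖α P‖ ^ 2 ≤ σ ^ 2 := by
    rw [mul_comm] at h3; exact le_of_mul_le_mul_right h3 (tlen_pos P)
  exact (pow_le_pow_iff_left₀ (norm_nonneg _) hσ two_ne_zero).1 h4

/-- The set `S` is covered by trees whose top intervals have total length at most `B`. -/
def TreeCover (S : Finset Tile) (B : ℝ) : Prop :=
  ∃ (ι : Type) (L : Finset ι) (t : ι → TreeTop), (∀ P ∈ S, ∃ i ∈ L, P ∈ fullTree S (t i)) ∧
    ∑ i ∈ L, (2 : ℝ) ^ (t i).1 ≤ B

lemma sum_le_sum_cover {ι : Type*} {S : Finset Tile} {L : Finset ι} {U : ι → Finset Tile}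
    {F : Tile → ℝ} (hF : ∀ P, 0 ≤ F P) (h : ∀ P ∈ S, ∃ i ∈ L, P ∈ U i) :
    ∑ P ∈ S, F P ≤ ∑ i ∈ L, ∑ P ∈ U i, F P := by
  induction L using Finset.induction_on generalizing S with
  | empty =>
    have : S = ∅ := Finset.eq_empty_of_forall_notMem fun P hP => by simpa using h P hP
    simp [this]
  | insert a L ha ih =>
    rw [Finset.sum_insert ha, ← Finset.sum_filter_add_sum_filter_not S (· ∈ U a)]
    refine add_le_add (Finset.sum_le_sum_of_subset_of_nonneg
      (fun P hP => (Finset.mem_filter.1 hP).2) fun P _ _ => hF P) (ih fun P hP => ?_)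
    obtain ⟨i, hi, hPi⟩ := h P (Finset.mem_filter.1 hP).1
    rcases Finset.mem_insert.1 hi with rfl | hi
    · exact absurd hPi (Finset.mem_filter.1 hP).2
    · exact ⟨i, hi, hPi⟩

lemma TreeCover.sum_le {S : Finset Tile} {B c : ℝ} (h : TreeCover S B) {F : Tile → ℝ}
    (hF : ∀ P, 0 ≤ F P) (hc : 0 ≤ c) (hT : ∀ t : TreeTop, ∑ P ∈ fullTree S t, F P ≤ c * 2 ^ t.1) :
    ∑ P ∈ S, F P ≤ c * B := by
  obtain ⟨ι, L, t, h1, h2⟩ := h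
  calc ∑ P ∈ S, F P ≤ ∑ i ∈ L, ∑ P ∈ fullTree S (t i), F P := sum_le_sum_cover hF h1
    _ ≤ ∑ i ∈ L, c * 2 ^ (t i).1 := Finset.sum_le_sum fun i _ => hT _
    _ ≤ _ := by rw [← Finset.mul_sum]; gcongr

lemma exists_min_bad {α : Tile → ℂ} {T : Finset Tile} {σ : ℝ} (h : ¬ SizeLe α T σ) :
    ∃ t : TreeTop, σ ^ 2 * 2 ^ t.1 < energy α (upTree T t) ∧
      ∀ t' : TreeTop, σ ^ 2 * 2 ^ t'.1 < energy α (upTree T t') → t.2.2 ≤ t'.2.2 := by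
  let e : Tile → ℝ := fun P => ((2 * P.2.2 + 1 : ℤ) : ℝ) * 2 ^ (-P.1 - 1)
  let bad : TreeTop → Prop := fun t => σ ^ 2 * 2 ^ t.1 < energy α (upTree T t)
  have key : ∀ t : TreeTop, bad t → ∃ ξ ∈ T.image e, ξ ≤ t.2.2 ∧ bad (t.1, t.2.1, ξ) := by
    intro t ht
    have hne : (upTree T t).Nonempty := by
      by_contra hne
      rw [Finset.not_nonempty_iff_eq_empty] at hne
      have ht' : σ ^ 2 * 2 ^ t.1 < energy α (upTree T t) := ht
      rw [hne] at ht'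
      simp only [energy, Finset.sum_empty] at ht'
      have := two_zpow_pos t.1
      nlinarith [mul_nonneg (sq_nonneg σ) this.le]
    obtain ⟨P, hP, hmax⟩ := Finset.exists_max_image (upTree T t) (fun P => P.1) hne
    have hP' := mem_upTree.1 hP
    have heP : e P ∈ tU P := left_mem_dy _ _
    refine ⟨e P, Finset.mem_image_of_mem _ hP'.1, ?_, ?_⟩
    · have := hP'.2.2; unfold tU at this; rw [mem_dy'] at this; exact this.1
    · refine lt_of_lt_of_le ht (energy_mono fun Q hQ => ?_)
      have hQ' := mem_upTree.1 hQ
      exact mem_upTree.2 ⟨hQ'.1, hQ'.2.1, dy_subset (by have := hmax Q hQ; lia) hP'.2.2 hQ'.2.2 heP⟩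
  have hex : ∃ t, bad t := by
    simpa only [SizeLe, not_forall, not_le] using h
  obtain ⟨t0, ht0⟩ := hex
  obtain ⟨ξ0, hξ0, -, hb0⟩ := key t0 ht0
  obtain ⟨ξ, hξ, hmin⟩ := Finset.exists_min_image
    ((T.image e).filter fun ξ => ∃ K m, bad (K, m, ξ)) id
    ⟨ξ0, Finset.mem_filter.2 ⟨hξ0, _, _, hb0⟩⟩
  obtain ⟨-, K, m, hb⟩ := Finset.mem_filter.1 hξ
  refine ⟨(K, m, ξ), hb, fun t' ht' => ?_⟩
  obtain ⟨ξ', hξ', hle, hb'⟩ := key t' ht'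
  exact (hmin ξ' (Finset.mem_filter.2 ⟨hξ', _, _, hb'⟩)).trans hle

lemma disjoint_of_not_subset {P : Tile} {K m : ℤ} (hP : P.1 ≤ K) (h : ¬ tI P ⊆ dy K m) :
    Disjoint (tI P) (dy K m) :=
  Set.disjoint_left.2 fun _ hx hx' => h (dy_subset hP hx hx')

/-- Greedy selection of upper trees of large energy, by increasing frequency. -/
lemma exists_greedy (α : Tile → ℂ) {σ : ℝ} (hσ : 0 < σ) (n : ℕ) : ∀ T : Finset Tile, T.card ≤ n →
    ∃ R ⊆ T, SizeLe α R σ ∧ ∃ L : Finset (TreeTop × Finset Tile),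
      (∀ P ∈ T \ R, ∃ e ∈ L, tI P ⊆ dy e.1.1 e.1.2.1 ∧ e.1.2.2 ∈ tW P) ∧
      (∀ e ∈ L, e.2 ⊆ upTree T e.1 ∧ σ ^ 2 * 2 ^ e.1.1 < energy α e.2) ∧
      (L : Set (TreeTop × Finset Tile)).PairwiseDisjoint Prod.snd ∧
      ∀ a ∈ L, ∀ b ∈ L, ∀ P ∈ a.2, ∀ Q ∈ b.2, Q.1 < P.1 → tW P ⊆ tL Q →
        Disjoint (tI Q) (dy a.1.1 a.1.2.1) := by
  induction n with
  | zero =>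
    intro T hT
    have : T = ∅ := Finset.card_eq_zero.1 (Nat.le_zero.1 hT)
    subst this
    refine ⟨∅, subset_rfl, fun t => ?_, ∅, by simp⟩
    have := two_zpow_pos t.1
    simp only [energy, upTree, Finset.filter_empty, Finset.sum_empty]; positivity
  | succ n ih =>
    intro T hT
    by_cases hs : SizeLe α T σ
    · exact ⟨T, subset_rfl, hs, ∅, by simp⟩
    obtain ⟨t, hbad, hmin⟩ := exists_min_bad hs
    have hpos : ∀ t : TreeTop, 0 < σ ^ 2 * (2 : ℝ) ^ t.1 := fun t => by
      have := two_zpow_pos t.1; positivity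
    have hne : ∀ U : Finset Tile, 0 < energy α U → U.Nonempty := by
      intro U hU
      by_contra h
      rw [Finset.not_nonempty_iff_eq_empty] at h
      simp [h, energy] at hU
    have hup : upTree T t ⊆ fullTree T t := fun P hP => by
      have := mem_upTree.1 hP
      exact mem_fullTree.2 ⟨this.1, this.2.1, tU_subset_tW P this.2.2⟩
    have hcard : (T \ fullTree T t).card ≤ n := by
      have h1 : T \ fullTree T t ⊂ T := by
        refine Finset.sdiff_ssubset (Finset.filter_subset _ _) ?_
        exact (hne _ ((hpos t).trans hbad)).mono hup
      have := Finset.card_lt_card h1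
      lia
    obtain ⟨R, hR, hRs, L, h1, h2, h3, h4⟩ := ih _ hcard
    have hLsub : ∀ e ∈ L, ∀ P ∈ e.2, P ∈ T ∧ ¬ (tI P ⊆ dy t.1 t.2.1 ∧ t.2.2 ∈ tW P) ∧
        tI P ⊆ dy e.1.1 e.1.2.1 ∧ e.1.2.2 ∈ tU P := by
      intro e he P hP
      have h5 := mem_upTree.1 ((h2 e he).1 hP)
      have h6 := Finset.mem_sdiff.1 h5.1
      exact ⟨h6.1, fun h => h6.2 (mem_fullTree.2 ⟨h6.1, h⟩), h5.2⟩
    have hLξ : ∀ e ∈ L, t.2.2 ≤ e.1.2.2 := fun e he =>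
      hmin _ ((h2 e he).2.trans_le (energy_mono fun P hP =>
        mem_upTree.2 ⟨(hLsub e he P hP).1, (hLsub e he P hP).2.2⟩))
    refine ⟨R, hR.trans Finset.sdiff_subset, hRs, insert (t, upTree T t) L, ?_, ?_, ?_, ?_⟩
    · intro P hP
      have hP' := Finset.mem_sdiff.1 hP
      by_cases hf : P ∈ fullTree T t
      · exact ⟨_, Finset.mem_insert_self _ _, (mem_fullTree.1 hf).2⟩
      · obtain ⟨e, he, h⟩ := h1 P (Finset.mem_sdiff.2 ⟨Finset.mem_sdiff.2 ⟨hP'.1, hf⟩, hP'.2⟩)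
        exact ⟨e, Finset.mem_insert_of_mem he, h⟩
    · intro e he
      rcases Finset.mem_insert.1 he with rfl | he
      · exact ⟨subset_rfl, hbad⟩
      · exact ⟨(h2 e he).1.trans (Finset.filter_subset_filter _ Finset.sdiff_subset), (h2 e he).2⟩
    · rw [Finset.coe_insert]
      refine h3.insert fun e he _ => Finset.disjoint_left.2 fun P hP hP' => ?_
      exact (hLsub e he P hP').2.1 (mem_fullTree.1 (hup hP)).2
    · intro a ha b hb P hP Q hQ hlt hsub
      rcases Finset.mem_insert.1 ha with rfl | ha <;> rcases Finset.mem_insert.1 hb with rfl | hb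
      · have hP' := (mem_upTree.1 hP).2.2
        have hQ' := (mem_upTree.1 hQ).2.2
        exact absurd hQ' (Set.disjoint_left.1 (disjoint_tL_tU Q) (hsub (tU_subset_tW P hP')))
      · have hP' := (mem_upTree.1 hP).2
        refine disjoint_of_not_subset (hlt.le.trans (le_of_dy_subset hP'.1)) fun hI => ?_
        exact (hLsub b hb Q hQ).2.1
          ⟨hI, tL_subset_tW Q (hsub (tU_subset_tW P hP'.2))⟩
      · have h5 := hsub (tU_subset_tW P (hLsub a ha P hP).2.2.2)
        have h6 := lt_of_mem_tL_of_mem_tU h5 (mem_upTree.1 hQ).2.2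
        exact absurd (hLξ a ha) (not_le.2 h6)
      · exact h4 a ha b hb P hP Q hQ hlt hsub

end size

section size
open Classical

lemma sum_cross_le {U : Finset Tile} {K m : ℤ} {ξ : ℝ} {V : Tile → Finset Tile}
    (hU : ∀ P ∈ U, tI P ⊆ dy K m ∧ ξ ∈ tW P)
    (hV : ∀ P ∈ U, ∀ Q ∈ V P, Q.1 ≤ P.1 ∧ Disjoint (tI Q) (dy K m))
    (hd : ∀ P ∈ U, (V P : Set Tile).PairwiseDisjoint tI) :
    ∑ P ∈ U, ∑ Q ∈ V P, tlen Q * wt (tlen P) (tctr P - tctr Q) ^ 8 ≤ 4096 * 2 ^ K := by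
  set S : Set ℝ := (dy K m)ᶜ with hS
  have hSm : MeasurableSet S := (measurableSet_dy K m).compl
  have h1 : ∀ P ∈ U, ∑ Q ∈ V P, tlen Q * wt (tlen P) (tctr P - tctr Q) ^ 8 ≤
      16 * ∫ y in S, wt (tlen P) (y - tctr P) ^ 4 := by
    intro P hP
    have hs := tlen_pos P
    calc _ ≤ ∑ Q ∈ V P, tlen Q * wt (tlen P) (tctr P - tctr Q) ^ 4 := by
          refine Finset.sum_le_sum fun Q _ => ?_
          exact mul_le_mul_of_nonneg_left (wt_pow_le hs (by norm_num)) (tlen_pos Q).le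
      _ ≤ 2 ^ 4 * ∫ y in S, wt (tlen P) (y - tctr P) ^ 4 := by
          refine sum_wt_pow_le (by norm_num) _ tI tctr tlen S (fun Q _ => measurableSet_tI Q)
            (fun Q hQ => (hV P hP Q hQ).2.subset_compl_right) (hd P hP)
            (fun Q _ => volume_real_tI Q) hs (fun Q hQ y hy => ?_) _
          have := abs_sub_tctr_le hy
          have h2 := tlen_le_iff.2 (hV P hP Q hQ).1
          have := tlen_pos Q
          linarith
      _ = _ := by norm_num
  have h2 : ∀ k : ℤ, ∑ P ∈ U with P.1 = k, ∫ y in S, wt (tlen P) (y - tctr P) ^ 4 ≤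
      128 * 2 ^ k := by
    intro k
    have hk := two_zpow_pos k
    set a : ℝ := m * 2 ^ K
    set b : ℝ := (m + 1) * 2 ^ K
    have hInt := fun c => integrable_wt_sq hk c
    have hpt : ∀ y ∈ S, ∑ P ∈ U with P.1 = k, wt (tlen P) (y - tctr P) ^ 4 ≤
        16 * (wt (2 ^ k) (y - a) ^ 2 + wt (2 ^ k) (y - b) ^ 2) := by
      intro y hy
      have h3 : ∀ P ∈ U.filter (fun P => P.1 = k), wt (tlen P) (y - tctr P) ^ 4 ≤
          wt (2 ^ k) (y - tctr P) ^ 2 * (wt (2 ^ k) (y - a) ^ 2 + wt (2 ^ k) (y - b) ^ 2) := by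
        intro P hP
        rw [Finset.mem_filter] at hP
        have hc := (hU P hP.1).1 (tctr_mem P)
        rw [mem_dy'] at hc
        have : tlen P = 2 ^ k := by rw [tlen, hP.2]
        rw [this]
        have p0 := wt_nonneg (u := y - tctr P) hk
        have pa := wt_nonneg (u := y - a) hk
        have pb := wt_nonneg (u := y - b) hk
        have h4 : wt (2 ^ k) (y - tctr P) ^ 2 ≤ wt (2 ^ k) (y - a) ^ 2 + wt (2 ^ k) (y - b)
            ^ 2 := by
          have hy' : y < a ∨ b ≤ y := by
            by_contra hcon
            push Not at hcon
            exact hy (mem_dy'.2 hcon)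
          rcases hy' with hy' | hy'
          · have : wt (2 ^ k) (y - tctr P) ≤ 1 * wt (2 ^ k) (y - a) := by
              refine wt_comp hk ?_
              rw [abs_of_neg (by linarith), abs_of_neg (by linarith [hc.1])]
              linarith [hc.1]
            nlinarith [sq_nonneg (wt (2 ^ k) (y - b))]
          · have : wt (2 ^ k) (y - tctr P) ≤ 1 * wt (2 ^ k) (y - b) := by
              refine wt_comp hk ?_
              rw [abs_of_nonneg (by linarith), abs_of_pos (by linarith [hc.2])]
              linarith [hc.2]
            nlinarith [sq_nonneg (wt (2 ^ k) (y - a))]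
        calc wt (2 ^ k) (y - tctr P) ^ 4 = wt (2 ^ k) (y - tctr P) ^ 2 * wt (2 ^ k) (y - tctr P)
            ^ 2 := by
              ring
          _ ≤ _ := by gcongr
      refine (Finset.sum_le_sum h3).trans ?_
      rw [← Finset.sum_mul]
      refine mul_le_mul_of_nonneg_right ?_ (by positivity)
      refine sum_wt_scale_le (fun P hP => (Finset.mem_filter.1 hP).2) ?_ y
      intro P hP Q hQ hne
      simp only [Finset.coe_filter, mem_ofPred_eq] at hP hQ
      exact disjoint_tI (by rw [hP.2, hQ.2]) (hU P hP.1).2 (hU Q hQ.1).2 hne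
    have hi4 : ∀ P, Integrable fun y => wt (tlen P) (y - tctr P) ^ 4 := fun P =>
      integrable_wt_pow (tlen_pos P) _ (by norm_num)
    rw [← integral_finsetSum _ fun P _ => (hi4 P).integrableOn]
    calc _ ≤ ∫ y in S, 16 * (wt (2 ^ k) (y - a) ^ 2 + wt (2 ^ k) (y - b) ^ 2) :=
          setIntegral_mono_on (integrable_finsetSum _ fun P _ => (hi4 P).integrableOn)
            ((((hInt a).add (hInt b)).const_mul 16).integrableOn) hSm hpt
      _ ≤ ∫ y, 16 * (wt (2 ^ k) (y - a) ^ 2 + wt (2 ^ k) (y - b) ^ 2) :=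
          setIntegral_le_integral (((hInt a).add (hInt b)).const_mul 16)
            (.of_forall fun y => by positivity)
      _ = 16 * ((∫ y, wt (2 ^ k) (y - a) ^ 2) + ∫ y, wt (2 ^ k) (y - b) ^ 2) := by
          rw [integral_const_mul, integral_add (hInt a) (hInt b)]
      _ ≤ 16 * (4 * 2 ^ k + 4 * 2 ^ k) := by
          have := integral_wt_sq_le hk a
          have := integral_wt_sq_le hk b
          linarith
      _ = _ := by ring
  have hK := two_zpow_pos K
  calc _ ≤ ∑ P ∈ U, 16 * ∫ y in S, wt (tlen P) (y - tctr P) ^ 4 := Finset.sum_le_sum h1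
    _ = ∑ k ∈ U.image (fun P => P.1), ∑ P ∈ U with P.1 = k,
          16 * ∫ y in S, wt (tlen P) (y - tctr P) ^ 4 :=
        (Finset.sum_fiberwise_of_maps_to (fun P hP => Finset.mem_image_of_mem _ hP) _).symm
    _ ≤ ∑ k ∈ U.image (fun P => P.1), 2048 * (2 : ℝ) ^ k := by
        refine Finset.sum_le_sum fun k _ => ?_
        rw [← Finset.mul_sum]
        linarith [h2 k]
    _ ≤ 2048 * (2 * 2 ^ K) := by
        rw [← Finset.mul_sum]
        refine mul_le_mul_of_nonneg_left (sum_two_zpow_le hK.le fun k hk => ?_) (by norm_num)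
        obtain ⟨P, hP, rfl⟩ := Finset.mem_image.1 hk
        exact zpow_le_zpow_right₀ one_le_two (le_of_dy_subset (hU P hP).1)
    _ = _ := by ring

variable {A : ℝ} {φ : Tile → ℝ → ℂ} {md : ℝ → ℝ → ℂ} {ker : ℤ → ℝ → ℝ → ℂ}

/-- Size decomposition. -/
lemma Packets.size_lemma (h : Packets A φ md ker) {f : ℝ → ℂ} (hf : MemLp f 2) {T : Finset Tile}
    {σ : ℝ} (hσ : 0 < σ) (hT : SizeLe (pcoef φ f) T (2 * σ)) :
    ∃ R ⊆ T, SizeLe (pcoef φ f) R σ ∧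
      TreeCover (T \ R) (2 ^ 18 * A ^ 2 * (σ ^ 2)⁻¹ * ∫ x, ‖f x‖ ^ 2) := by
  set α := pcoef φ f with hα
  obtain ⟨R, hRT, hR, L, hcov, hsub, hdis, hcross⟩ := exists_greedy α hσ T.card T le_rfl
  refine ⟨R, hRT, hR, _, L, fun e => e.1, fun P hP => ?_, ?_⟩
  · obtain ⟨e, he, hPe⟩ := hcov P hP
    exact ⟨e, he, mem_fullTree.2 ⟨hP, hPe⟩⟩
  set B : ℝ := ∑ e ∈ L, (2 : ℝ) ^ e.1.1 with hB
  have hf0 : 0 ≤ ∫ x, ‖f x‖ ^ 2 := integral_nonneg fun x => by positivity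
  set 𝒮 : Finset Tile := L.biUnion Prod.snd with h𝒮
  have h𝒮T : 𝒮 ⊆ T := fun P hP => by
    obtain ⟨e, he, hPe⟩ := Finset.mem_biUnion.1 hP
    exact (mem_upTree.1 ((hsub e he).1 hPe)).1
  set S := energy α 𝒮 with hSdef
  have hSsum : S = ∑ e ∈ L, energy α e.2 := Finset.sum_biUnion hdis
  have hBS : σ ^ 2 * B ≤ S := by
    rw [hSsum, hB, Finset.mul_sum]
    exact Finset.sum_le_sum fun e he => (hsub e he).2.le
  have hσ2 : 0 < σ ^ 2 := by positivity
  have hS0 : 0 ≤ S := energy_nonneg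
  have hαle : ∀ P ∈ 𝒮, ‖α P‖ ≤ 2 * σ := fun P hP => hT.norm_le (by positivity) (h𝒮T hP)
  let V : Tile → Finset Tile := fun P => 𝒮.filter fun Q => Q.1 < P.1 ∧ tW P ⊆ tL Q
  have hoff : ∑ P ∈ 𝒮, ∑ Q ∈ V P, ‖α P‖ * ‖α Q‖ * ipn φ P Q ≤ 2 ^ 16 * A ^ 2 * S := by
    have hbi : ∑ P ∈ 𝒮, ∑ Q ∈ V P, tlen Q * wt (tlen P) (tctr P - tctr Q) ^ 8 ≤ 4096 * B := by
      rw [h𝒮, Finset.sum_biUnion hdis, hB, Finset.mul_sum]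
      refine Finset.sum_le_sum fun e he => ?_
      have hmem : ∀ P ∈ e.2, tI P ⊆ dy e.1.1 e.1.2.1 ∧ e.1.2.2 ∈ tW P := fun P hP => by
        have := (mem_upTree.1 ((hsub e he).1 hP)).2
        exact ⟨this.1, tU_subset_tW P this.2⟩
      refine sum_cross_le hmem (fun P hP Q hQ => ?_) fun P hP Q hQ Q' hQ' hne => ?_
      · obtain ⟨hQ1, hQ2, hQ3⟩ := Finset.mem_filter.1 hQ
        obtain ⟨e', he', hQe'⟩ := Finset.mem_biUnion.1 hQ1
        exact ⟨hQ2.le, hcross e he e' he' P hP Q hQe' hQ2 hQ3⟩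
      · have main : ∀ Q Q' : Tile, Q ∈ V P → Q' ∈ V P → Q ≠ Q' → Q.1 ≤ Q'.1 →
            Disjoint (tI Q) (tI Q') := by
          intro Q Q' hQ hQ' hne hle
          obtain ⟨hQ1, hQ2, hQ3⟩ := Finset.mem_filter.1 hQ
          obtain ⟨hQ1', hQ2', hQ3'⟩ := Finset.mem_filter.1 hQ'
          have hξ := (hmem P hP).2
          rcases hle.eq_or_lt with heq | hlt
          · exact disjoint_tI heq (tL_subset_tW _ (hQ3 hξ)) (tL_subset_tW _ (hQ3' hξ)) hne
          · obtain ⟨a, ha, hQ'a⟩ := Finset.mem_biUnion.1 hQ1'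
            obtain ⟨b, hb, hQb⟩ := Finset.mem_biUnion.1 hQ1
            have h5 := hcross a ha b hb Q' hQ'a Q hQb hlt
              (tW_subset_tL hlt (tL_subset_tW _ (hQ3' hξ)) (hQ3 hξ))
            exact h5.mono_right (mem_upTree.1 ((hsub a ha).1 hQ'a)).2.1
        rcases le_total Q.1 Q'.1 with hle | hle
        · exact main Q Q' hQ hQ' hne hle
        · exact (main Q' Q hQ' hQ hne.symm hle).symm
    have hA := h.one_le
    calc _ ≤ ∑ P ∈ 𝒮, ∑ Q ∈ V P, 16 * A ^ 2 * σ ^ 2 *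
            (tlen Q * wt (tlen P) (tctr P - tctr Q) ^ 8) := by
          refine Finset.sum_le_sum fun P hP => Finset.sum_le_sum fun Q hQ => ?_
          obtain ⟨hQ1, hQ2, hQ3⟩ := Finset.mem_filter.1 hQ
          have hw : 0 ≤ tlen Q * wt (tlen P) (tctr P - tctr Q) ^ 8 :=
            mul_nonneg (tlen_pos Q).le (pow_nonneg (wt_nonneg (tlen_pos P)) _)
          calc _ ≤ (2 * σ) * (2 * σ) * (4 * A ^ 2 * (tlen Q * wt (tlen P) (tctr P - tctr Q) ^ 8))
              := by
                have h1 := hαle P hP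
                have h2 := hαle Q hQ1
                have h3 := h.ipn_le hQ2.le
                have h4 := ipn_nonneg (φ := φ) P Q
                gcongr
            _ = _ := by ring
      _ ≤ 16 * A ^ 2 * σ ^ 2 * (4096 * B) := by
          simp only [← Finset.mul_sum]
          gcongr
      _ = 2 ^ 16 * A ^ 2 * (σ ^ 2 * B) := by ring
      _ ≤ _ := by gcongr
  have hS2 : S * S ≤ (∫ x, ‖f x‖ ^ 2) * (2 ^ 18 * A ^ 2) * S := by
    have h1 := h.sq_sum_pcoef_le hf 𝒮
    have h2 := h.integral_norm_sq_sum_le α 𝒮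
    calc S * S = S ^ 2 := by ring
      _ ≤ _ := h1
      _ ≤ (∫ x, ‖f x‖ ^ 2) * (64 * A ^ 2 * S + 2 * (2 ^ 16 * A ^ 2 * S)) := by
          refine mul_le_mul_of_nonneg_left (h2.trans ?_) hf0
          exact add_le_add le_rfl (mul_le_mul_of_nonneg_left hoff (by norm_num))
      _ ≤ (∫ x, ‖f x‖ ^ 2) * (2 ^ 18 * A ^ 2 * S) := by
          refine mul_le_mul_of_nonneg_left ?_ hf0
          nlinarith [mul_nonneg (sq_nonneg A) hS0]
      _ = _ := by ring
  have hS1 : S ≤ (∫ x, ‖f x‖ ^ 2) * (2 ^ 18 * A ^ 2) := by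
    rcases hS0.eq_or_lt with h0 | h0
    · rw [← h0]; positivity
    · exact le_of_mul_le_mul_right hS2 h0
  calc B = (σ ^ 2)⁻¹ * (σ ^ 2 * B) := by field_simp
    _ ≤ (σ ^ 2)⁻¹ * ((∫ x, ‖f x‖ ^ 2) * (2 ^ 18 * A ^ 2)) :=
        mul_le_mul_of_nonneg_left (hBS.trans hS1) (by positivity)
    _ = _ := by ring

end size

section mass
open Classical

/-- The part of `E` on which `N` takes values in the frequency interval of the tile. -/
def mset (E : Set ℝ) (N : ℝ → ℝ) (Q : Tile) : Set ℝ := E ∩ N ⁻¹' tW Q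

/-- The density of `E`, `N` at a tile. -/
noncomputable def dens (E : Set ℝ) (N : ℝ → ℝ) (Q : Tile) : ℝ :=
  (tlen Q)⁻¹ * ∫ x in mset E N Q, wt (tlen Q) (x - tctr Q) ^ 4

/-- The mass of `T` is at most `μ`. -/
def MassLe (E : Set ℝ) (N : ℝ → ℝ) (T : Finset Tile) (μ : ℝ) : Prop :=
  ∀ P ∈ T, ∀ Q : Tile, tI P ⊆ tI Q → tW Q ⊆ tW P → dens E N Q ≤ μ

lemma MassLe.subset {E : Set ℝ} {N : ℝ → ℝ} {T T' : Finset Tile} {μ : ℝ} (h : MassLe E N T μ)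
    (hT : T' ⊆ T) : MassLe E N T' μ := fun P hP => h P (hT hP)

variable {E : Set ℝ} {N : ℝ → ℝ}

lemma measurableSet_mset (hE : MeasurableSet E) (hN : Measurable N) (Q : Tile) :
    MeasurableSet (mset E N Q) := hE.inter (hN (measurableSet_tW Q))

lemma sum_tlen_le_of_subset {X : Finset Tile} {a b : ℝ} (hab : a ≤ b)
    (hd : (X : Set Tile).PairwiseDisjoint tI) (hX : ∀ Q ∈ X, tI Q ⊆ Icc a b) :
    ∑ Q ∈ X, tlen Q ≤ b - a := by
  have h1 : ∑ Q ∈ X, tlen Q = volume.real (⋃ Q ∈ X, tI Q) := by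
    rw [measureReal_biUnion_finset hd (fun Q _ => measurableSet_tI Q)
      (fun Q _ => by rw [tI, volume_dy]; exact ENNReal.ofReal_ne_top)]
    simp only [volume_real_tI]
  rw [h1]
  calc _ ≤ volume.real (Icc a b) := measureReal_mono (iUnion₂_subset hX) (by simp)
    _ = _ := by rw [Real.volume_real_Icc_of_le hab]

lemma exists_large_ball (hE : MeasurableSet E) (hEf : volume E ≠ ∞) (hN : Measurable N) {μ : ℝ}
    (hμ : 0 < μ) {Q : Tile} (h : μ < dens E N Q) :
    ∃ j : ℕ, μ / 32 * tlen Q * 8 ^ j <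
      volume.real (mset E N Q ∩ {x | |x - tctr Q| ≤ 2 ^ j * tlen Q}) := by
  by_contra hcon
  push Not at hcon
  have hs := tlen_pos Q
  have hm := measurableSet_mset hE hN Q
  have hmf : volume (mset E N Q) ≠ ∞ := measure_ne_top_of_subset inter_subset_left hEf
  have hb : ∀ j : ℕ, MeasurableSet {x | |x - tctr Q| ≤ 2 ^ j * tlen Q} := fun j =>
    measurableSet_le (by fun_prop) measurable_const
  have key := integral_mul_wt_le (g := (mset E N Q).indicator 1)
    (fun x => indicator_nonneg (fun _ _ => zero_le_one) x)
    ((integrable_indicator_iff hm).2 (integrableOn_const hmf)) hs (M := μ / 32 * tlen Q)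
    (by positivity) (tctr Q) (fun j => by
      rw [setIntegral_indicator hm, Pi.one_def, setIntegral_const, smul_eq_mul, mul_one, inter_comm]
      exact hcon j)
  have h2 : ∫ x in mset E N Q, wt (tlen Q) (x - tctr Q) ^ 4 ≤ μ * tlen Q := by
    rw [← integral_indicator hm]
    refine le_trans (le_of_eq (integral_congr_ae (.of_forall fun x => ?_))) (key.trans_eq (by ring))
    by_cases hx : x ∈ mset E N Q <;> simp [hx]
  rw [dens] at h
  have h3 := mul_le_mul_of_nonneg_left h2 (inv_pos.2 hs).le
  rw [mul_comm μ, inv_mul_cancel_left₀ hs.ne'] at h3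
  linarith

lemma sum_tlen_dense_le (hE : MeasurableSet E) (hEf : volume E ≠ ∞) (hN : Measurable N) {μ : ℝ}
    (hμ : 0 < μ) {X : Finset Tile} (hX : ∀ P ∈ X, ∀ Q ∈ X, P ≠ Q → P.1 ≤ Q.1 →
      ∀ ξ ∈ tW P, ξ ∈ tW Q → Disjoint (tI P) (tI Q)) (j : ℕ)
    (hj : ∀ Q ∈ X, μ / 32 * tlen Q * 8 ^ j <
      volume.real (mset E N Q ∩ {x | |x - tctr Q| ≤ 2 ^ j * tlen Q})) :
    ∑ Q ∈ X, tlen Q ≤ 256 * μ⁻¹ * volume.real E * (1 / 4) ^ j := by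
  let B : Tile → Set (ℝ × ℝ) := fun Q => {x | |x - tctr Q| ≤ 2 ^ j * tlen Q} ×ˢ tW Q
  obtain ⟨M, hM⟩ : ∃ M, ∀ Q ∈ X, tlen Q ≤ M := by
    obtain ⟨M, hM⟩ := (X.image tlen).bddAbove
    exact ⟨M, fun Q hQ => hM (Finset.mem_coe.2 (Finset.mem_image_of_mem _ hQ))⟩
  obtain ⟨u, huX, hud, hu⟩ := Vitali.exists_disjoint_subfamily_covering_enlargement B (X : Set Tile)
    tlen (3 / 2) (by norm_num) (fun Q _ => (tlen_pos Q).le) M hM (fun Q _ =>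
      ⟨(tctr Q, (Q.2.2 : ℝ) * 2 ^ (-Q.1)), by
        have := tlen_pos Q
        refine ⟨?_, left_mem_dy _ _⟩
        simp only [mem_ofPred_eq, sub_self, abs_zero]; positivity⟩)
  have huf : u.Finite := X.finite_toSet.subset huX
  set U : Finset Tile := huf.toFinset with hU
  have hUmem : ∀ {b}, b ∈ U ↔ b ∈ u := by simp [hU]
  have hle : ∀ {a b : Tile}, tlen a ≤ 3 / 2 * tlen b → a.1 ≤ b.1 := by
    intro a b hab
    by_contra hcon
    push Not at hcon
    have : (2 : ℝ) ^ (b.1 + 1) ≤ 2 ^ a.1 := zpow_le_zpow_right₀ one_le_two hcon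
    rw [zpow_add_one₀ two_ne_zero] at this
    have hb := tlen_pos b
    unfold tlen at hab hb
    linarith
  let V : Tile → Finset Tile := fun b => X.filter fun a => (B a ∩ B b).Nonempty ∧ tlen a ≤ 3 / 2 *
      tlen b
  have hV : ∀ b ∈ U, ∑ a ∈ V b, tlen a ≤ 8 * 2 ^ j * tlen b := by
    intro b hb
    have hbs := tlen_pos b
    have hj1 : (1 : ℝ) ≤ 2 ^ j := one_le_pow₀ one_le_two
    have hsub : ∀ a ∈ V b, tI a ⊆ Icc (tctr b - 4 * 2 ^ j * tlen b) (tctr b + 4 * 2 ^ j * tlen b)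
        := by
      intro a ha x hx
      obtain ⟨haX, ⟨⟨y, ξ⟩, ⟨hy, -⟩, hy', -⟩, hal⟩ := Finset.mem_filter.1 ha
      have has := tlen_pos a
      have hal' := tlen_le_iff.2 (hle hal)
      simp only [mem_ofPred_eq] at hy hy'
      have hx' := abs_sub_tctr_le hx
      have h1 : |x - tctr b| ≤ 4 * 2 ^ j * tlen b := by
        calc |x - tctr b| ≤ |x - tctr a| + |y - tctr a| + |y - tctr b| := by
              rw [abs_sub_comm y (tctr a)]
              have := abs_sub_le x (tctr a) (tctr b)
              have := abs_sub_le (tctr a) y (tctr b)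
              linarith
          _ ≤ tlen b / 2 + 2 ^ j * tlen b + 2 ^ j * tlen b := by
              have : 2 ^ j * tlen a ≤ 2 ^ j * tlen b := by gcongr
              linarith
          _ ≤ _ := by nlinarith
      rw [abs_le] at h1
      exact ⟨by linarith [h1.1], by linarith [h1.2]⟩
    have hd : (V b : Set Tile).PairwiseDisjoint tI := by
      have hξ : ∀ a ∈ V b, (b.2.2 : ℝ) * 2 ^ (-b.1) ∈ tW a := by
        intro a ha
        obtain ⟨haX, ⟨⟨y, ξ⟩, ⟨-, hy⟩, -, hy'⟩, hal⟩ := Finset.mem_filter.1 ha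
        exact tW_subset_tW (hle hal) hy' hy (left_mem_dy _ _)
      intro a ha a' ha' hne
      have haX := (Finset.mem_filter.1 (Finset.mem_coe.1 ha)).1
      have haX' := (Finset.mem_filter.1 (Finset.mem_coe.1 ha')).1
      rcases le_total a.1 a'.1 with h | h
      · exact hX a haX a' haX' hne h _ (hξ a ha) (hξ a' ha')
      · exact (hX a' haX' a haX hne.symm h _ (hξ a' ha') (hξ a ha)).symm
    refine (sum_tlen_le_of_subset (by nlinarith) hd hsub).trans_eq (by ring)
  have hdisj : ∑ b ∈ U, volume.real (mset E N b ∩ {x | |x - tctr b| ≤ 2 ^ j * tlen b}) ≤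
      volume.real E := by
    rw [← measureReal_biUnion_finset (fun b hb b' hb' hne => Set.disjoint_left.2 fun x hx hx' =>
        Set.disjoint_left.1 (hud (hUmem.1 hb) (hUmem.1 hb') hne)
          (show (x, N x) ∈ B b from ⟨hx.2, hx.1.2⟩) ⟨hx'.2, hx'.1.2⟩)
      (fun b _ => (measurableSet_mset hE hN b).inter
        (measurableSet_le (by fun_prop) measurable_const))
      (fun b _ => measure_ne_top_of_subset (inter_subset_left.trans inter_subset_left) hEf)]
    exact measureReal_mono (iUnion₂_subset fun b _ => inter_subset_left.trans inter_subset_left) hEf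
  calc ∑ Q ∈ X, tlen Q ≤ ∑ b ∈ U, ∑ a ∈ V b, tlen a :=
        sum_le_sum_cover (fun P => (tlen_pos P).le) fun a ha => by
          obtain ⟨b, hb, h1, h2⟩ := hu a ha
          exact ⟨b, hUmem.2 hb, Finset.mem_filter.2 ⟨ha, h1, h2⟩⟩
    _ ≤ ∑ b ∈ U, 256 * μ⁻¹ * (1 / 4) ^ j *
          volume.real (mset E N b ∩ {x | |x - tctr b| ≤ 2 ^ j * tlen b}) := by
        refine Finset.sum_le_sum fun b hb => (hV b hb).trans ?_
        have h1 := (hj b (huX (hUmem.1 hb))).le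
        calc 8 * 2 ^ j * tlen b = 256 * μ⁻¹ * (1 / 4) ^ j * (μ / 32 * tlen b * 8 ^ j) := by
              have : (8 : ℝ) ^ j = 2 ^ j * 4 ^ j := by rw [← mul_pow]; norm_num
              rw [this]
              have h2 : (1 / 4 : ℝ) ^ j * 4 ^ j = 1 := by rw [← mul_pow]; norm_num
              have h3 : μ⁻¹ * μ = 1 := inv_mul_cancel₀ hμ.ne'
              calc _ = 8 * 2 ^ j * tlen b * (μ⁻¹ * μ) * ((1 / 4 : ℝ) ^ j * 4 ^ j) := by
                    rw [h2, h3]; ring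
                _ = _ := by ring
          _ ≤ _ := by gcongr
    _ = 256 * μ⁻¹ * (1 / 4) ^ j *
          ∑ b ∈ U, volume.real (mset E N b ∩ {x | |x - tctr b| ≤ 2 ^ j * tlen b}) := by
        rw [Finset.mul_sum]
    _ ≤ 256 * μ⁻¹ * (1 / 4) ^ j * volume.real E := by gcongr
    _ = _ := by ring

/-- Mass decomposition. -/
lemma mass_lemma (hE : MeasurableSet E) (hEf : volume E ≠ ∞) (hN : Measurable N) {μ : ℝ}
    (hμ : 0 < μ) (T : Finset Tile) :
    ∃ R ⊆ T, MassLe E N R μ ∧ TreeCover (T \ R) (512 * μ⁻¹ * volume.real E) := by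
  let le : Tile → Tile → Prop := fun P Q => tI P ⊆ tI Q ∧ tW Q ⊆ tW P
  let R := T.filter fun P => ∀ Q, le P Q → dens E N Q ≤ μ
  have hex : ∀ P ∈ T \ R, ∃ Q, le P Q ∧ μ < dens E N Q := by
    intro P hP
    obtain ⟨hPT, hPR⟩ := Finset.mem_sdiff.1 hP
    by_contra hcon
    push Not at hcon
    exact hPR (Finset.mem_filter.2 ⟨hPT, hcon⟩)
  choose! q hq hqd using hex
  set X := (T \ R).image q with hXdef
  set X' := X.filter fun Q => ∀ Q' ∈ X, le Q Q' → Q' = Q with hX'def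
  have hmax : ∀ Q ∈ X, ∃ Q' ∈ X', le Q Q' := by
    intro Q hQ
    obtain ⟨Q', hQ', hm⟩ := Finset.exists_max_image (X.filter (le Q)) (fun P => P.1)
      ⟨Q, Finset.mem_filter.2 ⟨hQ, subset_rfl, subset_rfl⟩⟩
    obtain ⟨hQ'X, hQQ'⟩ := Finset.mem_filter.1 hQ'
    refine ⟨Q', Finset.mem_filter.2 ⟨hQ'X, fun Q'' hQ'' hl => ?_⟩, hQQ'⟩
    have h1 := hm Q'' (Finset.mem_filter.2 ⟨hQ'', hQQ'.1.trans hl.1, hl.2.trans hQQ'.2⟩)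
    have h2 : Q'.1 ≤ Q''.1 := le_of_dy_subset hl.1
    exact tile_ext (le_antisymm h1 h2) (hl.1 (tctr_mem Q')) (tctr_mem Q')
      (left_mem_dy _ _) (hl.2 (left_mem_dy _ _))
  refine ⟨R, Finset.filter_subset _ _, fun P hP Q h1 h2 => (Finset.mem_filter.1 hP).2 Q ⟨h1, h2⟩,
    _, X', fun Q => (Q.1, Q.2.1, (Q.2.2 : ℝ) * 2 ^ (-Q.1)), fun P hP => ?_, ?_⟩
  · obtain ⟨Q, hQ, hl⟩ := hmax (q P) (Finset.mem_image_of_mem _ hP)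
    have h1 := hq P hP
    exact ⟨Q, hQ, mem_fullTree.2 ⟨hP, h1.1.trans hl.1, (hl.2.trans h1.2) (left_mem_dy _ _)⟩⟩
  have hX'd : ∀ P ∈ X', ∀ Q ∈ X', P ≠ Q → P.1 ≤ Q.1 →
      ∀ ξ ∈ tW P, ξ ∈ tW Q → Disjoint (tI P) (tI Q) := by
    intro P hP Q hQ hne hle ξ hξ hξ'
    refine Set.disjoint_left.2 fun x hx hx' => hne ?_
    exact ((Finset.mem_filter.1 hP).2 Q (Finset.mem_filter.1 hQ).1
      ⟨dy_subset hle hx hx', tW_subset_tW hle hξ' hξ⟩).symm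
  have hjex : ∀ Q ∈ X', ∃ j : ℕ, μ / 32 * tlen Q * 8 ^ j <
      volume.real (mset E N Q ∩ {x | |x - tctr Q| ≤ 2 ^ j * tlen Q}) := by
    intro Q hQ
    obtain ⟨P, hP, rfl⟩ := Finset.mem_image.1 (Finset.mem_filter.1 hQ).1
    exact exists_large_ball hE hEf hN hμ (hqd P hP)
  choose! J hJ using hjex
  have hg : ∀ s : Finset ℕ, ∑ j ∈ s, (1 / 4 : ℝ) ^ j ≤ 2 := fun s => by
    have h1 : Summable fun j : ℕ => (1 / 4 : ℝ) ^ j := summable_geometric_of_lt_one (by norm_num)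
        (by norm_num)
    refine (h1.sum_le_tsum s fun j _ => by positivity).trans ?_
    rw [tsum_geometric_of_lt_one (by norm_num) (by norm_num)]
    norm_num
  calc ∑ Q ∈ X', tlen Q = ∑ j ∈ X'.image J, ∑ Q ∈ X' with J Q = j, tlen Q :=
        (Finset.sum_fiberwise_of_maps_to (fun P hP => Finset.mem_image_of_mem _ hP) _).symm
    _ ≤ ∑ j ∈ X'.image J, 256 * μ⁻¹ * volume.real E * (1 / 4) ^ j := by
        refine Finset.sum_le_sum fun j _ => sum_tlen_dense_le hE hEf hN hμ ?_ j fun Q hQ => ?_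
        · exact fun P hP Q hQ => hX'd P (Finset.mem_filter.1 hP).1 Q (Finset.mem_filter.1 hQ).1
        · obtain ⟨h1, rfl⟩ := Finset.mem_filter.1 hQ
          exact hJ Q h1
    _ ≤ 256 * μ⁻¹ * volume.real E * 2 := by
        rw [← Finset.mul_sum]
        gcongr
        exact hg _
    _ = _ := by ring

end mass

lemma lintegral_cauchy_schwarz {α : Type*} [MeasurableSpace α] {μ : Measure α} {f g : α → ℝ≥0∞}
    (hf : AEMeasurable f μ) (hg : AEMeasurable g μ) :
    (∫⁻ x, f x * g x ∂μ) ^ 2 ≤ (∫⁻ x, f x ^ 2 ∂μ) * ∫⁻ x, g x ^ 2 ∂μ := by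
  have h := ENNReal.lintegral_mul_le_Lp_mul_Lq μ Real.HolderConjugate.two_two hf hg
  have e : ∀ a : ℝ≥0∞, (a ^ (1 / (2 : ℝ))) ^ 2 = a := fun a => by
    rw [← ENNReal.rpow_natCast, ← ENNReal.rpow_mul]; norm_num
  simp only [Pi.mul_apply, ENNReal.rpow_two] at h
  calc _ ≤ _ := pow_le_pow_left₀ (zero_le) h 2
    _ = _ := by rw [mul_pow, e, e]

/-- The standard averaging kernel at scale `2 ^ j`. -/
noncomputable def wk (j : ℤ) (u : ℝ) : ℝ≥0∞ := ENNReal.ofReal ((2 ^ j)⁻¹ * wt (2 ^ j) u ^ 4)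

/-- A majorant of the convolution of averaging kernels. -/
noncomputable def wk2 (j : ℤ) (u : ℝ) : ℝ≥0∞ := ENNReal.ofReal ((2 ^ j)⁻¹ * wt (2 ^ j) u ^ 2)

lemma measurable_wk : Measurable fun p : ℤ × ℝ => wk p.1 p.2 :=
  measurable_from_prod_countable_right fun j => by
    have := (continuous_wt (two_zpow_pos j)).measurable
    exact ((this.pow_const 4).const_mul (2 ^ j)⁻¹).ennreal_ofReal

lemma measurable_wk2 : Measurable fun p : ℤ × ℝ => wk2 p.1 p.2 :=
  measurable_from_prod_countable_right fun j => by
    have := (continuous_wt (two_zpow_pos j)).measurable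
    exact ((this.pow_const 2).const_mul (2 ^ j)⁻¹).ennreal_ofReal

lemma lintegral_wk2_le (j : ℤ) (z : ℝ) : ∫⁻ y, wk2 j (z - y) ≤ 4 := by
  have hj := two_zpow_pos j
  have hInt := (integrable_wt_sq hj z).const_mul (2 ^ j)⁻¹
  simp_rw [wk2, wt_sub_comm (u := z)]
  rw [← ofReal_integral_eq_lintegral_ofReal hInt (.of_forall fun y => by positivity),
    integral_const_mul]
  calc _ ≤ ENNReal.ofReal ((2 ^ j)⁻¹ * (4 * 2 ^ j)) := by
        gcongr; exact integral_wt_sq_le hj z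
    _ = 4 := by rw [mul_comm 4, inv_mul_cancel_left₀ hj.ne']; simp

lemma wk2_comm (j : ℤ) (z z' : ℝ) : wk2 j (z - z') = wk2 j (z' - z) := by
  rw [wk2, wk2, wt_sub_comm]

lemma lintegral_wk_mul_wk_le (i j : ℤ) (z z' : ℝ) :
    ∫⁻ y, wk i (z - y) * wk j (z' - y) ≤ 4 * (wk2 i (z - z') + wk2 j (z - z')) := by
  have main : ∀ i j : ℤ, ∀ z z' : ℝ, i ≤ j →
      ∫⁻ y, wk i (z - y) * wk j (z' - y) ≤ 4 * wk2 j (z - z') := by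
    intro i j z z' hij
    have hi := two_zpow_pos i
    have hj := two_zpow_pos j
    calc _ ≤ ∫⁻ y, wk2 i (z - y) * wk2 j (z - z') := by
          refine lintegral_mono fun y => ?_
          rw [wk, wk, wk2, wk2, ← ENNReal.ofReal_mul (by have := wt_nonneg (u := z - y) hi; positivity),
            ← ENNReal.ofReal_mul (by have := wt_nonneg (u := z - y) hi; positivity)]
          refine ENNReal.ofReal_le_ofReal ?_
          have p1 := wt_nonneg (u := z - y) hi
          have p2 := wt_nonneg (u := z - y) hj
          have p3 := wt_nonneg (u := z' - y) hj
          have h1 : wt (2 ^ i) (z - y) ≤ wt (2 ^ j) (z - y) :=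
            wt_mono hi (zpow_le_zpow_right₀ one_le_two hij)
          have h2 : wt (2 ^ j) (z - y) * wt (2 ^ j) (z' - y) ≤ wt (2 ^ j) (z - z') := by
            refine (wt_mul_wt_le hj).trans_eq ?_
            congr 1; ring
          calc _ = (2 ^ i)⁻¹ * wt (2 ^ i) (z - y) ^ 2 * (2 ^ j)⁻¹ *
                (wt (2 ^ i) (z - y) ^ 2 * wt (2 ^ j) (z' - y) ^ 4) := by ring
            _ ≤ (2 ^ i)⁻¹ * wt (2 ^ i) (z - y) ^ 2 * (2 ^ j)⁻¹ *
                (wt (2 ^ j) (z - y) ^ 2 * wt (2 ^ j) (z' - y) ^ 2) := by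
                refine mul_le_mul_of_nonneg_left ?_ (by positivity)
                exact mul_le_mul (pow_le_pow_left₀ p1 h1 2) (wt_pow_le hj (by norm_num))
                  (by positivity) (by positivity)
            _ = (2 ^ i)⁻¹ * wt (2 ^ i) (z - y) ^ 2 * (2 ^ j)⁻¹ *
                (wt (2 ^ j) (z - y) * wt (2 ^ j) (z' - y)) ^ 2 := by ring
            _ ≤ (2 ^ i)⁻¹ * wt (2 ^ i) (z - y) ^ 2 * (2 ^ j)⁻¹ * wt (2 ^ j) (z - z') ^ 2 := by
                gcongr
            _ = _ := by ring
      _ = (∫⁻ y, wk2 i (z - y)) * wk2 j (z - z') := by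
          refine lintegral_mul_const _ ?_
          exact measurable_wk2.comp (measurable_const.prodMk (measurable_const.sub measurable_id))
      _ ≤ _ := by gcongr; exact lintegral_wk2_le i z
  rcases le_total i j with hij | hij
  · exact (main i j z z' hij).trans (by gcongr; exact le_add_self)
  · simp_rw [mul_comm (wk i _)]
    refine (main j i z' z hij).trans ?_
    rw [wk2_comm]
    gcongr; exact le_self_add

/-- Square function bound for a linearized maximal operator, by the `TT*` method. -/
lemma lintegral_linearized_sq_le {J : Set ℝ} {g : ℝ → ℝ≥0∞} (hg : Measurable g)
    {s : ℝ → ℤ} (hs : Measurable s) :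
    (∫⁻ z in J, ∫⁻ y, wk (s z) (z - y) * g y) ^ 2 ≤ 32 * volume J * ∫⁻ y, g y ^ 2 := by
  have hk : Measurable fun p : ℝ × ℝ => wk (s p.1) (p.1 - p.2) :=
    measurable_wk.comp ((hs.comp measurable_fst).prodMk (measurable_fst.sub measurable_snd))
  have hk2 : Measurable fun p : ℝ × ℝ => wk2 (s p.1) (p.1 - p.2) :=
    measurable_wk2.comp ((hs.comp measurable_fst).prodMk (measurable_fst.sub measurable_snd))
  have hk' : Measurable fun p : ℝ × ℝ => wk (s p.2) (p.2 - p.1) := hk.comp measurable_swap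
  set H : ℝ → ℝ≥0∞ := fun y => ∫⁻ z in J, wk (s z) (z - y) with hH
  have hHm : Measurable H := hk'.lintegral_prod_right'
  have e1 : ∫⁻ z in J, ∫⁻ y, wk (s z) (z - y) * g y = ∫⁻ y, H y * g y := by
    rw [lintegral_lintegral_swap (by exact (hk.mul (hg.comp measurable_snd)).aemeasurable)]
    refine lintegral_congr fun y => ?_
    rw [lintegral_mul_const]
    exact hk.comp (measurable_id.prodMk measurable_const)
  have hH2 : ∫⁻ y, H y ^ 2 ≤ 32 * volume J := by
    have hm : ∀ y, Measurable fun z => wk (s z) (z - y) := fun y =>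
      hk.comp (measurable_id.prodMk measurable_const)
    calc ∫⁻ y, H y ^ 2 = ∫⁻ y, ∫⁻ z in J, ∫⁻ z' in J, wk (s z) (z - y) * wk (s z') (z' - y) := by
          refine lintegral_congr fun y => ?_
          rw [sq]
          simp only [hH]
          rw [← lintegral_mul_const _ (hm y)]
          refine lintegral_congr fun z => ?_
          rw [lintegral_const_mul _ (hm y)]
      _ = ∫⁻ z in J, ∫⁻ y, ∫⁻ z' in J, wk (s z) (z - y) * wk (s z') (z' - y) := by
          refine lintegral_lintegral_swap (Measurable.aemeasurable ?_)
          have : Measurable fun q : (ℝ × ℝ) × ℝ =>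
              wk (s q.1.2) (q.1.2 - q.1.1) * wk (s q.2) (q.2 - q.1.1) :=
            (hk.comp (measurable_fst.snd.prodMk measurable_fst.fst)).mul
              (hk.comp (measurable_snd.prodMk measurable_fst.fst))
          exact this.lintegral_prod_right'
      _ = ∫⁻ z in J, ∫⁻ z' in J, ∫⁻ y, wk (s z) (z - y) * wk (s z') (z' - y) := by
          refine lintegral_congr fun z => lintegral_lintegral_swap (Measurable.aemeasurable ?_)
          exact (hk.comp (measurable_const.prodMk measurable_fst)).mul
            (hk.comp (measurable_snd.prodMk measurable_fst))
      _ ≤ ∫⁻ z in J, ∫⁻ z' in J, 4 * (wk2 (s z) (z - z') + wk2 (s z') (z - z')) :=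
          lintegral_mono fun z => lintegral_mono fun z' => lintegral_wk_mul_wk_le _ _ _ _
      _ = 4 * ((∫⁻ z in J, ∫⁻ z' in J, wk2 (s z) (z - z')) +
            ∫⁻ z in J, ∫⁻ z' in J, wk2 (s z') (z' - z)) := by
          have hm1 : Measurable fun z => ∫⁻ z' in J, wk2 (s z) (z - z') := hk2.lintegral_prod_right'
          rw [← lintegral_add_left hm1, ← lintegral_const_mul' _ _ (by norm_num)]
          refine lintegral_congr fun z => ?_
          have hm2 : Measurable fun z' => wk2 (s z) (z - z') :=
            hk2.comp (measurable_const.prodMk measurable_id)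
          rw [← lintegral_add_left hm2, ← lintegral_const_mul' _ _ (by norm_num)]
          simp_rw [wk2_comm _ _ z]
      _ = 4 * ((∫⁻ z in J, ∫⁻ z' in J, wk2 (s z) (z - z')) +
            ∫⁻ z in J, ∫⁻ z' in J, wk2 (s z) (z - z')) := by
          congr 2
          exact lintegral_lintegral_swap (hk2.comp measurable_swap).aemeasurable
      _ ≤ 4 * ((∫⁻ _ in J, 4) + ∫⁻ _ in J, 4) := by
          gcongr with z z
          · exact (setLIntegral_le_lintegral _ _).trans (lintegral_wk2_le _ _)
          · exact (setLIntegral_le_lintegral _ _).trans (lintegral_wk2_le _ _)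
      _ = 32 * volume J := by
          simp only [lintegral_const, Measure.restrict_apply, MeasurableSet.univ, univ_inter]
          ring
  rw [e1]
  refine (lintegral_cauchy_schwarz hHm.aemeasurable hg.aemeasurable).trans ?_
  gcongr

lemma exists_measurable_argmax {G : ℤ → ℝ → ℝ≥0∞} (hG : ∀ j, Measurable (G j)) {S : Finset ℤ}
    (hS : S.Nonempty) :
    ∃ s : ℝ → ℤ, Measurable s ∧ ∀ z, ∀ j ∈ S, G j z ≤ G (s z) z := by
  have hG' : Measurable fun p : ℤ × ℝ => G p.1 p.2 := measurable_from_prod_countable_right hG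
  induction hS using Finset.Nonempty.cons_induction with
  | singleton a => exact ⟨fun _ => a, measurable_const, by simp⟩
  | cons a S ha hS ih =>
    obtain ⟨s, hs, h⟩ := ih
    have hm : Measurable fun z => G (s z) z := hG'.comp (hs.prodMk measurable_id)
    refine ⟨fun z => if G (s z) z ≤ G a z then a else s z,
      Measurable.ite (measurableSet_le hm (hG a)) measurable_const hs, fun z j hj => ?_⟩
    rcases Finset.mem_cons.1 hj with rfl | hj
    · by_cases hz : G (s z) z ≤ G j z
      · simp [hz]
      · simp only [hz, if_false]; exact (not_le.1 hz).le
    · by_cases hz : G (s z) z ≤ G a z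
      · simp only [hz, if_true]; exact (h z j hj).trans hz
      · simp only [hz, if_false]; exact h z j hj

/-- The maximal averaging operator over a finite set of scales. -/
noncomputable def maxAvg (S : Finset ℤ) (g : ℝ → ℝ≥0∞) (z : ℝ) : ℝ≥0∞ :=
  S.sup fun j => ∫⁻ y, wk j (z - y) * g y

lemma measurable_avg {g : ℝ → ℝ≥0∞} (hg : Measurable g) (j : ℤ) :
    Measurable fun z => ∫⁻ y, wk j (z - y) * g y := by
  have : Measurable fun p : ℝ × ℝ => wk j (p.1 - p.2) * g p.2 :=
    (measurable_wk.comp (measurable_const.prodMk (measurable_fst.sub measurable_snd))).mul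
      (hg.comp measurable_snd)
  exact this.lintegral_prod_right'

lemma lintegral_maxAvg_sq_le {J : Set ℝ} {g : ℝ → ℝ≥0∞} (hg : Measurable g) (S : Finset ℤ) :
    (∫⁻ z in J, maxAvg S g z) ^ 2 ≤ 32 * volume J * ∫⁻ y, g y ^ 2 := by
  rcases S.eq_empty_or_nonempty with rfl | hS
  · simp [maxAvg]
  obtain ⟨s, hs, h⟩ := exists_measurable_argmax (measurable_avg hg) hS
  refine le_trans ?_ (lintegral_linearized_sq_le hg hs)
  gcongr with z
  exact Finset.sup_le (h z)

/-- All tiles of `T` lie in the tree with top `t`. -/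
def IsTree (T : Finset Tile) (t : TreeTop) : Prop :=
  ∀ P ∈ T, tI P ⊆ dy t.1 t.2.1 ∧ t.2.2 ∈ tW P

/-- Centre of the top interval. -/
noncomputable def topCtr (t : TreeTop) : ℝ := (t.2.1 + 1 / 2) * 2 ^ t.1

/-- `r` is the distance function to the tiles of a tree, regularized by their lengths. -/
structure TreeRad (T : Finset Tile) (r : ℝ → ℝ) : Prop where
  le : ∀ x, ∀ P ∈ T, r x ≤ tlen P + |x - tctr P|
  ex : ∀ x, ∃ P ∈ T, r x = tlen P + |x - tctr P|

section treerad
variable {T : Finset Tile} {t : TreeTop} {r : ℝ → ℝ}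

lemma exists_treeRad (hT : T.Nonempty) : ∃ r, TreeRad T r :=
  ⟨fun x => T.inf' hT fun P => tlen P + |x - tctr P|, fun _ _ hP => Finset.inf'_le _ hP,
    fun _ => Finset.exists_mem_eq_inf' hT _⟩

lemma IsTree.tlen_le (hT : IsTree T t) {P : Tile} (hP : P ∈ T) : tlen P ≤ 2 ^ t.1 :=
  zpow_le_zpow_right₀ one_le_two (le_of_dy_subset (hT P hP).1)

lemma IsTree.abs_ctr_le (hT : IsTree T t) {P : Tile} (hP : P ∈ T) :
    |tctr P - topCtr t| ≤ 2 ^ t.1 / 2 := abs_sub_dy_ctr_le ((hT P hP).1 (tctr_mem P))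

lemma IsTree.disjoint_tI (hT : IsTree T t) {k : ℤ} :
    ((T.filter fun P => P.1 = k : Finset Tile) : Set Tile).PairwiseDisjoint tI := by
  intro P hP Q hQ hne
  simp only [Finset.coe_filter, mem_ofPred_eq] at hP hQ
  exact _root_.disjoint_tI (by rw [hP.2, hQ.2]) (hT P hP.1).2 (hT Q hQ.1).2 hne

lemma IsTree.subset {T' : Finset Tile} (hT : IsTree T t) (h : T' ⊆ T) : IsTree T' t :=
  fun P hP => hT P (h hP)

lemma IsTree.sum_wt_le (hT : IsTree T t) (k : ℤ) (x : ℝ) :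
    ∑ P ∈ T with P.1 = k, wt (tlen P) (x - tctr P) ^ 2 ≤ 16 := by
  refine le_trans (Finset.sum_le_sum fun P hP => ?_)
    (sum_wt_scale_le (fun P hP => (Finset.mem_filter.1 hP).2) (hT.disjoint_tI (k := k)) x)
  rw [tlen, (Finset.mem_filter.1 hP).2]

lemma TreeRad.pos (hr : TreeRad T r) (x : ℝ) : 0 < r x := by
  obtain ⟨P, -, h⟩ := hr.ex x
  rw [h]
  have := tlen_pos P
  positivity

lemma TreeRad.le_add (hr : TreeRad T r) (x y : ℝ) : r x ≤ r y + |x - y| := by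
  obtain ⟨P, hP, h⟩ := hr.ex y
  have h1 := hr.le x P hP
  have h2 := abs_sub_le x y (tctr P)
  linarith

lemma TreeRad.lipschitz (hr : TreeRad T r) : LipschitzWith 1 r :=
  LipschitzWith.of_le_add fun x y => by
    rw [Real.dist_eq]; exact hr.le_add x y

lemma TreeRad.continuous (hr : TreeRad T r) : Continuous r := hr.lipschitz.continuous

/-- Coefficient measuring the distance from a tile to the small tiles of the tree. -/
noncomputable def alp (r : ℝ → ℝ) (P : Tile) : ℝ :=
  (tlen P)⁻¹ * ∫ z, min (r z / tlen P) 1 * wt (tlen P) (z - tctr P) ^ 6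

lemma TreeRad.integrable_alp (hr : TreeRad T r) (P : Tile) :
    Integrable fun z => min (r z / tlen P) 1 * wt (tlen P) (z - tctr P) ^ 6 := by
  have hs := tlen_pos P
  refine (integrable_wt_pow hs (tctr P) (n := 6) (by norm_num)).mono' ?_ (.of_forall fun z => ?_)
  · refine Continuous.aestronglyMeasurable ?_
    exact ((hr.continuous.div_const _).min continuous_const).mul
      (((continuous_wt hs).comp (continuous_sub_right _)).pow 6)
  · have h1 := hr.pos z
    have h2 := wt_nonneg (u := z - tctr P) hs
    rw [Real.norm_of_nonneg (by positivity)]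
    exact mul_le_of_le_one_left (by positivity) (min_le_right _ _)

lemma TreeRad.alp_nonneg (hr : TreeRad T r) (P : Tile) : 0 ≤ alp r P := by
  have hs := tlen_pos P
  refine mul_nonneg (inv_pos.2 hs).le (integral_nonneg fun z => ?_)
  have h1 := hr.pos z
  have h2 := wt_nonneg (u := z - tctr P) hs
  simp only [Pi.zero_apply]; positivity

lemma TreeRad.alp_le (hr : TreeRad T r) (P : Tile) : alp r P ≤ 4 := by
  have hs := tlen_pos P
  have h1 : ∫ z, min (r z / tlen P) 1 * wt (tlen P) (z - tctr P) ^ 6 ≤ 4 * tlen P := by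
    refine (integral_mono (hr.integrable_alp P) (integrable_wt_pow hs (tctr P) (n := 6)
        (by norm_num))
      fun z => ?_).trans (integral_wt_pow_le hs _ (by norm_num))
    have h2 := wt_nonneg (u := z - tctr P) hs
    exact mul_le_of_le_one_left (by positivity) (min_le_right _ _)
  calc alp r P ≤ (tlen P)⁻¹ * (4 * tlen P) := by unfold alp; gcongr
    _ = 4 := by field_simp

lemma TreeRad.wt_le (hr : TreeRad T r) {P : Tile} (hP : P ∈ T) (z : ℝ) :
    wt (tlen P) (z - tctr P) ≤ min 1 (tlen P / r z) :=
  le_min (wt_le_one (tlen_pos P)) (wt_le_div (tlen_pos P) (hr.pos z) (hr.le z P hP))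

lemma IsTree.wt_le (hT : IsTree T t) {P : Tile} (hP : P ∈ T) (z : ℝ) :
    wt (tlen P) (z - tctr P) ≤ 2 * wt (2 ^ t.1) (z - topCtr t) := by
  refine (wt_mono (tlen_pos P) (hT.tlen_le hP)).trans (wt_comp (two_zpow_pos _) ?_)
  have h1 := hT.abs_ctr_le hP
  have h2 := abs_sub_le z (tctr P) (topCtr t)
  have := two_zpow_pos t.1
  have := abs_nonneg (z - tctr P)
  linarith

lemma TreeRad.sum_alp_le (hr : TreeRad T r) (hT : IsTree T t) :
    ∑ P ∈ T, tlen P * alp r P ≤ 1024 * 2 ^ t.1 := by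
  have hK := two_zpow_pos t.1
  have h1 : ∑ P ∈ T, tlen P * alp r P =
      ∫ z, ∑ P ∈ T, min (r z / tlen P) 1 * wt (tlen P) (z - tctr P) ^ 6 := by
    rw [integral_finsetSum _ fun P _ => hr.integrable_alp P]
    exact Finset.sum_congr rfl fun P _ => mul_inv_cancel_left₀ (tlen_pos P).ne' _
  have h2 : ∀ z, ∑ P ∈ T, min (r z / tlen P) 1 * wt (tlen P) (z - tctr P) ^ 6 ≤
      256 * wt (2 ^ t.1) (z - topCtr t) ^ 2 := by
    intro z
    have hrz := hr.pos z
    set W := wt (2 ^ t.1) (z - topCtr t)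
    have hW : 0 ≤ W := wt_nonneg hK
    calc _ = ∑ k ∈ T.image (fun P => P.1), ∑ P ∈ T with P.1 = k,
          min (r z / tlen P) 1 * wt (tlen P) (z - tctr P) ^ 6 :=
        (Finset.sum_fiberwise_of_maps_to (fun P hP => Finset.mem_image_of_mem _ hP) _).symm
      _ ≤ ∑ k ∈ T.image (fun P => P.1), ∑ P ∈ T with P.1 = k,
          min (r z / 2 ^ k) 1 * min 1 (2 ^ k / r z) * (4 * W ^ 2) *
            wt (tlen P) (z - tctr P) ^ 2 := by
          refine Finset.sum_le_sum fun k _ => Finset.sum_le_sum fun P hP => ?_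
          obtain ⟨hP', rfl⟩ := Finset.mem_filter.1 hP
          have hs := tlen_pos P
          have h3 := hr.wt_le hP' z
          have h4 := hT.wt_le hP' z
          change _ ≤ min (r z / tlen P) 1 * min 1 (tlen P / r z) * (4 * W ^ 2) * _
          set w := wt (tlen P) (z - tctr P)
          have hw : 0 ≤ w := wt_nonneg hs
          have hw1 : w ≤ 1 := wt_le_one hs
          have hm : 0 ≤ min (r z / tlen P) 1 := by positivity
          have hm' : 0 ≤ min 1 (tlen P / r z) := by positivity
          calc min (r z / tlen P) 1 * w ^ 6 = min (r z / tlen P) 1 * (w * w * w ^ 2) *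
              w ^ 2 := by ring
            _ ≤ min (r z / tlen P) 1 * (1 * min 1 (tlen P / r z) * (2 * W) ^ 2) * w ^ 2 := by
                gcongr
            _ = _ := by ring
      _ ≤ ∑ k ∈ T.image (fun P => P.1), min (r z / 2 ^ k) 1 * min 1 (2 ^ k / r z) * (64 * W ^ 2)
          := by
          refine Finset.sum_le_sum fun k _ => ?_
          rw [← Finset.mul_sum]
          have hk := two_zpow_pos k
          have h5 := hT.sum_wt_le k z
          calc _ ≤ min (r z / 2 ^ k) 1 * min 1 (2 ^ k / r z) * (4 * W ^ 2) * 16 := by gcongr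
            _ = _ := by ring
      _ ≤ 4 * (64 * W ^ 2) := by
          rw [← Finset.sum_mul]
          exact mul_le_mul_of_nonneg_right (sum_min_mul_min_le _ hrz) (by positivity)
      _ = _ := by ring
  rw [h1]
  calc _ ≤ ∫ z, 256 * wt (2 ^ t.1) (z - topCtr t) ^ 2 :=
        integral_mono (integrable_finsetSum _ fun P _ => hr.integrable_alp P)
          ((integrable_wt_sq hK _).const_mul _) h2
    _ = 256 * ∫ z, wt (2 ^ t.1) (z - topCtr t) ^ 2 := integral_const_mul _ _
    _ ≤ 256 * (4 * 2 ^ t.1) := by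
        gcongr; exact integral_wt_sq_le hK _
    _ = _ := by ring

lemma TreeRad.wt_pow_six_le (hr : TreeRad T r) {P : Tile} {x : ℝ} (hx : tlen P < 4 * r x) :
    wt (tlen P) (x - tctr P) ^ 6 ≤ 128 * alp r P := by
  have hs := tlen_pos P
  set w := wt (tlen P) (x - tctr P)
  have hw : 0 ≤ w := wt_nonneg hs
  set I := Icc (x - tlen P / 8) (x + tlen P / 8)
  have h1 : ∀ z ∈ I, w ^ 6 / 32 ≤ min (r z / tlen P) 1 * wt (tlen P) (z - tctr P) ^ 6 := by
    intro z hz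
    have hz' : |x - z| ≤ tlen P / 8 := abs_le.2 ⟨by linarith [hz.2], by linarith [hz.1]⟩
    have h2 := hr.le_add x z
    have h3 : 1 / 8 ≤ min (r z / tlen P) 1 := by
      refine le_min ?_ (by norm_num)
      rw [le_div_iff₀ hs]; linarith
    have h4 : w ≤ 9 / 8 * wt (tlen P) (z - tctr P) := by
      refine wt_comp hs ?_
      have h5 := abs_sub_le z x (tctr P)
      rw [abs_sub_comm z x] at h5
      have := abs_nonneg (x - tctr P)
      linarith
    calc w ^ 6 / 32 ≤ (9 / 8 * wt (tlen P) (z - tctr P)) ^ 6 / 32 := by gcongr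
      _ = (9 / 8) ^ 6 / 32 * wt (tlen P) (z - tctr P) ^ 6 := by ring
      _ ≤ 1 / 8 * wt (tlen P) (z - tctr P) ^ 6 := by
          have := wt_nonneg (u := z - tctr P) hs
          exact mul_le_mul_of_nonneg_right (by norm_num) (by positivity)
      _ ≤ _ := by
          have := wt_nonneg (u := z - tctr P) hs
          gcongr
  have h2 : w ^ 6 / 32 * (tlen P / 4) ≤
      ∫ z, min (r z / tlen P) 1 * wt (tlen P) (z - tctr P) ^ 6 := by
    calc w ^ 6 / 32 * (tlen P / 4) = ∫ z in I, w ^ 6 / 32 := by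
          rw [setIntegral_const, Real.volume_real_Icc_of_le (by linarith), smul_eq_mul]; ring
      _ ≤ ∫ z in I, min (r z / tlen P) 1 * wt (tlen P) (z - tctr P) ^ 6 :=
          setIntegral_mono_on (integrableOn_const (by simp [I]))
            (hr.integrable_alp P).integrableOn measurableSet_Icc h1
      _ ≤ _ := setIntegral_le_integral (hr.integrable_alp P) (.of_forall fun z => by
          have h1 := hr.pos z
          have h2 := wt_nonneg (u := z - tctr P) hs
          simp only [Pi.zero_apply]; positivity)
  calc w ^ 6 = 128 * ((tlen P)⁻¹ * (w ^ 6 / 32 * (tlen P / 4))) := by field_simp; ring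
    _ ≤ _ := by unfold alp; gcongr

end treerad

section largeset
variable {T : Finset Tile} {t : TreeTop} {r : ℝ → ℝ} {E : Set ℝ} {N : ℝ → ℝ} {μ : ℝ}

/-- The part of `E` where the large tiles of a tree are active. -/
def treeLarge (T : Finset Tile) (r : ℝ → ℝ) (E : Set ℝ) (N : ℝ → ℝ) : Set ℝ :=
  {x | x ∈ E ∧ ∃ P ∈ T, 4 * r x ≤ tlen P ∧ N x ∈ tW P}

lemma measurableSet_treeLarge (hr : TreeRad T r) (hE : MeasurableSet E) (hN : Measurable N) :
    MeasurableSet (treeLarge T r E N) := by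
  have : treeLarge T r E N = E ∩ ⋃ P ∈ T, {x | 4 * r x ≤ tlen P} ∩ N ⁻¹' tW P := by
    ext x; simp only [treeLarge, mem_ofPred_eq, mem_inter_iff, mem_iUnion, mem_preimage,
        exists_prop]
  rw [this]
  refine hE.inter (Finset.measurableSet_biUnion _ fun P _ => ?_)
  exact (measurableSet_le (hr.continuous.measurable.const_mul _) measurable_const).inter
    (hN (measurableSet_tW P))

lemma volume_treeLarge_le (hT : IsTree T t) (hr : TreeRad T r) (hE : MeasurableSet E)
    (hN : Measurable N) (hμ : MassLe E N T μ) (z : ℝ) :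
    volume (treeLarge T r E N ∩ {x | |x - z| < r z / 4}) ≤ ENNReal.ofReal (162 * μ * r z) := by
  obtain ⟨P₀, hP₀, hz⟩ := hr.ex z
  have hrz := hr.pos z
  obtain ⟨k, hk1, hk2⟩ := exists_mem_Ioc_zpow hrz (one_lt_two)
  have hk2' : r z ≤ 2 ^ (k + 1) := hk2
  have hk1' : (2 : ℝ) ^ (k + 1) < 2 * r z := by
    rw [zpow_add_one₀ two_ne_zero]; linarith
  set K := k + 1
  let Q : Tile := (K, ⌊tctr P₀ / 2 ^ K⌋, ⌊t.2.2 / 2 ^ (-K)⌋)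
  have hQl : tlen Q = 2 ^ K := rfl
  have hc0 : tctr P₀ ∈ tI Q := mem_dy_floor _ _
  have hξ : t.2.2 ∈ tW Q := mem_dy_floor _ _
  have hPQ : P₀.1 ≤ Q.1 := by
    rw [← tlen_le_iff, hQl]
    have := abs_nonneg (z - tctr P₀)
    linarith
  have hd : dens E N Q ≤ μ := hμ P₀ hP₀ Q (dy_subset hPQ (tctr_mem P₀) hc0)
    (tW_subset_tW hPQ hξ (hT P₀ hP₀).2)
  have hsub : treeLarge T r E N ∩ {x | |x - z| < r z / 4} ⊆
      mset E N Q ∩ {x | |x - tctr Q| ≤ 2 * tlen Q} := by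
    rintro x ⟨⟨hxE, P, hP, h4, hNx⟩, hxz⟩
    simp only [mem_ofPred_eq] at hxz
    have h1 := hr.le_add z x
    rw [abs_sub_comm] at h1
    have hQP : Q.1 ≤ P.1 := by
      rw [← tlen_le_iff, hQl]; linarith
    refine ⟨⟨hxE, tW_subset_tW hQP (hT P hP).2 hξ hNx⟩, ?_⟩
    have h2 := abs_sub_tctr_le hc0
    have h3 := abs_sub_le x z (tctr Q)
    have h5 := abs_sub_le z (tctr P₀) (tctr Q)
    have h6 := tlen_pos P₀
    rw [hQl] at *
    simp only [mem_ofPred_eq]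
    linarith
  have hQ := tlen_pos Q
  have hm : MeasurableSet (mset E N Q ∩ {x | |x - tctr Q| ≤ 2 * tlen Q}) :=
    (measurableSet_mset hE hN Q).inter
      (measurableSet_le ((measurable_id.sub_const _).abs) measurable_const)
  have hfin : volume (mset E N Q ∩ {x | |x - tctr Q| ≤ 2 * tlen Q}) ≠ ∞ := by
    refine ((measure_mono (t := Icc (tctr Q - 2 * tlen Q) (tctr Q + 2 * tlen Q)) ?_).trans_lt ?_).ne
    · rintro x ⟨-, hx⟩
      have hx' : |x - tctr Q| ≤ 2 * tlen Q := hx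
      have := abs_le.1 hx'
      exact ⟨by linarith, by linarith⟩
    · simp
  have hInt := (integrable_wt_pow hQ (tctr Q) (n := 4) (by norm_num))
  have key : volume.real (mset E N Q ∩ {x | |x - tctr Q| ≤ 2 * tlen Q}) * (1 / 81) ≤ 2 ^ K * μ := by
    calc _ = ∫ x in mset E N Q ∩ {x | |x - tctr Q| ≤ 2 * tlen Q}, (1 / 81 : ℝ) := by
          rw [setIntegral_const, smul_eq_mul]
      _ ≤ ∫ x in mset E N Q ∩ {x | |x - tctr Q| ≤ 2 * tlen Q}, wt (tlen Q) (x - tctr Q) ^ 4 := by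
          refine setIntegral_mono_on (integrableOn_const hfin) hInt.integrableOn hm ?_
          rintro x ⟨-, hx⟩
          simp only [mem_ofPred_eq] at hx
          have : 1 / 3 ≤ wt (tlen Q) (x - tctr Q) := by
            rw [wt, le_div_iff₀ (by positivity)]; linarith
          calc (1 / 81 : ℝ) = (1 / 3) ^ 4 := by norm_num
            _ ≤ _ := by gcongr
      _ ≤ ∫ x in mset E N Q, wt (tlen Q) (x - tctr Q) ^ 4 := by
          refine setIntegral_mono_set hInt.integrableOn (.of_forall fun x => ?_)
            inter_subset_left.eventuallyLE
          have := wt_nonneg (u := x - tctr Q) hQ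
          simp only [Pi.zero_apply]; positivity
      _ = 2 ^ K * dens E N Q := by
          rw [dens, ← hQl, mul_inv_cancel_left₀ hQ.ne']
      _ ≤ 2 ^ K * μ := by gcongr
  have hμ0 : 0 ≤ μ := by
    by_contra h
    have h1 := two_zpow_pos K
    have : (0 : ℝ) ≤ volume.real (mset E N Q ∩ {x | |x - tctr Q| ≤ 2 * tlen Q})
        := measureReal_nonneg
    nlinarith
  refine (measure_mono hsub).trans ?_
  rw [← ENNReal.ofReal_toReal hfin]
  refine ENNReal.ofReal_le_ofReal ?_
  have : 2 ^ K * μ ≤ 2 * r z * μ := by gcongr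
  change volume.real _ ≤ _
  linarith

lemma abs_sub_topCtr_le (hT : IsTree T t) (hr : TreeRad T r) {x z : ℝ}
    (hx : x ∈ treeLarge T r E N) (hz : |x - z| < r z / 4) : |z - topCtr t| ≤ 2 ^ t.1 := by
  obtain ⟨-, P, hP, h4, -⟩ := hx
  obtain ⟨P', hP', h5⟩ := hr.ex x
  have h1 := hT.tlen_le hP
  have h2 := hT.abs_ctr_le hP'
  have h3 := hr.le_add z x
  have h6 := abs_sub_le z x (topCtr t)
  have h7 := abs_sub_le x (tctr P') (topCtr t)
  have h8 := tlen_pos P'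
  rw [abs_sub_comm z x] at h3 h6
  have h9 := abs_nonneg (x - tctr P')
  linarith

/-- Averaging over the large set of a tree. -/
lemma lintegral_treeLarge_le (hT : IsTree T t) (hr : TreeRad T r) (hE : MeasurableSet E)
    (hN : Measurable N) (hμ : MassLe E N T μ) {F S : ℝ → ℝ≥0∞} (hS : Measurable S)
    (hF : ∀ x ∈ treeLarge T r E N, ∀ z, |x - z| < r z / 4 → F x ≤ S z) :
    ∫⁻ x in treeLarge T r E N, F x ≤
      ENNReal.ofReal (486 * μ) * ∫⁻ z in Icc (topCtr t - 2 ^ t.1) (topCtr t + 2 ^ t.1), S z := by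
  set G := treeLarge T r E N with hG
  have hGm : MeasurableSet G := measurableSet_treeLarge hr hE hN
  set J := Icc (topCtr t - 2 ^ t.1) (topCtr t + 2 ^ t.1)
  have hrm := hr.continuous.measurable
  let D : Set (ℝ × ℝ) := {p | p.1 ∈ G ∧ |p.1 - p.2| < r p.2 / 4}
  have hD : MeasurableSet D := (measurable_fst hGm).inter
    (measurableSet_lt ((measurable_fst.sub measurable_snd).abs)
      ((hrm.comp measurable_snd).div_const _))
  let κ : ℝ × ℝ → ℝ≥0∞ := D.indicator fun p => ENNReal.ofReal (r p.2)⁻¹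
  have hκ : Measurable κ := ((hrm.comp measurable_snd).inv.ennreal_ofReal).indicator hD
  have hκ1 : ∀ x ∈ G, ENNReal.ofReal (1 / 3) ≤ ∫⁻ z, κ (x, z) := by
    intro x hx
    have hrx := hr.pos x
    calc ENNReal.ofReal (1 / 3) = ∫⁻ z in Ioo (x - r x / 5) (x + r x / 5),
          ENNReal.ofReal (5 / (6 * r x)) := by
          rw [lintegral_const, Measure.restrict_apply_univ, Real.volume_Ioo,
            ← ENNReal.ofReal_mul (by positivity)]
          congr 1; field_simp; ring
      _ ≤ ∫⁻ z in Ioo (x - r x / 5) (x + r x / 5), κ (x, z) := by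
          refine setLIntegral_mono (hκ.comp (measurable_const.prodMk measurable_id)) fun z hz => ?_
          have hxz : |x - z| < r x / 5 := abs_lt.2 ⟨by linarith [hz.2], by linarith [hz.1]⟩
          have h1 := hr.le_add x z
          have h2 := hr.le_add z x
          rw [abs_sub_comm z x] at h2
          have hrz := hr.pos z
          have hmem : (x, z) ∈ D := ⟨hx, by simp only; linarith⟩
          simp only [κ, indicator_of_mem hmem]
          refine ENNReal.ofReal_le_ofReal ?_
          rw [div_le_iff₀ (by positivity), inv_mul_eq_div, le_div_iff₀ hrz]
          linarith
      _ ≤ _ := setLIntegral_le_lintegral _ _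
  have hpt : ∀ x ∈ G, F x ≤ 3 * ∫⁻ z in J, κ (x, z) * S z := by
    intro x hx
    calc F x = 3 * (F x * ENNReal.ofReal (1 / 3)) := by
          rw [mul_left_comm, show (3 : ℝ≥0∞) = ENNReal.ofReal 3 by simp,
            ← ENNReal.ofReal_mul (by norm_num)]; norm_num
      _ ≤ 3 * (F x * ∫⁻ z, κ (x, z)) := by gcongr; exact hκ1 x hx
      _ = 3 * ∫⁻ z, F x * κ (x, z) := by
          congr 1
          exact (lintegral_const_mul _ (hκ.comp (measurable_const.prodMk measurable_id))).symm
      _ ≤ 3 * ∫⁻ z, J.indicator (fun z => κ (x, z) * S z) z := by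
          gcongr with z
          by_cases hz : (x, z) ∈ D
          · have hzJ : z ∈ J := by
              have := abs_le.1 (abs_sub_topCtr_le hT hr hx hz.2)
              exact ⟨by linarith, by linarith⟩
            rw [indicator_of_mem hzJ, mul_comm]
            gcongr
            exact hF x hx z hz.2
          · simp [κ, indicator_of_notMem hz]
      _ = _ := by rw [lintegral_indicator measurableSet_Icc]
  calc ∫⁻ x in G, F x ≤ ∫⁻ x in G, 3 * ∫⁻ z in J, κ (x, z) * S z := setLIntegral_mono' hGm hpt
    _ = 3 * ∫⁻ x in G, ∫⁻ z in J, κ (x, z) * S z := lintegral_const_mul' _ _ (by norm_num)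
    _ = 3 * ∫⁻ z in J, ∫⁻ x in G, κ (x, z) * S z := by
        rw [lintegral_lintegral_swap]
        exact (hκ.mul (hS.comp measurable_snd)).aemeasurable
    _ ≤ 3 * ∫⁻ z in J, ENNReal.ofReal (162 * μ) * S z := by
        gcongr with z
        have hrz := hr.pos z
        refine (lintegral_mul_const _
          (hκ.comp (measurable_id.prodMk (measurable_const (a := z))))).trans_le ?_
        refine mul_le_mul_left ?_ _
        calc _ ≤ ∫⁻ x, (G ∩ {x | |x - z| < r z / 4}).indicator
              (fun _ => ENNReal.ofReal (r z)⁻¹) x := by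
              refine (setLIntegral_le_lintegral _ _).trans (lintegral_mono fun x => ?_)
              by_cases hx : (x, z) ∈ D
              · have hx' : x ∈ G ∩ {x | |x - z| < r z / 4} := hx
                rw [indicator_of_mem hx']
                have e : κ (x, z) = ENNReal.ofReal (r z)⁻¹ := indicator_of_mem hx _
                exact e.le
              · simp [κ, indicator_of_notMem hx]
          _ ≤ ENNReal.ofReal (r z)⁻¹ * volume (G ∩ {x | |x - z| < r z / 4}) :=
              lintegral_indicator_const_le _ _
          _ ≤ ENNReal.ofReal (r z)⁻¹ * ENNReal.ofReal (162 * μ * r z) := by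
              gcongr; exact volume_treeLarge_le hT hr hE hN hμ z
          _ = _ := by
              rw [← ENNReal.ofReal_mul (by positivity)]
              congr 1; field_simp
    _ = _ := by
        rw [lintegral_const_mul' _ _ ENNReal.ofReal_ne_top, ← mul_assoc]
        congr 1
        rw [show (3 : ℝ≥0∞) = ENNReal.ofReal 3 by simp, ← ENNReal.ofReal_mul (by norm_num)]
        congr 1; ring

end largeset

section treelemma
open Classical
variable {A : ℝ} {φ : Tile → ℝ → ℂ} {md : ℝ → ℝ → ℂ} {ker : ℤ → ℝ → ℝ → ℂ}
variable {T : Finset Tile} {t : TreeTop} {r : ℝ → ℝ} {E : Set ℝ} {N : ℝ → ℝ} {μ σ : ℝ}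
  {c : Tile → ℂ}

lemma Packets.sum_scale_le (h : Packets A φ md ker) (hT : IsTree T t) (hσ : 0 ≤ σ)
    (hc : ∀ P ∈ T, ‖c P‖ ≤ σ) (k : ℤ) {S : Finset Tile} (hS : S ⊆ T) (hSk : ∀ P ∈ S, P.1 = k)
    (x : ℝ) : ∑ P ∈ S, ‖c P * φ P x‖ ≤ 16 * A * σ := by
  have hA : 0 ≤ A := by linarith [h.one_le]
  calc ∑ P ∈ S, ‖c P * φ P x‖ ≤ ∑ P ∈ S, σ * A * wt (tlen P) (x - tctr P) ^ 2 := by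
        refine Finset.sum_le_sum fun P hP => ?_
        have hs := tlen_pos P
        have h1 := h.decay P x
        have h2 : wt (tlen P) (x - tctr P) ^ 10 ≤ wt (tlen P) (x - tctr P) ^ 2 :=
          wt_pow_le hs (by norm_num)
        rw [norm_mul, mul_assoc]
        exact mul_le_mul (hc P (hS hP)) (h1.trans (mul_le_mul_of_nonneg_left h2 hA)) (norm_nonneg _)
            hσ
    _ = σ * A * ∑ P ∈ S, wt (tlen P) (x - tctr P) ^ 2 := (Finset.mul_sum ..).symm
    _ ≤ σ * A * 16 := by
        refine mul_le_mul_of_nonneg_left ?_ (by positivity)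
        refine (Finset.sum_le_sum_of_subset_of_nonneg (t := T.filter fun P => P.1 = k) (fun P hP =>
          Finset.mem_filter.2 ⟨hS hP, hSk P hP⟩) fun P _ _ => by positivity).trans
          (hT.sum_wt_le k x)
    _ = _ := by ring

/-- Lower part of a tree: only one scale is active at each point. -/
lemma Packets.lower_le (h : Packets A φ md ker) (hT : IsTree T t) (hσ : 0 ≤ σ)
    (hc : ∀ P ∈ T, ‖c P‖ ≤ σ) (x ν : ℝ) {S : Finset Tile} (hS : S ⊆ T)
    (hSL : ∀ P ∈ S, t.2.2 ∈ tL P ∧ ν ∈ tU P) :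
    ‖∑ P ∈ S, c P * φ P x‖ ≤ 16 * A * σ := by
  rcases S.eq_empty_or_nonempty with rfl | ⟨P₀, hP₀⟩
  · have := h.one_le; simp; positivity
  refine (norm_sum_le _ _).trans (h.sum_scale_le hT hσ hc P₀.1 hS ?_ x)
  have key : ∀ P ∈ S, ∀ Q ∈ S, ¬ Q.1 < P.1 := fun P hP Q hQ hlt =>
    disjoint_left.1 (disjoint_tL_tU Q)
      (tW_subset_tL hlt (tL_subset_tW P (hSL P hP).1) (hSL Q hQ).1
        (tU_subset_tW P (hSL P hP).2)) (hSL Q hQ).2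
  intro P hP
  exact le_antisymm (not_lt.1 (key P hP P₀ hP₀)) (not_lt.1 (key P₀ hP₀ P hP))

/-- Reproducing a truncation of an upper tree from the full tree. -/
lemma Packets.truncation_le (h : Packets A φ md ker) (hT : IsTree T t) (hσ : 0 ≤ σ)
    (hc : ∀ P ∈ T, ‖c P‖ ≤ σ) (hU : ∀ P ∈ T, t.2.2 ∈ tU P) (j : ℤ) (x : ℝ) :
    ‖∑ P ∈ T with j ≤ P.1, c P * φ P x‖ₑ ≤
      ENNReal.ofReal A * (∫⁻ y, wk j (x - y) * ‖∑ P ∈ T, c P * φ P y‖ₑ) +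
        ENNReal.ofReal (192 * A ^ 2 * σ) := by
  have hA : 0 ≤ A := by linarith [h.one_le]
  have hj := two_zpow_pos j
  set ξ := t.2.2
  have hkc : Continuous fun y => ker j ξ (x - y) :=
    (h.ker_cont j ξ).comp (continuous_const.sub continuous_id)
  have hkb : ∀ y, ‖ker j ξ (x - y)‖ ≤ A * (2 ^ j)⁻¹ := fun y =>
    (h.ker_decay j ξ (x - y)).trans (mul_le_of_le_one_right (by positivity) (wt_pow_le_one hj))
  have hInt : ∀ P, Integrable fun y => c P * φ P y * ker j ξ (x - y) := fun P =>
    ((h.integrable P).const_mul (c P)).mul_bdd hkc.aestronglyMeasurable (.of_forall hkb)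
  have hsplit : ∀ g : Tile → ℂ, ∑ P ∈ T, g P = ∑ P ∈ T with j ≤ P.1, g P +
      (∑ P ∈ T with j - 4 < P.1 ∧ P.1 < j, g P + ∑ P ∈ T with P.1 ≤ j - 4, g P) := by
    intro g
    rw [← Finset.sum_filter_add_sum_filter_not T (fun P => j ≤ P.1) g]
    congr 1
    rw [← Finset.sum_filter_add_sum_filter_not (T.filter fun P => ¬ j ≤ P.1)
      (fun P => j - 4 < P.1) g, Finset.filter_filter, Finset.filter_filter]
    congr 2 <;> (refine Finset.filter_congr fun P _ => ?_; lia)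
  have e1 : ∫ y, (∑ P ∈ T, c P * φ P y) * ker j ξ (x - y) =
      ∑ P ∈ T with j ≤ P.1, c P * φ P x +
        ∫ y, (∑ P ∈ T with j - 4 < P.1 ∧ P.1 < j, c P * φ P y) * ker j ξ (x - y) := by
    simp_rw [Finset.sum_mul]
    rw [integral_finsetSum _ fun P _ => hInt P, integral_finsetSum _ fun P _ => hInt P, hsplit]
    congr 1
    · refine Finset.sum_congr rfl fun P hP => ?_
      obtain ⟨hP, hjP⟩ := Finset.mem_filter.1 hP
      simp_rw [mul_assoc]
      rw [integral_const_mul, h.repro P ξ (hU P hP) j hjP]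
    · rw [add_eq_left]
      refine Finset.sum_eq_zero fun P hP => ?_
      obtain ⟨hP, hjP⟩ := Finset.mem_filter.1 hP
      simp_rw [mul_assoc]
      rw [integral_const_mul, h.repro_zero P ξ (hU P hP) j hjP, mul_zero]
  have hmid : ∀ y, ‖∑ P ∈ T with j - 4 < P.1 ∧ P.1 < j, c P * φ P y‖ ≤ 48 * A * σ := by
    intro y
    have e : (T.filter fun P => j - 4 < P.1 ∧ P.1 < j) =
        (Finset.Icc (j - 3) (j - 1)).biUnion fun k => T.filter fun P => P.1 = k := by
      ext P
      simp only [Finset.mem_filter, Finset.mem_biUnion, Finset.mem_Icc]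
      constructor
      · rintro ⟨hP, h1, h2⟩; exact ⟨P.1, ⟨by lia, by lia⟩, hP, rfl⟩
      · rintro ⟨k, ⟨h1, h2⟩, hP, rfl⟩; exact ⟨hP, by lia, by lia⟩
    rw [e, Finset.sum_biUnion fun a _ b _ hab => Finset.disjoint_left.2 fun P hP hP' =>
      hab ((Finset.mem_filter.1 hP).2.symm.trans (Finset.mem_filter.1 hP').2)]
    calc _ ≤ ∑ k ∈ Finset.Icc (j - 3) (j - 1), 16 * A * σ :=
          (norm_sum_le _ _).trans <| Finset.sum_le_sum fun k _ => (norm_sum_le _ _).trans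
            (h.sum_scale_le hT hσ hc k (Finset.filter_subset _ _)
              (fun P hP => (Finset.mem_filter.1 hP).2) y)
      _ = 48 * A * σ := by
          rw [Finset.sum_const, Int.card_Icc, show j - 1 + 1 - (j - 3) = 3 by ring, nsmul_eq_mul]
          rw [show Int.toNat 3 = 3 from rfl]; push_cast; ring
  have hkint : ∫ y, ‖ker j ξ (x - y)‖ ≤ 4 * A := by
    have hi := integrable_wt_pow hj x (n := 4) (by norm_num)
    calc ∫ y, ‖ker j ξ (x - y)‖ ≤ ∫ y, A * (2 ^ j)⁻¹ * wt (2 ^ j) (y - x) ^ 4 := by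
          refine integral_mono_of_nonneg (.of_forall fun y => norm_nonneg _) (hi.const_mul _)
            (.of_forall fun y => ?_)
          simp only
          rw [wt_sub_comm]
          exact h.ker_decay j ξ (x - y)
      _ = A * (2 ^ j)⁻¹ * ∫ y, wt (2 ^ j) (y - x) ^ 4 := integral_const_mul _ _
      _ ≤ A * (2 ^ j)⁻¹ * (4 * 2 ^ j) := by
          gcongr; exact integral_wt_pow_le hj x (by norm_num)
      _ = 4 * A := by field_simp
  have hkI : Integrable fun y => ‖ker j ξ (x - y)‖ := by
    refine ((integrable_wt_pow hj x (n := 4) (by norm_num)).const_mul (A * (2 ^ j)⁻¹)).mono'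
      hkc.norm.aestronglyMeasurable (.of_forall fun y => ?_)
    rw [norm_norm, wt_sub_comm]
    exact h.ker_decay j ξ (x - y)
  have e2 : ‖∫ y, (∑ P ∈ T with j - 4 < P.1 ∧ P.1 < j, c P * φ P y) * ker j ξ (x - y)‖ ≤
      192 * A ^ 2 * σ := by
    calc _ ≤ ∫ y, 48 * A * σ * ‖ker j ξ (x - y)‖ := by
          refine norm_integral_le_of_norm_le (hkI.const_mul _) (.of_forall fun y => ?_)
          rw [norm_mul]
          exact mul_le_mul_of_nonneg_right (hmid y) (norm_nonneg _)
      _ = 48 * A * σ * ∫ y, ‖ker j ξ (x - y)‖ := integral_const_mul _ _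
      _ ≤ 48 * A * σ * (4 * A) := by gcongr
      _ = _ := by ring
  rw [eq_sub_of_add_eq e1.symm]
  refine (enorm_sub_le).trans (add_le_add ?_ ?_)
  · refine (enorm_integral_le_lintegral_enorm _).trans ?_
    rw [← lintegral_const_mul' _ _ ENNReal.ofReal_ne_top]
    refine lintegral_mono fun y => ?_
    rw [enorm_mul, mul_comm, ← mul_assoc]
    refine mul_le_mul_left ?_ _
    rw [← ofReal_norm, wk, ← ENNReal.ofReal_mul hA]
    refine ENNReal.ofReal_le_ofReal ((h.ker_decay j ξ (x - y)).trans_eq (mul_assoc _ _ _))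
  · rw [← ofReal_norm]
    exact ENNReal.ofReal_le_ofReal e2

lemma wk_le_wk {j : ℤ} {x z : ℝ} (hxz : |x - z| ≤ 2 ^ j) (y : ℝ) :
    wk j (x - y) ≤ 16 * wk j (z - y) := by
  have hj := two_zpow_pos j
  rw [wk, wk, show (16 : ℝ≥0∞) = ENNReal.ofReal 16 by simp, ← ENNReal.ofReal_mul (by norm_num)]
  refine ENNReal.ofReal_le_ofReal ?_
  have h1 : wt (2 ^ j) (x - y) ≤ 2 * wt (2 ^ j) (z - y) := by
    refine wt_comp hj ?_
    have := abs_sub_le z x y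
    rw [abs_sub_comm z x] at this
    have := abs_nonneg (x - y)
    linarith
  have h0 := wt_nonneg (u := x - y) hj
  calc (2 ^ j)⁻¹ * wt (2 ^ j) (x - y) ^ 4 ≤ (2 ^ j)⁻¹ * (2 * wt (2 ^ j) (z - y)) ^ 4 := by gcongr
    _ = _ := by ring

lemma Packets.truncation_le_maxAvg (h : Packets A φ md ker) (hT : IsTree T t) (hσ : 0 ≤ σ)
    (hc : ∀ P ∈ T, ‖c P‖ ≤ σ) (hU : ∀ P ∈ T, t.2.2 ∈ tU P) {S : Finset ℤ} {j : ℤ} (hjS : j ∈ S)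
    {x z : ℝ} (hxz : |x - z| ≤ 2 ^ j) :
    ‖∑ P ∈ T with j ≤ P.1, c P * φ P x‖ₑ ≤
      ENNReal.ofReal (16 * A) * maxAvg S (fun y => ‖∑ P ∈ T, c P * φ P y‖ₑ) z +
        ENNReal.ofReal (192 * A ^ 2 * σ) := by
  refine (h.truncation_le hT hσ hc hU j x).trans (add_le_add_left ?_ _)
  calc _ ≤ ENNReal.ofReal A * ∫⁻ y, 16 * (wk j (z - y) * ‖∑ P ∈ T, c P * φ P y‖ₑ) := by
        refine mul_le_mul_right (lintegral_mono fun y => ?_) _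
        rw [← mul_assoc]
        exact mul_le_mul_left (wk_le_wk hxz y) _
    _ = ENNReal.ofReal (16 * A) * ∫⁻ y, wk j (z - y) * ‖∑ P ∈ T, c P * φ P y‖ₑ := by
        rw [lintegral_const_mul' _ _ (by norm_num), ENNReal.ofReal_mul (by norm_num)]
        simp only [ENNReal.ofReal_ofNat]
        ring
    _ ≤ _ := by
        gcongr
        exact Finset.le_sup (f := fun j => ∫⁻ y, wk j (z - y) * ‖∑ P ∈ T, c P * φ P y‖ₑ) hjS

/-- Upper part of a tree, restricted to the active large tiles. -/
lemma Packets.upper_le (h : Packets A φ md ker) (hT : IsTree T t) (hσ : 0 ≤ σ)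
    (hc : ∀ P ∈ T, ‖c P‖ ≤ σ) (hU : ∀ P ∈ T, t.2.2 ∈ tU P) {x z ρ ν : ℝ} (hxz : |x - z| ≤ ρ) :
    ‖∑ P ∈ T with ν ∈ tU P ∧ ρ ≤ tlen P, c P * φ P x‖ₑ ≤
      2 * (ENNReal.ofReal (16 * A) * maxAvg (T.image (fun P => P.1) ∪ T.image fun P => P.1 + 1)
        (fun y => ‖∑ P ∈ T, c P * φ P y‖ₑ) z + ENNReal.ofReal (192 * A ^ 2 * σ)) := by
  set X := T.filter fun P => ν ∈ tU P ∧ ρ ≤ tlen P with hX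
  rcases X.eq_empty_or_nonempty with he | hne
  · rw [he]; simp
  obtain ⟨P₀, hP₀, hmin⟩ := X.exists_min_image (fun P => P.1) hne
  obtain ⟨P₁, hP₁, hmax⟩ := X.exists_max_image (fun P => P.1) hne
  obtain ⟨hP₀T, -, h0⟩ := Finset.mem_filter.1 hP₀
  obtain ⟨hP₁T, hν, -⟩ := Finset.mem_filter.1 hP₁
  have hle : P₀.1 ≤ P₁.1 := hmin _ hP₁
  have hle' : tlen P₀ ≤ tlen P₁ := tlen_le_iff.2 hle
  have hact : ∀ P ∈ T, P₀.1 ≤ P.1 → P.1 ≤ P₁.1 → P ∈ X := by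
    intro P hP h1 h2
    refine Finset.mem_filter.2 ⟨hP, ?_, h0.trans (tlen_le_iff.2 h1)⟩
    rcases h2.lt_or_eq with h2 | h2
    · exact tW_subset_tU h2 (tU_subset_tW _ (hU _ hP₁T)) (hU P hP) (tU_subset_tW _ hν)
    · have : tU P₁ ⊆ tU P := dy_subset (by lia) (hU _ hP₁T) (hU P hP)
      exact this hν
  have e : ∑ P ∈ X, c P * φ P x =
      ∑ P ∈ T with P₀.1 ≤ P.1, c P * φ P x - ∑ P ∈ T with P₁.1 + 1 ≤ P.1, c P * φ P x := by
    rw [eq_sub_iff_add_eq, ← Finset.sum_union]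
    · refine Finset.sum_congr ?_ fun _ _ => rfl
      ext P
      simp only [Finset.mem_union, Finset.mem_filter]
      constructor
      · rintro (hP | ⟨hP, h1⟩)
        · exact ⟨(Finset.mem_filter.1 hP).1, hmin P hP⟩
        · exact ⟨hP, by lia⟩
      · rintro ⟨hP, h1⟩
        by_cases h2 : P.1 ≤ P₁.1
        · exact Or.inl (hact P hP h1 h2)
        · exact Or.inr ⟨hP, by lia⟩
    · refine Finset.disjoint_left.2 fun P hP hP' => ?_
      have := hmax P hP
      have := (Finset.mem_filter.1 hP').2
      lia
  rw [e, two_mul]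
  refine enorm_sub_le.trans (add_le_add ?_ ?_)
  · refine h.truncation_le_maxAvg hT hσ hc hU ?_ (hxz.trans h0)
    exact Finset.mem_union_left _ (Finset.mem_image_of_mem _ hP₀T)
  · refine h.truncation_le_maxAvg hT hσ hc hU ?_ ((hxz.trans (h0.trans hle')).trans ?_)
    · exact Finset.mem_union_right _ (Finset.mem_image_of_mem (fun P : Tile => P.1 + 1) hP₁T)
    · exact zpow_le_zpow_right₀ one_le_two (by lia)

lemma Packets.lintegral_maxAvg_le (h : Packets A φ md ker) (hσ : 0 ≤ σ)
    (hs : energy c T ≤ σ ^ 2 * 2 ^ t.1) (hU : ∀ P ∈ T, t.2.2 ∈ tU P) (S : Finset ℤ) :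
    ∫⁻ z in Icc (topCtr t - 2 ^ t.1) (topCtr t + 2 ^ t.1),
      maxAvg S (fun y => ‖∑ P ∈ T, c P * φ P y‖ₑ) z ≤ ENNReal.ofReal (64 * A * σ * 2 ^ t.1) := by
  have hA : 0 ≤ A := by linarith [h.one_le]
  have hK := two_zpow_pos t.1
  have hcont : Continuous fun y => ∑ P ∈ T, c P * φ P y :=
    continuous_finsetSum _ fun P _ => continuous_const.mul (h.cont P)
  have h1 := lintegral_maxAvg_sq_le (J := Icc (topCtr t - 2 ^ t.1) (topCtr t + 2 ^ t.1))
    hcont.enorm.measurable S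
  have h2 : ∫⁻ y, ‖∑ P ∈ T, c P * φ P y‖ₑ ^ 2 ≤ ENNReal.ofReal (64 * A ^ 2 * (σ ^ 2 * 2 ^ t.1))
      := by
    have e : ∀ y, ‖∑ P ∈ T, c P * φ P y‖ₑ ^ 2 = ENNReal.ofReal (‖∑ P ∈ T, c P * φ P y‖ ^ 2) :=
      fun y => by rw [← ofReal_norm, ENNReal.ofReal_pow (norm_nonneg _)]
    simp_rw [e]
    rw [← ofReal_integral_eq_lintegral_ofReal
      ((memLp_two_iff_integrable_sq_norm hcont.aestronglyMeasurable).1 (h.memLp_sum c T))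
      (.of_forall fun y => by positivity)]
    refine ENNReal.ofReal_le_ofReal ((h.bessel c hU).trans ?_)
    gcongr
    exact hs
  rw [← ENNReal.pow_le_pow_left_iff two_ne_zero, ← ENNReal.ofReal_pow (by positivity)]
  refine h1.trans ?_
  rw [Real.volume_Icc]
  calc _ ≤ 32 * ENNReal.ofReal (topCtr t + 2 ^ t.1 - (topCtr t - 2 ^ t.1)) *
        ENNReal.ofReal (64 * A ^ 2 * (σ ^ 2 * 2 ^ t.1)) := by gcongr
    _ = ENNReal.ofReal ((64 * A * σ * 2 ^ t.1) ^ 2) := by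
        rw [show (32 : ℝ≥0∞) = ENNReal.ofReal 32 by simp, ← ENNReal.ofReal_mul (by norm_num),
          ← ENNReal.ofReal_mul (by linarith)]
        congr 1; ring

lemma measurable_maxAvg {g : ℝ → ℝ≥0∞} (hg : Measurable g) (S : Finset ℤ) :
    Measurable (maxAvg S g) := by
  induction S using Finset.induction_on with
  | empty =>
    have : maxAvg ∅ g = fun _ => 0 := by funext z; simp [maxAvg]
    rw [this]; exact measurable_const
  | insert a S _ ih =>
    have : maxAvg (insert a S) g = fun z => (∫⁻ y, wk a (z - y) * g y) ⊔ maxAvg S g z := by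
      funext z; simp [maxAvg, Finset.sup_insert]
    rw [this]; exact (measurable_avg hg a).sup ih

lemma Packets.large_lintegral_le (h : Packets A φ md ker) (hT : IsTree T t) (hr : TreeRad T r)
    (hσ : 0 ≤ σ) (hs : SizeLe c T σ) (hE : MeasurableSet E) (hN : Measurable N) (hμ0 : 0 ≤ μ)
    (hμ : MassLe E N T μ) :
    ∫⁻ x in E, ‖∑ P ∈ T with N x ∈ tU P ∧ 4 * r x ≤ tlen P, c P * φ P x‖ₑ ≤
      ENNReal.ofReal (486 * 2848 * A ^ 2 * σ * μ * 2 ^ t.1) := by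
  have hA : 1 ≤ A := h.one_le
  have hK := two_zpow_pos t.1
  have hc : ∀ P ∈ T, ‖c P‖ ≤ σ := fun P => hs.norm_le hσ
  set U := T.filter fun P => t.2.2 ∈ tU P with hUdef
  have hUT : U ⊆ T := Finset.filter_subset _ _
  have hUξ : ∀ P ∈ U, t.2.2 ∈ tU P := fun P hP => (Finset.mem_filter.1 hP).2
  have hE' : energy c U ≤ σ ^ 2 * 2 ^ t.1 := by
    refine le_trans (energy_mono fun P hP => ?_) (hs t)
    exact mem_upTree.2 ⟨hUT hP, (hT P (hUT hP)).1, hUξ P hP⟩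
  set M : ℝ → ℝ≥0∞ := maxAvg (U.image (fun P => P.1) ∪ U.image fun P => P.1 + 1)
        (fun y => ‖∑ P ∈ U, c P * φ P y‖ₑ) with hM
  have hcont : Continuous fun y => ∑ P ∈ U, c P * φ P y :=
    continuous_finsetSum _ fun P _ => continuous_const.mul (h.cont P)
  have hMm : Measurable M := measurable_maxAvg hcont.enorm.measurable _
  let S : ℝ → ℝ≥0∞ := fun z => 2 * (ENNReal.ofReal (16 * A) * M z + ENNReal.ofReal (192 * A ^ 2 *
      σ)) +
    ENNReal.ofReal (16 * A * σ)
  have hSm : Measurable S := (((hMm.const_mul _).add_const _).const_mul _).add_const _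
  let F : ℝ → ℝ≥0∞ := fun x => ‖∑ P ∈ T with N x ∈ tU P ∧ 4 * r x ≤ tlen P, c P * φ P x‖ₑ
  have hF : ∀ x ∈ treeLarge T r E N, ∀ z, |x - z| < r z / 4 → F x ≤ S z := by
    intro x _ z hxz
    have hxz' : |x - z| ≤ 4 * r x := by
      have := hr.le_add z x
      rw [abs_sub_comm] at this
      have := hr.pos x
      linarith
    have e : ∑ P ∈ T with N x ∈ tU P ∧ 4 * r x ≤ tlen P, c P * φ P x =
        ∑ P ∈ U with N x ∈ tU P ∧ 4 * r x ≤ tlen P, c P * φ P x +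
        ∑ P ∈ (T.filter fun P => N x ∈ tU P ∧ 4 * r x ≤ tlen P).filter fun P => ¬ t.2.2 ∈ tU P,
          c P * φ P x := by
      rw [← Finset.sum_filter_add_sum_filter_not (T.filter fun P => N x ∈ tU P ∧ 4 * r x ≤ tlen P)
        (fun P => t.2.2 ∈ tU P), Finset.filter_comm]
    simp only [F, S]
    rw [e]
    refine (enorm_add_le _ _).trans (add_le_add ?_ ?_)
    · exact h.upper_le (hT.subset hUT) hσ (fun P hP => hc P (hUT hP)) hUξ hxz'
    · rw [← ofReal_norm]
      refine ENNReal.ofReal_le_ofReal (h.lower_le hT hσ hc x (N x)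
        ((Finset.filter_subset _ _).trans (Finset.filter_subset _ _)) fun P hP => ?_)
      obtain ⟨hP, h1⟩ := Finset.mem_filter.1 hP
      obtain ⟨hP, h2, -⟩ := Finset.mem_filter.1 hP
      exact ⟨(tL_or_tU (hT P hP).2).resolve_right h1, h2⟩
  have hGE : treeLarge T r E N ⊆ E := fun x hx => hx.1
  have e1 : ∫⁻ x in E, F x = ∫⁻ x in treeLarge T r E N, F x := by
    rw [← lintegral_indicator hE, ← lintegral_indicator (measurableSet_treeLarge hr hE hN)]
    refine lintegral_congr fun x => ?_
    by_cases hx : x ∈ treeLarge T r E N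
    · rw [indicator_of_mem hx, indicator_of_mem (hGE hx)]
    · rw [indicator_of_notMem hx]
      by_cases hxE : x ∈ E
      · rw [indicator_of_mem hxE]
        have : (T.filter fun P => N x ∈ tU P ∧ 4 * r x ≤ tlen P) = ∅ := by
          refine Finset.filter_eq_empty_iff.2 fun P hP hcon => hx ⟨hxE, P, hP, hcon.2, ?_⟩
          exact tU_subset_tW _ hcon.1
        simp only [F]; rw [this]; simp
      · rw [indicator_of_notMem hxE]
  change ∫⁻ x in E, F x ≤ _
  rw [e1]
  refine (lintegral_treeLarge_le hT hr hE hN hμ hSm hF).trans ?_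
  have hS : ∫⁻ z in Icc (topCtr t - 2 ^ t.1) (topCtr t + 2 ^ t.1), S z ≤
      ENNReal.ofReal (2848 * A ^ 2 * σ * 2 ^ t.1) := by
    have hv : volume (Icc (topCtr t - 2 ^ t.1) (topCtr t + 2 ^ t.1)) = ENNReal.ofReal (2 * 2 ^ t.1)
        := by
      rw [Real.volume_Icc]; congr 1; ring
    simp only [S]
    rw [lintegral_add_right _ measurable_const, lintegral_const_mul' _ _ (by norm_num),
      lintegral_add_right _ measurable_const, lintegral_const_mul' _ _ ENNReal.ofReal_ne_top,
      lintegral_const, lintegral_const, Measure.restrict_apply_univ, hv]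
    calc _ ≤ 2 * (ENNReal.ofReal (16 * A) * ENNReal.ofReal (64 * A * σ * 2 ^ t.1) +
          ENNReal.ofReal (192 * A ^ 2 * σ) * ENNReal.ofReal (2 * 2 ^ t.1)) +
          ENNReal.ofReal (16 * A * σ) * ENNReal.ofReal (2 * 2 ^ t.1) := by
          have := h.lintegral_maxAvg_le (c := c) hσ hE' hUξ
            (U.image (fun P => P.1) ∪ U.image fun P => P.1 + 1)
          gcongr
      _ = ENNReal.ofReal (2 * (16 * A * (64 * A * σ * 2 ^ t.1) + 192 * A ^ 2 * σ * (2 * 2 ^ t.1)) +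
          16 * A * σ * (2 * 2 ^ t.1)) := by
          rw [show (2 : ℝ≥0∞) = ENNReal.ofReal 2 by simp, ← ENNReal.ofReal_mul (by positivity),
            ← ENNReal.ofReal_mul (by positivity), ← ENNReal.ofReal_mul (by positivity),
            ← ENNReal.ofReal_add (by positivity) (by positivity),
                ← ENNReal.ofReal_mul (by norm_num),
            ← ENNReal.ofReal_add (by positivity) (by positivity)]
      _ ≤ _ := by
          refine ENNReal.ofReal_le_ofReal ?_
          have : A * (σ * 2 ^ t.1) ≤ A ^ 2 * (σ * 2 ^ t.1) :=
            mul_le_mul_of_nonneg_right (by nlinarith) (by positivity)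
          linarith
  calc _ ≤ ENNReal.ofReal (486 * μ) * ENNReal.ofReal (2848 * A ^ 2 * σ * 2 ^ t.1) := by gcongr
    _ = _ := by
      rw [← ENNReal.ofReal_mul (by positivity)]; congr 1; ring

lemma Packets.small_lintegral_le (h : Packets A φ md ker) (hT : IsTree T t) (hr : TreeRad T r)
    (hσ : 0 ≤ σ) (hs : SizeLe c T σ) (hE : MeasurableSet E) (hN : Measurable N) (hμ0 : 0 ≤ μ)
    (hμ : MassLe E N T μ) :
    ∫⁻ x in E, ‖∑ P ∈ T with N x ∈ tU P ∧ ¬ 4 * r x ≤ tlen P, c P * φ P x‖ₑ ≤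
      ENNReal.ofReal (2 ^ 17 * A * σ * μ * 2 ^ t.1) := by
  have hA : 0 ≤ A := by linarith [h.one_le]
  have hc : ∀ P ∈ T, ‖c P‖ ≤ σ := fun P => hs.norm_le hσ
  have hwm : ∀ P : Tile, Measurable fun x => ENNReal.ofReal (wt (tlen P) (x - tctr P) ^ 4)
      := fun P =>
    ((((continuous_wt (tlen_pos P)).comp (continuous_sub_right _)).pow 4).measurable).ennreal_ofReal
  have hpt : ∀ x ∈ E, ‖∑ P ∈ T with N x ∈ tU P ∧ ¬ 4 * r x ≤ tlen P, c P * φ P x‖ₑ ≤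
      ∑ P ∈ T, ENNReal.ofReal (128 * σ * A * alp r P) *
        (mset E N P).indicator (fun x => ENNReal.ofReal (wt (tlen P) (x - tctr P) ^ 4)) x := by
    intro x hx
    refine (enorm_sum_le _ _).trans ((Finset.sum_le_sum fun P hP => ?_).trans
      (Finset.sum_le_sum_of_subset (Finset.filter_subset _ _)))
    obtain ⟨hP, hNx, h4⟩ := Finset.mem_filter.1 hP
    have hs := tlen_pos P
    have hx' : x ∈ mset E N P := ⟨hx, tU_subset_tW _ hNx⟩
    have h6 := hr.wt_pow_six_le (not_le.1 h4)
    have ha := hr.alp_nonneg P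
    have hw := wt_nonneg (u := x - tctr P) hs
    rw [indicator_of_mem hx', ← ENNReal.ofReal_mul (by positivity), ← ofReal_norm, norm_mul]
    refine ENNReal.ofReal_le_ofReal ?_
    calc ‖c P‖ * ‖φ P x‖ ≤ σ * (A * wt (tlen P) (x - tctr P) ^ 10) :=
          mul_le_mul (hc P hP) (h.decay P x) (norm_nonneg _) hσ
      _ = σ * A * (wt (tlen P) (x - tctr P) ^ 6 * wt (tlen P) (x - tctr P) ^ 4) := by ring
      _ ≤ σ * A * (128 * alp r P * wt (tlen P) (x - tctr P) ^ 4) := by gcongr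
      _ = _ := by ring
  calc _ ≤ ∫⁻ x, ∑ P ∈ T, ENNReal.ofReal (128 * σ * A * alp r P) *
        (mset E N P).indicator (fun x => ENNReal.ofReal (wt (tlen P) (x - tctr P) ^ 4)) x :=
        (setLIntegral_mono' hE hpt).trans (setLIntegral_le_lintegral _ _)
    _ = ∑ P ∈ T, ENNReal.ofReal (128 * σ * A * alp r P) *
          ∫⁻ x in mset E N P, ENNReal.ofReal (wt (tlen P) (x - tctr P) ^ 4) := by
        rw [lintegral_finsetSum _ fun P _ =>
          ((hwm P).indicator (measurableSet_mset hE hN P)).const_mul _]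
        refine Finset.sum_congr rfl fun P _ => ?_
        rw [lintegral_const_mul' _ _ ENNReal.ofReal_ne_top,
          lintegral_indicator (measurableSet_mset hE hN P)]
    _ ≤ ∑ P ∈ T, ENNReal.ofReal (128 * σ * A * alp r P * (tlen P * μ)) := by
        refine Finset.sum_le_sum fun P hP => ?_
        have ha := hr.alp_nonneg P
        have hs := tlen_pos P
        rw [ENNReal.ofReal_mul (p := 128 * σ * A * alp r P) (by positivity)]
        refine mul_le_mul_right ?_ _
        rw [← ofReal_integral_eq_lintegral_ofReal
          (integrable_wt_pow hs _ (by norm_num)).integrableOn (.of_forall fun x => by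
            have := wt_nonneg (u := x - tctr P) hs
            simp only [Pi.zero_apply]; positivity)]
        refine ENNReal.ofReal_le_ofReal ?_
        have hd : dens E N P ≤ μ := hμ P hP P subset_rfl subset_rfl
        calc _ = tlen P * dens E N P := by rw [dens, mul_inv_cancel_left₀ hs.ne']
          _ ≤ _ := by gcongr
    _ = ENNReal.ofReal (128 * σ * A * μ * ∑ P ∈ T, tlen P * alp r P) := by
        rw [Finset.mul_sum, ENNReal.ofReal_sum_of_nonneg fun P _ => by
          have := hr.alp_nonneg P
          have := tlen_pos P
          positivity]
        refine Finset.sum_congr rfl fun P _ => ?_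
        congr 1; ring
    _ ≤ _ := by
        refine ENNReal.ofReal_le_ofReal ?_
        calc _ ≤ 128 * σ * A * μ * (1024 * 2 ^ t.1) :=
              mul_le_mul_of_nonneg_left (hr.sum_alp_le hT) (by positivity)
          _ = _ := by ring

/-- Coefficient of the linearized operator. -/
noncomputable def wcoef (φ : Tile → ℝ → ℂ) (E : Set ℝ) (N : ℝ → ℝ) (w : ℝ → ℂ) (P : Tile) : ℂ :=
  ∫ x in E ∩ N ⁻¹' tU P, φ P x * w x

/-- The tree lemma. -/
lemma Packets.tree_lemma (h : Packets A φ md ker) (hT : IsTree T t) (hσ : 0 ≤ σ)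
    (hs : SizeLe c T σ) (hE : MeasurableSet E) (hN : Measurable N)
    (hμ0 : 0 ≤ μ) (hμ : MassLe E N T μ) {w : ℝ → ℂ} (hw : Measurable w) (hw1 : ∀ x, ‖w x‖ ≤ 1) :
    ∑ P ∈ T, ‖c P‖ * ‖wcoef φ E N w P‖ ≤ 2 ^ 21 * A ^ 2 * σ * μ * 2 ^ t.1 := by
  have hA := h.one_le
  rcases T.eq_empty_or_nonempty with rfl | hne
  · simp; positivity
  obtain ⟨r, hr⟩ := exists_treeRad hne
  have hph : ∀ z : ℂ, ∃ e : ℂ, ‖e‖ ≤ 1 ∧ (‖z‖ : ℂ) = e * z := by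
    intro z
    refine ⟨conj z / ‖z‖, ?_, ?_⟩
    · rw [norm_div, RCLike.norm_conj, Complex.norm_real, norm_norm]; exact div_self_le_one _
    · rcases eq_or_ne z 0 with rfl | hz
      · simp
      · have : (‖z‖ : ℂ) ≠ 0 := by simpa using hz
        field_simp
        rw [mul_comm, Complex.mul_conj, Complex.normSq_eq_norm_sq]; push_cast; ring
  choose ε hε1 hε2 using hph
  let c' : Tile → ℂ := fun P => ‖c P‖ * ε (wcoef φ E N w P)
  have hc'c : ∀ P, ‖c' P‖ ≤ ‖c P‖ := fun P => by
    simp only [c', norm_mul, Complex.norm_real, norm_norm]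
    exact mul_le_of_le_one_right (norm_nonneg _) (hε1 _)
  have hs' : SizeLe c' T σ := fun t' => le_trans (Finset.sum_le_sum fun P _ => by
    have := tlen_pos P
    have := hc'c P
    gcongr) (hs t')
  have hm : ∀ P, MeasurableSet (E ∩ N ⁻¹' tU P) := fun P => hE.inter (hN (measurableSet_tU P))
  have hInt : ∀ P, Integrable fun x => φ P x * w x := fun P =>
    (h.integrable P).mul_bdd hw.aestronglyMeasurable (.of_forall hw1)
  have e1 : ((∑ P ∈ T, ‖c P‖ * ‖wcoef φ E N w P‖ : ℝ) : ℂ) =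
      ∫ x in E, (∑ P ∈ T with N x ∈ tU P, c' P * φ P x) * w x := by
    have : ∀ x ∈ E, (∑ P ∈ T with N x ∈ tU P, c' P * φ P x) * w x =
        ∑ P ∈ T, c' P * (E ∩ N ⁻¹' tU P).indicator (fun x => φ P x * w x) x := by
      intro x hx
      rw [Finset.sum_mul, Finset.sum_filter]
      refine Finset.sum_congr rfl fun P _ => ?_
      by_cases hNx : N x ∈ tU P
      · rw [if_pos hNx, indicator_of_mem (show x ∈ E ∩ N ⁻¹' tU P from ⟨hx, hNx⟩), mul_assoc]
      · rw [if_neg hNx, indicator_of_notMem (fun h => hNx h.2), mul_zero]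
    rw [setIntegral_congr_fun hE this, integral_finsetSum _ fun P _ =>
      (((hInt P).indicator (hm P)).const_mul _).integrableOn]
    push_cast
    refine Finset.sum_congr rfl fun P _ => ?_
    rw [integral_const_mul, setIntegral_indicator (hm P), ← inter_assoc, inter_self, mul_assoc]
    rw [hε2 (wcoef φ E N w P)]; rfl
  have e2 : ∑ P ∈ T, ‖c P‖ * ‖wcoef φ E N w P‖ =
      ‖((∑ P ∈ T, ‖c P‖ * ‖wcoef φ E N w P‖ : ℝ) : ℂ)‖ := by
    rw [Complex.norm_real, Real.norm_of_nonneg (by positivity)]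
  rw [← ENNReal.ofReal_le_ofReal_iff (by positivity), e2, e1, ofReal_norm]
  refine (enorm_integral_le_lintegral_enorm _).trans ?_
  calc _ ≤ ∫⁻ x in E, (‖∑ P ∈ T with N x ∈ tU P ∧ ¬ 4 * r x ≤ tlen P, c' P * φ P x‖ₑ +
        ‖∑ P ∈ T with N x ∈ tU P ∧ 4 * r x ≤ tlen P, c' P * φ P x‖ₑ) := by
        refine lintegral_mono fun x => ?_
        rw [enorm_mul]
        have hwx : ‖w x‖ₑ ≤ 1 := by
          rw [← ofReal_norm]; exact ENNReal.ofReal_le_one.2 (hw1 x)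
        refine (mul_le_of_le_one_right' hwx).trans ?_
        rw [← Finset.sum_filter_not_add_sum_filter _ (fun P => 4 * r x ≤ tlen P),
            Finset.filter_filter,
          Finset.filter_filter]
        exact enorm_add_le _ _
    _ ≤ ENNReal.ofReal (2 ^ 17 * A * σ * μ * 2 ^ t.1) +
        ENNReal.ofReal (486 * 2848 * A ^ 2 * σ * μ * 2 ^ t.1) := by
        rw [lintegral_add_left']
        · exact add_le_add (h.small_lintegral_le hT hr hσ hs' hE hN hμ0 hμ)
            (h.large_lintegral_le hT hr hσ hs' hE hN hμ0 hμ)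
        · have e : ∀ x, (∑ P ∈ T with N x ∈ tU P ∧ ¬ 4 * r x ≤ tlen P, c' P * φ P x) =
              ∑ P ∈ T, (N ⁻¹' tU P ∩ {x | ¬ 4 * r x ≤ tlen P}).indicator
                (fun x => c' P * φ P x) x := by
            intro x
            rw [Finset.sum_filter]
            refine Finset.sum_congr rfl fun P _ => ?_
            rw [indicator_apply]; rfl
          simp_rw [e]
          refine (Measurable.enorm ?_).aemeasurable
          refine Finset.measurable_sum _ fun P _ => ?_
          refine ((h.cont P).measurable.const_mul _).indicator ((hN (measurableSet_tU P)).inter ?_)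
          exact (measurableSet_le (hr.continuous.measurable.const_mul _) measurable_const).compl
    _ ≤ _ := by
        rw [← ENNReal.ofReal_add (by positivity) (by positivity)]
        refine ENNReal.ofReal_le_ofReal ?_
        have : A * (σ * μ * 2 ^ t.1) ≤ A ^ 2 * (σ * μ * 2 ^ t.1) :=
          mul_le_mul_of_nonneg_right (by nlinarith) (by positivity)
        have : 0 ≤ A ^ 2 * (σ * μ * 2 ^ t.1) := by positivity
        linarith

end treelemma

section regularize
variable {T : Finset Tile} {t : TreeTop} {r : ℝ → ℝ}

/-- Averaging kernel at the scale of the tree radius. -/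
noncomputable def regk (r : ℝ → ℝ) : ℝ × ℝ → ℝ :=
  {p : ℝ × ℝ | |p.2 - p.1| < r p.1 / 4}.indicator fun p => (r p.1)⁻¹

/-- Total mass of the averaging kernel. -/
noncomputable def regmass (r : ℝ → ℝ) (x : ℝ) : ℝ := ∫ z, regk r (z, x)

/-- The normalized averaging kernel. -/
noncomputable def regn (r : ℝ → ℝ) (p : ℝ × ℝ) : ℝ := regk r p * (regmass r p.2)⁻¹

lemma TreeRad.measurable_regk (hr : TreeRad T r) : Measurable (regk r) :=
  ((hr.continuous.measurable.comp measurable_fst).inv).indicator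
    (measurableSet_lt ((measurable_snd.sub measurable_fst).abs)
      ((hr.continuous.measurable.comp measurable_fst).div_const _))

lemma TreeRad.regk_nonneg (hr : TreeRad T r) (p : ℝ × ℝ) : 0 ≤ regk r p :=
  indicator_nonneg (fun p _ => (inv_pos.2 (hr.pos p.1)).le) p

lemma TreeRad.integrable_regk (hr : TreeRad T r) (x : ℝ) : Integrable fun z => regk r (z, x) := by
  have hx := hr.pos x
  have h1 : Integrable ((Icc (x - r x) (x + r x)).indicator fun _ => 2 / r x) :=
    (integrable_indicator_iff measurableSet_Icc).2 (integrableOn_const (by simp))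
  refine h1.mono' (hr.measurable_regk.comp (measurable_id.prodMk measurable_const)).aestronglyMeasurable
    (.of_forall fun z => ?_)
  rw [Real.norm_of_nonneg (hr.regk_nonneg _)]
  by_cases hz : |x - z| < r z / 4
  · have h2 := hr.le_add z x
    have h3 := hr.le_add x z
    rw [abs_sub_comm z x] at h2
    have hz' := hr.pos z
    have h4 := abs_le.1 (show |x - z| ≤ r x by linarith)
    rw [indicator_of_mem (show z ∈ Icc (x - r x) (x + r x) from ⟨by linarith, by linarith⟩)]
    have : regk r (z, x) = (r z)⁻¹ := indicator_of_mem (by exact hz) _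
    rw [this, inv_eq_one_div, div_le_div_iff₀ hz' hx]
    linarith
  · have : regk r (z, x) = 0 := indicator_of_notMem (by exact hz) _
    rw [this]
    exact indicator_nonneg (fun _ _ => by positivity) _

lemma TreeRad.le_regmass (hr : TreeRad T r) (x : ℝ) : 1 / 4 ≤ regmass r x := by
  have hx := hr.pos x
  have h0 : (1 / 4 : ℝ) ≤ ∫ z in Icc (x - r x / 6) (x + r x / 6), (6 / 7 / r x : ℝ) := by
    rw [setIntegral_const, Real.volume_real_Icc_of_le (by linarith), smul_eq_mul]
    have : (x + r x / 6 - (x - r x / 6)) * (6 / 7 / r x) = 2 / 7 := by field_simp; ring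
    rw [this]; norm_num
  refine h0.trans ((setIntegral_mono_on (integrableOn_const (by simp))
    (hr.integrable_regk x).integrableOn measurableSet_Icc fun z hz => ?_).trans
    (setIntegral_le_integral (hr.integrable_regk x) (.of_forall fun z => hr.regk_nonneg _)))
  have hxz : |x - z| ≤ r x / 6 := abs_le.2 ⟨by linarith [hz.2], by linarith [hz.1]⟩
  have h2 := hr.le_add z x
  have h3 := hr.le_add x z
  rw [abs_sub_comm z x] at h2
  have hz' := hr.pos z
  have h4 : (z, x) ∈ {p : ℝ × ℝ | |p.2 - p.1| < r p.1 / 4} := by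
    change |x - z| < r z / 4
    linarith
  have : regk r (z, x) = (r z)⁻¹ := indicator_of_mem h4 _
  rw [this, inv_eq_one_div, div_le_div_iff₀ hx hz']
  linarith

lemma TreeRad.regn_nonneg (hr : TreeRad T r) (p : ℝ × ℝ) : 0 ≤ regn r p :=
  mul_nonneg (hr.regk_nonneg p) (inv_nonneg.2 (by linarith [hr.le_regmass p.2]))

lemma TreeRad.measurable_regmass (hr : TreeRad T r) : Measurable (regmass r) :=
  (hr.measurable_regk.stronglyMeasurable.integral_prod_left').measurable

lemma TreeRad.measurable_regn (hr : TreeRad T r) : Measurable (regn r) :=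
  hr.measurable_regk.mul (hr.measurable_regmass.comp measurable_snd).inv

lemma TreeRad.integral_regn (hr : TreeRad T r) (x : ℝ) : ∫ z, regn r (z, x) = 1 := by
  simp only [regn]
  rw [integral_mul_const]
  exact mul_inv_cancel₀ (by linarith [hr.le_regmass x] : (0:ℝ) < regmass r x).ne'

lemma TreeRad.regn_le (hr : TreeRad T r) (z x : ℝ) :
    regn r (z, x) ≤ (Icc (z - r z) (z + r z)).indicator (fun _ => 4 * (r z)⁻¹) x := by
  have hz := hr.pos z
  by_cases h : |x - z| < r z / 4
  · have h4 := abs_lt.1 h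
    rw [indicator_of_mem (show x ∈ Icc (z - r z) (z + r z) from ⟨by linarith, by linarith⟩)]
    have h5 : regk r (z, x) = (r z)⁻¹ := indicator_of_mem (by exact h) _
    rw [regn, h5, mul_comm]
    refine mul_le_mul_of_nonneg_right ?_ (inv_pos.2 hz).le
    have := inv_anti₀ (by norm_num) (hr.le_regmass x)
    simpa using this
  · have h5 : regk r (z, x) = 0 := indicator_of_notMem (by exact h) _
    rw [regn, h5, zero_mul]
    exact indicator_nonneg (fun _ _ => by positivity) _

lemma abs_sub_lt_of_regn {z x : ℝ} (h : regn r (z, x) ≠ 0) :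
    |x - z| < r z / 4 := by
  by_contra h1
  have h5 : regk r (z, x) = 0 := indicator_of_notMem (by exact h1) _
  exact h (by rw [regn, h5, zero_mul])

lemma TreeRad.integrable_regn_mul (hr : TreeRad T r) {F : ℝ → ℂ} (hF : Integrable F) :
    Integrable (fun p : ℝ × ℝ => (regn r p : ℂ) * F p.2) (volume.prod volume) := by
  have hm : AEStronglyMeasurable (fun p : ℝ × ℝ => (regn r p : ℂ) * F p.2)
      (volume.prod volume) :=
    (Complex.measurable_ofReal.comp hr.measurable_regn).aestronglyMeasurable.mul
      hF.aestronglyMeasurable.comp_snd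
  refine (integrable_prod_iff' hm).2 ⟨.of_forall fun x => ?_, ?_⟩
  · have : Integrable fun z => regn r (z, x) := (hr.integrable_regk x).mul_const (regmass r x)⁻¹
    exact (this.ofReal (𝕜 := ℂ)).mul_const (F x)
  · refine hF.norm.congr (.of_forall fun x => ?_)
    simp only [norm_mul, Complex.norm_real, Real.norm_of_nonneg (hr.regn_nonneg _)]
    rw [integral_mul_const, hr.integral_regn, one_mul]

/-- `f` has averages at most `lam` on all dilates of the tile interval. -/
def LightTile (f : ℝ → ℂ) (lam : ℝ) (P : Tile) : Prop :=
  ∀ j : ℕ, ∫ x in {x | |x - tctr P| ≤ 2 ^ j * tlen P}, ‖f x‖ ≤ lam * (2 ^ j * tlen P)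

lemma TreeRad.light_le (hr : TreeRad T r) {f : ℝ → ℂ} (hf : Integrable f) {lam : ℝ}
    (h0 : 0 ≤ lam) (hl : ∀ P ∈ T, LightTile f lam P) (z : ℝ) :
    ∫ x in Icc (z - r z) (z + r z), ‖f x‖ ≤ 4 * lam * r z := by
  obtain ⟨P, hP, h⟩ := hr.ex z
  have hs := tlen_pos P
  have hz := abs_nonneg (z - tctr P)
  obtain ⟨j, hj1, hj2⟩ := exists_nat_pow_near (x := 2 * r z / tlen P) (y := (2 : ℝ))
    ((one_le_div hs).2 (by linarith)) one_lt_two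
  rw [div_lt_iff₀ hs] at hj2
  rw [le_div_iff₀ hs] at hj1
  refine (setIntegral_mono_set hf.norm.integrableOn (.of_forall fun x => norm_nonneg _)
    (LE.le.eventuallyLE fun x hx => ?_)).trans ((hl P hP (j + 1)).trans ?_)
  · change |x - tctr P| ≤ 2 ^ (j + 1) * tlen P
    have h1 := abs_sub_le x z (tctr P)
    have h2 : |x - z| ≤ r z := abs_le.2 ⟨by linarith [hx.1], by linarith [hx.2]⟩
    linarith
  · calc lam * (2 ^ (j + 1) * tlen P) ≤ lam * (4 * r z) := by
          refine mul_le_mul_of_nonneg_left ?_ h0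
          rw [pow_succ]; linarith
      _ = _ := by ring

lemma TreeRad.integral_regn_mul_le (hr : TreeRad T r) {f : ℝ → ℂ} (hf : Integrable f) {lam : ℝ}
    (h0 : 0 ≤ lam) (hl : ∀ P ∈ T, LightTile f lam P) (z : ℝ) :
    Integrable (fun x => regn r (z, x) * ‖f x‖) ∧ ∫ x, regn r (z, x) * ‖f x‖ ≤ 16 * lam := by
  have hz := hr.pos z
  have h1 : Integrable ((Icc (z - r z) (z + r z)).indicator fun x => 4 * (r z)⁻¹ * ‖f x‖) :=
    (hf.norm.const_mul _).indicator measurableSet_Icc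
  have h2 : ∀ x, regn r (z, x) * ‖f x‖ ≤
      (Icc (z - r z) (z + r z)).indicator (fun x => 4 * (r z)⁻¹ * ‖f x‖) x := fun x => by
    refine (mul_le_mul_of_nonneg_right (hr.regn_le z x) (norm_nonneg _)).trans_eq ?_
    by_cases hx : x ∈ Icc (z - r z) (z + r z)
    · simp only [indicator_of_mem hx]
    · simp only [indicator_of_notMem hx, zero_mul]
  have h3 : Integrable fun x => regn r (z, x) * ‖f x‖ := by
    refine h1.mono' ((hr.measurable_regn.comp measurable_prodMk_left).aestronglyMeasurable.mul
      hf.norm.aestronglyMeasurable) (.of_forall fun x => ?_)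
    rw [Real.norm_of_nonneg (mul_nonneg (hr.regn_nonneg _) (norm_nonneg _))]
    exact h2 x
  refine ⟨h3, (integral_mono h3 h1 h2).trans ?_⟩
  rw [integral_indicator measurableSet_Icc, integral_const_mul]
  calc _ ≤ 4 * (r z)⁻¹ * (4 * lam * r z) :=
        mul_le_mul_of_nonneg_left (hr.light_le hf h0 hl z) (by positivity)
    _ = _ := by field_simp; ring

end regularize

section sizebound
variable {A : ℝ} {φ : Tile → ℝ → ℂ} {md : ℝ → ℝ → ℂ} {ker : ℤ → ℝ → ℝ → ℂ}
  {T : Finset Tile} {t : TreeTop} {r : ℝ → ℝ}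

/-- A neighbourhood of the top interval. -/
def topNbhd (t : TreeTop) : Set ℝ := Icc (topCtr t - 2 * 2 ^ t.1) (topCtr t + 2 * 2 ^ t.1)

lemma Packets.cutoff_le (h : Packets A φ md ker) (hr : TreeRad T r) (hT : IsTree T t) {P : Tile}
    (hP : P ∈ T) (hU : t.2.2 ∈ tU P) {x z : ℝ} (hxz : |x - z| < r z / 4) :
    ‖md t.2.2 x * φ P x - (topNbhd t).indicator (fun z => md t.2.2 z * φ P z) z‖ ≤
      7 * A * (min (r z / tlen P) 1 * wt (tlen P) (z - tctr P) ^ 6) := by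
  have hs := tlen_pos P
  have hz := hr.pos z
  have hA := h.one_le
  have hrz := hr.le z P hP
  have e1 := abs_sub_le z x (tctr P)
  rw [abs_sub_comm z x] at e1
  set w := wt (tlen P) (z - tctr P)
  have hw : 0 ≤ w := wt_nonneg hs
  have hw1 : w ≤ 1 := wt_le_one hs
  have hb : ∀ y, ‖md t.2.2 y * φ P y‖ ≤ A * wt (tlen P) (y - tctr P) ^ 6 := fun y => by
    rw [norm_mul, h.md_norm, one_mul]
    exact (h.decay P y).trans (mul_le_mul_of_nonneg_left (wt_pow_le hs (by norm_num)) (by linarith))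
  have hx : ‖md t.2.2 x * φ P x‖ ≤ 6 * A * w ^ 6 := by
    have h1 : wt (tlen P) (x - tctr P) ≤ 4 / 3 * w := wt_comp hs (by linarith)
    have h2 := pow_le_pow_left₀ (wt_nonneg hs) h1 6
    rw [mul_pow] at h2
    have h3 : 0 ≤ w ^ 6 := by positivity
    refine (hb x).trans ?_
    rw [mul_comm 6 A, mul_assoc]
    refine mul_le_mul_of_nonneg_left (h2.trans ?_) (by linarith)
    norm_num
    linarith
  have hAw : 0 ≤ A * w ^ 6 := by positivity
  by_cases hzJ : z ∈ topNbhd t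
  · rw [indicator_of_mem hzJ]
    rcases le_or_gt (r z) (4 * tlen P) with h4 | h4
    · refine (h.lip P _ hU x z (by linarith)).trans ?_
      have h1 : |x - z| / tlen P ≤ min (r z / tlen P) 1 :=
        le_min (div_le_div_of_nonneg_right (by linarith) hs.le) ((div_le_one hs).2 (by linarith))
      have h2 : w ^ 10 ≤ w ^ 6 := wt_pow_le hs (by norm_num)
      have h3 : 0 ≤ |x - z| / tlen P := by positivity
      calc A * (|x - z| / tlen P) * w ^ 10 ≤ A * (min (r z / tlen P) 1 * w ^ 6) := by
            rw [mul_assoc]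
            exact mul_le_mul_of_nonneg_left (mul_le_mul h1 h2 (by positivity) (by positivity))
              (by linarith)
        _ ≤ _ := by
          have : 0 ≤ A * (min (r z / tlen P) 1 * w ^ 6) := by positivity
          linarith
    · rw [min_eq_right ((one_le_div hs).2 (by linarith)), one_mul]
      refine (norm_sub_le _ _).trans ?_
      linarith [hb z]
  · rw [indicator_of_notMem hzJ, sub_zero]
    have h1 : 2 * 2 ^ t.1 < |z - topCtr t| := by
      by_contra! h5
      have := abs_le.1 h5
      exact hzJ ⟨by linarith, by linarith⟩
    have h2 : tlen P ≤ r z := by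
      obtain ⟨Q, hQ, hQr⟩ := hr.ex z
      have h3 := hT.abs_ctr_le hQ
      have h4 := hT.tlen_le hP
      have h5 := abs_sub_le z (tctr Q) (topCtr t)
      have := tlen_pos Q
      have := two_zpow_pos t.1
      linarith
    rw [min_eq_right ((one_le_div hs).2 h2), one_mul]
    linarith

/-- The regularization of `f` adapted to a tree. -/
noncomputable def regf (md : ℝ → ℝ → ℂ) (r : ℝ → ℝ) (t : TreeTop) (f : ℝ → ℂ) : ℝ → ℂ :=
  (topNbhd t).indicator fun z =>
    (∫ x, (regn r (z, x) : ℂ) * (md t.2.2 x * f x)) * conj (md t.2.2 z)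

lemma Packets.measurable_regf (h : Packets A φ md ker) (hr : TreeRad T r) {f : ℝ → ℂ}
    (hf : Measurable f) : Measurable (regf md r t f) := by
  refine Measurable.indicator ?_ measurableSet_Icc
  refine Measurable.mul ?_ (Complex.continuous_conj.comp (h.md_cont _)).measurable
  have : Measurable fun p : ℝ × ℝ => (regn r p : ℂ) * (md t.2.2 p.2 * f p.2) :=
    (Complex.measurable_ofReal.comp hr.measurable_regn).mul
      (((h.md_cont _).measurable.comp measurable_snd).mul (hf.comp measurable_snd))
  exact (this.stronglyMeasurable.integral_prod_right').measurable

lemma Packets.norm_regf_le (h : Packets A φ md ker) (hr : TreeRad T r) {f : ℝ → ℂ}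
    (hf : Integrable f) {lam : ℝ} (h0 : 0 ≤ lam) (hl : ∀ P ∈ T, LightTile f lam P) (z : ℝ) :
    ‖regf md r t f z‖ ≤ (topNbhd t).indicator (fun _ => 16 * lam) z := by
  by_cases hz : z ∈ topNbhd t
  · rw [regf, indicator_of_mem hz, indicator_of_mem hz, norm_mul, RCLike.norm_conj, h.md_norm,
      mul_one]
    obtain ⟨h1, h2⟩ := hr.integral_regn_mul_le hf h0 hl z
    refine (norm_integral_le_of_norm_le h1 (.of_forall fun x => ?_)).trans h2
    rw [norm_mul, norm_mul, h.md_norm, one_mul, Complex.norm_real,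
      Real.norm_of_nonneg (hr.regn_nonneg _)]
  · rw [regf, indicator_of_notMem hz, indicator_of_notMem hz, norm_zero]

lemma Packets.pcoef_le (h : Packets A φ md ker) (hr : TreeRad T r) (hT : IsTree T t) {P : Tile}
    (hP : P ∈ T) (hU : t.2.2 ∈ tU P) {f : ℝ → ℂ}
    (hf : Integrable f) {lam : ℝ} (h0 : 0 ≤ lam) (hl : ∀ P ∈ T, LightTile f lam P) :
    ‖pcoef φ f P‖ ≤ ‖pcoef φ (regf md r t f) P‖ + 112 * A * lam * alp r P := by
  have hs := tlen_pos P
  have hA := h.one_le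
  set ξ := t.2.2
  set ψ : ℝ → ℂ := fun x => md ξ x * φ P x
  set F : ℝ → ℂ := fun x => md ξ x * f x
  have hψm : Measurable ψ := ((h.md_cont ξ).mul (h.cont P)).measurable
  have hψb : ∀ x, ‖ψ x‖ ≤ A := fun x => by
    rw [norm_mul, h.md_norm, one_mul]; exact h.norm_le P x
  have hF : Integrable F := hf.bdd_mul (h.md_cont ξ).aestronglyMeasurable
    (.of_forall fun x => (h.md_norm ξ x).le)
  have hmd : ∀ x, md ξ x * conj (md ξ x) = 1 := fun x => by
    rw [Complex.mul_conj, Complex.normSq_eq_norm_sq, h.md_norm]; simp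
  set χ : ℝ → ℂ := (topNbhd t).indicator ψ
  have hχm : Measurable χ := hψm.indicator measurableSet_Icc
  have hχb : ∀ x, ‖χ x‖ ≤ A := fun x => (norm_indicator_le_norm_self _ _).trans (hψb x)
  have hprod := hr.integrable_regn_mul hF
  have i1 : Integrable (fun p : ℝ × ℝ => conj (ψ p.2) * ((regn r p : ℂ) * F p.2))
      (volume.prod volume) :=
    hprod.bdd_mul (c := A) (Complex.continuous_conj.measurable.comp
      (hψm.comp measurable_snd)).aestronglyMeasurable
      (.of_forall fun p => by rw [RCLike.norm_conj]; exact hψb _)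
  have i2 : Integrable (fun p : ℝ × ℝ => conj (χ p.1) * ((regn r p : ℂ) * F p.2))
      (volume.prod volume) :=
    hprod.bdd_mul (c := A) (Complex.continuous_conj.measurable.comp
      (hχm.comp measurable_fst)).aestronglyMeasurable
      (.of_forall fun p => by rw [RCLike.norm_conj]; exact hχb _)
  have e1 : ∫ x, f x * conj (φ P x) = ∫ z, ∫ x, conj (ψ x) * ((regn r (z, x) : ℂ) * F x) := by
    rw [integral_integral_swap (f := fun z x => conj (ψ x) * ((regn r (z, x) : ℂ) * F x)) i1]
    refine integral_congr_ae (.of_forall fun x => ?_)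
    simp only
    have e0 : ∫ z, ((regn r (z, x) : ℝ) : ℂ) = 1 := by
      rw [integral_complex_ofReal, hr.integral_regn]; simp
    rw [integral_const_mul, integral_mul_const, e0]
    simp only [ψ, F, map_mul]
    linear_combination (-(f x * conj (φ P x))) * hmd x
  have e2 : ∫ x, regf md r t f x * conj (φ P x) =
      ∫ z, ∫ x, conj (χ z) * ((regn r (z, x) : ℂ) * F x) := by
    refine integral_congr_ae (.of_forall fun z => ?_)
    simp only
    rw [integral_const_mul]
    by_cases hz : z ∈ topNbhd t
    · simp only [regf, χ, indicator_of_mem hz, ψ, F, map_mul]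
      ring
    · simp only [regf, χ, indicator_of_notMem hz, map_zero, zero_mul]
  have i3 : Integrable (fun p : ℝ × ℝ => ‖conj (ψ p.2) * ((regn r p : ℂ) * F p.2) -
      conj (χ p.1) * ((regn r p : ℂ) * F p.2)‖) (volume.prod volume) := (i1.sub i2).norm
  have e3 : ‖(∫ x, f x * conj (φ P x)) - ∫ x, regf md r t f x * conj (φ P x)‖ ≤
      112 * A * lam * (tlen P * alp r P) := by
    rw [e1, e2, ← integral_prod _ i1, ← integral_prod _ i2, ← integral_sub i1 i2]
    refine (norm_integral_le_integral_norm _).trans ?_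
    rw [integral_prod _ i3, alp, mul_inv_cancel_left₀ hs.ne', ← integral_const_mul]
    refine integral_mono i3.integral_prod_left ((hr.integrable_alp P).const_mul _) fun z => ?_
    obtain ⟨h1, h2⟩ := hr.integral_regn_mul_le hf h0 hl z
    have h3 : 0 ≤ min (r z / tlen P) 1 * wt (tlen P) (z - tctr P) ^ 6 := by
      have := wt_nonneg (u := z - tctr P) hs
      have := hr.pos z
      positivity
    set m := min (r z / tlen P) 1 * wt (tlen P) (z - tctr P) ^ 6
    have h4 : ∀ x, ‖conj (ψ x) * ((regn r (z, x) : ℂ) * F x) -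
        conj (χ z) * ((regn r (z, x) : ℂ) * F x)‖ ≤ 7 * A * m * (regn r (z, x) * ‖f x‖) := by
      intro x
      have hF' : ‖F x‖ = ‖f x‖ := by rw [norm_mul, h.md_norm, one_mul]
      rw [← sub_mul, ← map_sub, norm_mul, RCLike.norm_conj, norm_mul, Complex.norm_real,
        Real.norm_of_nonneg (hr.regn_nonneg _), hF']
      by_cases h5 : regn r (z, x) = 0
      · rw [h5]; simp
      · exact mul_le_mul_of_nonneg_right
          (h.cutoff_le hr hT hP hU (abs_sub_lt_of_regn h5))
          (mul_nonneg (hr.regn_nonneg _) (norm_nonneg _))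
    calc _ ≤ ∫ x, 7 * A * m * (regn r (z, x) * ‖f x‖) :=
          integral_mono_of_nonneg (.of_forall fun x => norm_nonneg _) (h1.const_mul _)
            (.of_forall h4)
      _ ≤ 7 * A * m * (16 * lam) := by
          rw [integral_const_mul]
          exact mul_le_mul_of_nonneg_left h2 (by positivity)
      _ = 112 * A * lam * m := by ring
  have e4 := norm_sub_norm_le (∫ x, f x * conj (φ P x)) (∫ x, regf md r t f x * conj (φ P x))
  have hn : ‖((tlen P : ℝ) : ℂ)⁻¹‖ = (tlen P)⁻¹ := by
    rw [norm_inv, Complex.norm_real, Real.norm_of_nonneg hs.le]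
  rw [pcoef, pcoef, norm_mul, norm_mul, hn]
  calc _ ≤ (tlen P)⁻¹ * (‖∫ x, regf md r t f x * conj (φ P x)‖ +
        112 * A * lam * (tlen P * alp r P)) :=
        mul_le_mul_of_nonneg_left (by linarith) (inv_pos.2 hs).le
    _ = _ := by field_simp

/-- Wave packet coefficients along light tiles have bounded size. -/
lemma Packets.sizeLe_of_light (h : Packets A φ md ker) {f : ℝ → ℂ} (hfm : Measurable f)
    (hf : Integrable f) {lam : ℝ} (h0 : 0 ≤ lam) (hl : ∀ P ∈ T, LightTile f lam P) :
    SizeLe (pcoef φ f) T (2 ^ 14 * A * lam) := by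
  intro t
  have hA := h.one_le
  have hK := two_zpow_pos t.1
  rcases (upTree T t).eq_empty_or_nonempty with hU | hU
  · rw [hU]; simp only [energy, Finset.sum_empty]; positivity
  obtain ⟨r, hr⟩ := exists_treeRad hU
  have hT : IsTree (upTree T t) t := fun P hP => by
    obtain ⟨-, h2, h3⟩ := mem_upTree.1 hP
    exact ⟨h2, tU_subset_tW P h3⟩
  have hl' : ∀ P ∈ upTree T t, LightTile f lam P := fun P hP => hl P (mem_upTree.1 hP).1
  have hb : ∀ P ∈ upTree T t, ‖pcoef φ f P‖ ≤
      ‖pcoef φ (regf md r t f) P‖ + 112 * A * lam * alp r P := fun P hP =>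
    h.pcoef_le hr hT hP (mem_upTree.1 hP).2.2 hf h0 hl'
  have hgm := (h.measurable_regf hr (t := t) hfm)
  have hgb := h.norm_regf_le hr (t := t) hf h0 hl'
  have i1 : Integrable ((topNbhd t).indicator fun _ => (16 * lam) ^ 2) :=
    (integrable_indicator_iff measurableSet_Icc).2 (integrableOn_const (by simp))
  have hgb2 : ∀ x, ‖regf md r t f x‖ ^ 2 ≤ (topNbhd t).indicator (fun _ => (16 * lam) ^ 2) x :=
    fun x => by
      refine (pow_le_pow_left₀ (norm_nonneg _) (hgb x) 2).trans_eq ?_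
      by_cases hx : x ∈ topNbhd t
      · simp only [indicator_of_mem hx]
      · simp only [indicator_of_notMem hx]; simp
  have i2 : Integrable fun x => ‖regf md r t f x‖ ^ 2 :=
    i1.mono' (hgm.norm.pow_const 2).aestronglyMeasurable (.of_forall fun x => by
      rw [Real.norm_of_nonneg (by positivity)]; exact hgb2 x)
  have hg2 : MemLp (regf md r t f) 2 :=
    (memLp_two_iff_integrable_sq_norm hgm.aestronglyMeasurable).2 i2
  have hg3 : ∫ x, ‖regf md r t f x‖ ^ 2 ≤ 1024 * lam ^ 2 * 2 ^ t.1 := by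
    refine (integral_mono i2 i1 hgb2).trans_eq ?_
    rw [topNbhd, integral_indicator measurableSet_Icc, setIntegral_const,
      Real.volume_real_Icc_of_le (by linarith), smul_eq_mul]
    ring
  have h5 := h.bessel_dual hg2 (T := upTree T t) (ξ := t.2.2) fun P hP => (mem_upTree.1 hP).2.2
  have h6 := hr.sum_alp_le hT
  have h7 : ∀ P ∈ upTree T t, tlen P * ‖pcoef φ f P‖ ^ 2 ≤
      2 * (tlen P * ‖pcoef φ (regf md r t f) P‖ ^ 2) +
        100352 * (A * lam) ^ 2 * (tlen P * alp r P) := fun P hP => by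
    have hs := tlen_pos P
    have a0 := hr.alp_nonneg P
    have a1 := hr.alp_le P
    have := pow_le_pow_left₀ (norm_nonneg _) (hb P hP) 2
    have h8 : ‖pcoef φ f P‖ ^ 2 ≤ 2 * ‖pcoef φ (regf md r t f) P‖ ^ 2 +
        100352 * (A * lam) ^ 2 * alp r P := by
      have h9 : alp r P ^ 2 ≤ 4 * alp r P := by nlinarith
      have h10 := mul_le_mul_of_nonneg_left h9 (show 0 ≤ 25088 * (A * lam) ^ 2 by positivity)
      nlinarith [sq_nonneg (‖pcoef φ (regf md r t f) P‖ - 112 * A * lam * alp r P)]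
    calc _ ≤ tlen P * (2 * ‖pcoef φ (regf md r t f) P‖ ^ 2 +
        100352 * (A * lam) ^ 2 * alp r P) := mul_le_mul_of_nonneg_left h8 hs.le
      _ = _ := by ring
  have h8 := Finset.sum_le_sum h7
  rw [Finset.sum_add_distrib, ← Finset.mul_sum, ← Finset.mul_sum] at h8
  have h9 : 100352 * (A * lam) ^ 2 * ∑ P ∈ upTree T t, tlen P * alp r P ≤
      100352 * (A * lam) ^ 2 * (1024 * 2 ^ t.1) := mul_le_mul_of_nonneg_left h6 (by positivity)
  have h10 : 64 * A ^ 2 * ∫ x, ‖regf md r t f x‖ ^ 2 ≤ 64 * A ^ 2 * (1024 * lam ^ 2 * 2 ^ t.1) :=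
    mul_le_mul_of_nonneg_left hg3 (by positivity)
  have h11 : 0 ≤ (A * lam) ^ 2 * 2 ^ t.1 := by positivity
  calc energy (pcoef φ f) (upTree T t)
      ≤ 2 * (64 * A ^ 2 * (1024 * lam ^ 2 * 2 ^ t.1)) +
        100352 * (A * lam) ^ 2 * (1024 * 2 ^ t.1) := by
        unfold energy; linarith
    _ ≤ _ := by nlinarith

end sizebound

section bad
open Metric Classical
variable {A : ℝ} {φ : Tile → ℝ → ℂ} {md : ℝ → ℝ → ℂ} {ker : ℤ → ℝ → ℝ → ℂ}
  {E Ω : Set ℝ} {N : ℝ → ℝ} {w : ℝ → ℂ} {f : ℝ → ℂ} {lam : ℝ}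

lemma Packets.bad_pcoef_le (h : Packets A φ md ker) (hf : Integrable f) (h0 : 0 ≤ lam)
    (hne : Ωᶜ.Nonempty) (hl : ∀ y ∉ Ω, ∀ R > 0, ∫ x in ball y R, ‖f x‖ ≤ lam * R)
    {P : Tile} (hP : ball (tctr P) (2 * tlen P) ⊆ Ω) :
    2 * tlen P ≤ infDist (tctr P) Ωᶜ ∧
      ‖pcoef φ f P‖ ≤ 96 * A * lam * (infDist (tctr P) Ωᶜ / tlen P) := by
  have hs := tlen_pos P
  have hA := h.one_le
  set d := infDist (tctr P) Ωᶜ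
  have hd : 2 * tlen P ≤ d := by
    refine (le_infDist hne).2 fun y hy => ?_
    by_contra! h1
    exact hy (hP (by rwa [mem_ball, dist_comm]))
  refine ⟨hd, ?_⟩
  have hd0 : 0 < d := by linarith
  have key : ∀ j : ℕ, ∫ x in {x | |x - tctr P| ≤ 2 ^ j * tlen P}, ‖f x‖ ≤ 3 * lam * d * 8 ^ j := by
    intro j
    obtain ⟨y, hy, hyd⟩ := (infDist_lt_iff (r := 2 * d) hne).1 (by linarith : d < 2 * d)
    rw [Real.dist_eq, abs_sub_comm] at hyd
    have h2 : (1 : ℝ) ≤ 2 ^ j := one_le_pow₀ one_le_two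
    have h3 : (2 : ℝ) ^ j ≤ 8 ^ j := pow_le_pow_left₀ (by norm_num) (by norm_num) j
    refine (setIntegral_mono_set hf.norm.integrableOn (.of_forall fun x => norm_nonneg _)
      (LE.le.eventuallyLE fun x hx => ?_)).trans
      ((hl y hy (2 * d + 2 ^ j * tlen P) (by positivity)).trans ?_)
    · have hx' : |x - tctr P| ≤ 2 ^ j * tlen P := hx
      change dist x y < _
      rw [Real.dist_eq]
      have := abs_sub_le x (tctr P) y
      rw [abs_sub_comm (tctr P) y] at this
      linarith
    · rw [show 3 * lam * d * 8 ^ j = lam * (3 * d * 8 ^ j) by ring]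
      refine mul_le_mul_of_nonneg_left ?_ h0
      nlinarith
  have h1 := integral_mul_wt_le (g := fun x => ‖f x‖) (fun x => norm_nonneg _) hf.norm hs
    (by positivity) (tctr P) key
  have h2 : ‖∫ x, f x * conj (φ P x)‖ ≤ A * (32 * (3 * lam * d)) := by
    refine (norm_integral_le_of_norm_le (g := fun x => A * (‖f x‖ * wt (tlen P) (x - tctr P) ^ 4))
      ?_ (.of_forall fun x => ?_)).trans ?_
    · refine (hf.norm.mul_bdd (c := 1) ?_ (.of_forall fun x => ?_)).const_mul A
      · exact (((continuous_wt hs).comp (continuous_sub_right _)).pow 4).aestronglyMeasurable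
      · rw [Real.norm_of_nonneg (pow_nonneg (wt_nonneg hs) _)]; exact wt_pow_le_one hs
    · rw [norm_mul, RCLike.norm_conj]
      have h3 : ‖φ P x‖ ≤ A * wt (tlen P) (x - tctr P) ^ 4 :=
        (h.decay P x).trans (mul_le_mul_of_nonneg_left (wt_pow_le hs (by norm_num)) (by linarith))
      calc _ ≤ ‖f x‖ * (A * wt (tlen P) (x - tctr P) ^ 4) :=
            mul_le_mul_of_nonneg_left h3 (norm_nonneg _)
        _ = _ := by ring
    · rw [integral_const_mul]
      exact mul_le_mul_of_nonneg_left h1 (by linarith)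
  rw [pcoef, norm_mul, norm_inv, Complex.norm_real, Real.norm_of_nonneg hs.le]
  calc _ ≤ (tlen P)⁻¹ * (A * (32 * (3 * lam * d))) :=
        mul_le_mul_of_nonneg_left h2 (inv_pos.2 hs).le
    _ = _ := by field_simp; ring

lemma Packets.bad_wcoef_le (h : Packets A φ md ker) (hE : MeasurableSet E) (hN : Measurable N)
    (hw1 : ∀ x, ‖w x‖ ≤ 1) (hEΩ : Disjoint E Ω) {S : Finset Tile} {I : ℤ × ℤ}
    (hI : ∀ P ∈ S, (P.1, P.2.1) = I) {d : ℝ} (hd0 : 0 < d)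
    (hd : d = infDist (((I.2 : ℝ) + 1 / 2) * 2 ^ I.1) Ωᶜ) :
    ∑ P ∈ S, ‖wcoef φ E N w P‖ ≤ 4 * A * 2 ^ I.1 * (2 ^ I.1 / d) ^ 2 := by
  have hA := h.one_le
  set s : ℝ := 2 ^ I.1
  have hs : 0 < s := two_zpow_pos _
  set c := ((I.2 : ℝ) + 1 / 2) * s
  have hsP : ∀ P ∈ S, tlen P = s ∧ tctr P = c := fun P hP => by
    have := hI P hP
    simp only [tlen, tctr, s, c, ← this, and_self]
  set g : ℝ → ℝ := fun x => A * (s / d) ^ 2 * wt s (x - c) ^ 2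
  have hg : Integrable g := (integrable_wt_sq hs c).const_mul _
  have hg0 : ∀ x, 0 ≤ g x := fun x => by
    have := wt_nonneg (u := x - c) hs
    positivity
  have hm : ∀ P : Tile, MeasurableSet (E ∩ N ⁻¹' tU P) := fun P =>
    hE.inter (hN (measurableSet_tU P))
  calc ∑ P ∈ S, ‖wcoef φ E N w P‖ ≤ ∑ P ∈ S, ∫ x in E ∩ N ⁻¹' tU P, g x := by
        refine Finset.sum_le_sum fun P hP => ?_
        refine norm_integral_le_of_norm_le hg.integrableOn
          ((ae_restrict_iff' (hm P)).2 (.of_forall fun x hx => ?_))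
        obtain ⟨h1, h2⟩ := hsP P hP
        have h3 : d ≤ s + |x - c| := by
          have := infDist_le_dist_of_mem (s := Ωᶜ) (x := c) (disjoint_left.1 hEΩ hx.1)
          rw [Real.dist_eq, abs_sub_comm] at this
          linarith
        have h4 : wt s (x - c) ≤ s / d := wt_le_div hs hd0 h3
        have h5 := h.decay P x
        rw [h1, h2] at h5
        have h6 := wt_nonneg (u := x - c) hs
        rw [norm_mul]
        calc _ ≤ A * wt s (x - c) ^ 10 * 1 := mul_le_mul h5 (hw1 x) (norm_nonneg _) (by positivity)
          _ ≤ A * wt s (x - c) ^ 4 := by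
            rw [mul_one]
            exact mul_le_mul_of_nonneg_left (wt_pow_le hs (by norm_num)) (by linarith)
          _ = A * (wt s (x - c) ^ 2 * wt s (x - c) ^ 2) := by ring
          _ ≤ A * ((s / d) ^ 2 * wt s (x - c) ^ 2) :=
            mul_le_mul_of_nonneg_left (mul_le_mul_of_nonneg_right (pow_le_pow_left₀ h6 h4 2)
              (by positivity)) (by linarith)
          _ = g x := by simp only [g]; ring
    _ = ∫ x in ⋃ P ∈ S, E ∩ N ⁻¹' tU P, g x := by
        refine (integral_biUnion_finset S (fun P _ => hm P) (fun P hP Q hQ hne => ?_)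
          fun P _ => hg.integrableOn).symm
        refine disjoint_left.2 fun x hx hx' => hne ?_
        have h1 := hI P hP
        have h2 := hI Q hQ
        have h3 := hx.2
        have h4 := hx'.2
        have h5 : (P.1, P.2.1) = (Q.1, Q.2.1) := h1.trans h2.symm
        have h6 : tctr P ∈ tI Q := by
          have : tI P = tI Q := by
            rw [tI, tI, show P.1 = Q.1 from (Prod.ext_iff.1 h5).1,
              show P.2.1 = Q.2.1 from (Prod.ext_iff.1 h5).2]
          rw [← this]; exact tctr_mem P
        exact tile_ext (Prod.ext_iff.1 h5).1 (tctr_mem P) h6 (tU_subset_tW P h3) (tU_subset_tW Q h4)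
    _ ≤ ∫ x, g x := setIntegral_le_integral hg (.of_forall hg0)
    _ ≤ A * (s / d) ^ 2 * (4 * s) := by
        rw [integral_const_mul]
        exact mul_le_mul_of_nonneg_left (integral_wt_sq_le hs c) (by positivity)
    _ = _ := by ring

lemma sum_dyadic_infDist_le (hΩ : MeasurableSet Ω) (hΩf : volume Ω ≠ ∞)
    {J : Finset (ℤ × ℤ)}
    (hJ : ∀ I ∈ J, 2 * (2 : ℝ) ^ I.1 ≤ infDist (((I.2 : ℝ) + 1 / 2) * 2 ^ I.1) Ωᶜ) :
    ∑ I ∈ J, (2 : ℝ) ^ I.1 * (2 ^ I.1 / infDist (((I.2 : ℝ) + 1 / 2) * 2 ^ I.1) Ωᶜ) ≤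
      5 / 2 * volume.real Ω := by
  have hx : ∀ I ∈ J, ∀ x ∈ dy I.1 I.2, 0 < infDist x Ωᶜ ∧ (2 : ℝ) ^ I.1 ≤ infDist x Ωᶜ ∧
      infDist x Ωᶜ ≤ 5 / 4 * infDist (((I.2 : ℝ) + 1 / 2) * 2 ^ I.1) Ωᶜ := by
    intro I hI x hx
    have h1 := hJ I hI
    have h2 := abs_sub_dy_ctr_le hx
    have h3 := infDist_le_infDist_add_dist (s := Ωᶜ) (x := x) (y := ((I.2 : ℝ) + 1 / 2) * 2 ^ I.1)
    have h4 := infDist_le_infDist_add_dist (s := Ωᶜ) (y := x) (x := ((I.2 : ℝ) + 1 / 2) * 2 ^ I.1)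
    rw [dist_comm] at h4
    rw [Real.dist_eq] at h3 h4
    have := two_zpow_pos I.1
    refine ⟨by linarith, by linarith, by linarith⟩
  have hsub : ∀ I ∈ J, dy I.1 I.2 ⊆ Ω := fun I hI x hxI => by
    by_contra hxΩ
    have := infDist_zero_of_mem (s := Ωᶜ) hxΩ
    linarith [(hx I hI x hxI).1]
  set G : ℤ × ℤ → ℝ → ℝ := fun I => (dy I.1 I.2).indicator fun x => 2 ^ I.1 / infDist x Ωᶜ
  have hGm : ∀ I, Measurable (G I) := fun I =>
    (measurable_const.div (continuous_infDist_pt _).measurable).indicator (measurableSet_dy _ _)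
  have hG0 : ∀ I x, 0 ≤ G I x := fun I x =>
    indicator_nonneg (fun _ _ => div_nonneg (two_zpow_pos _).le infDist_nonneg) _
  have hG1 : ∀ I ∈ J, ∀ x, G I x ≤ (dy I.1 I.2).indicator (fun _ => 1) x := fun I hI x => by
    by_cases h1 : x ∈ dy I.1 I.2
    · simp only [G, indicator_of_mem h1]
      obtain ⟨h2, h3, -⟩ := hx I hI x h1
      exact (div_le_one h2).2 h3
    · simp only [G, indicator_of_notMem h1, le_refl]
  have hGi : ∀ I ∈ J, Integrable (G I) := fun I hI => by
    refine Integrable.mono' (g := (dy I.1 I.2).indicator fun _ => 1) ?_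
      (hGm I).aestronglyMeasurable (.of_forall fun x => ?_)
    · exact (integrable_indicator_iff (measurableSet_dy _ _)).2
        (integrableOn_const (by simp [volume_dy]))
    · rw [Real.norm_of_nonneg (hG0 I x)]; exact hG1 I hI x
  have hle : ∀ I ∈ J, (2 : ℝ) ^ I.1 * (2 ^ I.1 / infDist (((I.2 : ℝ) + 1 / 2) * 2 ^ I.1) Ωᶜ) ≤
      5 / 4 * ∫ x, G I x := fun I hI => by
    rw [integral_indicator (measurableSet_dy _ _)]
    have hd := hJ I hI
    set d := infDist (((I.2 : ℝ) + 1 / 2) * 2 ^ I.1) Ωᶜ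
    have hs := two_zpow_pos I.1
    have h1 : ∫ x in dy I.1 I.2, (2 : ℝ) ^ I.1 / (5 / 4 * d) ≤
        ∫ x in dy I.1 I.2, 2 ^ I.1 / infDist x Ωᶜ := by
      refine setIntegral_mono_on (integrableOn_const (by simp [volume_dy]))
        ((integrable_indicator_iff (measurableSet_dy _ _)).1 (hGi I hI)) (measurableSet_dy _ _)
        fun x h2 => ?_
      obtain ⟨h3, -, h4⟩ := hx I hI x h2
      exact div_le_div_of_nonneg_left hs.le h3 h4
    rw [setIntegral_const, volume_real_dy, smul_eq_mul] at h1
    have h2 : (2 : ℝ) ^ I.1 * (2 ^ I.1 / d) = 5 / 4 * (2 ^ I.1 * (2 ^ I.1 / (5 / 4 * d))) := by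
      have : 0 < d := by linarith
      field_simp
    linarith
  have hpt : ∀ x, ∑ I ∈ J, G I x ≤ Ω.indicator (fun _ => 2) x := by
    intro x
    by_cases hxJ : ∃ I ∈ J, x ∈ dy I.1 I.2
    · obtain ⟨I0, hI0, hxI0⟩ := hxJ
      rw [indicator_of_mem (hsub I0 hI0 hxI0)]
      have hd := (hx I0 hI0 x hxI0).1
      set J' := J.filter fun I => x ∈ dy I.1 I.2
      have h1 : ∑ I ∈ J, G I x = ∑ I ∈ J', (2 : ℝ) ^ I.1 / infDist x Ωᶜ := by
        rw [Finset.sum_filter]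
        exact Finset.sum_congr rfl fun I _ => by simp only [G, indicator_apply]
      have hinj : Set.InjOn Prod.fst (J' : Set (ℤ × ℤ)) := by
        intro I hI I' hI' he
        have h2 := mem_dy.1 (Finset.mem_filter.1 hI).2
        have h3 := mem_dy.1 (Finset.mem_filter.1 hI').2
        have he' : I.1 = I'.1 := he
        exact Prod.ext he (by rw [← h2, ← h3, he'])
      rw [h1, ← Finset.sum_div, div_le_iff₀ hd]
      have h2 : ∑ I ∈ J', (2 : ℝ) ^ I.1 = ∑ k ∈ J'.image Prod.fst, (2 : ℝ) ^ k := by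
        rw [Finset.sum_image hinj]
      rw [h2]
      refine sum_two_zpow_le hd.le fun k hk => ?_
      obtain ⟨I, hI, rfl⟩ := Finset.mem_image.1 hk
      obtain ⟨hI1, hI2⟩ := Finset.mem_filter.1 hI
      exact (hx I hI1 x hI2).2.1
    · push Not at hxJ
      rw [Finset.sum_eq_zero fun I hI => indicator_of_notMem (hxJ I hI) _]
      exact indicator_nonneg (fun _ _ => by norm_num) _
  calc _ ≤ ∑ I ∈ J, 5 / 4 * ∫ x, G I x := Finset.sum_le_sum hle
    _ = 5 / 4 * ∫ x, ∑ I ∈ J, G I x := by rw [← Finset.mul_sum, integral_finsetSum _ hGi]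
    _ ≤ 5 / 4 * ∫ x, Ω.indicator (fun _ => 2) x := by
        refine mul_le_mul_of_nonneg_left (integral_mono (integrable_finsetSum _ hGi)
          ((integrable_indicator_iff hΩ).2 (integrableOn_const hΩf)) hpt) (by norm_num)
    _ = _ := by
        rw [integral_indicator hΩ, setIntegral_const, smul_eq_mul]
        ring

/-- Tiles deep inside an exceptional set contribute little outside of it. -/
lemma Packets.bad_sum_le (h : Packets A φ md ker) (hf : Integrable f) (h0 : 0 ≤ lam)
    (hE : MeasurableSet E) (hN : Measurable N) (hw1 : ∀ x, ‖w x‖ ≤ 1)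
    (hΩ : MeasurableSet Ω) (hΩf : volume Ω ≠ ∞) (hEΩ : Disjoint E Ω)
    (hl : ∀ y ∉ Ω, ∀ R > 0, ∫ x in ball y R, ‖f x‖ ≤ lam * R) {S : Finset Tile}
    (hS : ∀ P ∈ S, ball (tctr P) (2 * tlen P) ⊆ Ω) :
    ∑ P ∈ S, ‖pcoef φ f P‖ * ‖wcoef φ E N w P‖ ≤ 960 * A ^ 2 * lam * volume.real Ω := by
  have hA := h.one_le
  have hne : Ωᶜ.Nonempty := by
    rw [nonempty_compl]
    rintro rfl
    simp at hΩf
  set d : ℤ × ℤ → ℝ := fun I => infDist (((I.2 : ℝ) + 1 / 2) * 2 ^ I.1) Ωᶜ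
  set π : Tile → ℤ × ℤ := fun P => (P.1, P.2.1)
  have hJ : ∀ I ∈ S.image π, 2 * (2 : ℝ) ^ I.1 ≤ d I := by
    intro I hI
    obtain ⟨P, hP, rfl⟩ := Finset.mem_image.1 hI
    exact (h.bad_pcoef_le hf h0 hne hl (hS P hP)).1
  rw [← Finset.sum_fiberwise_of_maps_to (t := S.image π) (g := π)
    fun P hP => Finset.mem_image_of_mem _ hP]
  calc _ ≤ ∑ I ∈ S.image π, 384 * A ^ 2 * lam * ((2 : ℝ) ^ I.1 * (2 ^ I.1 / d I)) := by
        refine Finset.sum_le_sum fun I hI => ?_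
        have hs := two_zpow_pos I.1
        have hd : 0 < d I := by linarith [hJ I hI]
        have h1 := h.bad_wcoef_le hE hN hw1 hEΩ (S := S.filter fun P => π P = I) (I := I)
          (fun P hP => (Finset.mem_filter.1 hP).2) hd rfl
        calc _ ≤ ∑ P ∈ S with π P = I, 96 * A * lam * (d I / 2 ^ I.1) * ‖wcoef φ E N w P‖ := by
              refine Finset.sum_le_sum fun P hP => mul_le_mul_of_nonneg_right ?_ (norm_nonneg _)
              obtain ⟨hP1, rfl⟩ := Finset.mem_filter.1 hP
              exact (h.bad_pcoef_le hf h0 hne hl (hS P hP1)).2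
          _ ≤ 96 * A * lam * (d I / 2 ^ I.1) * (4 * A * 2 ^ I.1 * (2 ^ I.1 / d I) ^ 2) := by
              rw [← Finset.mul_sum]
              exact mul_le_mul_of_nonneg_left h1 (by positivity)
          _ = _ := by field_simp; ring
    _ ≤ 384 * A ^ 2 * lam * (5 / 2 * volume.real Ω) := by
        rw [← Finset.mul_sum]
        exact mul_le_mul_of_nonneg_left (sum_dyadic_infDist_le hΩ hΩf hJ) (by positivity)
    _ = _ := by ring

end bad

section mainsum
open Classical
variable {A : ℝ} {φ : Tile → ℝ → ℂ} {md : ℝ → ℝ → ℂ} {ker : ℤ → ℝ → ℝ → ℂ}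
  {E : Set ℝ} {N : ℝ → ℝ} {w : ℝ → ℂ} {f : ℝ → ℂ} {S T : Finset Tile}

lemma SizeLe.mono {α : Tile → ℂ} {σ σ' : ℝ} (h : SizeLe α T σ) (h0 : 0 ≤ σ) (hσ : σ ≤ σ') :
    SizeLe α T σ' := fun t => (h t).trans
  (mul_le_mul_of_nonneg_right (pow_le_pow_left₀ h0 hσ 2) (two_zpow_pos _).le)

lemma SizeLe.min {α : Tile → ℂ} {σ σ' : ℝ} (h : SizeLe α T σ) (h' : SizeLe α T σ') :
    SizeLe α T (min σ σ') := by
  rcases min_choice σ σ' with h1 | h1 <;> rw [h1] <;> assumption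

lemma MassLe.min {μ μ' : ℝ} (h : MassLe E N T μ) (h' : MassLe E N T μ') :
    MassLe E N T (min μ μ') := fun P hP Q h1 h2 => le_min (h P hP Q h1 h2) (h' P hP Q h1 h2)

lemma dens_le_four (E : Set ℝ) (N : ℝ → ℝ) (Q : Tile) : dens E N Q ≤ 4 := by
  have hs := tlen_pos Q
  have h1 : ∫ x in mset E N Q, wt (tlen Q) (x - tctr Q) ^ 4 ≤ 4 * tlen Q :=
    (setIntegral_le_integral (integrable_wt_pow hs _ (by norm_num))
      (.of_forall fun x => pow_nonneg (wt_nonneg hs)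
          _)).trans (integral_wt_pow_le hs _ (by norm_num))
  calc dens E N Q ≤ (tlen Q)⁻¹ * (4 * tlen Q) := mul_le_mul_of_nonneg_left h1 (inv_pos.2 hs).le
    _ = 4 := by field_simp

lemma Packets.cover_sum_le (h : Packets A φ md ker) {c : Tile → ℂ} {σ μ B : ℝ} (hσ : 0 ≤ σ)
    (hμ0 : 0 ≤ μ) (hs : SizeLe c S σ) (hE : MeasurableSet E) (hN : Measurable N)
    (hμ : MassLe E N S μ) (hw : Measurable w) (hw1 : ∀ x, ‖w x‖ ≤ 1) (hB : TreeCover S B) :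
    ∑ P ∈ S, ‖c P‖ * ‖wcoef φ E N w P‖ ≤ 2 ^ 21 * A ^ 2 * σ * μ * B := by
  refine hB.sum_le (fun P => by positivity) (by positivity) fun t => ?_
  have hsub : fullTree S t ⊆ S := Finset.filter_subset _ _
  exact h.tree_lemma (fun P hP => (mem_fullTree.1 hP).2) hσ (hs.subset hsub) hE hN hμ0
    (hμ.subset hsub) hw hw1

/-- One step of the decomposition into trees. -/
lemma Packets.step (h : Packets A φ md ker) (hf : MemLp f 2) {F e τ x : ℝ} (hF : 0 < F)
    (hfF : ∫ x, ‖f x‖ ^ 2 ≤ F) (hE : MeasurableSet E) (hEf : volume E ≠ ∞)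
    (he : volume.real E = e) (he0 : 0 < e) (hN : Measurable N) (hw : Measurable w)
    (hw1 : ∀ x, ‖w x‖ ≤ 1) (hτ : 0 ≤ τ) (hx : 0 < x) (hT : SizeLe (pcoef φ f) T τ)
    (hT1 : SizeLe (pcoef φ f) T (√F * x⁻¹)) (hT2 : MassLe E N T (e * (x ^ 2)⁻¹)) :
    ∃ R ⊆ T, SizeLe (pcoef φ f) R (√F * (2 * x)⁻¹) ∧ MassLe E N R (e * ((2 * x) ^ 2)⁻¹) ∧
      ∑ P ∈ T, ‖pcoef φ f P‖ * ‖wcoef φ E N w P‖ ≤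
        2 ^ 42 * A ^ 4 * (min (√F * x⁻¹) τ * min e (4 * x ^ 2)) +
          ∑ P ∈ R, ‖pcoef φ f P‖ * ‖wcoef φ E N w P‖ := by
  have hA := h.one_le
  have hF' := Real.sqrt_pos.2 hF
  obtain ⟨R1, hR1, hm, hc1⟩ := mass_lemma hE hEf hN (μ := e * ((2 * x) ^ 2)⁻¹) (by positivity) T
  obtain ⟨R, hR, hs, hc2⟩ := h.size_lemma hf (σ := √F * (2 * x)⁻¹) (T := R1) (by positivity)
    (by convert hT1.subset hR1 using 1; field_simp)
  refine ⟨R, hR.trans hR1, hs, hm.subset hR, ?_⟩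
  rw [he] at hc1
  have hσ : 0 ≤ min (√F * x⁻¹) τ := le_min (by positivity) hτ
  have hμ : 0 ≤ min (e * (x ^ 2)⁻¹) 4 := le_min (by positivity) (by norm_num)
  have hsz := hT1.min hT
  have hmass : MassLe E N T (min (e * (x ^ 2)⁻¹) 4) :=
    hT2.min fun P _ Q _ _ => dens_le_four E N Q
  have b1 := h.cover_sum_le hσ hμ (hsz.subset Finset.sdiff_subset) hE hN
    (hmass.subset Finset.sdiff_subset) hw hw1 hc1
  have hsub : R1 \ R ⊆ T := Finset.sdiff_subset.trans hR1
  have b2 := h.cover_sum_le hσ hμ (hsz.subset hsub) hE hN (hmass.subset hsub) hw hw1 hc2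
  rw [← Finset.sum_sdiff hR1, ← Finset.sum_sdiff hR, ← add_assoc]
  refine add_le_add_left ((add_le_add b1 b2).trans ?_) _
  have e1 : 512 * (e * ((2 * x) ^ 2)⁻¹)⁻¹ * e = 2 ^ 11 * x ^ 2 := by field_simp; norm_num
  have e2 : 2 ^ 18 * A ^ 2 * ((√F * (2 * x)⁻¹) ^ 2)⁻¹ * ∫ x, ‖f x‖ ^ 2 ≤
      2 ^ 20 * A ^ 2 * x ^ 2 := by
    rw [mul_pow, Real.sq_sqrt hF.le]
    calc _ ≤ 2 ^ 18 * A ^ 2 * (F * (2 * x)⁻¹ ^ 2)⁻¹ * F :=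
          mul_le_mul_of_nonneg_left hfF (by positivity)
      _ = _ := by field_simp
  have e3 : min (e * (x ^ 2)⁻¹) 4 * x ^ 2 = min e (4 * x ^ 2) := by
    rw [min_mul_of_nonneg _ _ (by positivity)]; congr 1; field_simp
  have hA2 : 1 ≤ A ^ 2 := one_le_pow₀ hA
  set s := min (√F * x⁻¹) τ
  set m := min (e * (x ^ 2)⁻¹) 4
  rw [e1, ← mul_add]
  calc _ ≤ 2 ^ 21 * A ^ 2 * s * m * (2 ^ 21 * A ^ 2 * x ^ 2) := by
        refine mul_le_mul_of_nonneg_left ?_ (by positivity)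
        nlinarith [mul_le_mul_of_nonneg_right hA2 (sq_nonneg x)]
    _ = _ := by rw [← e3]; ring

lemma sum_pow_natAbs_le {q : ℝ} (h0 : 0 ≤ q) (h1 : q < 1) (m : ℤ) (S : Finset ℤ) :
    ∑ n ∈ S, q ^ (n - m).natAbs ≤ 2 * (1 - q)⁻¹ := by
  have key : ∀ S' : Finset ℤ, Set.InjOn (fun n : ℤ => (n - m).natAbs) S' →
      ∑ n ∈ S', q ^ (n - m).natAbs ≤ (1 - q)⁻¹ := fun S' hS' => by
    rw [← Finset.sum_image (f := fun k => q ^ k) hS', ← tsum_geometric_of_lt_one h0 h1]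
    exact (summable_geometric_of_lt_one h0 h1).sum_le_tsum _ fun k _ => pow_nonneg h0 k
  rw [← Finset.sum_filter_add_sum_filter_not S (fun n => m ≤ n), two_mul]
  refine add_le_add (key _ ?_) (key _ ?_)
  · intro a ha b hb hab
    simp only [Finset.coe_filter, mem_ofPred_eq] at ha hb hab
    lia
  · intro a ha b hb hab
    simp only [Finset.coe_filter, mem_ofPred_eq] at ha hb hab
    lia

lemma min_le_rpow_mul {a b θ : ℝ} (ha : 0 ≤ a) (hb : 0 ≤ b) (h0 : 0 ≤ θ) (h1 : θ ≤ 1) :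
    min a b ≤ a ^ θ * b ^ (1 - θ) := by
  have hm := le_min ha hb
  rcases hm.eq_or_lt with h | h
  · rw [← h]; positivity
  calc min a b = min a b ^ θ * min a b ^ (1 - θ) := by
        rw [← Real.rpow_add h, add_sub_cancel, Real.rpow_one]
    _ ≤ _ := mul_le_mul (Real.rpow_le_rpow hm (min_le_left _ _) h0)
        (Real.rpow_le_rpow hm (min_le_right _ _) (by linarith)) (by positivity) (by positivity)

lemma exists_min_mul_le {e θ : ℝ} (he : 0 < e) (h0 : 0 ≤ θ) (h1 : θ ≤ 1) :
    ∃ m : ℤ, ∀ n : ℤ, min e (4 * (2 ^ n) ^ 2) * (((2 : ℝ) ^ n)⁻¹) ^ θ ≤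
      4 * e ^ (1 - θ / 2) * ((2 : ℝ)⁻¹ ^ θ) ^ (n - m).natAbs := by
  obtain ⟨m, hm1, hm2⟩ := exists_mem_Ico_zpow he (by norm_num : (1 : ℝ) < 4)
  have hc : ∀ k : ℤ, (4 : ℝ) ^ k = (2 : ℝ) ^ (2 * k : ℝ) := fun k => by
    rw [Real.rpow_mul (by norm_num), Real.rpow_intCast]; norm_num
  have hc2 : ∀ k : ℤ, ((2 : ℝ) ^ k) = (2 : ℝ) ^ (k : ℝ) := fun k => (Real.rpow_intCast _ _).symm
  rw [hc] at hm1 hm2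
  have two0 : (0 : ℝ) < 2 := two_pos
  refine ⟨m, fun n => ?_⟩
  have hi : (((2 : ℝ) ^ n)⁻¹) ^ θ = (2 : ℝ) ^ (-(n * θ)) := by
    rw [hc2, ← Real.rpow_neg two0.le, ← Real.rpow_mul two0.le]; ring_nf
  have hj : ((2 : ℝ)⁻¹ ^ θ) ^ (n - m).natAbs = (2 : ℝ) ^ (-(θ * |(n : ℝ) - m|)) := by
    rw [← Real.rpow_neg_one, ← Real.rpow_mul two0.le, ← Real.rpow_natCast, ← Real.rpow_mul two0.le,
      Nat.cast_natAbs]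
    push_cast
    ring_nf
  rw [hi, hj]
  rcases le_or_gt m n with hmn | hmn
  · have hmn' : (m : ℝ) ≤ n := by exact_mod_cast hmn
    rw [abs_of_nonneg (by linarith)]
    have h2 : e ^ (θ / 2) ≤ 4 * 2 ^ (m * θ) := by
      calc e ^ (θ / 2) ≤ ((2 : ℝ) ^ (2 * ((m + 1 : ℤ) : ℝ))) ^ (θ / 2) :=
            Real.rpow_le_rpow he.le hm2.le (by linarith)
        _ = 2 ^ θ * 2 ^ (m * θ) := by
            rw [← Real.rpow_mul two0.le, ← Real.rpow_add two0]; push_cast; ring_nf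
        _ ≤ _ := by
            refine mul_le_mul_of_nonneg_right ?_ (by positivity)
            calc (2 : ℝ) ^ θ ≤ 2 ^ (1 : ℝ) := Real.rpow_le_rpow_of_exponent_le one_le_two h1
              _ ≤ 4 := by norm_num
    calc min e (4 * (2 ^ n) ^ 2) * (2 : ℝ) ^ (-(n * θ)) ≤ e * 2 ^ (-(n * θ)) :=
          mul_le_mul_of_nonneg_right (min_le_left _ _) (by positivity)
      _ = e ^ (1 - θ / 2) * e ^ (θ / 2) * 2 ^ (-(n * θ)) := by
          rw [← Real.rpow_add he, sub_add_cancel, Real.rpow_one]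
      _ ≤ e ^ (1 - θ / 2) * (4 * 2 ^ (m * θ)) * 2 ^ (-(n * θ)) := by gcongr
      _ = 4 * e ^ (1 - θ / 2) * (2 ^ (m * θ) * 2 ^ (-(n * θ))) := by ring
      _ = _ := by rw [← Real.rpow_add two0]; ring_nf
  · have hmn' : (n : ℝ) ≤ m := by exact_mod_cast hmn.le
    rw [abs_of_nonpos (by linarith)]
    have h2 : (2 : ℝ) ^ (m * (2 - θ)) ≤ e ^ (1 - θ / 2) := by
      calc (2 : ℝ) ^ (m * (2 - θ)) = ((2 : ℝ) ^ (2 * (m : ℝ))) ^ (1 - θ / 2) := by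
            rw [← Real.rpow_mul two0.le]; ring_nf
        _ ≤ _ := Real.rpow_le_rpow (by positivity) hm1 (by linarith)
    calc min e (4 * (2 ^ n) ^ 2) * (2 : ℝ) ^ (-(n * θ)) ≤ 4 * (2 ^ n) ^ 2 * 2 ^ (-(n * θ)) :=
          mul_le_mul_of_nonneg_right (min_le_right _ _) (by positivity)
      _ = 4 * (2 ^ (m * (2 - θ)) * 2 ^ ((2 - θ) * (n - m))) := by
          rw [hc2, ← Real.rpow_natCast, ← Real.rpow_mul two0.le, mul_assoc, ← Real.rpow_add two0,
            ← Real.rpow_add two0]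
          push_cast; ring_nf
      _ ≤ 4 * (e ^ (1 - θ / 2) * 2 ^ (-(θ * -((n : ℝ) - m)))) := by
          refine mul_le_mul_of_nonneg_left (mul_le_mul h2
            (Real.rpow_le_rpow_of_exponent_le one_le_two ?_) (by positivity) (by positivity))
            (by norm_num)
          nlinarith
      _ = _ := by ring

end mainsum

section iteration
open Classical
variable {A : ℝ} {φ : Tile → ℝ → ℂ} {md : ℝ → ℝ → ℂ} {ker : ℤ → ℝ → ℝ → ℂ}
  {E : Set ℝ} {N : ℝ → ℝ} {w : ℝ → ℂ} {f : ℝ → ℂ} {T : Finset Tile}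

lemma Packets.steps (h : Packets A φ md ker) (hf : MemLp f 2) {F e τ : ℝ} (hF : 0 < F)
    (hfF : ∫ x, ‖f x‖ ^ 2 ≤ F) (hE : MeasurableSet E) (hEf : volume E ≠ ∞)
    (he : volume.real E = e) (he0 : 0 < e) (hN : Measurable N) (hw : Measurable w)
    (hw1 : ∀ x, ‖w x‖ ≤ 1) (hτ : 0 ≤ τ) (n : ℤ) (hT : SizeLe (pcoef φ f) T τ)
    (hT1 : SizeLe (pcoef φ f) T (√F * (2 ^ n)⁻¹)) (hT2 : MassLe E N T (e * ((2 ^ n) ^ 2)⁻¹))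
    (M : ℕ) :
    ∃ R ⊆ T, SizeLe (pcoef φ f) R (√F * (2 ^ (n + M))⁻¹) ∧
      MassLe E N R (e * ((2 ^ (n + M)) ^ 2)⁻¹) ∧
      ∑ P ∈ T, ‖pcoef φ f P‖ * ‖wcoef φ E N w P‖ ≤
        2 ^ 42 * A ^ 4 * ∑ k ∈ Finset.Ico n (n + M),
          (min (√F * (2 ^ k)⁻¹) τ * min e (4 * (2 ^ k) ^ 2)) +
          ∑ P ∈ R, ‖pcoef φ f P‖ * ‖wcoef φ E N w P‖ := by
  induction M with
  | zero => exact ⟨T, subset_rfl, by simpa using hT1, by simpa using hT2, by simp⟩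
  | succ M ih =>
    obtain ⟨R, hR, h1, h2, h3⟩ := ih
    obtain ⟨R', hR', h1', h2', h3'⟩ := h.step hf hF hfF hE hEf he he0 hN hw hw1 hτ
      (two_zpow_pos (n + M)) (hT.subset hR) h1 h2
    have e1 : (2 : ℝ) * 2 ^ (n + M) = 2 ^ (n + (M + 1 : ℕ)) := by
      rw [mul_comm, ← zpow_add_one₀ two_ne_zero]; push_cast; ring_nf
    rw [e1] at h1' h2'
    refine ⟨R', hR'.trans hR, h1', h2', h3.trans ?_⟩
    have e2 : Finset.Ico n (n + (M + 1 : ℕ)) = insert (n + M : ℤ) (Finset.Ico n (n + M)) := by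
      ext k; simp only [Finset.mem_Ico, Finset.mem_insert]; lia
    rw [e2, Finset.sum_insert (by simp)]
    linarith [h3']

/-- The model sum over tiles on which the coefficients have size at most `τ`. -/
lemma Packets.main_sum_le (h : Packets A φ md ker) (hf : MemLp f 2) {F e τ θ : ℝ} (hF : 0 < F)
    (hfF : ∫ x, ‖f x‖ ^ 2 ≤ F) (hE : MeasurableSet E) (hEf : volume E ≠ ∞)
    (he : volume.real E = e) (he0 : 0 < e) (hN : Measurable N) (hw : Measurable w)
    (hw1 : ∀ x, ‖w x‖ ≤ 1) (hτ : 0 ≤ τ) (hT : SizeLe (pcoef φ f) T τ) (h0 : 0 < θ)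
    (h1 : θ ≤ 1) :
    ∑ P ∈ T, ‖pcoef φ f P‖ * ‖wcoef φ E N w P‖ ≤
      2 ^ 45 * A ^ 4 * (1 - (2 : ℝ)⁻¹ ^ θ)⁻¹ * (F ^ (θ / 2) * τ ^ (1 - θ) * e ^ (1 - θ / 2)) := by
  have hF' := Real.sqrt_pos.2 hF
  have hA := h.one_le
  set q : ℝ := (2 : ℝ)⁻¹ ^ θ
  have hq0 : 0 ≤ q := by positivity
  have hq1 : q < 1 := Real.rpow_lt_one (by norm_num) (by norm_num) h0
  obtain ⟨n0, hn1, hn2⟩ : ∃ n : ℤ, (2 : ℝ) ^ n * τ ≤ √F ∧ 4 * ((2 : ℝ) ^ n) ^ 2 ≤ e := by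
    obtain ⟨k, hk⟩ := exists_pow_lt_of_lt_one
      (lt_min (div_pos hF' (by linarith : 0 < τ + 1)) (lt_min one_pos (by linarith : 0 < e / 4)))
      (by norm_num : (2 : ℝ)⁻¹ < 1)
    have e0 : (2 : ℝ) ^ (-(k : ℤ)) = 2⁻¹ ^ k := by simp
    have a1 := hk.trans_le (min_le_left _ _)
    have a2 := hk.trans_le ((min_le_right _ _).trans (min_le_left _ _))
    have a3 := hk.trans_le ((min_le_right _ _).trans (min_le_right _ _))
    have a0 : 0 < (2 : ℝ)⁻¹ ^ k := by positivity
    refine ⟨-k, ?_, ?_⟩ <;> rw [e0]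
    · rw [lt_div_iff₀ (by linarith)] at a1; nlinarith
    · nlinarith
  have hs1 : SizeLe (pcoef φ f) T (√F * (2 ^ n0)⁻¹) :=
    hT.mono hτ (by rw [← div_eq_mul_inv, le_div_iff₀ (two_zpow_pos _)]; linarith)
  have hs2 : MassLe E N T (e * ((2 ^ n0) ^ 2)⁻¹) := fun P _ Q _ _ => (dens_le_four E N Q).trans
    (by rw [← div_eq_mul_inv, le_div_iff₀ (pow_pos (two_zpow_pos _) 2)]; linarith)
  obtain ⟨m, hm⟩ := exists_min_mul_le he0 h0.le h1
  set B : ℝ := 2 ^ 45 * A ^ 4 * (1 - q)⁻¹ * (F ^ (θ / 2) * τ ^ (1 - θ) * e ^ (1 - θ / 2))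
  set W := ∑ P ∈ T, ‖wcoef φ E N w P‖
  have key : ∀ M : ℕ, ∑ P ∈ T, ‖pcoef φ f P‖ * ‖wcoef φ E N w P‖ ≤
      B + √F * (2 ^ n0)⁻¹ * W * 2⁻¹ ^ M := fun M => by
    obtain ⟨R, hR, g1, -, g3⟩ := h.steps hf hF hfF hE hEf he he0 hN hw hw1 hτ n0 hT hs1 hs2 M
    refine g3.trans (add_le_add ?_ ?_)
    · calc 2 ^ 42 * A ^ 4 * ∑ k ∈ Finset.Ico n0 (n0 + M),
              (min (√F * (2 ^ k)⁻¹) τ * min e (4 * (2 ^ k) ^ 2))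
          ≤ 2 ^ 42 * A ^ 4 * ∑ k ∈ Finset.Ico n0 (n0 + M),
              F ^ (θ / 2) * τ ^ (1 - θ) * (4 * e ^ (1 - θ / 2)) * q ^ (k - m).natAbs := by
            refine mul_le_mul_of_nonneg_left (Finset.sum_le_sum fun k _ => ?_) (by positivity)
            have hk := two_zpow_pos k
            have b1 := min_le_rpow_mul (a := √F * (2 ^ k)⁻¹) (b := τ) (by positivity) hτ h0.le h1
            have b2 : (√F * (2 ^ k)⁻¹) ^ θ = F ^ (θ / 2) * ((2 ^ k)⁻¹) ^ θ := by
              rw [Real.mul_rpow hF'.le (by positivity), Real.sqrt_eq_rpow, ← Real.rpow_mul hF.le]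
              ring_nf
            rw [b2] at b1
            calc _ ≤ F ^ (θ / 2) * ((2 ^ k)⁻¹) ^ θ * τ ^ (1 - θ) * min e (4 * (2 ^ k) ^ 2) :=
                  mul_le_mul_of_nonneg_right b1 (le_min he0.le (by positivity))
              _ = F ^ (θ / 2) * τ ^ (1 - θ) * (min e (4 * (2 ^ k) ^ 2) * ((2 ^ k)⁻¹) ^ θ) := by ring
              _ ≤ F ^ (θ / 2) * τ ^ (1 - θ) * (4 * e ^ (1 - θ / 2) * q ^ (k - m).natAbs) :=
                  mul_le_mul_of_nonneg_left (hm k) (by positivity)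
              _ = _ := by ring
        _ ≤ 2 ^ 42 * A ^ 4 * (F ^ (θ / 2) * τ ^ (1 - θ) * (4 * e ^ (1 - θ / 2)) *
              (2 * (1 - q)⁻¹)) := by
            rw [← Finset.mul_sum]
            exact mul_le_mul_of_nonneg_left (mul_le_mul_of_nonneg_left
              (sum_pow_natAbs_le hq0 hq1 m _) (by positivity)) (by positivity)
        _ = B := by ring
    · have hσ : 0 ≤ √F * ((2 : ℝ) ^ (n0 + M))⁻¹ := by positivity
      calc _ ≤ ∑ P ∈ R, √F * ((2 : ℝ) ^ (n0 + M))⁻¹ * ‖wcoef φ E N w P‖ :=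
            Finset.sum_le_sum fun P hP =>
              mul_le_mul_of_nonneg_right (g1.norm_le hσ hP) (norm_nonneg _)
        _ ≤ √F * ((2 : ℝ) ^ (n0 + M))⁻¹ * W := by
            rw [← Finset.mul_sum]
            exact mul_le_mul_of_nonneg_left
              (Finset.sum_le_sum_of_subset_of_nonneg hR fun _ _ _ => norm_nonneg _) hσ
        _ = _ := by
            rw [zpow_add₀ two_ne_zero, zpow_natCast, mul_inv, inv_pow]; ring
  have hlim : Filter.Tendsto (fun M : ℕ => B + √F * (2 ^ n0)⁻¹ * W * (2 : ℝ)⁻¹ ^ M)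
      Filter.atTop (nhds (B + √F * (2 ^ n0)⁻¹ * W * 0)) :=
    tendsto_const_nhds.add ((tendsto_pow_atTop_nhds_zero_of_lt_one (by norm_num)
      (by norm_num)).const_mul _)
  rw [mul_zero, add_zero] at hlim
  exact ge_of_tendsto' hlim key

end iteration

section exceptional
open Metric

/-- The set where the maximal average of the indicator of `G` exceeds `κ`. -/
def exSet (G : Set ℝ) (κ : ℝ) : Set ℝ :=
  ⋃ b ∈ {b : ℝ × ℝ | 0 < b.2 ∧ κ * b.2 < volume.real (G ∩ ball b.1 b.2)}, ball b.1 b.2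

lemma isOpen_exSet (G : Set ℝ) (κ : ℝ) : IsOpen (exSet G κ) :=
  isOpen_biUnion fun _ _ => isOpen_ball

lemma ball_subset_exSet {G : Set ℝ} {κ y R : ℝ} (hR : 0 < R)
    (h : κ * R < volume.real (G ∩ ball y R)) : ball y R ⊆ exSet G κ :=
  subset_biUnion_of_mem (u := fun b : ℝ × ℝ => ball b.1 b.2)
    (show (y, R) ∈ {b : ℝ × ℝ | 0 < b.2 ∧ κ * b.2 < volume.real (G ∩ ball b.1 b.2)} from ⟨hR, h⟩)

lemma volume_exSet_le {G : Set ℝ} (hG : MeasurableSet G) (hGf : volume G ≠ ∞) {κ : ℝ}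
    (hκ : 0 < κ) : volume (exSet G κ) ≤ ENNReal.ofReal (10 * κ⁻¹ * volume.real G) := by
  set t : Set (ℝ × ℝ) := {b | 0 < b.2 ∧ κ * b.2 < volume.real (G ∩ ball b.1 b.2)}
  have ht : ∀ b ∈ t, 0 < b.2 ∧ κ * b.2 < volume.real (G ∩ ball b.1 b.2) := fun b hb => hb
  have hr : ∀ b ∈ t, b.2 ≤ κ⁻¹ * volume.real G := fun b hb => by
    rw [inv_mul_eq_div, le_div_iff₀ hκ, mul_comm]
    exact (ht b hb).2.le.trans (measureReal_mono inter_subset_left hGf)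
  obtain ⟨s, hst, hd, hcov⟩ := Vitali.exists_disjoint_subfamily_covering_enlargement_closedBall t
    Prod.fst Prod.snd _ hr 5 (by norm_num)
  have hsc : s.Countable := hd.countable_of_nonempty_interior fun b hb => by
    rw [interior_closedBall _ (ht b (hst hb)).1.ne']
    exact nonempty_ball.2 (ht b (hst hb)).1
  have hsub : exSet G κ ⊆ ⋃ b ∈ s, closedBall b.1 (5 * b.2) := by
    refine iUnion₂_subset fun a ha => ?_
    obtain ⟨b, hb, hab⟩ := hcov a ha
    exact (ball_subset_closedBall.trans hab).trans
      (subset_biUnion_of_mem (u := fun b : ℝ × ℝ => closedBall b.1 (5 * b.2)) hb)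
  have hone : ∀ b ∈ s, volume (closedBall b.1 (5 * b.2)) ≤
      ENNReal.ofReal (10 * κ⁻¹) * volume (G ∩ closedBall b.1 b.2) := fun b hb => by
    obtain ⟨h1, h2⟩ := ht b (hst hb)
    have hfin : volume (G ∩ closedBall b.1 b.2) ≠ ∞ := measure_ne_top_of_subset inter_subset_left hGf
    rw [Real.volume_closedBall, ← ofReal_measureReal hfin, ← ENNReal.ofReal_mul (by positivity)]
    refine ENNReal.ofReal_le_ofReal ?_
    have h3 := h2.le.trans (measureReal_mono
      (inter_subset_inter_right G (ball_subset_closedBall (x := b.1) (ε := b.2))) hfin)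
    calc 2 * (5 * b.2) = 10 * κ⁻¹ * (κ * b.2) := by field_simp; ring
      _ ≤ _ := mul_le_mul_of_nonneg_left h3 (by positivity)
  calc volume (exSet G κ) ≤ volume (⋃ b ∈ s, closedBall b.1 (5 * b.2)) := measure_mono hsub
    _ ≤ ∑' b : s, volume (closedBall (b : ℝ × ℝ).1 (5 * (b : ℝ × ℝ).2)) :=
        measure_biUnion_le _ hsc _
    _ ≤ ∑' b : s, ENNReal.ofReal (10 * κ⁻¹) * volume (G ∩ closedBall (b : ℝ × ℝ).1 (b : ℝ × ℝ).2) :=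
        ENNReal.tsum_le_tsum fun b => hone b b.2
    _ = ENNReal.ofReal (10 * κ⁻¹) * volume (⋃ b ∈ s, G ∩ closedBall b.1 b.2) := by
        rw [ENNReal.tsum_mul_left, measure_biUnion hsc
          (fun a ha b hb hab => (hd ha hb hab).mono inter_subset_right inter_subset_right)
          fun b _ => hG.inter measurableSet_closedBall]
    _ ≤ ENNReal.ofReal (10 * κ⁻¹) * volume G := mul_le_mul_right
        (measure_mono (iUnion₂_subset fun _ _ => inter_subset_left)) _
    _ = _ := by rw [ENNReal.ofReal_mul (p := 10 * κ⁻¹) (by positivity), ofReal_measureReal hGf]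

variable {f : ℝ → ℂ} {G : Set ℝ}

lemma setIntegral_norm_le_measureReal (hG : MeasurableSet G) (hGf : volume G ≠ ∞)
    (hfG : ∀ x, ‖f x‖ ≤ G.indicator 1 x) {s : Set ℝ} :
    ∫ x in s, ‖f x‖ ≤ volume.real (G ∩ s) := by
  have hi : Integrable (G.indicator (1 : ℝ → ℝ)) := by
    rw [integrable_indicator_iff hG]; exact integrableOn_const (by simpa using hGf)
  calc ∫ x in s, ‖f x‖ ≤ ∫ x in s, G.indicator (1 : ℝ → ℝ) x :=
        integral_mono_of_nonneg (.of_forall fun _ => norm_nonneg _) hi.integrableOn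
          (.of_forall hfG)
    _ = volume.real (G ∩ s) := by
        rw [integral_indicator_one hG, measureReal_restrict_apply hG]

lemma setIntegral_ball_le_of_notMem_exSet (hG : MeasurableSet G) (hGf : volume G ≠ ∞)
    (hfG : ∀ x, ‖f x‖ ≤ G.indicator 1 x) {κ y R : ℝ} (hy : y ∉ exSet G κ) (hR : 0 < R) :
    ∫ x in ball y R, ‖f x‖ ≤ κ * R := by
  refine (setIntegral_norm_le_measureReal hG hGf hfG).trans ?_
  by_contra! h
  exact hy (ball_subset_exSet hR h (mem_ball_self hR))

lemma ball_subset_exSet_of_not_lightTile (hG : MeasurableSet G) (hGf : volume G ≠ ∞)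
    (hfG : ∀ x, ‖f x‖ ≤ G.indicator 1 x) {κ : ℝ} {P : Tile} (hP : ¬LightTile f (2 * κ) P) :
    ball (tctr P) (2 * tlen P) ⊆ exSet G κ := by
  unfold LightTile at hP
  push Not at hP
  obtain ⟨j, hj⟩ := hP
  have hs := tlen_pos P
  have h2 : (1 : ℝ) ≤ 2 ^ j := one_le_pow₀ one_le_two
  have h1 := setIntegral_norm_le_measureReal (s := {x | |x - tctr P| ≤ 2 ^ j * tlen P}) hG hGf hfG
  have hsub : {x | |x - tctr P| ≤ 2 ^ j * tlen P} ⊆ ball (tctr P) (2 * (2 ^ j * tlen P)) := by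
    intro x hx
    have hx' : |x - tctr P| ≤ 2 ^ j * tlen P := hx
    rw [mem_ball, Real.dist_eq]
    nlinarith [mul_pos (pow_pos two_pos j : (0 : ℝ) < 2 ^ j) hs]
  refine (ball_subset_ball (by nlinarith)).trans (ball_subset_exSet (R := 2 * (2 ^ j * tlen P))
    (by positivity) ?_)
  have h3 := measureReal_mono (inter_subset_inter_right G hsub)
    (measure_ne_top_of_subset inter_subset_left hGf)
  linarith

lemma lightTile_two (hG : MeasurableSet G) (hGf : volume G ≠ ∞)
    (hfG : ∀ x, ‖f x‖ ≤ G.indicator 1 x) (P : Tile) : LightTile f 2 P := fun j => by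
  have hs := tlen_pos P
  refine (setIntegral_norm_le_measureReal hG hGf hfG).trans ?_
  have : {x | |x - tctr P| ≤ 2 ^ j * tlen P} = closedBall (tctr P) (2 ^ j * tlen P) := by
    ext x; simp [Real.dist_eq]
  rw [this]
  refine (measureReal_mono inter_subset_right measure_closedBall_lt_top.ne).trans ?_
  rw [Real.volume_real_closedBall (by positivity)]

end exceptional

section restricted
open Classical Metric
variable {A : ℝ} {φ : Tile → ℝ → ℂ} {md : ℝ → ℝ → ℂ} {ker : ℤ → ℝ → ℝ → ℂ}
  {E G : Set ℝ} {N : ℝ → ℝ} {w : ℝ → ℂ} {f : ℝ → ℂ} {T : Finset Tile}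

lemma integral_norm_sq_le_measureReal (hG : MeasurableSet G) (hGf : volume G ≠ ∞)
    (hfG : ∀ x, ‖f x‖ ≤ G.indicator 1 x) : ∫ x, ‖f x‖ ^ 2 ≤ volume.real G := by
  have hi : Integrable (G.indicator (1 : ℝ → ℝ)) := by
    rw [integrable_indicator_iff hG]; exact integrableOn_const (by simpa using hGf)
  calc ∫ x, ‖f x‖ ^ 2 ≤ ∫ x, G.indicator (1 : ℝ → ℝ) x := by
        refine integral_mono_of_nonneg (.of_forall fun _ => by positivity) hi
          (.of_forall fun x => ?_)
        have h0 := norm_nonneg (f x)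
        have h1 := hfG x
        by_cases hx : x ∈ G
        · simp only [indicator_of_mem hx, Pi.one_apply] at h1 ⊢; nlinarith
        · simp only [indicator_of_notMem hx] at h1 ⊢; nlinarith
    _ = volume.real G := integral_indicator_one hG

lemma memLp_of_norm_le_indicator (hf : Measurable f) (hG : MeasurableSet G) (hGf : volume G ≠ ∞)
    (hfG : ∀ x, ‖f x‖ ≤ G.indicator 1 x) (p : ℝ≥0∞) : MemLp f p :=
  (memLp_indicator_const p hG (1 : ℝ) (Or.inr hGf)).mono hf.aestronglyMeasurable
    (.of_forall fun x => (hfG x).trans (le_abs_self _))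

/-- The model sum is controlled after splitting off tiles near an exceptional set. -/
lemma Packets.split_sum_le (h : Packets A φ md ker) (hf : Measurable f) (hG : MeasurableSet G)
    (hGf : volume G ≠ ∞) (hfG : ∀ x, ‖f x‖ ≤ G.indicator 1 x) (hE : MeasurableSet E)
    (hEf : volume E ≠ ∞) (hN : Measurable N) (hw : Measurable w) (hw1 : ∀ x, ‖w x‖ ≤ 1)
    {κ : ℝ} (hκ : 0 < κ) (hd : Disjoint E (exSet G κ)) (hg0 : 0 < volume.real G)
    (he0 : 0 < volume.real E) {θ : ℝ} (h0 : 0 < θ) (h1 : θ ≤ 1) :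
    ∑ P ∈ T, ‖pcoef φ f P‖ * ‖wcoef φ E N w P‖ ≤
      2 ^ 45 * A ^ 4 * (1 - (2 : ℝ)⁻¹ ^ θ)⁻¹ * (volume.real G ^ (θ / 2) *
        (2 ^ 14 * A * (2 * κ)) ^ (1 - θ) * volume.real E ^ (1 - θ / 2)) +
      9600 * A ^ 2 * volume.real G := by
  have hA := h.one_le
  have hfi : Integrable f := memLp_one_iff_integrable.1
    (memLp_of_norm_le_indicator hf hG hGf hfG 1)
  rw [← Finset.sum_filter_add_sum_filter_not T (fun P => LightTile f (2 * κ) P)]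
  have hvol := volume_exSet_le hG hGf hκ
  refine add_le_add ?_ ?_
  · exact h.main_sum_le (memLp_of_norm_le_indicator hf hG hGf hfG 2) hg0
      (integral_norm_sq_le_measureReal hG hGf hfG) hE hEf rfl he0 hN hw hw1 (by positivity)
      (h.sizeLe_of_light hf hfi (by positivity) fun P hP => (Finset.mem_filter.1 hP).2) h0 h1
  · refine (h.bad_sum_le hfi hκ.le hE hN hw1 (isOpen_exSet G κ).measurableSet
      (ne_top_of_le_ne_top ENNReal.ofReal_ne_top hvol) hd
      (fun y hy R hR => setIntegral_ball_le_of_notMem_exSet hG hGf hfG hy hR) fun P hP =>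
      ball_subset_exSet_of_not_lightTile hG hGf hfG (Finset.mem_filter.1 hP).2).trans ?_
    have : volume.real (exSet G κ) ≤ 10 * κ⁻¹ * volume.real G :=
      ENNReal.toReal_le_of_le_ofReal (by positivity) hvol
    calc 960 * A ^ 2 * κ * volume.real (exSet G κ)
        ≤ 960 * A ^ 2 * κ * (10 * κ⁻¹ * volume.real G) :=
          mul_le_mul_of_nonneg_left this (by positivity)
      _ = _ := by field_simp; ring

/-- Restricted weak type bound for the model sum. -/
theorem exists_restricted_bound {A p : ℝ} (hA : 1 ≤ A) (hp : 1 < p) :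
    ∃ C : ℝ, 0 < C ∧ ∀ G E : Set ℝ, MeasurableSet G → volume G ≠ ∞ → MeasurableSet E →
      volume E ≠ ∞ → ∃ E' ⊆ E, MeasurableSet E' ∧ volume.real E ≤ 2 * volume.real E' ∧
        ∀ (φ : Tile → ℝ → ℂ) (md : ℝ → ℝ → ℂ) (ker : ℤ → ℝ → ℝ → ℂ), Packets A φ md ker →
        ∀ (f : ℝ → ℂ) (N : ℝ → ℝ) (w : ℝ → ℂ) (T : Finset Tile), Measurable f →
          (∀ x, ‖f x‖ ≤ G.indicator 1 x) → Measurable N → Measurable w → (∀ x, ‖w x‖ ≤ 1) →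
          ∑ P ∈ T, ‖pcoef φ f P‖ * ‖wcoef φ E' N w P‖ ≤
            C * (volume.real G ^ (1 / p) * volume.real E ^ (1 - 1 / p)) := by
  have hp0 : 0 < 1 / p := by positivity
  have hp1 : 1 / p < 1 := by rw [div_lt_one (by linarith)]; exact hp
  have hq : ∀ θ : ℝ, 0 < θ → 0 < (1 - (2 : ℝ)⁻¹ ^ θ)⁻¹ := fun θ hθ =>
    inv_pos.2 (sub_pos.2 (Real.rpow_lt_one (by norm_num) (by norm_num) hθ))
  set Q : ℝ := (1 - (2 : ℝ)⁻¹ ^ (1 / p))⁻¹ + (1 - (2 : ℝ)⁻¹ ^ (1 - 1 / p))⁻¹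
  have hQ1 : (1 - (2 : ℝ)⁻¹ ^ (1 / p))⁻¹ ≤ Q := le_add_of_nonneg_right (hq _ (by linarith)).le
  have hQ2 : (1 - (2 : ℝ)⁻¹ ^ (1 - 1 / p))⁻¹ ≤ Q := le_add_of_nonneg_left (hq _ hp0).le
  have hQ : 0 < Q := (hq _ hp0).trans_le hQ1
  have hA0 : 0 < A := by linarith
  refine ⟨2 ^ 45 * A ^ 4 * Q * (2 ^ 14 * A * 40) + 9600 * A ^ 2, by positivity,
    fun G E hG hGf hE hEf => ?_⟩
  set g := volume.real G with hg
  set e := volume.real E with he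
  have hg0 : 0 ≤ g := measureReal_nonneg
  have he0 : 0 ≤ e := measureReal_nonneg
  rcases he0.eq_or_lt with he1 | he1
  · refine ⟨∅, empty_subset _, .empty, by simp [← he1], ?_⟩
    intro φ md ker h f N w T _ _ _ _ _
    have : ∀ P, wcoef φ ∅ N w P = 0 := fun P => by simp [wcoef]
    simp only [this, norm_zero, mul_zero, Finset.sum_const_zero]
    positivity
  rcases hg0.eq_or_lt with hg1 | hg1
  · refine ⟨E, subset_rfl, hE, by linarith, ?_⟩
    intro φ md ker h f N w T hf hfG _ _ _
    have hz : f =ᵐ[volume] 0 := by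
      have h0 : volume G = 0 := by
        rw [← ofReal_measureReal hGf, ← hg, ← hg1, ENNReal.ofReal_zero]
      filter_upwards [measure_eq_zero_iff_ae_notMem.1 h0] with x hx
      have := hfG x
      rw [indicator_of_notMem hx] at this
      simpa using this
    have : ∀ P, pcoef φ f P = 0 := fun P => by
      rw [pcoef, integral_eq_zero_of_ae, mul_zero]
      filter_upwards [hz] with x hx
      simp [hx]
    simp only [this, norm_zero, zero_mul, Finset.sum_const_zero]
    positivity
  have hr0 : 0 < g / e := by positivity
  have hge : ∀ s : ℝ, g ^ s * e ^ (1 - s) = e * (g / e) ^ s := fun s => by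
    rw [Real.div_rpow hg0 he0, Real.rpow_sub he1, Real.rpow_one]; ring
  have hmul : 0 ≤ 2 ^ 45 * A ^ 4 := by positivity
  have hfin : ∀ X Y Z : ℝ, 0 ≤ Z → X ≤ 2 ^ 45 * A ^ 4 * Q * (2 ^ 14 * A * 40) * Z →
      Y ≤ 9600 * A ^ 2 * Z → X + Y ≤ (2 ^ 45 * A ^ 4 * Q * (2 ^ 14 * A * 40) + 9600 * A ^ 2) * Z :=
    fun X Y Z _ h1 h2 => by linarith
  rcases le_total e g with hc | hc
  · refine ⟨E, subset_rfl, hE, by linarith, ?_⟩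
    intro φ md ker h f N w T hf hfG hN hw hw1
    have hr1 : 1 ≤ g / e := (one_le_div he1).2 hc
    have hb := h.main_sum_le (T := T) (θ := 1 / p) (memLp_of_norm_le_indicator hf hG hGf hfG 2) hg1
      (integral_norm_sq_le_measureReal hG hGf hfG) hE hEf rfl he1 hN hw hw1 (by positivity)
      (h.sizeLe_of_light hf (memLp_one_iff_integrable.1
        (memLp_of_norm_le_indicator hf hG hGf hfG 1)) zero_le_two fun P _ =>
          lightTile_two hG hGf hfG P) hp0 hp1.le
    refine hb.trans ((add_zero _).symm.le.trans (hfin _ _ _ (by positivity) ?_ (by positivity)))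
    rw [mul_right_comm (g ^ _), hge, hge]
    have e1 : (g / e) ^ (1 / p / 2) ≤ (g / e) ^ (1 / p) :=
      Real.rpow_le_rpow_of_exponent_le hr1 (by linarith)
    have e2 : (2 ^ 14 * A * 2) ^ (1 - 1 / p) ≤ 2 ^ 14 * A * 40 := by
      calc _ ≤ (2 ^ 14 * A * 2) ^ (1 : ℝ) :=
            Real.rpow_le_rpow_of_exponent_le (by linarith) (by linarith)
        _ ≤ _ := by rw [Real.rpow_one]; linarith
    calc _ ≤ 2 ^ 45 * A ^ 4 * Q * (e * (g / e) ^ (1 / p) * (2 ^ 14 * A * 40)) := by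
          refine mul_le_mul (mul_le_mul_of_nonneg_left hQ1 hmul) (mul_le_mul
            (mul_le_mul_of_nonneg_left e1 he0) e2 (by positivity) (by positivity))
            (by positivity) (by positivity)
      _ = _ := by ring
  · set κ : ℝ := 20 * (g / e)
    have hκ : 0 < κ := by positivity
    have hO : MeasurableSet (exSet G κ) := (isOpen_exSet G κ).measurableSet
    have hvol : volume.real (exSet G κ) ≤ e / 2 := by
      refine ENNReal.toReal_le_of_le_ofReal (by positivity)
        ((volume_exSet_le hG hGf hκ).trans_eq ?_)
      congr 1
      simp only [κ, ← hg]
      field_simp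
      norm_num
    have hE' : e ≤ 2 * volume.real (E \ exSet G κ) := by
      have := measureReal_inter_add_sdiff (μ := volume) (s := E) hO (h := hEf)
      have h2 : volume.real (E ∩ exSet G κ) ≤ volume.real (exSet G κ) :=
        measureReal_mono inter_subset_right
          (ne_top_of_le_ne_top ENNReal.ofReal_ne_top (volume_exSet_le hG hGf hκ))
      linarith
    refine ⟨E \ exSet G κ, sdiff_subset, hE.diff hO, hE', ?_⟩
    intro φ md ker h f N w T hf hfG hN hw hw1
    have hr1 : g / e ≤ 1 := (div_le_one he1).2 hc
    set θ := 1 - 1 / p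
    have hθ0 : 0 < θ := by simp only [θ]; linarith
    have hθ1 : θ ≤ 1 := by simp only [θ]; linarith
    have hE'f : volume (E \ exSet G κ) ≠ ∞ := measure_ne_top_of_subset sdiff_subset hEf
    have hle : volume.real (E \ exSet G κ) ≤ e := measureReal_mono sdiff_subset hEf
    refine (h.split_sum_le (T := T) (θ := θ) hf hG hGf hfG (hE.diff hO) hE'f hN hw hw1 hκ
      disjoint_sdiff_left hg1 (by linarith) hθ0 hθ1).trans (hfin _ _ _ (by positivity) ?_ ?_)
    · rw [hge]
      have e0 : volume.real (E \ exSet G κ) ^ (1 - θ / 2) ≤ e ^ (1 - θ / 2) :=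
        Real.rpow_le_rpow measureReal_nonneg hle (by linarith)
      have e1 : (2 ^ 14 * A * (2 * κ)) ^ (1 - θ) ≤ 2 ^ 14 * A * 40 * (g / e) ^ (1 - θ) := by
        rw [show 2 ^ 14 * A * (2 * κ) = 2 ^ 14 * A * 40 * (g / e) by simp only [κ]; ring,
          Real.mul_rpow (by positivity) hr0.le]
        refine mul_le_mul_of_nonneg_right ?_ (by positivity)
        calc _ ≤ (2 ^ 14 * A * 40) ^ (1 : ℝ) :=
              Real.rpow_le_rpow_of_exponent_le (by linarith) (by linarith)
          _ = _ := Real.rpow_one _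
      have e2 : (g / e) ^ (θ / 2) * (g / e) ^ (1 - θ) ≤ (g / e) ^ (1 / p) := by
        rw [← Real.rpow_add hr0]
        exact Real.rpow_le_rpow_of_exponent_ge hr0 hr1 (by simp only [θ]; linarith)
      calc _ ≤ 2 ^ 45 * A ^ 4 * Q * (g ^ (θ / 2) * (2 ^ 14 * A * 40 * (g / e) ^ (1 - θ)) *
              e ^ (1 - θ / 2)) := by
            have := measureReal_nonneg (μ := volume) (s := E \ exSet G κ)
            gcongr
        _ = 2 ^ 45 * A ^ 4 * Q * (2 ^ 14 * A * 40) * (g ^ (θ / 2) * e ^ (1 - θ / 2) *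
              (g / e) ^ (1 - θ)) := by ring
        _ ≤ _ := by
            rw [hge, mul_assoc e]
            exact mul_le_mul_of_nonneg_left (mul_le_mul_of_nonneg_left e2 he0) (by positivity)
    · rw [hge]
      refine mul_le_mul_of_nonneg_left ?_ (by positivity)
      calc g = e * (g / e) ^ (1 : ℝ) := by rw [Real.rpow_one]; field_simp
        _ ≤ _ := mul_le_mul_of_nonneg_left
          (Real.rpow_le_rpow_of_exponent_ge hr0 hr1 hp1.le) he0

end restricted

section echar

lemma eChar_add (s t x : ℝ) : eChar (s + t) x = eChar s x * eChar t x := by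
  rw [eChar, eChar, eChar, ← Complex.exp_add]; push_cast; ring_nf

lemma eChar_comm (s x : ℝ) : eChar s x = eChar x s := by
  rw [eChar, eChar]; ring_nf

lemma eChar_add_right (s x y : ℝ) : eChar s (x + y) = eChar s x * eChar s y := by
  rw [eChar_comm, eChar_add, eChar_comm x, eChar_comm y]

lemma eChar_zero_right (x : ℝ) : eChar x 0 = 1 := by simp [eChar]

lemma eChar_eq_of_mul_eq {s x t y : ℝ} (h : s * x = t * y) : eChar s x = eChar t y := by
  have h' : (s : ℂ) * x = t * y := by exact_mod_cast h
  rw [eChar, eChar, mul_assoc, h', ← mul_assoc]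

lemma eChar_eq_exp (s x : ℝ) : eChar s x = Complex.exp ((2 * Real.pi * (s * x) : ℝ) * Complex.I)
    := by
  rw [eChar]; push_cast; ring_nf

@[simp] lemma norm_eChar (s x : ℝ) : ‖eChar s x‖ = 1 := by
  rw [eChar_eq_exp, Complex.norm_exp_ofReal_mul_I]

lemma conj_eChar (s x : ℝ) : conj (eChar s x) = eChar (-s) x := by
  rw [eChar, eChar, ← Complex.exp_conj]; simp [Complex.conj_ofNat]

lemma continuous_eChar : Continuous fun p : ℝ × ℝ => eChar p.1 p.2 := by
  unfold eChar; fun_prop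

@[fun_prop]
lemma Continuous.eChar {X : Type*} [TopologicalSpace X] {f g : X → ℝ} (hf : Continuous f)
    (hg : Continuous g) : Continuous fun x => _root_.eChar (f x) (g x) :=
  continuous_eChar.comp (hf.prodMk hg)

@[fun_prop]
lemma Measurable.eChar {X : Type*} [MeasurableSpace X] {f g : X → ℝ} (hf : Measurable f)
    (hg : Measurable g) : Measurable fun x => _root_.eChar (f x) (g x) :=
  continuous_eChar.measurable.comp (hf.prodMk hg)

lemma norm_eChar_sub_le (t x z : ℝ) : ‖eChar t x - eChar t z‖ ≤ 2 * Real.pi * (|t| * |x - z|) := by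
  have h1 : eChar t x - eChar t z = (eChar t (x - z) - 1) * eChar t z := by
    rw [sub_mul, ← eChar_add_right, one_mul, sub_add_cancel]
  rw [h1, norm_mul, norm_eChar, mul_one, eChar_eq_exp, mul_comm _ Complex.I]
  refine Real.norm_exp_I_mul_ofReal_sub_one_le.trans ?_
  rw [Real.norm_eq_abs, abs_mul, abs_of_pos (by positivity : 0 < 2 * Real.pi), abs_mul]

end echar

/-- The inverse Fourier transform. -/
noncomputable def invF (B : ℝ → ℂ) (x : ℝ) : ℂ := ∫ ξ, B ξ * eChar ξ x

section schwartz
open FourierTransform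

lemma fourierT_eq_fourier (f : ℝ → ℂ) : fourierT f = 𝓕 f := by
  ext ξ
  rw [Real.fourier_eq', fourierT]
  congr 1
  ext x
  rw [eChar_eq_exp, smul_eq_mul, mul_comm]
  congr 3
  simp

lemma invF_eq_fourierInv (B : ℝ → ℂ) : invF B = 𝓕⁻ B := by
  ext x
  rw [Real.fourierInv_eq', invF]
  congr 1
  ext ξ
  rw [eChar_eq_exp, smul_eq_mul, mul_comm]
  congr 3
  simp [mul_comm]

lemma exists_norm_le_wt (f : SchwartzMap ℝ ℂ) (m : ℕ) :
    ∃ C : ℝ, 1 ≤ C ∧ ∀ x, ‖f x‖ ≤ C * wt 1 x ^ m := by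
  obtain ⟨D, hD⟩ : ∃ D : ℝ, ∀ x, (1 + ‖x‖) ^ m * ‖f x‖ ≤ D := ⟨_, fun x => by
    have h := SchwartzMap.one_add_le_sup_seminorm_apply (𝕜 := ℝ) (m := (m, 0)) le_rfl le_rfl f x
    rwa [norm_iteratedFDeriv_zero] at h⟩
  refine ⟨max 1 D, le_max_left _ _, fun x => ?_⟩
  have h := hD x
  have hp : 0 < (1 + ‖x‖) ^ m := by positivity
  rw [wt, ← Real.norm_eq_abs, div_pow, one_pow, mul_one_div, le_div_iff₀ hp, mul_comm]
  exact h.trans (le_max_right _ _)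

lemma wt_pow_le_of_abs_sub_le {s u v : ℝ} (hs : 0 < s) (h : |u - v| ≤ s) (m : ℕ) :
    wt s u ^ m ≤ 2 ^ m * wt s v ^ m := by
  rw [← mul_pow]
  refine pow_le_pow_left₀ (wt_nonneg hs) (wt_comp hs ?_) m
  have := abs_sub_abs_le_abs_sub v u
  rw [abs_sub_comm] at this
  have := abs_nonneg u
  linarith

/-- A profile with all the properties that the wave packets and kernels need. -/
lemma exists_profile (B : SchwartzMap ℝ ℂ) : ∃ C : ℝ, 1 ≤ C ∧ Continuous (invF B) ∧
    Integrable (invF B) ∧ (∀ u, ‖invF B u‖ ≤ C * wt 1 u ^ 10) ∧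
    (∀ u v, |u - v| ≤ 1 → ‖invF B u - invF B v‖ ≤ C * |u - v| * wt 1 v ^ 10) ∧
    ∀ σ, ∫ u, invF B u * eChar (-σ) u = B σ := by
  set b : SchwartzMap ℝ ℂ := 𝓕⁻ B
  have hb : invF B = b := by rw [invF_eq_fourierInv, SchwartzMap.fourierInv_coe]
  obtain ⟨C1, h1, hC1⟩ := exists_norm_le_wt b 10
  obtain ⟨C2, h2, hC2⟩ := exists_norm_le_wt (SchwartzMap.derivCLM ℝ ℂ b) 10
  have hC2p : 0 ≤ C2 := by linarith
  refine ⟨max C1 (C2 * 2 ^ 10), h1.trans (le_max_left _ _), ?_⟩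
  rw [hb]
  refine ⟨b.continuous, b.integrable, fun u => (hC1 u).trans
    (mul_le_mul_of_nonneg_right (le_max_left _ _) (pow_nonneg (wt_nonneg one_pos) _)), ?_, ?_⟩
  · intro u v huv
    have hd : ∀ x ∈ uIcc v u, ‖deriv b x‖ ≤ C2 * 2 ^ 10 * wt 1 v ^ 10 := fun x hx => by
      rw [mul_assoc]
      refine (hC2 x).trans (mul_le_mul_of_nonneg_left (wt_pow_le_of_abs_sub_le one_pos ?_ 10) hC2p)
      exact (abs_sub_left_of_mem_uIcc hx).trans (by rwa [abs_sub_comm] at huv ⊢)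
    have := Convex.norm_image_sub_le_of_norm_deriv_le (fun x _ => b.differentiableAt) hd
      (convex_uIcc v u) left_mem_uIcc right_mem_uIcc
    refine this.trans ?_
    rw [Real.norm_eq_abs, mul_right_comm]
    exact mul_le_mul_of_nonneg_right (mul_le_mul_of_nonneg_right (le_max_right _ _)
      (abs_nonneg _)) (pow_nonneg (wt_nonneg one_pos) _)
  · intro σ
    have : fourierT b σ = B σ := by
      rw [fourierT_eq_fourier, ← SchwartzMap.fourier_coe, FourierTransform.fourier_fourierInv_eq]
    exact this

lemma exists_bump (c r R : ℝ) (hr : 0 < r) (hR : r < R) : ∃ B : SchwartzMap ℝ ℂ, ∃ β : ℝ → ℝ,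
    (∀ x, B x = β x) ∧ (∀ x, 0 ≤ β x) ∧ (∀ x, |x - c| ≤ r → β x = 1) ∧
    (∀ x, R ≤ |x - c| → β x = 0) ∧ Continuous β := by
  let f : ContDiffBump c := ⟨r, R, hr, hR⟩
  have hf : HasCompactSupport fun x => (f x : ℂ) :=
    f.hasCompactSupport.comp_left (g := Complex.ofReal) Complex.ofReal_zero
  have hd : ContDiff ℝ (⊤ : ℕ∞) fun x => (f x : ℂ) :=
    Complex.ofRealCLM.contDiff.comp f.contDiff
  refine ⟨hf.toSchwartzMap hd, f, fun x => rfl, fun x => f.nonneg, fun x hx => ?_, fun x hx => ?_,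
    f.continuous⟩
  · exact f.one_of_mem_closedBall (Metric.mem_closedBall.2 ((Real.dist_eq x c).trans_le hx))
  · exact f.zero_of_le_dist (hx.trans_eq (Real.dist_eq x c).symm)

end schwartz

section transforms
variable {b ϑ : ℝ → ℂ} {B Θ : ℝ → ℂ}

/-- Fourier transform of a modulated, translated and dilated profile. -/
lemma integral_modulated (hB : ∀ σ, ∫ u, b u * eChar (-σ) u = B σ) {r : ℝ} (hr : 0 < r)
    (ω κ y : ℝ) : ∫ x, eChar ω (x - y) * b ((x - y) / r) * eChar (-κ) x =
      r * eChar (-κ) y * B (r * (κ - ω)) := by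
  have h1 : ∀ x, eChar ω (x - y) * b ((x - y) / r) * eChar (-κ) x =
      (fun z => eChar (-κ) y * (b (z / r) * eChar (-(r * (κ - ω))) (z / r))) (x - y) := fun x => by
    have e1 : eChar (-κ) x = eChar (-κ) (x - y) * eChar (-κ) y := by
      rw [← eChar_add_right, sub_add_cancel]
    have e2 : eChar (-(r * (κ - ω))) ((x - y) / r) = eChar ω (x - y) * eChar (-κ) (x - y) := by
      rw [← eChar_add]; exact eChar_eq_of_mul_eq (by field_simp; ring)
    simp only [e1, e2]; ring
  simp_rw [h1]
  rw [integral_sub_right_eq_self (fun z => eChar (-κ) y * (b (z / r) *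
    eChar (-(r * (κ - ω))) (z / r))), integral_const_mul,
    Measure.integral_comp_div (fun u => b u * eChar (-(r * (κ - ω))) u), hB, abs_of_pos hr,
    Complex.real_smul]
  ring

end transforms

/-- `b` is the inverse Fourier transform of `B`, with quantitative decay. -/
structure IsProfile (B b : ℝ → ℂ) (C : ℝ) : Prop where
  one_le : 1 ≤ C
  cont : Continuous b
  int : Integrable b
  decay : ∀ u, ‖b u‖ ≤ C * wt 1 u ^ 10
  lip : ∀ u v, |u - v| ≤ 1 → ‖b u - b v‖ ≤ C * |u - v| * wt 1 v ^ 10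
  transform : ∀ σ, ∫ u, b u * eChar (-σ) u = B σ
  intB : Integrable B
  inverse : ∀ u, b u = ∫ σ, B σ * eChar σ u

lemma exists_isProfile (B : SchwartzMap ℝ ℂ) : ∃ C, IsProfile B (invF B) C := by
  obtain ⟨C, h1, h2, h3, h4, h5, h6⟩ := exists_profile B
  exact ⟨C, h1, h2, h3, h4, h5, h6, B.integrable, fun u => rfl⟩

lemma IsProfile.mono {B b : ℝ → ℂ} {C C' : ℝ} (h : IsProfile B b C) (hC : C ≤ C') :
    IsProfile B b C' where
  one_le := h.one_le.trans hC
  cont := h.cont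
  int := h.int
  decay u := (h.decay u).trans
    (mul_le_mul_of_nonneg_right hC (pow_nonneg (wt_nonneg one_pos) _))
  lip u v huv := (h.lip u v huv).trans (mul_le_mul_of_nonneg_right
    (mul_le_mul_of_nonneg_right hC (abs_nonneg _)) (pow_nonneg (wt_nonneg one_pos) _))
  transform := h.transform
  intB := h.intB
  inverse := h.inverse

section modulated
variable {B b : ℝ → ℂ} {C r : ℝ}

/-- A translated, dilated and modulated profile. -/
noncomputable def modp (b : ℝ → ℂ) (ω y r x : ℝ) : ℂ := eChar ω (x - y) * b ((x - y) / r)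

lemma IsProfile.continuous_modp (h : IsProfile B b C) (ω y r : ℝ) :
    Continuous (modp b ω y r) := by
  have := h.cont
  unfold modp; fun_prop

lemma IsProfile.norm_modp_le (h : IsProfile B b C) (ω y r x : ℝ) : ‖modp b ω y r x‖ ≤ C := by
  rw [modp, norm_mul, norm_eChar, one_mul]
  refine (h.decay _).trans (mul_le_of_le_one_right (by linarith [h.one_le]) ?_)
  exact wt_pow_le_one one_pos

lemma IsProfile.integrable_modp (h : IsProfile B b C) (ω y : ℝ) (hr : 0 < r) :
    Integrable (modp b ω y r) := by
  have h1 : Integrable fun x => b ((x - y) / r) := (h.int.comp_div hr.ne').comp_sub_right y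
  exact h1.bdd_mul (c := 1) (f := fun x => eChar ω (x - y))
    (Continuous.aestronglyMeasurable (by fun_prop)) (.of_forall fun x => by simp)

lemma IsProfile.transform_modp (h : IsProfile B b C) (hr : 0 < r) (ω κ y : ℝ) :
    ∫ x, modp b ω y r x * eChar (-κ) x = r * eChar (-κ) y * B (r * (κ - ω)) :=
  integral_modulated h.transform hr ω κ y

lemma IsProfile.modp_eq (h : IsProfile B b C) (ω y r x : ℝ) :
    modp b ω y r x = ∫ σ, B σ * eChar (ω + σ / r) (x - y) := by
  rw [modp, h.inverse, ← integral_const_mul]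
  congr 1
  ext σ
  rw [eChar_add, eChar_eq_of_mul_eq (show σ / r * (x - y) = σ * ((x - y) / r) by ring)]
  ring

/-- Pairing of a profile with an integrable function, on the frequency side. -/
lemma IsProfile.integral_modp_mul (h : IsProfile B b C) {g : ℝ → ℂ} (hg : Integrable g)
    (ω y r : ℝ) : ∫ x, modp b ω y r x * g x =
      ∫ σ, B σ * ∫ x, g x * eChar (ω + σ / r) (x - y) := by
  have h1 : ∀ x, modp b ω y r x * g x = ∫ σ, B σ * g x * eChar (ω + σ / r) (x - y) := fun x => by
    rw [h.modp_eq, ← integral_mul_const]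
    congr 1; ext σ; ring
  simp_rw [h1, ← integral_const_mul]
  rw [integral_integral_swap]
  · congr 1; ext σ; congr 1; ext x; ring
  · have h2 : Integrable (fun p : ℝ × ℝ => B p.2 * g p.1) (volume.prod volume) := by
      refine (hg.mul_prod h.intB).congr (.of_forall fun p => mul_comm _ _)
    refine h2.mul_bdd (c := 1) (Continuous.aestronglyMeasurable ?_) (.of_forall fun p => ?_)
    · show Continuous fun p : ℝ × ℝ => eChar (ω + p.2 / r) (p.1 - y)
      fun_prop
    · simp

lemma IsProfile.integral_modp_conv (h : IsProfile B b C) {g : ℝ → ℂ} (hg : Integrable g)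
    (ω y r x : ℝ) : ∫ z, modp b ω y r z * g (x - z) =
      ∫ σ, B σ * (eChar (ω + σ / r) (x - y) * ∫ v, g v * eChar (-(ω + σ / r)) v) := by
  rw [h.integral_modp_mul (hg.comp_sub_left x)]
  congr 1; ext σ; congr 1
  rw [← integral_const_mul, ← integral_sub_left_eq_self _ volume x]
  congr 1; ext z
  have : eChar (ω + σ / r) (x - z - y) = eChar (ω + σ / r) (x - y) * eChar (-(ω + σ / r)) z := by
    rw [eChar_eq_of_mul_eq (show -(ω + σ / r) * z = (ω + σ / r) * (-z) by ring),
      ← eChar_add_right]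
    congr 1; ring
  rw [this, sub_sub_cancel]; ring

/-- Parseval's identity for profiles. -/
lemma IsProfile.integral_modp_mul_conj {B' b' : ℝ → ℂ} {C' : ℝ} (h : IsProfile B b C)
    (h' : IsProfile B' b' C') {r' : ℝ} (hr' : 0 < r') (ω y ω' y' : ℝ) :
    ∫ x, modp b ω y r x * conj (modp b' ω' y' r' x) =
      r' * ∫ σ, B σ * conj (B' (r' * (ω + σ / r - ω'))) * eChar (ω + σ / r) (y' - y) := by
  have hi : Integrable fun x => conj (modp b' ω' y' r' x) :=
    (Complex.conjCLE : ℂ →L[ℝ] ℂ).integrable_comp (h'.integrable_modp ω' y' hr')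
  rw [h.integral_modp_mul hi, ← integral_const_mul]
  congr 1; ext σ
  have h1 : ∀ x, conj (modp b' ω' y' r' x) * eChar (ω + σ / r) (x - y) =
      eChar (ω + σ / r) (-y) * conj (modp b' ω' y' r' x * eChar (-(ω + σ / r)) x) := fun x => by
    rw [map_mul, conj_eChar, neg_neg, sub_eq_add_neg, eChar_add_right]; ring
  simp_rw [h1]
  rw [integral_const_mul, integral_conj, h'.transform_modp hr', map_mul, map_mul, conj_eChar,
    neg_neg, Complex.conj_ofReal, sub_eq_add_neg y', eChar_add_right]
  ring

end modulated

section packets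

/-- Spatial center of a wave packet. -/
noncomputable def wpos (t : ℝ) (P : Tile) : ℝ := (P.2.1 + t) * 2 ^ P.1

/-- Base frequency of a wave packet. -/
noncomputable def wfreq (lam η : ℝ) (P : Tile) : ℝ := (P.2.2 * 2 ^ (-P.1) + η) / lam

/-- The wave packets. -/
noncomputable def wpk (b : ℝ → ℂ) (lam η t : ℝ) (P : Tile) : ℝ → ℂ :=
  modp b (wfreq lam η P) (wpos t P) (lam * 2 ^ P.1)

/-- Modulations adapted to the frequency of a tree. -/
noncomputable def wmd (lam η ξ : ℝ) (x : ℝ) : ℂ := eChar (-((ξ + η) / lam)) x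

/-- Reproducing kernels. -/
noncomputable def wker (ϑ : ℝ → ℂ) (lam η : ℝ) (j : ℤ) (ξ u : ℝ) : ℂ :=
  ((lam * 2 ^ j)⁻¹ : ℝ) * modp ϑ ((ξ + η) / lam) 0 (lam * 2 ^ j) u

variable {B b Θ ϑ : ℝ → ℂ} {C lam η t : ℝ}

lemma abs_wpos_sub_tctr_le (ht : t ∈ Icc (0 : ℝ) 1) (P : Tile) :
    |wpos t P - tctr P| ≤ tlen P / 2 := by
  have hs := two_zpow_pos P.1
  rw [wpos, tctr, tlen, ← sub_mul, abs_le]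
  constructor <;> nlinarith [ht.1, ht.2]

lemma wt_packet_le (hl1 : 1 ≤ lam) (hl2 : lam ≤ 2) (ht : t ∈ Icc (0 : ℝ) 1) (P : Tile) (x : ℝ) :
    wt 1 ((x - wpos t P) / (lam * 2 ^ P.1)) ≤ 2 * wt (tlen P) (x - tctr P) := by
  have hs := tlen_pos P
  have hl : 0 < lam := by linarith
  have e : wt 1 ((x - wpos t P) / (lam * 2 ^ P.1)) =
      wt (tlen P) ((x - wpos t P) / lam) := by
    change wt 1 ((x - wpos t P) / (lam * tlen P)) = _
    rw [wt, wt, abs_div, abs_div, abs_of_pos hl, abs_of_pos (mul_pos hl hs)]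
    field_simp
  rw [e]
  refine wt_comp hs ?_
  have h1 := abs_wpos_sub_tctr_le ht P
  have h2 : |x - tctr P| ≤ |x - wpos t P| + |wpos t P - tctr P| := abs_sub_le _ _ _
  have h3 : |x - wpos t P| / 2 ≤ |(x - wpos t P) / lam| := by
    rw [abs_div, abs_of_pos hl]
    exact div_le_div_of_nonneg_left (abs_nonneg _) hl hl2
  linarith

lemma IsProfile.integral_wker (h : IsProfile Θ ϑ C) (hl : 0 < lam) (j : ℤ) (ξ κ : ℝ) :
    ∫ v, wker ϑ lam η j ξ v * eChar (-κ) v = Θ (2 ^ j * (lam * κ - η - ξ)) := by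
  have hr : 0 < lam * (2 : ℝ) ^ j := by positivity
  have hr' : ((lam * (2 : ℝ) ^ j : ℝ) : ℂ) ≠ 0 := by exact_mod_cast hr.ne'
  simp_rw [wker, mul_assoc]
  rw [integral_const_mul, h.transform_modp hr, eChar_zero_right, mul_one, ← mul_assoc,
    ← Complex.ofReal_mul, inv_mul_cancel₀ hr.ne', Complex.ofReal_one, one_mul]
  congr 1
  field_simp
  ring

lemma wfreq_scale (hl : 0 < lam) (P : Tile) (σ : ℝ) :
    lam * (wfreq lam η P + σ / (lam * 2 ^ P.1)) - η = (P.2.2 + σ) * 2 ^ (-P.1) := by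
  have hs := two_zpow_pos P.1
  rw [wfreq, zpow_neg]; field_simp; ring

theorem packets_wpk (hb : IsProfile B b C) (hϑ : IsProfile Θ ϑ C)
    (hB : ∀ σ, B σ ≠ 0 → 1 / 8 < σ ∧ σ < 3 / 8) (hΘ1 : ∀ x, |x| ≤ 1 → Θ x = 1)
    (hΘ2 : ∀ x, 2 ≤ |x| → Θ x = 0) (hl1 : 1 ≤ lam) (hl2 : lam ≤ 2) (ht : t ∈ Icc (0 : ℝ) 1) :
    Packets (2 ^ 24 * C) (wpk b lam η t) (wmd lam η) (wker ϑ lam η) := by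
  have hC := hb.one_le
  have hl : 0 < lam := by linarith
  have hInt : ∀ j ξ, Integrable (wker ϑ lam η j ξ) := fun j ξ =>
    (hϑ.integrable_modp _ _ (by positivity)).const_mul _
  have hconv : ∀ (P : Tile) (ξ : ℝ) (j : ℤ) (x : ℝ),
      ∫ y, wpk b lam η t P y * wker ϑ lam η j ξ (x - y) = ∫ σ, B σ *
        (eChar (wfreq lam η P + σ / (lam * 2 ^ P.1)) (x - wpos t P) *
          Θ (2 ^ j * ((P.2.2 + σ) * 2 ^ (-P.1) - ξ))) := fun P ξ j x => by
    unfold wpk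
    rw [hb.integral_modp_conv (hInt j ξ)]
    congr 1; ext σ
    rw [hϑ.integral_wker hl, wfreq_scale hl]
  have hU : ∀ (P : Tile) (ξ : ℝ), ξ ∈ tU P → (P.2.2 + 1 / 2) * 2 ^ (-P.1) ≤ ξ ∧
      ξ < (P.2.2 + 1) * (2 : ℝ) ^ (-P.1) := fun P ξ hξ => by
    have h := mem_dy'.1 hξ
    rw [zpow_sub_one₀ two_ne_zero] at h
    push_cast at h
    constructor <;> nlinarith [h.1, h.2]
  refine ⟨by linarith, fun P => hb.continuous_modp _ _ _, fun P x => ?_, fun P Q hPQ => ?_,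
    fun ξ => ?_, fun ξ x => norm_eChar _ _, fun P ξ hξ x z hxz => ?_, fun j ξ => ?_,
    fun j ξ x => ?_, fun P ξ hξ j hj x => ?_, fun P ξ hξ j hj x => ?_⟩
  · have hw := wt_nonneg (u := x - tctr P) (tlen_pos P)
    rw [wpk, modp, norm_mul, norm_eChar, one_mul]
    calc _ ≤ C * wt 1 ((x - wpos t P) / (lam * 2 ^ P.1)) ^ 10 := hb.decay _
      _ ≤ C * (2 * wt (tlen P) (x - tctr P)) ^ 10 := mul_le_mul_of_nonneg_left
          (pow_le_pow_left₀ (wt_nonneg one_pos) (wt_packet_le hl1 hl2 ht P x) _) (by linarith)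
      _ ≤ _ := by
          rw [mul_pow, ← mul_assoc]
          exact mul_le_mul_of_nonneg_right (by linarith) (by positivity)
  · unfold wpk
    rw [hb.integral_modp_mul_conj hb (by positivity)]
    refine mul_eq_zero_of_right _ (integral_eq_zero_of_ae (.of_forall fun σ => ?_))
    have hsP := two_zpow_pos (-P.1)
    have hsQ := two_zpow_pos (-Q.1)
    by_cases h1 : B σ = 0
    · simp [h1]
    by_cases h2 : B (lam * 2 ^ Q.1 * (wfreq lam η P + σ / (lam * 2 ^ P.1) - wfreq lam η Q)) = 0
    · simp [h2]
    exfalso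
    have hP := hB _ h1
    have hQ := hB _ h2
    set ρ := lam * 2 ^ Q.1 * (wfreq lam η P + σ / (lam * 2 ^ P.1) - wfreq lam η Q)
    have e2 : ((P.2.2 : ℝ) + σ) * 2 ^ (-P.1) = (Q.2.2 + ρ) * (2 : ℝ) ^ (-Q.1) := by
      rw [← wfreq_scale hl (η := η) P σ, ← wfreq_scale hl (η := η) Q ρ]
      have := two_zpow_pos Q.1
      simp only [ρ]
      field_simp
      ring
    have hne : ((P.2.2 : ℝ) + σ) * 2 ^ (-P.1) ∈ tL P → _ ∉ tL Q := fun h => disjoint_left.1 hPQ h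
    refine hne ?_ ?_
    · refine mem_dy'.2 ?_
      rw [zpow_sub_one₀ two_ne_zero]; push_cast
      constructor <;> nlinarith [hP.1, hP.2]
    · rw [e2]
      refine mem_dy'.2 ?_
      rw [zpow_sub_one₀ two_ne_zero]; push_cast
      constructor <;> nlinarith [hQ.1, hQ.2]
  · unfold wmd; fun_prop
  · have hs := tlen_pos P
    obtain ⟨u1, u2⟩ := hU P ξ hξ
    set y := wpos t P
    set ω := wfreq lam η P
    set X := (x - y) / (lam * 2 ^ P.1)
    set Z := (z - y) / (lam * 2 ^ P.1)
    set δ := ω - (ξ + η) / lam with hδ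
    have hδ1 : |δ| ≤ (tlen P)⁻¹ := by
      have e : δ = (P.2.2 * 2 ^ (-P.1) - ξ) / lam := by
        simp only [hδ, ω, wfreq]; field_simp; ring
      rw [e, abs_div, abs_of_pos hl, tlen, ← zpow_neg]
      have hsP := two_zpow_pos (-P.1)
      refine (div_le_self (abs_nonneg _) hl1).trans ?_
      rw [abs_le]; constructor <;> nlinarith
    have hXZ : |X - Z| ≤ |x - z| / tlen P := by
      have e : X - Z = (x - z) / (lam * tlen P) := by
        simp only [X, Z, tlen]; rw [← sub_div]; congr 1; ring
      rw [e, abs_div, abs_of_pos (mul_pos hl hs)]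
      exact div_le_div_of_nonneg_left (abs_nonneg _) hs (le_mul_of_one_le_left hs.le hl1)
    have hXZ1 : |X - Z| ≤ 1 := hXZ.trans ((div_le_one hs).2 hxz)
    have hm : ∀ w, wmd lam η ξ w * wpk b lam η t P w =
        eChar (-ω) y * (eChar δ w * b ((w - y) / (lam * 2 ^ P.1))) := fun w => by
      have : eChar (-((ξ + η) / lam)) w * eChar ω (w - y) = eChar (-ω) y * eChar δ w := by
        rw [hδ, sub_eq_add_neg ω, eChar_add, sub_eq_add_neg w, eChar_add_right,
          eChar_eq_of_mul_eq (show ω * -y = -ω * y by ring)]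
        ring
      rw [wmd, wpk, modp, ← mul_assoc, this]; ring
    rw [hm, hm, ← mul_sub, norm_mul, norm_eChar, one_mul]
    have hsplit : eChar δ x * b X - eChar δ z * b Z =
        (eChar δ x - eChar δ z) * b X + eChar δ z * (b X - b Z) := by ring
    have hw1 := wt_nonneg (u := Z) one_pos
    have hW := wt_nonneg (u := z - tctr P) hs
    have hwZ : wt 1 Z ^ 10 ≤ 2 ^ 10 * wt (tlen P) (z - tctr P) ^ 10 := by
      rw [← mul_pow]; exact pow_le_pow_left₀ hw1 (wt_packet_le hl1 hl2 ht P z) _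
    have hd0 : 0 ≤ |x - z| / tlen P := by positivity
    have b1 : ‖(eChar δ x - eChar δ z) * b X‖ ≤
        8 * (|x - z| / tlen P) * (C * (2 ^ 10 * wt 1 Z ^ 10)) := by
      rw [norm_mul]
      refine mul_le_mul ?_ ((hb.decay X).trans (mul_le_mul_of_nonneg_left
        (wt_pow_le_of_abs_sub_le one_pos hXZ1 10) (by linarith))) (norm_nonneg _) (by positivity)
      refine (norm_eChar_sub_le _ _ _).trans ?_
      calc 2 * Real.pi * (|δ| * |x - z|) ≤ 2 * 4 * ((tlen P)⁻¹ * |x - z|) := by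
            gcongr; exact Real.pi_le_four
        _ = _ := by rw [div_eq_inv_mul]; ring
    have b2 : ‖eChar δ z * (b X - b Z)‖ ≤ C * (|x - z| / tlen P) * wt 1 Z ^ 10 := by
      rw [norm_mul, norm_eChar, one_mul]
      exact (hb.lip X Z hXZ1).trans (mul_le_mul_of_nonneg_right
        (mul_le_mul_of_nonneg_left hXZ (by linarith)) (by positivity))
    change ‖eChar δ x * b X - eChar δ z * b Z‖ ≤ _
    rw [hsplit]
    calc _ ≤ _ := (norm_add_le _ _).trans (add_le_add b1 b2)
      _ = (2 ^ 13 + 1) * C * (|x - z| / tlen P) * wt 1 Z ^ 10 := by ring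
      _ ≤ 2 ^ 14 * C * (|x - z| / tlen P) * (2 ^ 10 * wt (tlen P) (z - tctr P) ^ 10) := by
          gcongr; norm_num
      _ = _ := by ring
  · exact continuous_const.mul (hϑ.continuous_modp _ _ _)
  · have hj := two_zpow_pos j
    have hw := wt_nonneg (u := x) hj
    have e1 : wt 1 (x / (lam * 2 ^ j)) = wt (2 ^ j) (x / lam) := by
      rw [wt, wt, abs_div, abs_div, abs_of_pos hl, abs_of_pos (mul_pos hl hj)]
      field_simp
    have e2 : wt 1 (x / (lam * 2 ^ j)) ≤ 2 * wt (2 ^ j) x := by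
      rw [e1]
      refine wt_comp hj ?_
      have h3 : |x| / 2 ≤ |x / lam| := by
        rw [abs_div, abs_of_pos hl]
        exact div_le_div_of_nonneg_left (abs_nonneg _) hl hl2
      linarith
    rw [wker, norm_mul, modp, norm_mul, norm_eChar, one_mul, sub_zero, Complex.norm_real,
      Real.norm_eq_abs, abs_of_pos (by positivity)]
    calc _ ≤ (2 ^ j)⁻¹ * (C * (2 * wt (2 ^ j) x) ^ 4) := by
          refine mul_le_mul ?_ ((hϑ.decay _).trans (mul_le_mul_of_nonneg_left
            ((wt_pow_le one_pos (by norm_num)).trans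
              (pow_le_pow_left₀ (wt_nonneg one_pos) e2 _)) (by linarith)))
            (norm_nonneg _) (by positivity)
          exact inv_anti₀ hj (le_mul_of_one_le_left hj.le hl1)
      _ = 2 ^ 4 * C * (2 ^ j)⁻¹ * wt (2 ^ j) x ^ 4 := by ring
      _ ≤ _ := by gcongr <;> norm_num
  · rw [hconv, wpk, hb.modp_eq]
    congr 1; ext σ
    by_cases h1 : B σ = 0
    · simp [h1]
    obtain ⟨s1, s2⟩ := hB σ h1
    obtain ⟨u1, u2⟩ := hU P ξ hξ
    have hsP := two_zpow_pos (-P.1)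
    have hj0 := two_zpow_pos j
    have hjP : (2 : ℝ) ^ j * 2 ^ (-P.1) ≤ 1 := by
      rw [← zpow_add₀ two_ne_zero]
      exact zpow_le_one_of_nonpos₀ one_le_two (by lia)
    rw [hΘ1, mul_one]
    rw [abs_mul, abs_of_pos hj0]
    have : |(P.2.2 + σ) * 2 ^ (-P.1) - ξ| ≤ (2 : ℝ) ^ (-P.1) := by
      rw [abs_le]; constructor <;> nlinarith
    exact (mul_le_mul_of_nonneg_left this hj0.le).trans hjP
  · rw [hconv]
    refine integral_eq_zero_of_ae (.of_forall fun σ => ?_)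
    by_cases h1 : B σ = 0
    · simp [h1]
    obtain ⟨s1, s2⟩ := hB σ h1
    obtain ⟨u1, u2⟩ := hU P ξ hξ
    have hsP := two_zpow_pos (-P.1)
    have hj0 := two_zpow_pos j
    have hjP : (16 : ℝ) ≤ 2 ^ j * 2 ^ (-P.1) := by
      rw [← zpow_add₀ two_ne_zero]
      calc (16 : ℝ) = 2 ^ (4 : ℤ) := by norm_num
        _ ≤ _ := zpow_le_zpow_right₀ one_le_two (by lia)
    change B σ * (_ * Θ _) = 0
    rw [hΘ2, mul_zero, mul_zero]
    rw [abs_mul, abs_of_pos hj0]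
    have : 1 / 8 * (2 : ℝ) ^ (-P.1) ≤ |(P.2.2 + σ) * 2 ^ (-P.1) - ξ| := by
      refine le_trans ?_ (neg_le_abs _)
      nlinarith
    calc (2 : ℝ) = 1 / 8 * 16 := by norm_num
      _ ≤ 1 / 8 * (2 ^ j * 2 ^ (-P.1)) := by linarith
      _ = 2 ^ j * (1 / 8 * 2 ^ (-P.1)) := by ring
      _ ≤ _ := mul_le_mul_of_nonneg_left this hj0.le

end packets

/-- Fubini's theorem for two integrable densities and a bounded kernel. -/
lemma integral_mul_integral_swap {X Y : Type*} [MeasurableSpace X] [MeasurableSpace Y]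
    {μ : Measure X} {ν : Measure Y} [SFinite μ] [SFinite ν] {f : X → ℂ} {g : Y → ℂ}
    (hf : Integrable f μ) (hg : Integrable g ν) {k : X → Y → ℂ}
    (hk : Measurable fun p : X × Y => k p.1 p.2) {D : ℝ} (hD : ∀ x y, ‖k x y‖ ≤ D) :
    ∫ x, f x * ∫ y, g y * k x y ∂ν ∂μ = ∫ y, g y * ∫ x, f x * k x y ∂μ ∂ν := by
  simp_rw [← integral_const_mul]
  rw [integral_integral_swap]
  · congr 1; ext y; congr 1; ext x; ring
  · refine ((hf.mul_prod hg).mul_bdd (c := D) hk.aestronglyMeasurable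
      (.of_forall fun p => hD p.1 p.2)).congr (.of_forall fun p => ?_)
    simp only [Function.uncurry]; ring

lemma norm_fourierT_le (f : ℝ → ℂ) (ξ : ℝ) : ‖fourierT f ξ‖ ≤ ∫ x, ‖f x‖ := by
  refine (norm_integral_le_integral_norm _).trans (le_of_eq ?_)
  simp

lemma continuous_fourierT {f : ℝ → ℂ} (hf : Integrable f) : Continuous (fourierT f) := by
  refine continuous_of_dominated (bound := fun x => ‖f x‖) (fun ξ => ?_) (fun ξ => ?_) hf.norm ?_
  · exact hf.aestronglyMeasurable.mul (Continuous.aestronglyMeasurable (by fun_prop))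
  · exact .of_forall fun x => by simp
  · exact .of_forall fun x => by fun_prop

section average
variable {B b : ℝ → ℂ} {C r : ℝ} {f g : ℝ → ℂ}

lemma IsProfile.eq_fourierT (h : IsProfile B b C) : B = fourierT b :=
  funext fun σ => (h.transform σ).symm

lemma IsProfile.continuous_transform (h : IsProfile B b C) : Continuous B := by
  rw [h.eq_fourierT]; exact continuous_fourierT h.int

lemma IsProfile.integrable_mul_conj (h : IsProfile B b C) :
    Integrable fun σ => B σ * conj (B σ) := by
  refine h.intB.mul_bdd (c := ∫ x, ‖b x‖)
    (Complex.continuous_conj.comp h.continuous_transform).aestronglyMeasurable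
    (.of_forall fun σ => ?_)
  rw [Complex.norm_conj, h.eq_fourierT]
  exact norm_fourierT_le _ _

lemma IsProfile.integral_modp_center (h : IsProfile B b C) (hr : 0 < r) (ω x z : ℝ) :
    ∫ y, modp b ω y r x * conj (modp b ω y r z) =
      r * ∫ σ, B σ * conj (B σ) * eChar (ω + σ / r) (x - z) := by
  have h1 := h.integral_modp_mul_conj h hr (r := r) ω 0 ω (x - z)
  simp only [add_sub_cancel_left, mul_div_cancel₀ _ hr.ne', sub_zero] at h1
  rw [← h1, ← integral_sub_left_eq_self _ volume x]
  congr 1; ext y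
  simp only [modp]
  congr 3 <;> ring_nf

lemma continuous_modp_uncurry (hb : Continuous b) (ω r : ℝ) :
    Continuous fun p : ℝ × ℝ => modp b ω p.1 r p.2 := by
  unfold modp; fun_prop

lemma IsProfile.integrable_shear (h : IsProfile B b C) (hr : 0 < r) (hg : Integrable g) (ω : ℝ) :
    Integrable (fun p : ℝ × ℝ => g p.1 * modp b ω p.2 r p.1) (volume.prod volume) := by
  have h1 : Integrable fun u => modp b ω 0 r (-u) := (h.integrable_modp ω 0 hr).comp_neg
  have h2 := (measurePreserving_prod_sub (volume : Measure ℝ)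
      (volume : Measure ℝ)).integrable_comp_of_integrable
    (hg.mul_prod h1)
  refine h2.congr (.of_forall fun p => ?_)
  simp only [Function.comp_apply, modp, sub_zero, neg_sub]

/-- Averaging the packet expansion over translations. -/
lemma IsProfile.integral_packet_pairing (h : IsProfile B b C) (hr : 0 < r) (hf : Integrable f)
    (hg : Integrable g) (ω : ℝ) :
    Integrable (fun y => (∫ z, f z * conj (modp b ω y r z)) * ∫ x, modp b ω y r x * g x) ∧
    ∫ y, (∫ z, f z * conj (modp b ω y r z)) * ∫ x, modp b ω y r x * g x =
      r * ∫ σ, B σ * conj (B σ) *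
        (fourierT f (ω + σ / r) * fourierT g (-(ω + σ / r))) := by
  have hm := continuous_modp_uncurry h.cont ω r
  have hmc : Continuous fun p : ℝ × ℝ => conj (modp b ω p.1 r p.2) :=
    Complex.continuous_conj.comp hm
  have hb : ∀ y x, ‖conj (modp b ω y r x)‖ ≤ C := fun y x => by
    rw [Complex.norm_conj]; exact h.norm_modp_le _ _ _ _
  have hBB : Integrable fun σ => B σ * conj (B σ) := h.integrable_mul_conj
  set a : ℝ → ℂ := fun y => ∫ z, f z * conj (modp b ω y r z)
  have ha : Continuous a := by
    refine continuous_of_dominated (bound := fun z => ‖f z‖ * C) (fun y => ?_) (fun y => ?_)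
      (hf.norm.mul_const C) ?_
    · exact hf.aestronglyMeasurable.mul
        (hmc.comp (Continuous.prodMk_right y)).aestronglyMeasurable
    · exact .of_forall fun z => by
        rw [norm_mul]; exact mul_le_mul_of_nonneg_left (hb _ _) (norm_nonneg _)
    · exact .of_forall fun z => continuous_const.mul (hmc.comp (Continuous.prodMk_left z))
  have hab : ∀ y, ‖a y‖ ≤ (∫ z, ‖f z‖) * C := fun y => by
    refine (norm_integral_le_integral_norm _).trans ?_
    rw [← integral_mul_const]
    refine integral_mono_of_nonneg (.of_forall fun _ => norm_nonneg _) (hf.norm.mul_const C)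
      (.of_forall fun z => ?_)
    simp only [norm_mul]
    exact mul_le_mul_of_nonneg_left (hb _ _) (norm_nonneg _)
  have hs := h.integrable_shear hr hg ω
  have hsa : Integrable (fun p : ℝ × ℝ => g p.1 * modp b ω p.2 r p.1 * a p.2)
      (volume.prod volume) :=
    hs.mul_bdd (ha.comp continuous_snd).aestronglyMeasurable (.of_forall fun p => hab p.2)
  have he : ∀ y, a y * ∫ x, modp b ω y r x * g x = ∫ x, g x * modp b ω y r x * a y := fun y => by
    rw [← integral_const_mul]; congr 1; ext x; ring
  change Integrable (fun y => a y * ∫ x, modp b ω y r x * g x) ∧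
    ∫ y, a y * ∫ x, modp b ω y r x * g x = _
  simp_rw [he]
  refine ⟨hsa.integral_prod_right, ?_⟩
  rw [← integral_integral_swap (f := fun x y => g x * modp b ω y r x * a y) hsa]
  have hi : ∀ x, Integrable fun y => modp b ω y r x := fun x => by
    refine (((h.integrable_modp ω 0 hr).comp_sub_left x)).congr (.of_forall fun y => ?_)
    simp only [modp, sub_zero]
  have h1 : ∀ x, ∫ y, g x * modp b ω y r x * a y =
      g x * (r * ∫ σ, B σ * conj (B σ) * (eChar (ω + σ / r) x * fourierT f (ω + σ / r))) :=
      fun x => by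
    simp_rw [mul_assoc (g x)]
    rw [integral_const_mul, integral_mul_integral_swap (hi x) hf hmc.measurable hb]
    simp_rw [h.integral_modp_center hr]
    have h2 : ∀ z, f z * (r * ∫ σ, B σ * conj (B σ) * eChar (ω + σ / r) (x - z)) =
        r * (f z * ∫ σ, B σ * conj (B σ) * eChar (ω + σ / r) (x - z)) := fun z => by ring
    simp_rw [h2]
    rw [integral_const_mul, integral_mul_integral_swap hf hBB (by fun_prop) (D := 1) (by simp)]
    congr 3; ext σ; congr 1
    rw [fourierT, ← integral_const_mul]
    congr 1; ext z
    rw [sub_eq_add_neg, eChar_add_right, eChar_eq_of_mul_eq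
      (show (ω + σ / r) * -z = -(ω + σ / r) * z by ring)]
    ring
  simp_rw [h1]
  have h3 : ∀ x, g x * (r * ∫ σ, B σ * conj (B σ) *
      (eChar (ω + σ / r) x * fourierT f (ω + σ / r))) = r * (g x * ∫ σ, B σ * conj (B σ) *
      (eChar (ω + σ / r) x * fourierT f (ω + σ / r))) := fun x => by ring
  simp_rw [h3]
  have hfc := continuous_fourierT hf
  rw [integral_const_mul, integral_mul_integral_swap hg hBB
    (Continuous.measurable (by fun_prop)) (D := ∫ x, ‖f x‖) fun x σ => by
      rw [norm_mul, norm_eChar, one_mul]; exact norm_fourierT_le _ _]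
  congr 2; ext σ; congr 1
  rw [fourierT, fourierT, ← integral_const_mul]
  congr 1; ext x
  rw [neg_neg]; ring

end average

open Filter Topology

/-- Frequency side of the translation average of the packet expansion at a frequency interval. -/
noncomputable def freqAvg (W H : ℝ → ℂ) (lam η : ℝ) (k l : ℤ) : ℂ :=
  (2 ^ (-k) * lam : ℝ) * ∫ σ, W σ * H (wfreq lam η (k, 0, l) + σ / (lam * 2 ^ k))

lemma sum_integral_translates {F : ℝ → ℂ} (hF : Integrable F) (M : ℕ) :
    ∑ n ∈ Finset.Ico (-M : ℤ) M, ∫ t in (0 : ℝ)..1, F (n + t) = ∫ t in (-M : ℝ)..M, F t := by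
  have h1 : ∀ n : ℤ, ∫ t in (0 : ℝ)..1, F (n + t) = ∫ t in (n : ℝ)..(n + 1 : ℤ), F t := fun n => by
    rw [intervalIntegral.integral_comp_add_left]; simp
  simp_rw [h1]
  induction M with
  | zero => simp
  | succ M ih =>
    have e : Finset.Ico (-(M + 1 : ℕ) : ℤ) (M + 1 : ℕ) =
        insert (-(M : ℤ) - 1) (insert (M : ℤ) (Finset.Ico (-M : ℤ) M)) := by
      ext n; simp only [Finset.mem_Ico, Finset.mem_insert]; push_cast; lia
    have hi : ∀ a b : ℝ, IntervalIntegrable F volume a b := fun a b => hF.intervalIntegrable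
    rw [e, Finset.sum_insert (by simp only [Finset.mem_Ico, Finset.mem_insert]; lia),
      Finset.sum_insert (by simp), ih, add_comm (∫ t in _..((M : ℤ) + 1 : ℤ), F t),
      ← add_assoc]
    push_cast
    rw [sub_add_cancel, intervalIntegral.integral_add_adjacent_intervals (hi _ _) (hi _ _),
      intervalIntegral.integral_add_adjacent_intervals (hi _ _) (hi _ _), neg_add']

section stage
variable {B b Θ ϑ : ℝ → ℂ} {C lam η X : ℝ} {f w : ℝ → ℂ} {N : ℝ → ℝ} {E : Set ℝ}

lemma IsProfile.norm_sum_freqAvg_le (hb : IsProfile B b C) (hl : 0 < lam) (hf : Integrable f)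
    (hE : MeasurableSet E) (hN : Measurable N) (hw : IntegrableOn w E)
    (hX : ∀ t ∈ Icc (0 : ℝ) 1, ∀ T : Finset Tile, ∑ P ∈ T, ‖pcoef (wpk b lam η t) f P‖ *
      ‖wcoef (wpk b lam η t) E N w P‖ ≤ X) (S : Finset (ℤ × ℤ)) :
    ‖∑ q ∈ S, freqAvg (fun σ => B σ * conj (B σ)) (fun κ => fourierT f κ *
      fourierT ((E ∩ N ⁻¹' tU (q.1, 0, q.2)).indicator w) (-κ)) lam η q.1 q.2‖ ≤ X := by
  set g : ℤ × ℤ → ℝ → ℂ := fun q => (E ∩ N ⁻¹' tU (q.1, 0, q.2)).indicator w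
  have hms : ∀ q : ℤ × ℤ, MeasurableSet (E ∩ N ⁻¹' tU (q.1, 0, q.2)) := fun q =>
    hE.inter (hN (measurableSet_tU _))
  have hg : ∀ q, Integrable (g q) := fun q =>
    (hw.mono_set inter_subset_left).integrable_indicator (hms q)
  set A : ℤ × ℤ → ℝ → ℂ := fun q y =>
    (∫ z, f z * conj (modp b (wfreq lam η (q.1, 0, q.2)) y (lam * 2 ^ q.1) z)) *
      ∫ x, modp b (wfreq lam η (q.1, 0, q.2)) y (lam * 2 ^ q.1) x * g q x
  set F : ℤ × ℤ → ℝ → ℂ := fun q ρ => (2 ^ (-q.1) : ℝ) * A q (ρ * 2 ^ q.1) with hF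
  have key : ∀ q, Integrable (A q) ∧ ∫ y, A q y = _ := fun q : ℤ × ℤ =>
    hb.integral_packet_pairing (r := lam * 2 ^ q.1) (by positivity) hf
      (hg q) (wfreq lam η (q.1, 0, q.2))
  have hFi : ∀ q, Integrable (F q) := fun q =>
    ((key q).1.comp_mul_right' (two_zpow_pos q.1).ne').const_mul _
  have hFI : ∀ q, ∫ ρ, F q ρ = freqAvg (fun σ => B σ * conj (B σ)) (fun κ => fourierT f κ *
      fourierT (g q) (-κ)) lam η q.1 q.2 := fun q => by
    have h2 := two_zpow_pos q.1
    simp only [hF]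
    rw [integral_const_mul, Measure.integral_comp_mul_right, (key q).2, freqAvg,
      abs_of_pos (inv_pos.2 h2), Complex.real_smul, ← mul_assoc, ← mul_assoc,
      ← Complex.ofReal_mul, ← Complex.ofReal_mul]
    congr 2
    field_simp
  have hFt : ∀ q : ℤ × ℤ, ∀ n : ℤ, ∀ t : ℝ, F q (n + t) =
      pcoef (wpk b lam η t) f (q.1, n, q.2) * wcoef (wpk b lam η t) E N w (q.1, n, q.2) :=
      fun q n t => by
    simp only [hF, A, pcoef, wcoef, tlen]
    rw [zpow_neg, mul_assoc, ← integral_indicator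
      (show MeasurableSet (E ∩ N ⁻¹' tU (q.1, n, q.2)) from hms q)]
    congr 2
    · push_cast; rfl
    · congr 1; ext x
      rw [← indicator_mul_right]; rfl
  have hM : ∀ M : ℕ, ‖∑ q ∈ S, ∫ t in (-M : ℝ)..M, F q t‖ ≤ X := fun M => by
    have hi : ∀ q, ∀ n : ℤ, IntervalIntegrable (fun t : ℝ => F q (n + t)) volume 0 1 :=
      fun q n => ((hFi q).comp_add_left n).intervalIntegrable
    simp_rw [← sum_integral_translates (hFi _) M]
    simp_rw [← intervalIntegral.integral_finsetSum fun n _ => hi _ n]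
    rw [← intervalIntegral.integral_finsetSum fun q _ => by
      simpa only [Finset.sum_fn] using IntervalIntegrable.sum (Finset.Ico (-M : ℤ) M)
        fun n _ => hi q n]
    refine (intervalIntegral.norm_integral_le_of_norm_le_const (C := X) fun t ht => ?_).trans
      (by simp)
    rw [uIoc_of_le zero_le_one] at ht
    refine le_trans ?_ (hX t (Ioc_subset_Icc_self ht) ((S ×ˢ Finset.Ico (-M : ℤ) M).image
      fun p => (p.1.1, p.2, p.1.2)))
    rw [Finset.sum_image (by rintro ⟨⟨a, b⟩, c⟩ _ ⟨⟨a', b'⟩, c'⟩ _ h; simp_all),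
      Finset.sum_product]
    refine (norm_sum_le _ _).trans (Finset.sum_le_sum fun q _ => (norm_sum_le _ _).trans
      (Finset.sum_le_sum fun n _ => ?_))
    rw [hFt, norm_mul]
  change ‖∑ q ∈ S, freqAvg (fun σ => B σ * conj (B σ)) (fun κ => fourierT f κ *
    fourierT (g q) (-κ)) lam η q.1 q.2‖ ≤ X
  simp_rw [← hFI]
  have hlim : Tendsto (fun M : ℕ => ‖∑ q ∈ S, ∫ t in (-M : ℝ)..M, F q t‖) atTop
      (𝓝 ‖∑ q ∈ S, ∫ t, F q t‖) := ?_
  · exact le_of_tendsto hlim (.of_forall hM)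
  refine (tendsto_finsetSum _ fun q _ => ?_).norm
  exact intervalIntegral_tendsto_integral (hFi q)
    (tendsto_neg_atTop_atBot.comp tendsto_natCast_atTop_atTop) tendsto_natCast_atTop_atTop

/-- Pairing density of `f` with the part of `w` where the frequency choice equals `ν`. -/
noncomputable def pairDens (f w : ℝ → ℂ) (E : Set ℝ) (u : ℝ → ℝ) (ν κ : ℝ) : ℂ :=
  fourierT f κ * fourierT ((E ∩ u ⁻¹' {ν}).indicator w) (-κ)

lemma continuous_pairDens (hf : Integrable f) (hE : MeasurableSet E) {u : ℝ → ℝ}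
    (hu : Measurable u) (hw : IntegrableOn w E) (ν : ℝ) : Continuous (pairDens f w E u ν) := by
  have h1 := continuous_fourierT hf
  have h2 : Integrable ((E ∩ u ⁻¹' {ν}).indicator w) :=
    (hw.mono_set inter_subset_left).integrable_indicator
      (hE.inter (hu (measurableSet_singleton ν)))
  have h3 := continuous_fourierT h2
  unfold pairDens; fun_prop

lemma norm_pairDens_le (f w : ℝ → ℂ) (E : Set ℝ) (u : ℝ → ℝ) (ν κ : ℝ) :
    ‖pairDens f w E u ν κ‖ ≤ (∫ x, ‖f x‖) * ∫ x, ‖(E ∩ u ⁻¹' {ν}).indicator w x‖ := by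
  rw [pairDens, norm_mul]
  exact mul_le_mul (norm_fourierT_le _ _) (norm_fourierT_le _ _) (norm_nonneg _)
    (integral_nonneg fun _ => norm_nonneg _)

lemma integrable_mul_comp {W H : ℝ → ℂ} (hW : Integrable W) (hH : Continuous H) {D : ℝ}
    (hD : ∀ κ, ‖H κ‖ ≤ D) (c d : ℝ) : Integrable fun σ => W σ * H (c + σ / d) :=
  hW.mul_bdd (c := D) (Continuous.aestronglyMeasurable (by fun_prop)) (.of_forall fun _ => hD _)

lemma IsProfile.norm_sum_pairDens_le (hb : IsProfile B b C) (hl : 0 < lam) (hf : Integrable f)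
    (hE : MeasurableSet E) {u : ℝ → ℝ} (hu : Measurable u) (hw : IntegrableOn w E)
    {V : Finset ℝ} (hV : ∀ x, u x ∈ V)
    (hX : ∀ t ∈ Icc (0 : ℝ) 1, ∀ T : Finset Tile, ∑ P ∈ T, ‖pcoef (wpk b lam η t) f P‖ *
      ‖wcoef (wpk b lam η t) E (fun x => lam * u x - η) w P‖ ≤ X) (S : Finset (ℤ × ℤ)) :
    ‖∑ ν ∈ V, ∑ q ∈ S, (tU (q.1, 0, q.2)).indicator (fun _ =>
      freqAvg (fun σ => B σ * conj (B σ)) (pairDens f w E u ν) lam η q.1 q.2)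
        (lam * ν - η)‖ ≤ X := by
  have h := hb.norm_sum_freqAvg_le hl hf hE ((hu.const_mul lam).sub_const η) hw hX S
  convert h using 2
  rw [Finset.sum_comm]
  refine Finset.sum_congr rfl fun q _ => ?_
  have hms : ∀ ν, MeasurableSet (E ∩ u ⁻¹' {ν}) := fun ν =>
    hE.inter (hu (measurableSet_singleton ν))
  have hgi : ∀ ν, Integrable ((E ∩ u ⁻¹' {ν}).indicator w) := fun ν =>
    (hw.mono_set inter_subset_left).integrable_indicator (hms ν)
  have h1 : ∀ κ, fourierT ((E ∩ (fun x => lam * u x - η) ⁻¹' tU (q.1, 0, q.2)).indicator w) κ =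
      ∑ ν ∈ V, (tU (q.1, 0, q.2)).indicator 1 (lam * ν - η) *
        fourierT ((E ∩ u ⁻¹' {ν}).indicator w) κ := fun κ => by
    have hi : ∀ ν, Integrable fun x => (E ∩ u ⁻¹' {ν}).indicator w x * eChar (-κ) x := fun ν =>
      (hgi ν).mul_bdd (c := 1) (Continuous.aestronglyMeasurable (by fun_prop))
        (.of_forall fun _ => by simp)
    simp_rw [fourierT, ← integral_const_mul]
    rw [← integral_finsetSum _ fun ν _ => (hi ν).const_mul _]
    congr 1; ext x
    rw [Finset.sum_eq_single_of_mem (u x) (hV x)]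
    · by_cases hx : x ∈ E <;> by_cases hx' : lam * u x - η ∈ tU (q.1, 0, q.2) <;>
        simp [indicator, hx, hx']
    · intro ν _ hν
      simp [indicator, Ne.symm hν]
  have h2 : ∀ ν, (tU (q.1, 0, q.2)).indicator (fun _ =>
      freqAvg (fun σ => B σ * conj (B σ)) (pairDens f w E u ν) lam η q.1 q.2) (lam * ν - η) =
      (tU (q.1, 0, q.2)).indicator 1 (lam * ν - η) *
      freqAvg (fun σ => B σ * conj (B σ)) (pairDens f w E u ν) lam η q.1 q.2 := fun ν => by
    by_cases hx' : lam * ν - η ∈ tU (q.1, 0, q.2) <;> simp [hx']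
  simp_rw [h2, h1, freqAvg]
  simp_rw [mul_left_comm _ ((2 ^ (-q.1) * lam : ℝ) : ℂ), ← integral_const_mul]
  rw [← integral_finsetSum _ fun ν _ => (integrable_mul_comp
    hb.integrable_mul_conj (continuous_pairDens hf hE hu hw ν) (norm_pairDens_le f w E u ν)
    _ _).const_mul _ |>.const_mul _]
  congr 1; ext σ
  simp only [Finset.mul_sum]
  refine Finset.sum_congr rfl fun ν _ => ?_
  rw [pairDens]; ring

end stage

section scale
variable {W H : ℝ → ℂ} {D lam ν : ℝ}

/-- Superposition of values of `H` to the left of `ν`, at distance comparable to `c`. -/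
noncomputable def leftAvg (W H : ℝ → ℂ) (ν s c : ℝ) : ℂ := ∫ σ, W σ * H (ν - (s - σ) * c)

lemma continuous_leftAvg (hW : Integrable W) (hH : Continuous H) (hD : ∀ κ, ‖H κ‖ ≤ D) (ν : ℝ) :
    Continuous fun p : ℝ × ℝ => leftAvg W H ν p.1 p.2 := by
  refine continuous_of_dominated (bound := fun σ => ‖W σ‖ * D) (fun p => ?_) (fun p => ?_)
    (hW.norm.mul_const D) (.of_forall fun σ => by fun_prop)
  · exact hW.aestronglyMeasurable.mul (Continuous.aestronglyMeasurable (by fun_prop))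
  · exact .of_forall fun σ => by
      rw [norm_mul]; exact mul_le_mul_of_nonneg_left (hD _) (norm_nonneg _)

lemma norm_leftAvg_le (hW : Integrable W) (hD : ∀ κ, ‖H κ‖ ≤ D) (ν s c : ℝ) :
    ‖leftAvg W H ν s c‖ ≤ (∫ σ, ‖W σ‖) * D := by
  refine (norm_integral_le_integral_norm _).trans ?_
  rw [← integral_mul_const]
  refine integral_mono_of_nonneg (.of_forall fun _ => norm_nonneg _) (hW.norm.mul_const D)
    (.of_forall fun σ => ?_)
  simp only [norm_mul]
  exact mul_le_mul_of_nonneg_left (hD _) (norm_nonneg _)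

/-- The periodic function of the base frequency produced by the packets at a given scale. -/
noncomputable def perAvg (W H : ℝ → ℂ) (ν lam : ℝ) (k : ℤ) (y : ℝ) : ℂ :=
  (Ici (1 / 2 : ℝ)).indicator
    (fun s => ((2 ^ (-k) * lam : ℝ) : ℂ) * leftAvg W H ν s (2 ^ (-k) / lam)) (Int.fract y)

lemma sum_freqAvg_eq (hl : 0 < lam) (η : ℝ) (k : ℤ) {Λ : Finset ℤ}
    (hΛ : ⌊2 ^ k * (lam * ν - η)⌋ ∈ Λ) :
    ∑ l ∈ Λ, (tU (k, 0, l)).indicator (fun _ => freqAvg W H lam η k l) (lam * ν - η) =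
      perAvg W H ν lam k (2 ^ k * (lam * ν - η)) := by
  have hk := two_zpow_pos k
  set z := lam * ν - η with hz
  have hmem : ∀ l, z ∈ tU (k, 0, l) ↔ ⌊2 ^ k * z⌋ = l ∧ 1 / 2 ≤ Int.fract (2 ^ k * z) := fun l => by
    have e : (2 : ℝ) ^ (-k - 1) = (2 ^ k)⁻¹ / 2 := by
      rw [zpow_sub_one₀ two_ne_zero, zpow_neg]; rfl
    have h1 : z ∈ tU (k, 0, l) ↔ l + 1 / 2 ≤ 2 ^ k * z ∧ 2 ^ k * z < l + 1 := by
      have h2 : 2 ^ k * z * ((2 ^ k)⁻¹ / 2) * 2 = z := by field_simp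
      have h3 : 0 < ((2 : ℝ) ^ k)⁻¹ := inv_pos.2 hk
      rw [tU, mem_dy', e]
      push_cast
      generalize (2 : ℝ) ^ k * z = y at *
      constructor
      · rintro ⟨a, b⟩
        constructor
        · by_contra h; push Not at h; nlinarith
        · by_contra h; push Not at h; nlinarith
      · rintro ⟨a, b⟩
        constructor <;> nlinarith
    rw [h1]
    constructor
    · rintro ⟨a, b⟩
      have : ⌊2 ^ k * z⌋ = l := Int.floor_eq_iff.2 ⟨by linarith, b⟩
      exact ⟨this, by rw [Int.fract, this]; linarith⟩
    · rintro ⟨rfl, h⟩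
      rw [Int.fract] at h
      exact ⟨by linarith, Int.lt_floor_add_one _⟩
  rw [Finset.sum_eq_single_of_mem _ hΛ]
  · rw [perAvg]
    by_cases h : 1 / 2 ≤ Int.fract (2 ^ k * z)
    · rw [indicator_of_mem ((hmem _).2 ⟨rfl, h⟩), indicator_of_mem (mem_Ici.2 h), freqAvg, leftAvg]
      congr 2; ext σ; congr 2
      rw [wfreq, zpow_neg, Int.fract, hz]
      field_simp; ring
    · rw [indicator_of_notMem fun h' => h ((hmem _).1 h').2,
        indicator_of_notMem (s := Ici _) h]
  · intro l _ hl'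
    exact indicator_of_notMem (fun h' => hl' ((hmem _).1 h').1.symm) _

lemma perAvg_periodic (k : ℤ) : Function.Periodic (perAvg W H ν lam k) 1 := fun y => by
  rw [perAvg, perAvg, Int.fract_add_one]

lemma measurable_perAvg (hW : Integrable W) (hH : Continuous H) (hD : ∀ κ, ‖H κ‖ ≤ D) (k : ℤ) :
    Measurable (perAvg W H ν lam k) := by
  have h := continuous_leftAvg hW hH hD ν
  refine Measurable.comp (Measurable.indicator ?_ measurableSet_Ici) measurable_fract
  exact measurable_const.mul (h.comp (Continuous.prodMk_left _)).measurable

lemma intervalIntegrable_perAvg (hW : Integrable W) (hH : Continuous H) (hD : ∀ κ, ‖H κ‖ ≤ D)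
    (k : ℤ) {g : ℝ → ℝ} (hg : Measurable g) (a b : ℝ) :
    IntervalIntegrable (fun y => perAvg W H ν lam k (g y)) volume a b := by
  refine (intervalIntegrable_const (c := ‖((2 ^ (-k) * lam : ℝ) : ℂ)‖ * ((∫ σ, ‖W σ‖) *
      D))).mono_fun
    ((measurable_perAvg hW hH hD k).comp hg).aestronglyMeasurable (.of_forall fun y => ?_)
  refine le_trans ?_ (le_abs_self _)
  refine (norm_indicator_le_norm_self _ _).trans ?_
  rw [norm_mul]
  exact mul_le_mul_of_nonneg_left (norm_leftAvg_le hW hD _ _ _) (norm_nonneg _)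

lemma integral_perAvg (hW : Integrable W) (hH : Continuous H) (hD : ∀ κ, ‖H κ‖ ≤ D) (k : ℤ) :
    ∫ y in (0 : ℝ)..1, perAvg W H ν lam k y =
      ((2 ^ (-k) * lam : ℝ) : ℂ) * ∫ s in (1 / 2 : ℝ)..1, leftAvg W H ν s (2 ^ (-k) / lam) := by
  have hi : ∀ a b, IntervalIntegrable (perAvg W H ν lam k) volume a b :=
    intervalIntegrable_perAvg hW hH hD k measurable_id
  rw [← intervalIntegral.integral_add_adjacent_intervals (hi 0 (1 / 2)) (hi _ _)]
  have h1 : ∫ y in (0 : ℝ)..(1 / 2), perAvg W H ν lam k y = 0 := by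
    refine intervalIntegral.integral_zero_ae ?_
    filter_upwards [compl_mem_ae_iff.2 (measure_singleton (1 / 2 : ℝ))] with y hy hy2
    rw [uIoc_of_le (by norm_num)] at hy2
    have h3 : y < 1 / 2 := lt_of_le_of_ne hy2.2 hy
    rw [perAvg, Int.fract_eq_self.2 ⟨hy2.1.le, by linarith⟩,
      indicator_of_notMem (s := Ici _) (not_le.2 h3)]
  rw [h1, zero_add, ← intervalIntegral.integral_const_mul]
  refine intervalIntegral.integral_congr_ae ?_
  filter_upwards [compl_mem_ae_iff.2 (measure_singleton (1 : ℝ))] with y hy hy2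
  rw [uIoc_of_le (by norm_num)] at hy2
  have h3 : y < 1 := lt_of_le_of_ne hy2.2 hy
  rw [perAvg, Int.fract_eq_self.2 ⟨by linarith [hy2.1], h3⟩,
    indicator_of_mem (s := Ici _) hy2.1.le]

lemma integral_perAvg_shift (hW : Integrable W) (hH : Continuous H) (hD : ∀ κ, ‖H κ‖ ≤ D)
    {k : ℤ} {K : ℕ} (hk : -(K : ℤ) ≤ k) :
    ∫ η in (0 : ℝ)..2 ^ K, perAvg W H ν lam k (2 ^ k * (lam * ν - η)) =
      ((2 ^ K : ℝ) : ℂ) * (((2 ^ (-k) * lam : ℝ) : ℂ) *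
        ∫ s in (1 / 2 : ℝ)..1, leftAvg W H ν s (2 ^ (-k) / lam)) := by
  have hk0 := two_zpow_pos k
  rw [← integral_perAvg hW hH hD]
  obtain ⟨n, hn⟩ := Int.le.dest hk
  have h1 := (perAvg_periodic (W := W) (H := H) (ν := ν) (lam := lam)
      k).intervalIntegral_add_zsmul_eq
    (2 ^ n) (2 ^ k * (lam * ν) - 2 ^ n) (intervalIntegrable_perAvg hW hH hD k measurable_id)
  rw [(perAvg_periodic k).intervalIntegral_add_eq _ 0, zero_add] at h1
  have h2 : (2 : ℝ) ^ k * 2 ^ K = 2 ^ n := by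
    rw [← hn, ← zpow_natCast, ← zpow_natCast, ← zpow_add₀ two_ne_zero]; congr 1; ring
  have h3 : ∀ η, (2 : ℝ) ^ k * (lam * ν - η) = 2 ^ k * (lam * ν) - 2 ^ k * η := fun η => by ring
  simp_rw [h3]
  rw [intervalIntegral.integral_comp_sub_mul _ hk0.ne', mul_zero, sub_zero, h2]
  rw [zsmul_eq_mul, zsmul_eq_mul, mul_one] at h1
  push_cast at h1
  rw [sub_add_cancel] at h1
  rw [h1, Complex.real_smul, ← mul_assoc]
  congr 1
  rw [show (2 : ℂ) ^ n = ((2 ^ n : ℝ) : ℂ) by push_cast; rfl, ← Complex.ofReal_mul, ← h2]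
  congr 1
  field_simp

/-- Averaging over base frequencies. -/
lemma norm_sum_leftAvg_le {V : Finset ℝ} {H : ℝ → ℝ → ℂ} {X : ℝ} (hl : 0 < lam)
    (hW : Integrable W) (hH : ∀ ν, Continuous (H ν)) (hD : ∀ ν, ∃ D, ∀ κ, ‖H ν κ‖ ≤ D)
    (hX : ∀ η, ∀ S : Finset (ℤ × ℤ), ‖∑ ν ∈ V, ∑ q ∈ S, (tU (q.1, 0, q.2)).indicator (fun _ =>
      freqAvg W (H ν) lam η q.1 q.2) (lam * ν - η)‖ ≤ X) (K : ℕ) :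
    ‖∑ ν ∈ V, ∑ k ∈ Finset.Ico (-K : ℤ) K, ((2 ^ (-k) * lam : ℝ) : ℂ) *
      ∫ s in (1 / 2 : ℝ)..1, leftAvg W (H ν) ν s (2 ^ (-k) / lam)‖ ≤ X := by
  choose D hD using hD
  have hK : (0 : ℝ) < 2 ^ K := by positivity
  have h1 : ∀ η, ‖∑ ν ∈ V, ∑ k ∈ Finset.Ico (-K : ℤ) K,
      perAvg W (H ν) ν lam k (2 ^ k * (lam * ν - η))‖ ≤ X := fun η => by
    set Λ := (V ×ˢ Finset.Ico (-K : ℤ) K).image fun p => ⌊(2 : ℝ) ^ p.2 * (lam * p.1 - η)⌋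
    refine le_trans (le_of_eq ?_) (hX η (Finset.Ico (-K : ℤ) K ×ˢ Λ))
    congr 1
    refine Finset.sum_congr rfl fun ν hν => ?_
    rw [Finset.sum_product]
    refine Finset.sum_congr rfl fun k hk => (sum_freqAvg_eq hl η k ?_).symm
    exact Finset.mem_image.2 ⟨(ν, k), Finset.mem_product.2 ⟨hν, hk⟩, rfl⟩
  have hi : ∀ ν k, IntervalIntegrable (fun η => perAvg W (H ν) ν lam k (2 ^ k * (lam * ν - η)))
      volume 0 (2 ^ K) := fun ν k =>
    intervalIntegrable_perAvg hW (hH ν) (hD ν) k (by fun_prop) _ _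
  have h2 : ∫ η in (0 : ℝ)..2 ^ K, ∑ ν ∈ V, ∑ k ∈ Finset.Ico (-K : ℤ) K,
      perAvg W (H ν) ν lam k (2 ^ k * (lam * ν - η)) = ((2 ^ K : ℝ) : ℂ) * ∑ ν ∈ V,
      ∑ k ∈ Finset.Ico (-K : ℤ) K, ((2 ^ (-k) * lam : ℝ) : ℂ) *
      ∫ s in (1 / 2 : ℝ)..1, leftAvg W (H ν) ν s (2 ^ (-k) / lam) := by
    rw [intervalIntegral.integral_finsetSum fun ν _ => by
      simpa only [Finset.sum_fn] using IntervalIntegrable.sum (Finset.Ico (-K : ℤ) K)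
        fun k _ => hi ν k, Finset.mul_sum]
    refine Finset.sum_congr rfl fun ν _ => ?_
    rw [intervalIntegral.integral_finsetSum fun k _ => hi ν k, Finset.mul_sum]
    exact Finset.sum_congr rfl fun k hk =>
      integral_perAvg_shift hW (hH ν) (hD ν) (Finset.mem_Ico.1 hk).1
  have h3 := intervalIntegral.norm_integral_le_of_norm_le_const (a := 0) (b := 2 ^ K)
    fun η _ => h1 η
  rw [h2, norm_mul, Complex.norm_real, Real.norm_of_nonneg hK.le, sub_zero, abs_of_pos hK,
    mul_comm] at h3
  exact le_of_mul_le_mul_right h3 hK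

lemma sum_integral_dyadic {G : ℝ → ℂ} (hG : Continuous G) (K : ℕ) :
    ∑ k ∈ Finset.Ico (-K : ℤ) K, ∫ m in (1 / 2 : ℝ)..1, ((2 ^ (-k) : ℝ) : ℂ) * G (2 ^ (-k) * m) =
      ∫ c in (2 ^ (-K : ℤ) : ℝ)..2 ^ (K : ℤ), G c := by
  have h1 : ∀ k : ℤ, ∫ m in (1 / 2 : ℝ)..1, ((2 ^ (-k) : ℝ) : ℂ) * G (2 ^ (-k) * m) =
      ∫ c in (2 ^ (-k - 1) : ℝ)..2 ^ (-k), G c := fun k => by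
    have hk := two_zpow_pos (-k)
    rw [intervalIntegral.integral_const_mul, intervalIntegral.integral_comp_mul_left _ hk.ne',
      Complex.real_smul, ← mul_assoc, ← Complex.ofReal_mul, mul_inv_cancel₀ hk.ne',
      Complex.ofReal_one, one_mul, mul_one, zpow_sub_one₀ two_ne_zero, one_div]
  simp_rw [h1]
  have hi : ∀ a b : ℝ, IntervalIntegrable G volume a b := fun a b => hG.intervalIntegrable _ _
  induction K with
  | zero => simp
  | succ M ih =>
    have e : Finset.Ico (-(M + 1 : ℕ) : ℤ) (M + 1 : ℕ) =
        insert (-(M : ℤ) - 1) (insert (M : ℤ) (Finset.Ico (-M : ℤ) M)) := by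
      ext n; simp only [Finset.mem_Ico, Finset.mem_insert]; push_cast; lia
    rw [e, Finset.sum_insert (by simp only [Finset.mem_Ico, Finset.mem_insert]; lia),
      Finset.sum_insert (by simp), ih]
    rw [show -(-(M : ℤ) - 1) - 1 = M by ring, show -(-(M : ℤ) - 1) = M + 1 by ring,
      add_comm (∫ c in (2 ^ (M : ℤ) : ℝ).._, G c),
      intervalIntegral.integral_add_adjacent_intervals (hi _ _) (hi _ _),
      intervalIntegral.integral_add_adjacent_intervals (hi _ _) (hi _ _)]
    congr 2
    push_cast; ring

/-- Averaging over dilations. -/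
lemma norm_sum_integral_leftAvg_le {V : Finset ℝ} {H : ℝ → ℝ → ℂ} {X : ℝ}
    (hW : Integrable W) (hH : ∀ ν, Continuous (H ν)) (hD : ∀ ν, ∃ D, ∀ κ, ‖H ν κ‖ ≤ D)
    (hX : ∀ lam, 1 ≤ lam → lam ≤ 2 → ∀ η, ∀ S : Finset (ℤ × ℤ), ‖∑ ν ∈ V, ∑ q ∈ S,
      (tU (q.1, 0, q.2)).indicator (fun _ => freqAvg W (H ν) lam η q.1 q.2) (lam * ν - η)‖ ≤ X)
    (K : ℕ) : ‖∑ ν ∈ V, ∫ c in (2 ^ (-K : ℤ) : ℝ)..2 ^ (K : ℤ),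
      ∫ s in (1 / 2 : ℝ)..1, leftAvg W (H ν) ν s c‖ ≤ X := by
  have hX0 : 0 ≤ X := (norm_nonneg _).trans (hX 1 le_rfl one_le_two 0 ∅)
  have hc : ∀ ν, Continuous fun c => ∫ s in (1 / 2 : ℝ)..1, leftAvg W (H ν) ν s c := fun ν => by
    obtain ⟨D, hD⟩ := hD ν
    have := continuous_leftAvg hW (hH ν) hD ν
    exact intervalIntegral.continuous_parametric_intervalIntegral_of_continuous'
      (f := fun c s => leftAvg W (H ν) ν s c) (this.comp continuous_swap) _ _
  simp_rw [← sum_integral_dyadic (hc _) K]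
  have hi : ∀ ν, ∀ k : ℤ, IntervalIntegrable (fun m => ((2 ^ (-k) : ℝ) : ℂ) *
      (∫ s in (1 / 2 : ℝ)..1, leftAvg W (H ν) ν s (2 ^ (-k) * m))) volume (1 / 2) 1 := fun ν k =>
    (continuous_const.mul ((hc ν).comp (continuous_const.mul continuous_id))).intervalIntegrable _ _
  simp_rw [← intervalIntegral.integral_finsetSum fun k _ => hi _ k]
  rw [← intervalIntegral.integral_finsetSum fun ν _ => by
      simpa only [Finset.sum_fn] using IntervalIntegrable.sum (Finset.Ico (-K : ℤ) K)
        fun k _ => hi ν k]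
  refine (intervalIntegral.norm_integral_le_of_norm_le_const (C := X) fun m hm => ?_).trans
    (by norm_num; linarith)
  rw [uIoc_of_le (by norm_num)] at hm
  have hm0 : 0 < m := by linarith [hm.1]
  have h1 := norm_sum_leftAvg_le (inv_pos.2 hm0) hW hH hD (hX m⁻¹ ((one_le_inv₀ hm0).2 hm.2)
    ((inv_le_comm₀ hm0 two_pos).2 (by linarith [hm.1]))) K
  refine le_trans (le_of_eq_of_le ?_ (mul_le_of_le_one_left (norm_nonneg _) hm.2)) h1
  have e : ∀ z : ℂ, m * ‖z‖ = ‖(m : ℂ) * z‖ := by simp [abs_of_pos hm0]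
  rw [e, Finset.mul_sum]
  congr 1
  refine Finset.sum_congr rfl fun ν _ => ?_
  rw [Finset.mul_sum]
  refine Finset.sum_congr rfl fun k _ => ?_
  rw [div_inv_eq_mul, ← mul_assoc, ← Complex.ofReal_mul]
  congr 2
  field_simp

end scale

section dilation
variable {W H F f g : ℝ → ℂ} {D ν a b : ℝ}

/-- The parameter space of the averages: a dilation `c ∈ (a,b]`, an offset `s`, a frequency `σ`. -/
noncomputable def dilMeas (a b : ℝ) : Measure (ℝ × ℝ × ℝ) :=
  (volume.restrict (Ioc a b)).prod ((volume.restrict (Ioc (1 / 2) 1)).prod volume)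

instance (a b : ℝ) : SFinite (dilMeas a b) := by unfold dilMeas; infer_instance

/-- The average of `H` over the points `ν - (s - σ) * c` with density `W σ`. -/
noncomputable def dilAvg (W H : ℝ → ℂ) (ν a b : ℝ) : ℂ :=
  ∫ p, W p.2.2 * H (ν - (p.2.1 - p.2.2) * p.1) ∂dilMeas a b

lemma integrable_dil (hW : Integrable W) (a b : ℝ) :
    Integrable (fun p : ℝ × ℝ × ℝ => W p.2.2) (dilMeas a b) :=
  (hW.comp_snd (volume.restrict (Ioc (1 / 2 : ℝ) 1))).comp_snd _

lemma integrable_dil_mul (hW : Integrable W) (hH : Continuous H) (hD : ∀ κ, ‖H κ‖ ≤ D) (ν a b : ℝ) :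
    Integrable (fun p : ℝ × ℝ × ℝ => W p.2.2 * H (ν - (p.2.1 - p.2.2) * p.1)) (dilMeas a b) :=
  (integrable_dil hW a b).mul_bdd (c := D)
    (Continuous.aestronglyMeasurable (by fun_prop)) (.of_forall fun _ => hD _)

lemma dilAvg_eq (hW : Integrable W) (hH : Continuous H) (hD : ∀ κ, ‖H κ‖ ≤ D) (hab : a ≤ b) :
    dilAvg W H ν a b = ∫ c in a..b, ∫ s in (1 / 2 : ℝ)..1, leftAvg W H ν s c := by
  have h := integrable_dil_mul hW hH hD ν a b
  rw [dilAvg, dilMeas, integral_prod _ h, intervalIntegral.integral_of_le hab]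
  refine integral_congr_ae ?_
  filter_upwards [h.prod_right_ae] with c hc
  rw [integral_prod _ hc, intervalIntegral.integral_of_le (by norm_num)]
  rfl

/-- Convolution with the kernel whose multiplier is given by `dilAvg`. -/
noncomputable def dilConv (W : ℝ → ℂ) (ν a b : ℝ) (f : ℝ → ℂ) (x : ℝ) : ℂ :=
  ∫ z, f z * dilAvg W (fun κ => eChar κ (x - z)) ν a b

lemma dilConv_eq (hW : Integrable W) (hf : Integrable f) (x : ℝ) :
    dilConv W ν a b f x = dilAvg W (fun κ => fourierT f κ * eChar κ x) ν a b := by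
  unfold dilConv dilAvg
  rw [integral_mul_integral_swap hf (integrable_dil hW a b)
    (k := fun z p => eChar (ν - (p.2.1 - p.2.2) * p.1) (x - z))
    (Continuous.measurable (by fun_prop)) (D := 1) fun _ _ => by simp]
  congr 1; ext p
  change _ = W p.2.2 * ((∫ z, _) * _)
  rw [← integral_mul_const]
  congr 2; ext z
  rw [sub_eq_add_neg x, eChar_add_right, mul_assoc, mul_comm (eChar _ x),
    eChar_eq_of_mul_eq (neg_mul_comm _ z).symm]

lemma continuous_dilConv (hW : Integrable W) (hf : Integrable f) :
    Continuous (dilConv W ν a b f) := by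
  have hc := continuous_fourierT hf
  rw [funext (dilConv_eq hW hf)]
  refine continuous_of_dominated (bound := fun p => ‖W p.2.2‖ * ∫ z, ‖f z‖) (fun x => ?_)
    (fun x => .of_forall fun p => ?_) ((integrable_dil hW a b).norm.mul_const _)
    (.of_forall fun p => by fun_prop)
  · exact (integrable_dil hW a b).aestronglyMeasurable.mul
      (Continuous.aestronglyMeasurable (by fun_prop))
  · rw [norm_mul, norm_mul, norm_eChar, mul_one]
    exact mul_le_mul_of_nonneg_left (norm_fourierT_le f _) (norm_nonneg _)

lemma exists_norm_dilAvg_le (W : ℝ → ℂ) (ν a b : ℝ) :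
    ∃ D, ∀ y, ‖dilAvg W (fun κ => eChar κ y) ν a b‖ ≤ D := by
  refine ⟨∫ p, ‖W p.2.2‖ ∂dilMeas a b, fun y => ?_⟩
  refine (norm_integral_le_integral_norm _).trans (le_of_eq ?_)
  simp

lemma measurable_dilAvg (hW : Integrable W) (ν a b : ℝ) :
    Measurable fun y => dilAvg W (fun κ => eChar κ y) ν a b := by
  refine (continuous_of_dominated (bound := fun p => ‖W p.2.2‖) (fun x => ?_)
    (fun x => .of_forall fun p => by simp) (integrable_dil hW a b).norm
    (.of_forall fun p => by fun_prop)).measurable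
  exact (integrable_dil hW a b).aestronglyMeasurable.mul
      (Continuous.aestronglyMeasurable (by fun_prop))

lemma norm_dilConv_le (hf : Integrable f) (hD : ∀ y, ‖dilAvg W (fun κ => eChar κ y) ν a b‖ ≤ D)
    (x : ℝ) : ‖dilConv W ν a b f x‖ ≤ (∫ z, ‖f z‖) * D := by
  refine (norm_integral_le_integral_norm _).trans ?_
  rw [← integral_mul_const]
  refine integral_mono_of_nonneg (.of_forall fun _ => norm_nonneg _) (hf.norm.mul_const D)
    (.of_forall fun z => ?_)
  simp only [norm_mul]
  exact mul_le_mul_of_nonneg_left (hD _) (norm_nonneg _)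

lemma integral_mul_dilConv (hW : Integrable W) (hf : Integrable f) (hg : Integrable g) :
    ∫ x, g x * dilConv W ν a b f x =
      dilAvg W (fun κ => fourierT f κ * fourierT g (-κ)) ν a b := by
  have hc := continuous_fourierT hf
  simp_rw [dilConv_eq hW hf]
  unfold dilAvg
  rw [integral_mul_integral_swap hg (integrable_dil hW a b) (k := fun x p =>
      fourierT f (ν - (p.2.1 - p.2.2) * p.1) * eChar (ν - (p.2.1 - p.2.2) * p.1) x)
    (Continuous.measurable (by fun_prop)) (D := ∫ z, ‖f z‖) fun x p => by
      rw [norm_mul, norm_eChar, mul_one]; exact norm_fourierT_le f _]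
  congr 1; ext p
  change _ = W p.2.2 * (_ * ∫ x, g x * eChar (- -(ν - (p.2.1 - p.2.2) * p.1)) x)
  rw [neg_neg, ← integral_const_mul, ← integral_const_mul, ← integral_const_mul]
  congr 1; funext z
  ring

lemma tendsto_dilAvg (hW : Integrable W) (hs : ∀ σ, W σ ≠ 0 → 1 / 8 < σ ∧ σ < 3 / 8)
    (hF : Integrable F) (hFc : Continuous F) (hD : ∀ κ, ‖F κ‖ ≤ D) (ν : ℝ) :
    Tendsto (fun K : ℕ => dilAvg W F ν (2 ^ (-K : ℤ)) (2 ^ (K : ℤ))) atTop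
      (𝓝 ((∫ q : ℝ × ℝ, W q.2 * ((q.1 - q.2)⁻¹ : ℝ) ∂((volume.restrict (Ioc (1 / 2 : ℝ)
          1)).prod volume)) *
        ∫ κ in Iic ν, F κ)) := by
  have e : ∀ K : ℕ, dilAvg W F ν (2 ^ (-K : ℤ)) (2 ^ (K : ℤ)) =
      ∫ q : ℝ × ℝ, W q.2 * (∫ c in (2 ^ (-K : ℤ) : ℝ)..2 ^ (K : ℤ), F (ν - (q.1 - q.2) * c))
        ∂((volume.restrict (Ioc (1 / 2 : ℝ) 1)).prod volume) := fun K => by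
    rw [dilAvg, dilMeas, integral_prod_symm _ (integrable_dil_mul hW hFc hD ν _ _)]
    refine integral_congr_ae (.of_forall fun q => ?_)
    simp only
    rw [integral_const_mul, intervalIntegral.integral_of_le
      (zpow_le_zpow_right₀ one_le_two (by lia))]
  simp_rw [e, ← integral_mul_const]
  have hα : ∀ᵐ q ∂((volume.restrict (Ioc (1 / 2 : ℝ) 1)).prod volume),
      W q.2 ≠ 0 → 1 / 8 < q.1 - q.2 := by
    have h1 : ∀ᵐ q ∂((volume.restrict (Ioc (1 / 2 : ℝ) 1)).prod (volume : Measure ℝ)),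
        q.1 ∈ Ioc (1 / 2 : ℝ) 1 :=
      Measure.quasiMeasurePreserving_fst.ae (ae_restrict_mem measurableSet_Ioc)
    filter_upwards [h1] with q hq h
    linarith [hq.1, (hs _ h).2]
  have hsub : ∀ α : ℝ, 0 < α → ∀ K : ℕ,
      ∫ c in (2 ^ (-K : ℤ) : ℝ)..2 ^ (K : ℤ), F (ν - α * c) =
      (α⁻¹ : ℝ) * ∫ ζ in (ν - α * 2 ^ (K : ℤ))..(ν - α * 2 ^ (-K : ℤ)), F ζ := fun α hα K => by
    rw [intervalIntegral.integral_comp_sub_mul _ hα.ne', Complex.real_smul]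
  refine tendsto_integral_of_dominated_convergence (fun q => ‖W q.2‖ * (8 * ∫ ζ, ‖F ζ‖))
    (fun K => ?_) ((hW.norm.comp_snd _).mul_const _) (fun K => ?_) ?_
  · refine (hW.comp_snd _).aestronglyMeasurable.mul (Continuous.aestronglyMeasurable ?_)
    exact intervalIntegral.continuous_parametric_intervalIntegral_of_continuous'
      (f := fun (q : ℝ × ℝ) c => F (ν - (q.1 - q.2) * c)) (by fun_prop) _ _
  · filter_upwards [hα] with q hq
    rw [norm_mul]
    by_cases h : W q.2 = 0
    · simp [h]
    refine mul_le_mul_of_nonneg_left ?_ (norm_nonneg _)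
    have h0 := hq h
    have h1 : (q.1 - q.2)⁻¹ ≤ 8 := (inv_le_comm₀ (by linarith) (by norm_num)).2 (by linarith)
    have h2 : 0 ≤ (q.1 - q.2)⁻¹ := inv_nonneg.2 (by linarith)
    rw [hsub _ (by linarith), norm_mul, Complex.norm_real, Real.norm_of_nonneg h2]
    refine mul_le_mul h1 ?_ (norm_nonneg _) (by norm_num)
    refine intervalIntegral.norm_integral_le_integral_norm_uIoc.trans ?_
    exact setIntegral_le_integral hF.norm (.of_forall fun _ => norm_nonneg _)
  · filter_upwards [hα] with q hq
    by_cases h : W q.2 = 0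
    · simp [h]
    have h0 : 0 < q.1 - q.2 := by linarith [hq h]
    simp_rw [hsub _ h0, mul_assoc]
    refine Tendsto.const_mul _ (Tendsto.const_mul _ ?_)
    have hi : ∀ a b : ℝ, IntervalIntegrable F volume a b := fun a b => hFc.intervalIntegrable _ _
    have t1 : Tendsto (fun K : ℕ => (2 : ℝ) ^ (K : ℤ)) atTop atTop := by
      simpa using tendsto_pow_atTop_atTop_of_one_lt one_lt_two
    have t2 : Tendsto (fun K : ℕ => (2 : ℝ) ^ (-K : ℤ)) atTop (𝓝 0) := by
      simp only [zpow_neg]; exact t1.inv_tendsto_atTop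
    have t3 := intervalIntegral_tendsto_integral_Iic ν hF.integrableOn (l := atTop)
      (a := fun K : ℕ => ν - (q.1 - q.2) * 2 ^ (K : ℤ))
      (tendsto_atBot_add_const_left _ ν (tendsto_neg_atTop_atBot.comp (t1.const_mul_atTop h0)))
    have t4 : Tendsto (fun K : ℕ => ∫ ζ in ν..(ν - (q.1 - q.2) * 2 ^ (-K : ℤ)), F ζ) atTop
        (𝓝 0) := by
      have h5 := (intervalIntegral.continuous_primitive hi ν).tendsto ν
      rw [intervalIntegral.integral_same] at h5
      refine h5.comp ?_
      simpa using (t2.const_mul (q.1 - q.2)).const_sub ν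
    rw [← add_zero (∫ κ in Iic ν, F κ)]
    exact (t3.add t4).congr fun K =>
      intervalIntegral.integral_add_adjacent_intervals (hi _ ν) (hi ν _)

end dilation

/-- The averaging constant does not vanish. -/
lemma dilConst_ne_zero {β : ℝ → ℝ} (hβ : Continuous β)
    (hβ1 : ∀ x, |x - 1 / 4| ≤ 1 / 16 → β x = 1) (hs : ∀ σ, β σ ≠ 0 → 1 / 8 < σ ∧ σ < 3 / 8) :
    ∫ q : ℝ × ℝ, ((β q.2 ^ 2 : ℝ) : ℂ) * ((q.1 - q.2)⁻¹ : ℝ)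
      ∂((volume.restrict (Ioc (1 / 2 : ℝ) 1)).prod volume) ≠ 0 := by
  have hpos : 0 < ((volume.restrict (Ioc (1 / 2 : ℝ) 1)).prod (volume : Measure ℝ))
      (Ioc (1 / 2) 1 ×ˢ Ioo (3 / 16) (5 / 16)) := by
    rw [Measure.prod_prod, Measure.restrict_apply_self, Real.volume_Ioc, Real.volume_Ioo]
    norm_num
  have h1 : ∀ᵐ q ∂((volume.restrict (Ioc (1 / 2 : ℝ) 1)).prod (volume : Measure ℝ)),
      q.1 ∈ Ioc (1 / 2 : ℝ) 1 :=
    Measure.quasiMeasurePreserving_fst.ae (ae_restrict_mem measurableSet_Ioc)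
  have hc : HasCompactSupport β := .intro (isCompact_Icc (a := 1 / 8) (b := 3 / 8)) fun x hx => by
    by_contra h; exact hx ⟨(hs x h).1.le, (hs x h).2.le⟩
  have hβ2 : Integrable fun x => β x ^ 2 := by
    refine Continuous.integrable_of_hasCompactSupport (hβ.pow 2) ?_
    simpa only [pow_two] using! hc.mul_right (f' := β)
  have hi := hβ2.comp_snd (volume.restrict (Ioc (1 / 2 : ℝ) 1))
  generalize hμ : (volume.restrict (Ioc (1 / 2 : ℝ) 1)).prod (volume : Measure ℝ) = μ at *
  have hα : ∀ᵐ q ∂μ, β q.2 ≠ 0 → 1 / 8 < q.1 - q.2 := by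
    filter_upwards [h1] with q hq h
    linarith [hq.1, (hs _ h).2]
  simp_rw [← Complex.ofReal_mul]
  rw [integral_complex_ofReal, Complex.ofReal_ne_zero]
  refine ((integral_pos_iff_support_of_nonneg_ae ?_ ?_).2 ?_).ne'
  · filter_upwards [hα] with q hq
    by_cases h : β q.2 = 0
    · simp [h]
    · have := hq h
      exact mul_nonneg (sq_nonneg _) (inv_nonneg.2 (by linarith))
  · refine (hi.mul_const 8).mono' (Measurable.aestronglyMeasurable (by fun_prop)) ?_
    filter_upwards [hα] with q hq
    by_cases h : β q.2 = 0
    · simp [h]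
    have := hq h
    rw [norm_mul, norm_inv, Real.norm_of_nonneg (sq_nonneg _), Real.norm_of_nonneg (by linarith)]
    exact mul_le_mul_of_nonneg_left
      ((inv_le_comm₀ (by linarith) (by norm_num)).2 (by linarith)) (sq_nonneg _)
  · refine hpos.trans_le (measure_mono ?_)
    rintro q ⟨hq1, hq2⟩
    have h3 := hβ1 q.2 (abs_le.2 ⟨by linarith [hq2.1], by linarith [hq2.2]⟩)
    have h4 : q.1 - q.2 ≠ 0 := by linarith [hq1.1, hq2.2]
    simp [Function.mem_support, h3, h4]

/-- Restricted-type bound, with constant `C`, for the linearized maximal convolution operator with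
kernels `k ν`. -/
def RestrictedBound (k : ℝ → ℝ → ℂ) (q C : ℝ) : Prop :=
  ∀ G E : Set ℝ, MeasurableSet G → volume G ≠ ∞ → MeasurableSet E → volume E ≠ ∞ →
    ∃ E' ⊆ E, MeasurableSet E' ∧ volume.real E ≤ 2 * volume.real E' ∧
      ∀ (f w : ℝ → ℂ) (u : ℝ → ℝ) (V : Finset ℝ), Measurable f → (∀ x, ‖f x‖ ≤ G.indicator 1 x) →
        Measurable u → (∀ x, u x ∈ V) → Measurable w → (∀ x, ‖w x‖ ≤ 1) →
        ‖∫ x in E', w x * ∫ z, f z * k (u x) (x - z)‖ ≤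
          C * (volume.real G ^ (1 / q) * volume.real E ^ (1 - 1 / q))

lemma integrable_of_norm_le_indicator {G : Set ℝ} (hG : MeasurableSet G) (hG' : volume G ≠ ∞)
    {f : ℝ → ℂ} (hf : Measurable f) (h : ∀ x, ‖f x‖ ≤ G.indicator 1 x) : Integrable f :=
  ((integrable_indicator_iff hG).2 (integrableOn_const (C := (1 : ℝ)) hG' (by simp))).mono'
    hf.aestronglyMeasurable (.of_forall h)

theorem exists_restrictedBound (B : SchwartzMap ℝ ℂ) (hB : ∀ σ, B σ ≠ 0 → 1 / 8 < σ ∧ σ < 3 / 8)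
    {q : ℝ} (hq : 1 < q) : ∃ C, 0 < C ∧ ∀ K : ℕ, RestrictedBound (fun ν y =>
      dilAvg (fun σ => B σ * conj (B σ)) (fun κ => eChar κ y) ν (2 ^ (-K : ℤ)) (2 ^ (K : ℤ)))
          q C := by
  obtain ⟨Θ, ϑ, hΘ, -, hΘ1, hΘ2, -⟩ := exists_bump 0 1 2 one_pos one_lt_two
  obtain ⟨C1, hC1⟩ := exists_isProfile B
  obtain ⟨C2, hC2⟩ := exists_isProfile Θ
  have hb := hC1.mono (le_max_left C1 C2)
  have hϑ := hC2.mono (le_max_right C1 C2)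
  obtain ⟨C, hC, h⟩ := exists_restricted_bound (A := 2 ^ 24 * max C1 C2)
    (by nlinarith [hb.one_le]) hq
  refine ⟨C, hC, fun K G E hG hG' hE hE' => ?_⟩
  obtain ⟨E', hsub, hEm, hEE, h⟩ := h G E hG hG' hE hE'
  refine ⟨E', hsub, hEm, hEE, fun f w u V hf hfG hu hV hw hw1 => ?_⟩
  have hfi := integrable_of_norm_le_indicator hG hG' hf hfG
  have hE'f : volume E' ≠ ∞ := ne_top_of_le_ne_top hE' (measure_mono hsub)
  have hwi : IntegrableOn w E' :=
    (integrableOn_const (C := (1 : ℝ)) hE'f (by simp)).mono' hw.aestronglyMeasurable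
      (.of_forall hw1)
  have hW := hb.integrable_mul_conj
  have hms : ∀ ν, MeasurableSet (E' ∩ u ⁻¹' {ν}) := fun ν =>
    hEm.inter (hu (measurableSet_singleton ν))
  have hgi : ∀ ν, Integrable ((E' ∩ u ⁻¹' {ν}).indicator w) := fun ν =>
    (hwi.mono_set inter_subset_left).integrable_indicator (hms ν)
  have hc := continuous_pairDens hfi hEm hu hwi
  have hn := norm_pairDens_le f w E' u
  have hab : (2 : ℝ) ^ (-K : ℤ) ≤ 2 ^ (K : ℤ) := zpow_le_zpow_right₀ one_le_two (by lia)
  have key := norm_sum_integral_leftAvg_le (V := V) (H := pairDens f w E' u)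
    (X := C * (volume.real G ^ (1 / q) * volume.real E ^ (1 - 1 / q))) hW hc (fun ν => ⟨_, hn ν⟩)
    (fun lam hl1 hl2 η S => hb.norm_sum_pairDens_le (by linarith) hfi hEm hu hwi hV
      (fun t ht T => h _ _ _ (packets_wpk (η := η) hb hϑ hB
        (fun x hx => by rw [hΘ, hΘ1 x (by simpa using hx), Complex.ofReal_one])
        (fun x hx => by rw [hΘ, hΘ2 x (by simpa using hx), Complex.ofReal_zero]) hl1 hl2 ht)
        f _ w T hf hfG ((hu.const_mul lam).sub_const η) hw hw1) S) K
  refine le_of_eq_of_le ?_ key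
  congr 1
  change ∫ x in E', w x * dilConv (fun σ => B σ * conj (B σ)) (u x) _ _ f x = _
  simp_rw [← dilAvg_eq hW (hc _) (hn _) hab]
  have e : ∀ ν, dilAvg (fun σ => B σ * conj (B σ)) (pairDens f w E' u ν) ν (2 ^ (-K : ℤ))
      (2 ^ (K : ℤ)) = ∫ x, (E' ∩ u ⁻¹' {ν}).indicator w x *
        dilConv (fun σ => B σ * conj (B σ)) ν (2 ^ (-K : ℤ)) (2 ^ (K : ℤ)) f x := fun ν =>
    (integral_mul_dilConv hW hfi (hgi ν)).symm
  simp_rw [e]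
  rw [← integral_finsetSum, ← integral_indicator hEm]
  · congr 1; ext x
    rw [Finset.sum_eq_single_of_mem (u x) (hV x)]
    · by_cases hx : x ∈ E' <;> simp [indicator, hx]
    · intro ν _ hν
      simp [indicator, Ne.symm hν]
  · intro ν _
    obtain ⟨D, hD⟩ := exists_norm_dilAvg_le (fun σ => B σ * conj (B σ)) ν (2 ^ (-K : ℤ))
        (2 ^ (K : ℤ))
    exact (hgi ν).mul_bdd (continuous_dilConv hW hfi).aestronglyMeasurable
      (.of_forall (norm_dilConv_le hfi hD))

section maximal
variable {k : ℝ → ℝ → ℂ} {f : ℝ → ℂ} {V : Finset ℝ} {q C : ℝ}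

/-- The maximal convolution operator over finitely many kernels. -/
noncomputable def maxConv (k : ℝ → ℝ → ℂ) (V : Finset ℝ) (f : ℝ → ℂ) (x : ℝ) : ℝ≥0∞ :=
  V.sup fun ν => ‖∫ z, f z * k ν (x - z)‖ₑ

lemma measurable_conv (hk : ∀ ν, Measurable (k ν)) (hf : Measurable f) (ν : ℝ) :
    Measurable fun x => ∫ z, f z * k ν (x - z) := by
  refine (StronglyMeasurable.integral_prod_right (f := fun x z => f z * k ν (x - z))
    (Measurable.stronglyMeasurable ?_)).measurable
  have := hk ν
  simp only [Function.uncurry_def]; fun_prop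

lemma ofReal_lt_enorm_iff {α : ℝ} (hα : 0 ≤ α) (z : ℂ) : ENNReal.ofReal α < ‖z‖ₑ ↔ α < ‖z‖ := by
  rw [← ofReal_norm, ENNReal.ofReal_lt_ofReal_iff_of_nonneg hα]

lemma measurable_maxConv (hk : ∀ ν, Measurable (k ν)) (hf : Measurable f) :
    Measurable (maxConv k V f) := by
  have e : maxConv k V f = V.sup fun ν x => ‖∫ z, f z * k ν (x - z)‖ₑ := by
    ext x; simp [maxConv, Finset.sup_apply]
  rw [e]
  exact Finset.sup_induction measurable_const (fun _ h _ h' => h.sup h')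
    fun ν _ => (measurable_conv hk hf ν).enorm

/-- A measurable choice of an index at which a function exceeds `α`. -/
lemma exists_measurable_choice {F : ℝ → ℝ → ℂ} (hF : ∀ ν, Measurable (F ν)) (α : ℝ)
    (V : Finset ℝ) : ∃ u : ℝ → ℝ, Measurable u ∧ (∀ x, u x ∈ insert 0 V) ∧
      (Measurable fun x => F (u x) x) ∧ ∀ x, (∃ ν ∈ V, α < ‖F ν x‖) → α < ‖F (u x) x‖ := by
  classical
  induction V using Finset.induction_on with
  | empty => exact ⟨fun _ => 0, measurable_const, by simp, hF 0, by simp⟩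
  | insert a S _ ih =>
    obtain ⟨u, hu, huS, huF, h⟩ := ih
    have hs : MeasurableSet {x | α < ‖F a x‖} := measurableSet_lt measurable_const (hF a).norm
    refine ⟨fun x => if α < ‖F a x‖ then a else u x, Measurable.ite hs measurable_const hu,
      fun x => ?_, ?_, fun x hx => ?_⟩
    · have := huS x
      simp only [Finset.mem_insert] at this ⊢
      split_ifs <;> tauto
    · have e : (fun x => F (if α < ‖F a x‖ then a else u x) x) =
          fun x => if α < ‖F a x‖ then F a x else F (u x) x := by ext x; split_ifs <;> rfl
      rw [e]; exact Measurable.ite hs (hF a) huF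
    · by_cases hxa : α < ‖F a x‖
      · simp [hxa]
      · simp only [hxa, if_false]
        refine h x ?_
        obtain ⟨ν, hν, h'⟩ := hx
        rcases Finset.mem_insert.1 hν with rfl | hν
        · exact absurd h' hxa
        · exact ⟨ν, hν, h'⟩

lemma RestrictedBound.measureReal_le (h : RestrictedBound k q C) (hq : 1 < q) (hC : 0 < C)
    (hk : ∀ ν, Measurable (k ν)) (hD : ∀ ν, ∃ D, ∀ y, ‖k ν y‖ ≤ D) {G E : Set ℝ}
    (hG : MeasurableSet G) (hG' : volume G ≠ ∞) (hE : MeasurableSet E) (hE' : volume E ≠ ∞)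
    (hf : Measurable f) (hfG : ∀ x, ‖f x‖ ≤ G.indicator 1 x) {α : ℝ} (hα : 0 < α)
    (hM : ∀ x ∈ E, ∃ ν ∈ V, α < ‖∫ z, f z * k ν (x - z)‖) :
    volume.real E ≤ (2 * C / α) ^ q * volume.real G := by
  obtain ⟨E', hsub, hEm, hEE, h⟩ := h G E hG hG' hE hE'
  have hE'f : volume E' ≠ ∞ := ne_top_of_le_ne_top hE' (measure_mono hsub)
  obtain ⟨u, hu, huV, huF, hsel⟩ := exists_measurable_choice (measurable_conv hk hf) α V
  choose D hD using hD
  set T : ℝ → ℂ := fun x => ∫ z, f z * k (u x) (x - z) with hT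
  have hfi := integrable_of_norm_le_indicator hG hG' hf hfG
  have hTb : ∀ x, ‖T x‖ ≤ (∫ z, ‖f z‖) * ∑ ν ∈ insert 0 V, D ν := fun x => by
    refine (norm_integral_le_integral_norm _).trans ?_
    rw [← integral_mul_const]
    refine integral_mono_of_nonneg (.of_forall fun _ => norm_nonneg _) (hfi.norm.mul_const _)
      (.of_forall fun z => ?_)
    simp only [norm_mul]
    exact mul_le_mul_of_nonneg_left ((hD _ _).trans (Finset.single_le_sum (f := D)
      (fun ν _ => (norm_nonneg _).trans (hD ν 0)) (huV x))) (norm_nonneg _)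
  have hTi : IntegrableOn (fun x => ‖T x‖) E' :=
    (integrableOn_const (C := (∫ z, ‖f z‖) * ∑ ν ∈ insert 0 V, D ν) hE'f
      (by simp [ENNReal.mul_eq_top])).mono' huF.norm.aestronglyMeasurable (.of_forall fun x =>
          by simpa using hTb x)
  have h1 := h f (fun x => conj (T x) / (‖T x‖ : ℂ)) u (insert 0 V) hf hfG hu huV
    ((Complex.continuous_conj.measurable.comp huF).div
      (Complex.measurable_ofReal.comp huF.norm)) fun x => by
        rw [norm_div, RCLike.norm_conj, Complex.norm_real, norm_norm]; exact div_self_le_one _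
  have h2 : ∀ x, conj (T x) / (‖T x‖ : ℂ) * T x = (‖T x‖ : ℂ) := fun x => by
    rw [div_mul_eq_mul_div, mul_comm, Complex.mul_conj, Complex.normSq_eq_norm_sq]
    by_cases hx : ‖T x‖ = 0
    · simp [hx]
    · push_cast; field_simp
  change ‖∫ x in E', _ * T x‖ ≤ _ at h1
  simp_rw [h2] at h1
  rw [integral_complex_ofReal, Complex.norm_real] at h1
  have h3 := setIntegral_ge_of_const_le_real hEm hE'f (fun x hx => (hsel x (hM x (hsub hx))).le) hTi
  have h4 := h3.trans ((le_abs_self _).trans h1)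
  set e := volume.real E
  set g := volume.real G
  have he0 : 0 ≤ e := measureReal_nonneg
  have hg0 : 0 ≤ g := measureReal_nonneg
  rcases he0.eq_or_lt with he | he
  · rw [← he]; positivity
  have h5 : α * e ≤ 2 * C * (g ^ (1 / q) * e ^ (1 - 1 / q)) := by nlinarith
  have h6 : e = e ^ (1 / q) * e ^ (1 - 1 / q) := by
    rw [← Real.rpow_add he]; simp
  have h7 : 0 < e ^ (1 - 1 / q) := Real.rpow_pos_of_pos he _
  have h8 : e ^ (1 / q) ≤ 2 * C / α * g ^ (1 / q) := by
    rw [div_mul_eq_mul_div, le_div_iff₀ hα]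
    refine le_of_mul_le_mul_right ?_ h7
    rw [mul_right_comm, ← h6]; linarith
  have hq0 : q ≠ 0 := by linarith
  have h9 := Real.rpow_le_rpow (by positivity) h8 (by linarith : 0 ≤ q)
  rwa [Real.mul_rpow (by positivity) (by positivity), ← Real.rpow_mul he0, ← Real.rpow_mul hg0,
    one_div_mul_cancel hq0, Real.rpow_one, Real.rpow_one] at h9

/-- The restricted weak-type bound for the maximal operator. -/
lemma RestrictedBound.measure_maxConv_le (h : RestrictedBound k q C) (hq : 1 < q) (hC : 0 < C)
    (hk : ∀ ν, Measurable (k ν)) (hD : ∀ ν, ∃ D, ∀ y, ‖k ν y‖ ≤ D) {G : Set ℝ}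
    (hG : MeasurableSet G) (hG' : volume G ≠ ∞) (hf : Measurable f) {s α : ℝ} (hs : 0 < s)
    (hα : 0 < α) (hfG : ∀ x, ‖f x‖ ≤ G.indicator (fun _ => s) x) :
    volume {x | ENNReal.ofReal α < maxConv k V f x} ≤
      ENNReal.ofReal ((2 * C * s / α) ^ q) * volume G := by
  set S := {x | ENNReal.ofReal α < maxConv k V f x}
  have hS : MeasurableSet S := measurableSet_lt measurable_const (measurable_maxConv hk hf)
  have hSu : S = ⋃ n : ℕ, S ∩ Metric.ball 0 n := by
    rw [← inter_iUnion, Metric.iUnion_ball_nat, inter_univ]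
  rw [hSu, Monotone.measure_iUnion fun m n hmn => inter_subset_inter_right _
    (Metric.ball_subset_ball (by exact_mod_cast hmn))]
  refine iSup_le fun n => ?_
  have hfin : volume (S ∩ Metric.ball 0 n) ≠ ∞ :=
    ne_top_of_le_ne_top measure_ball_lt_top.ne (measure_mono inter_subset_right)
  have h1 := h.measureReal_le (V := V) (f := fun x => (s⁻¹ : ℝ) * f x) hq hC hk hD hG hG'
    (hS.inter Metric.isOpen_ball.measurableSet) hfin (hf.const_mul _) (fun x => ?_)
    (div_pos hα hs) fun x hx => ?_
  · rw [← ofReal_measureReal hfin, ← ofReal_measureReal hG', ← ENNReal.ofReal_mul (by positivity)]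
    rw [div_div_eq_mul_div] at h1
    exact ENNReal.ofReal_le_ofReal h1
  · have h2 := hfG x
    rw [norm_mul, Complex.norm_real, Real.norm_of_nonneg (by positivity)]
    by_cases hx : x ∈ G
    · simp only [indicator_of_mem hx, Pi.one_apply] at h2 ⊢
      rwa [inv_mul_le_iff₀ hs, mul_one]
    · simp only [indicator_of_notMem hx] at h2 ⊢
      rw [le_antisymm h2 (norm_nonneg _), mul_zero]
  · have h3 : ENNReal.ofReal α < V.sup fun ν => ‖∫ z, f z * k ν (x - z)‖ₑ := hx.1
    obtain ⟨ν, hν, h2⟩ := Finset.lt_sup_iff.1 h3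
    refine ⟨ν, hν, ?_⟩
    simp_rw [mul_assoc]
    rw [integral_const_mul, norm_mul, Complex.norm_real, Real.norm_of_nonneg (by positivity),
      div_eq_inv_mul]
    exact mul_lt_mul_of_pos_left ((ofReal_lt_enorm_iff hα.le _).1 h2) (by positivity)

end maximal

lemma summable_two_rpow_neg_abs {δ : ℝ} (hδ : 0 < δ) :
    Summable fun i : ℤ => (2 : ℝ) ^ (-δ * |(i : ℝ)|) := by
  have h : Summable fun n : ℕ => (2 : ℝ) ^ (-δ * (n : ℝ)) := by
    simp_rw [Real.rpow_mul zero_le_two, Real.rpow_natCast]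
    exact summable_geometric_of_lt_one (by positivity)
      (Real.rpow_lt_one_of_one_lt_of_neg one_lt_two (by linarith))
  refine Summable.of_nat_of_neg ?_ ?_ <;> simpa using h

/-- Interpolation of restricted weak-type bounds for the dyadic pieces of a function. -/
lemma exists_lintegral_rpow_le {p c : ℝ} (hp : 1 < p) (hc : 0 < c) : ∃ A : ℝ, 0 < A ∧
    ∀ (N : ℝ → ℝ≥0∞) (M : ℤ → ℝ → ℝ≥0∞) (g : ℤ → ℝ≥0∞), Measurable N → (∀ x, N x ≠ ∞) →
      (∀ x, N x ≤ ∑' j, M j x) → (∀ q ∈ ({(1 + p) / 2, 2 * p} : Set ℝ), ∀ j, ∀ α > (0 : ℝ),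
        volume {x | ENNReal.ofReal α < M j x} ≤
          ENNReal.ofReal ((c * 2 ^ (j : ℝ) / α) ^ q) * g j) →
      ∫⁻ x, N x ^ p ≤ ENNReal.ofReal A * ∑' j : ℤ, ENNReal.ofReal (2 ^ (j * p)) * g j := by
  set ε := (p - 1) / (4 * p) with hε
  have hε0 : 0 < ε := div_pos (by linarith) (by linarith)
  have hεp : ε * p = (p - 1) / 4 := by rw [hε]; field_simp
  have hε4 : ε ≤ 1 / 4 := by rw [hε, div_le_iff₀ (by linarith)]; linarith
  have hw := summable_two_rpow_neg_abs hε0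
  set B := ∑' i : ℤ, (2 : ℝ) ^ (-ε * |(i : ℝ)|)
  have hB : 0 < B := hw.tsum_pos (fun i => by positivity) 0 (by positivity)
  have hδ := summable_two_rpow_neg_abs (show 0 < (p - 1) / 4 by linarith)
  set D := ∑' i : ℤ, (2 : ℝ) ^ (-((p - 1) / 4) * |(i : ℝ)|)
  have hD : 0 < D := hδ.tsum_pos (fun i => by positivity) 0 (by positivity)
  set L := 2 ^ p * max 1 (c * B) ^ (2 * p) with hL
  have hL0 : 0 < L := by positivity
  refine ⟨L * D, by positivity, fun N M g hN hNf hNM hM => ?_⟩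
  have h1 : ∀ x, N x ^ p ≤ ∑' m : ℤ, {x | ENNReal.ofReal (2 ^ (m : ℝ)) < N x}.indicator
      (fun _ => ENNReal.ofReal (2 ^ ((m + 1) * p : ℝ))) x := fun x => by
    rcases eq_or_ne (N x) 0 with h | h
    · simp [h, ENNReal.zero_rpow_of_pos (by linarith : 0 < p)]
    obtain ⟨m, hm⟩ := exists_mem_Ioc_zpow (ENNReal.toReal_pos h (hNf x)) one_lt_two
    refine le_trans ?_ (ENNReal.le_tsum m)
    rw [indicator_of_mem (s := {x | _ < N x})]
    · rw [Real.rpow_mul zero_le_two, ← ENNReal.ofReal_rpow_of_pos (by positivity)]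
      refine ENNReal.rpow_le_rpow ?_ (by linarith)
      rw [← ENNReal.ofReal_toReal (hNf x)]
      refine ENNReal.ofReal_le_ofReal (hm.2.trans_eq ?_)
      exact_mod_cast (Real.rpow_intCast 2 (m + 1)).symm
    · rw [mem_ofPred_eq, ENNReal.ofReal_lt_iff_lt_toReal (by positivity) (hNf x),
        Real.rpow_intCast]
      exact hm.1
  have h2 : ∀ m : ℤ, {x | ENNReal.ofReal (2 ^ (m : ℝ)) < N x} ⊆ ⋃ i : ℤ,
      {x | ENNReal.ofReal (2 ^ (m : ℝ) / B * 2 ^ (-ε * |(i : ℝ)|)) < M (i + m) x} :=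
      fun m x hx => by
    by_contra! h
    simp only [mem_iUnion, mem_ofPred_eq, not_exists, not_lt] at h
    refine absurd (hNM x) (not_le.2 (lt_of_le_of_lt ?_ hx))
    rw [← (Equiv.addRight m).tsum_eq]
    refine (ENNReal.tsum_le_tsum h).trans_eq ?_
    rw [← ENNReal.ofReal_tsum_of_nonneg (fun i => by positivity) (hw.mul_left _), tsum_mul_left,
      div_mul_cancel₀ _ hB.ne']
  have h3 : ∀ m i : ℤ, ENNReal.ofReal (2 ^ ((m + 1) * p : ℝ)) *
      volume {x | ENNReal.ofReal (2 ^ (m : ℝ) / B * 2 ^ (-ε * |(i : ℝ)|)) < M (i + m) x} ≤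
      ENNReal.ofReal (L * 2 ^ (-((p - 1) / 4) * |(i : ℝ)|)) *
        (ENNReal.ofReal (2 ^ ((i + m : ℤ) * p)) * g (i + m)) := fun m i => by
    obtain ⟨q, hq, hq0, hq2, hqi⟩ : ∃ q ∈ ({(1 + p) / 2, 2 * p} : Set ℝ), 0 ≤ q ∧ q ≤ 2 * p ∧
        i * q + ε * |(i : ℝ)| * q ≤ i * p - (p - 1) / 4 * |(i : ℝ)| := by
      rcases le_or_gt 0 (i : ℝ) with hi | hi
      · refine ⟨_, Or.inl rfl, by linarith, by linarith, ?_⟩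
        rw [abs_of_nonneg hi]
        have : (i : ℝ) * ((p - 1) / 4 - ε * ((1 + p) / 2)) ≥ 0 :=
          mul_nonneg hi (by nlinarith)
        nlinarith
      · refine ⟨_, Or.inr rfl, by linarith, by linarith, ?_⟩
        rw [abs_of_neg hi]
        nlinarith
    refine (mul_le_mul_right (hM q hq _ _ (by positivity)) _).trans ?_
    rw [← mul_assoc, ← mul_assoc, ← ENNReal.ofReal_mul (by positivity),
      ← ENNReal.ofReal_mul (by positivity)]
    refine mul_le_mul_left (ENNReal.ofReal_le_ofReal ?_) _
    have e1 : c * 2 ^ ((i + m : ℤ) : ℝ) / (2 ^ (m : ℝ) / B * 2 ^ (-ε * |(i : ℝ)|)) =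
        c * B * 2 ^ (i + ε * |(i : ℝ)|) := by
      rw [neg_mul, Real.rpow_neg zero_le_two, Real.rpow_add two_pos, Int.cast_add,
        Real.rpow_add two_pos]
      field_simp
    rw [e1, Real.mul_rpow (by positivity) (by positivity), ← Real.rpow_mul zero_le_two]
    calc _ ≤ 2 ^ ((m + 1) * p) * (max 1 (c * B) ^ (2 * p) *
          2 ^ (i * p - (p - 1) / 4 * |(i : ℝ)|)) := by
          refine mul_le_mul_of_nonneg_left (mul_le_mul ?_ (Real.rpow_le_rpow_of_exponent_le
            one_le_two (by linarith)) (by positivity) (by positivity)) (by positivity)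
          exact (Real.rpow_le_rpow (by positivity) (le_max_right _ _) hq0).trans
            (Real.rpow_le_rpow_of_exponent_le (le_max_left _ _) hq2)
      _ = _ := by
          rw [hL, mul_left_comm, ← Real.rpow_add two_pos, mul_right_comm (2 ^ p), mul_right_comm,
            ← Real.rpow_add two_pos, ← Real.rpow_add two_pos, mul_comm]
          congr 2; push_cast; ring
  calc ∫⁻ x, N x ^ p ≤ ∑' m : ℤ, ENNReal.ofReal (2 ^ ((m + 1) * p : ℝ)) *
        volume {x | ENNReal.ofReal (2 ^ (m : ℝ)) < N x} := by
        refine (lintegral_mono h1).trans ?_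
        rw [lintegral_tsum fun m => (measurable_const.indicator
          (measurableSet_lt measurable_const hN)).aemeasurable]
        exact ENNReal.tsum_le_tsum fun m => lintegral_indicator_const_le _ _
    _ ≤ ∑' (m : ℤ) (i : ℤ), ENNReal.ofReal (L * 2 ^ (-((p - 1) / 4) * |(i : ℝ)|)) *
        (ENNReal.ofReal (2 ^ ((i + m : ℤ) * p)) * g (i + m)) := ENNReal.tsum_le_tsum fun m => by
        refine (mul_le_mul_right ((measure_mono (h2 m)).trans (measure_iUnion_le _)) _).trans ?_
        rw [← ENNReal.tsum_mul_left]
        exact ENNReal.tsum_le_tsum (h3 m)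
    _ = _ := by
        rw [ENNReal.tsum_comm]
        simp_rw [ENNReal.tsum_mul_left]
        have e : ∀ i : ℤ, ∑' m : ℤ, ENNReal.ofReal (2 ^ ((i + m : ℤ) * p)) * g (i + m) =
            ∑' j : ℤ, ENNReal.ofReal (2 ^ (j * p)) * g j := fun i => (Equiv.addLeft i).tsum_eq
          fun j : ℤ => ENNReal.ofReal (2 ^ (j * p)) * g j
        simp_rw [e]
        rw [ENNReal.tsum_mul_right, ← ENNReal.ofReal_tsum_of_nonneg (fun i => by positivity)
          (hδ.mul_left _), tsum_mul_left]

lemma RestrictedBound.mono {k : ℝ → ℝ → ℂ} {q C C' : ℝ} (h : RestrictedBound k q C)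
    (hC : C ≤ C') : RestrictedBound k q C' := fun G E hG hG' hE hE' => by
  obtain ⟨E', h1, h2, h3, h⟩ := h G E hG hG' hE hE'
  exact ⟨E', h1, h2, h3, fun f w u V hf hfG hu hV hw hw1 =>
    (h f w u V hf hfG hu hV hw hw1).trans (by gcongr)⟩

/-- The strong-type bound for the maximal operator. -/
theorem exists_lintegral_maxConv_le {p C : ℝ} (hp : 1 < p) (hC : 0 < C) : ∃ A : ℝ, 0 < A ∧
    ∀ k : ℝ → ℝ → ℂ, (∀ ν, Measurable (k ν)) → (∀ ν, ∃ D, ∀ y, ‖k ν y‖ ≤ D) →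
      RestrictedBound k ((1 + p) / 2) C → RestrictedBound k (2 * p) C →
      ∀ (V : Finset ℝ) (f : ℝ → ℂ), Measurable f → Integrable f →
        ∫⁻ x, maxConv k V f x ^ p ≤ ENNReal.ofReal A * ∫⁻ x, ‖f x‖ₑ ^ p := by
  obtain ⟨A, hA, h⟩ := exists_lintegral_rpow_le hp (show 0 < 4 * C by linarith)
  refine ⟨A, hA, fun k hk hD h0 h1 V f hf hfi => ?_⟩
  set G : ℤ → Set ℝ := fun j => (fun x => ‖f x‖) ⁻¹' Ioc (2 ^ j) (2 ^ (j + 1))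
  have hG : ∀ j, MeasurableSet (G j) := fun j => hf.norm measurableSet_Ioc
  have hGd : Pairwise (Function.onFun Disjoint G) := fun i j hij =>
    Set.disjoint_left.2 fun x hi hj => hij <| by
      have h1 := (zpow_lt_zpow_iff_right₀ one_lt_two).1 (hi.1.trans_le hj.2)
      have h2 := (zpow_lt_zpow_iff_right₀ one_lt_two).1 (hj.1.trans_le hi.2)
      lia
  have hGu : ∀ x ∉ ⋃ j, G j, f x = 0 := fun x hx => by
    by_contra h
    obtain ⟨m, hm⟩ := exists_mem_Ioc_zpow (norm_pos_iff.2 h) one_lt_two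
    exact hx (mem_iUnion.2 ⟨m, hm⟩)
  have hGf : ∀ j, volume (G j) ≠ ∞ := fun j =>
    ne_top_of_le_ne_top (hfi.measure_norm_ge_lt_top (show (0 : ℝ) < 2 ^ j by positivity)).ne
      (measure_mono fun x hx => hx.1.le)
  refine (h _ (fun j => maxConv k V ((G j).indicator f)) (fun j => volume (G j))
    (measurable_maxConv hk hf) (fun x => ?_) (fun x => ?_) (fun q hq j α hα => ?_)).trans ?_
  · exact ((Finset.sup_lt_iff ENNReal.coe_lt_top).2 fun ν _ => enorm_lt_top).ne
  · refine Finset.sup_le fun ν hν => ?_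
    have hi : Integrable fun z => f z * k ν (x - z) := by
      obtain ⟨D, hD⟩ := hD ν
      exact hfi.mul_bdd (c := D) ((hk ν).comp (measurable_const.sub measurable_id)).aestronglyMeasurable
        (.of_forall fun z => hD _)
    rw [← setIntegral_eq_integral_of_forall_compl_eq_zero (s := ⋃ j, G j) fun z hz => by
      rw [hGu z hz, zero_mul], integral_iUnion hG hGd hi.integrableOn]
    refine enorm_tsum_le_tsum_enorm.trans (ENNReal.tsum_le_tsum fun j => ?_)
    rw [← integral_indicator (hG j)]
    simp_rw [indicator_mul_left]
    exact Finset.le_sup (f := fun ν => ‖∫ z, (G j).indicator f z * k ν (x - z)‖ₑ) hν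
  · have hb : RestrictedBound k q C ∧ 1 < q := by
      rcases hq with rfl | rfl
      · exact ⟨h0, by linarith⟩
      · exact ⟨h1, by linarith⟩
    refine (hb.1.measure_maxConv_le hb.2 hC hk hD (hG j) (hGf j) (hf.indicator (hG j))
      (s := 2 ^ (j + 1)) (by positivity) hα fun x => ?_).trans_eq ?_
    · by_cases hx : x ∈ G j
      · rw [indicator_of_mem hx, indicator_of_mem hx]; exact hx.2
      · simp [hx]
    · rw [Real.rpow_intCast, zpow_add_one₀ two_ne_zero]
      ring_nf
  · refine mul_le_mul_right ?_ _
    calc _ ≤ ∑' j, ∫⁻ x in G j, ‖f x‖ₑ ^ p := ENNReal.tsum_le_tsum fun j => by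
          rw [← setLIntegral_const]
          refine setLIntegral_mono' (hG j) fun x hx => ?_
          rw [Real.rpow_mul zero_le_two, ← ENNReal.ofReal_rpow_of_pos (by positivity),
              ← ofReal_norm,
            Real.rpow_intCast]
          exact ENNReal.rpow_le_rpow (ENNReal.ofReal_le_ofReal hx.1.le) (by linarith)
      _ ≤ _ := by
          rw [← lintegral_iUnion hG hGd]
          exact setLIntegral_le_lintegral _ _

lemma integrable_fourierT (f : SchwartzMap ℝ ℂ) : Integrable (fourierT f) := by
  rw [fourierT_eq_fourier, ← SchwartzMap.fourier_coe]
  exact SchwartzMap.integrable _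

/-- The Carleson–Hunt theorem, for finitely many frequencies. -/
theorem exists_lintegral_sup_fproj_le {p : ℝ} (hp : 1 < p) : ∃ C : ℝ, 0 < C ∧
    ∀ (V : Finset ℝ) (f : SchwartzMap ℝ ℂ),
      ∫⁻ x, (V.sup fun ν => ‖fproj (Iic ν) f x‖ₑ) ^ p ≤ ENNReal.ofReal C * ∫⁻ x, ‖f x‖ₑ ^ p := by
  obtain ⟨B, β, hBβ, -, hβ1, hβ0, hβc⟩ := exists_bump (1 / 4) (1 / 16) (1 / 10) (by norm_num)
    (by norm_num)
  have hβs : ∀ σ, β σ ≠ 0 → 1 / 8 < σ ∧ σ < 3 / 8 := fun σ hσ => by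
    by_contra! h
    refine hσ (hβ0 σ ?_)
    rcases le_or_gt σ (1 / 8) with h1 | h1
    · rw [abs_of_nonpos] <;> linarith
    · rw [abs_of_nonneg] <;> linarith [h h1]
  have hB : ∀ σ, B σ ≠ 0 → 1 / 8 < σ ∧ σ < 3 / 8 := fun σ hσ =>
    hβs σ fun h => hσ (by rw [hBβ, h, Complex.ofReal_zero])
  obtain ⟨C0, hC0, h0⟩ := exists_restrictedBound B hB (show 1 < (1 + p) / 2 by linarith)
  obtain ⟨C1, hC1, h1⟩ := exists_restrictedBound B hB (show 1 < 2 * p by linarith)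
  obtain ⟨A, hA, h⟩ := exists_lintegral_maxConv_le hp (lt_max_of_lt_left hC0 : 0 < max C0 C1)
  set W : ℝ → ℂ := fun σ => B σ * conj (B σ) with hWdef
  obtain ⟨CB, hCB⟩ := exists_isProfile B
  have hW : Integrable W := hCB.integrable_mul_conj
  have hWs : ∀ σ, W σ ≠ 0 → 1 / 8 < σ ∧ σ < 3 / 8 := fun σ hσ => hB σ (left_ne_zero_of_mul hσ)
  set c := ∫ q : ℝ × ℝ, W q.2 * ((q.1 - q.2)⁻¹ : ℝ)
    ∂((volume.restrict (Ioc (1 / 2 : ℝ) 1)).prod volume) with hc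
  have hc0 : c ≠ 0 := by
    have e : W = fun σ => ((β σ ^ 2 : ℝ) : ℂ) := by
      ext σ; simp [hWdef, hBβ, sq]
    rw [hc, e]
    exact dilConst_ne_zero hβc hβ1 hβs
  have hc' : 0 < ‖c‖ := norm_pos_iff.2 hc0
  refine ⟨‖c‖⁻¹ ^ p * A, by positivity, fun V f => ?_⟩
  set k : ℕ → ℝ → ℝ → ℂ := fun K ν y =>
    dilAvg W (fun κ => eChar κ y) ν (2 ^ (-K : ℤ)) (2 ^ (K : ℤ))
  have hfm : Measurable f := f.continuous.measurable
  have hk : ∀ K ν, Measurable (k K ν) := fun K ν => measurable_dilAvg hW ν _ _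
  have hb : ∀ K, ∫⁻ x, maxConv (k K) V f x ^ p ≤ ENNReal.ofReal A * ∫⁻ x, ‖f x‖ₑ ^ p := fun K =>
    h (k K) (hk K) (fun ν => exists_norm_dilAvg_le W ν _ _)
      ((h0 K).mono (le_max_left _ _)) ((h1 K).mono (le_max_right _ _)) V f hfm f.integrable
  have hlim : ∀ x, Tendsto (fun K => maxConv (k K) V f x ^ p) atTop
      (𝓝 ((V.sup fun ν => ‖c * fproj (Iic ν) f x‖ₑ) ^ p)) := fun x => by
    refine ((ENNReal.continuous_rpow_const).tendsto _).comp
      (Tendsto.finset_sup_nhds_apply fun ν _ => Tendsto.enorm ?_)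
    change Tendsto (fun K : ℕ => dilConv W ν (2 ^ (-K : ℤ)) (2 ^ (K : ℤ)) f x) _ _
    simp_rw [dilConv_eq hW f.integrable]
    refine tendsto_dilAvg (D := ∫ z, ‖f z‖) hW hWs ?_ ?_ (fun κ => ?_) ν
    · exact (integrable_fourierT f).mul_bdd (c := 1) (by fun_prop) (.of_forall fun κ => by simp)
    · exact (continuous_fourierT f.integrable).mul (by fun_prop)
    · simpa using norm_fourierT_le f κ
  calc _ ≤ ∫⁻ x, ENNReal.ofReal (‖c‖⁻¹ ^ p) *
        liminf (fun K => maxConv (k K) V f x ^ p) atTop := by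
        refine lintegral_mono fun x => ?_
        rw [(hlim x).liminf_eq, ← ENNReal.ofReal_rpow_of_pos (by positivity),
          ← ENNReal.mul_rpow_of_nonneg _ _ (by linarith)]
        refine ENNReal.rpow_le_rpow (Finset.sup_le fun ν hν => ?_) (by linarith)
        refine le_trans (le_of_eq ?_) (mul_le_mul_right
          (Finset.le_sup (f := fun ν => ‖c * fproj (Iic ν) f x‖ₑ) hν) _)
        rw [← ofReal_norm, ← ofReal_norm, ← ENNReal.ofReal_mul (by positivity), norm_mul,
          inv_mul_cancel_left₀ hc'.ne']
    _ ≤ _ := by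
        rw [lintegral_const_mul' _ _ ENNReal.ofReal_ne_top, ENNReal.ofReal_mul (by positivity),
          mul_assoc]
        refine mul_le_mul_right ((lintegral_liminf_le fun K =>
          (measurable_maxConv (hk K) hfm).pow_const p).trans ?_) _
        exact liminf_le_of_le (by isBoundedDefault) fun b hb' =>
          (hb'.exists.choose_spec).trans (hb _)

open FourierTransform
open scoped SchwartzMap

lemma continuous_invF {a : ℝ → ℂ} (ha : Integrable a) : Continuous (invF a) :=
  continuous_of_dominated (fun x => ha.1.mul (by fun_prop)) (bound := fun ξ => ‖a ξ‖)
    (fun x => .of_forall fun ξ => by simp) ha.norm (.of_forall fun ξ => by fun_prop)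

lemma norm_invF_le (a : ℝ → ℂ) (x : ℝ) : ‖invF a x‖ ≤ ∫ ξ, ‖a ξ‖ :=
  (norm_integral_le_integral_norm _).trans_eq (by simp)

/-- The inverse Fourier transform on `L²` agrees with the integral on `L¹ ∩ L²`. -/
lemma fourierInv_toLp_ae_eq {a : ℝ → ℂ} (ha : Integrable a) (ha2 : MemLp a 2) :
    (𝓕⁻ (ha2.toLp a) : Lp ℂ 2 (volume : Measure ℝ)) =ᵐ[volume] invF a := by
  refine ae_eq_of_integral_contDiff_smul_eq ((Lp.memLp _).locallyIntegrable (by norm_num))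
    (continuous_invF ha).locallyIntegrable fun φ hφ hφc => ?_
  have hd : ContDiff ℝ (⊤ : ℕ∞) fun x => (φ x : ℂ) := Complex.ofRealCLM.contDiff.comp hφ
  have hc : HasCompactSupport fun x => (φ x : ℂ) := hφc.comp_left Complex.ofReal_zero
  set Φ : 𝓢(ℝ, ℂ) := hc.toSchwartzMap hd
  have hΦ : ∀ x, Φ x = φ x := fun x => rfl
  have h := congrArg (fun T => T Φ) (Lp.fourierInv_toTemperedDistribution_eq (ha2.toLp a))
  simp only [TemperedDistribution.fourierInv_apply, Lp.toTemperedDistribution_apply,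
    smul_eq_mul] at h
  simp_rw [Complex.real_smul, ← hΦ]
  rw [← h, integral_congr_ae (g := fun x => (𝓕⁻ Φ) x * a x)
    (by filter_upwards [ha2.coeFn_toLp] with x hx; rw [hx]), SchwartzMap.fourierInv_coe,
    ← invF_eq_fourierInv]
  refine Eq.trans (integral_congr_ae (.of_forall fun ξ => ?_)) (integral_mul_integral_swap
    (f := Φ) (k := fun x ξ => eChar ξ x) Φ.integrable ha (by fun_prop) (D := 1)
    fun x y => by simp).symm
  simp_rw [invF, fun x => eChar_comm x ξ]
  exact mul_comm _ _

lemma memLp_invF {a : ℝ → ℂ} (ha : Integrable a) (ha2 : MemLp a 2) : MemLp (invF a) 2 :=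
  (memLp_congr_ae (fourierInv_toLp_ae_eq ha ha2)).1 (Lp.memLp _)

/-- Parseval's identity on `L¹ ∩ L²`. -/
lemma integral_invF_mul_conj {a b : ℝ → ℂ} (ha : Integrable a) (ha2 : MemLp a 2)
    (hb : Integrable b) (hb2 : MemLp b 2) :
    ∫ x, invF a x * conj (invF b x) = ∫ ξ, a ξ * conj (b ξ) := by
  have h := Lp.inner_fourier_eq (𝓕⁻ (hb2.toLp b)) (𝓕⁻ (ha2.toLp a))
  rw [fourier_fourierInv_eq, fourier_fourierInv_eq, L2.inner_def, L2.inner_def] at h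
  simp only [RCLike.inner_apply] at h
  rw [integral_congr_ae (g := fun ξ => a ξ * conj (b ξ)),
    integral_congr_ae (f := fun x => _ * conj ((𝓕⁻ (hb2.toLp b) : Lp ℂ 2 volume) x))
    (g := fun ξ => invF a ξ * conj (invF b ξ))] at h
  · exact h.symm
  · filter_upwards [fourierInv_toLp_ae_eq ha ha2, fourierInv_toLp_ae_eq hb hb2] with x h1 h2
    rw [h1, h2]
  · filter_upwards [ha2.coeFn_toLp, hb2.coeFn_toLp] with x h1 h2
    rw [h1, h2]

lemma integral_invF_trilinear {a b c : ℝ → ℂ} (ha : Integrable a) (hb : Integrable b)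
    (hb2 : MemLp b 2) (hc : Integrable c) (hc2 : MemLp c 2) (t : ℝ) :
    ∫ x, invF a x * (invF b x * conj (invF c x) * eChar (-t) x) =
      ∫ ξ, a ξ * ∫ η, b η * conj (c (η + (ξ - t))) := by
  have hP : Integrable fun x => invF b x * conj (invF c x) * eChar (-t) x :=
    ((memLp_invF hb hb2).integrable_mul (memLp_invF hc hc2).star).mul_bdd (c := 1)
      (by fun_prop) (.of_forall fun x => by simp)
  simp_rw [mul_comm (invF a _)]
  refine (integral_mul_integral_swap (k := fun x ξ => eChar ξ x) hP ha (by fun_prop)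
    (D := 1) fun x y => by simp).trans (integral_congr_ae (.of_forall fun ξ => ?_))
  have hc' : Integrable fun η => c (η + (ξ - t)) := hc.comp_add_right _
  have hc2' : MemLp (fun η => c (η + (ξ - t))) 2 :=
    hc2.comp_measurePreserving (measurePreserving_add_right volume (ξ - t))
  simp only
  rw [← integral_invF_mul_conj hb hb2 hc' hc2']
  congr 2; ext x
  have e : invF (fun η => c (η + (ξ - t))) x = invF c x * eChar (t - ξ) x := by
    rw [invF, invF, ← integral_mul_const]
    rw [← integral_add_right_eq_self (fun η => c η * eChar η x * eChar (t - ξ) x) (ξ - t)]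
    congr 1; ext η
    rw [mul_assoc, ← eChar_add]; congr 2; ring
  rw [e, map_mul, conj_eChar, mul_assoc, mul_assoc, ← eChar_add]
  congr 3; ring

/-- Frequency localization of a trilinear form. -/
lemma integral_invF_localize {a b c : ℝ → ℂ} (ha : Integrable a) (hb : Integrable b)
    (hb2 : MemLp b 2) (hc : Integrable c) (hc2 : MemLp c 2) {t : ℝ} {S : Set ℝ}
    (hS : MeasurableSet S) (h : ∀ ξ η, a ξ ≠ 0 → b η ≠ 0 → η + (ξ - t) ∈ S) :
    ∫ x, invF a x * (invF b x * conj (invF c x) * eChar (-t) x) =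
      ∫ x, invF a x * (invF b x * conj (invF (S.indicator c) x) * eChar (-t) x) := by
  rw [integral_invF_trilinear ha hb hb2 hc hc2, integral_invF_trilinear ha hb hb2
    (hc.indicator hS) (hc2.indicator hS)]
  congr 1; ext ξ
  by_cases hξ : a ξ = 0
  · simp [hξ]
  congr 2; ext η
  by_cases hη : b η = 0
  · simp [hη]
  rw [indicator_of_mem (h ξ η hξ hη)]

/-- An `L^{p'}` bound follows by testing against Schwartz functions. -/
lemma eLpNorm_le_of_schwartz {p : ℝ} (hp : 1 < p) {F : ℝ → ℂ} (hFm : Measurable F)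
    (hF : MemLp F (ENNReal.ofReal (p / (p - 1)))) {K : ℝ≥0∞} (hK : K ≠ ∞)
    (h : ∀ g : 𝓢(ℝ, ℂ), ‖∫ x, F x * conj (g x)‖ₑ ≤ K * eLpNorm g (ENNReal.ofReal p) volume) :
    eLpNorm F (ENNReal.ofReal (p / (p - 1))) volume ≤ K := by
  set q := p / (p - 1) with hq
  have hp1 : 0 < p - 1 := by linarith
  have hq1 : 0 < q - 1 := by rw [hq, div_sub_one hp1.ne']; exact div_pos (by linarith) hp1
  have hpq : p.HolderConjugate q := .conjExponent hp
  have hpq' : p * (q - 1) = q := by rw [hq]; field_simp; ring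
  set X := eLpNorm F (ENNReal.ofReal q) volume with hX
  set F' : ℝ → ℂ := fun x => F x * (‖F x‖ ^ (q - 2) : ℝ)
  have hF'n : ∀ x, ‖F' x‖ = ‖F x‖ ^ (q - 1) := fun x => by
    rw [norm_mul, Complex.norm_real, Real.norm_of_nonneg (by positivity)]
    rcases (norm_nonneg (F x)).eq_or_lt with h0 | h0
    · rw [← h0, zero_mul, Real.zero_rpow hq1.ne']
    · rw [← Real.rpow_one_add' h0.le (by linarith)]; congr 1; ring
  have hF'X : eLpNorm F' (ENNReal.ofReal p) volume = X ^ (q - 1) := by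
    rw [← eLpNorm_norm, funext hF'n, eLpNorm_norm_rpow F hq1, ← ENNReal.ofReal_mul (by linarith),
      hpq']
  have hXt : X ≠ ∞ := hF.2.ne
  have hF'm : Measurable F' := by fun_prop
  have hF' : MemLp F' (ENNReal.ofReal p) :=
    ⟨hF'm.aestronglyMeasurable, hF'X ▸ (ENNReal.rpow_lt_top_of_nonneg hq1.le hXt)⟩
  have hq0 : (ENNReal.ofReal q) ≠ 0 := by simp; linarith
  have hp0 : (ENNReal.ofReal p) ≠ 0 := by simp; linarith
  have hH : ENNReal.HolderTriple (ENNReal.ofReal q) (ENNReal.ofReal p) 1 := ⟨by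
    rw [inv_one, ← ENNReal.ofReal_inv_of_pos (by linarith), ← ENNReal.ofReal_inv_of_pos
      (by linarith), ← ENNReal.ofReal_add (by positivity) (by positivity), add_comm,
      hpq.inv_add_inv_eq_one, ENNReal.ofReal_one]⟩
  have hInt : ∀ {g : ℝ → ℂ}, MemLp g (ENNReal.ofReal p) → Integrable fun x => F x * conj (g x) :=
    fun hg => hF.integrable_mul hg.star
  have hHo : ∀ {g : ℝ → ℂ}, MemLp g (ENNReal.ofReal p) →
      ‖∫ x, F x * conj (g x)‖ₑ ≤ X * eLpNorm g (ENNReal.ofReal p) volume := fun {g} hg => by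
    refine (enorm_integral_le_lintegral_enorm _).trans ?_
    rw [← eLpNorm_one_eq_lintegral_enorm]
    refine (eLpNorm_smul_le_mul_eLpNorm (p := ENNReal.ofReal q) (q := ENNReal.ofReal p)
      (r := 1) (φ := F) (f := star g) hg.star.1 hF.1).trans_eq ?_
    rw [eLpNorm_congr_norm_ae (f := star g) (g := g) (.of_forall fun x => by simp)]
  have hT : ‖∫ x, F x * conj (F' x)‖ₑ = X ^ q := by
    have e : ∀ x, F x * conj (F' x) = ((‖F x‖ ^ q : ℝ) : ℂ) := fun x => by
      rw [map_mul, Complex.conj_ofReal, ← mul_assoc, Complex.mul_conj, Complex.normSq_eq_norm_sq,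
        ← Complex.ofReal_mul]
      congr 1
      rcases (norm_nonneg (F x)).eq_or_lt with h0 | h0
      · rw [← h0, Real.zero_rpow (by linarith : 0 < q).ne']; simp
      · rw [← Real.rpow_natCast, ← Real.rpow_add h0]; norm_num
    simp_rw [e]
    rw [integral_complex_ofReal, ← ofReal_norm, Complex.norm_real, Real.norm_of_nonneg
      (integral_nonneg fun x => by positivity), hX, hF.eLpNorm_eq_integral_rpow_norm hq0
      ENNReal.ofReal_ne_top, ENNReal.toReal_ofReal (by linarith),
      ENNReal.ofReal_rpow_of_nonneg (by positivity) (by linarith), ← Real.rpow_mul (by positivity),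
      inv_mul_cancel₀ (by linarith), Real.rpow_one]
  have h1 : ∀ δ : ℝ, 0 < δ → X ^ q ≤ K * X ^ (q - 1) + (K + X) * ENNReal.ofReal δ := fun δ hδ => by
    obtain ⟨g, hg1, hg2, hg3⟩ := MemLp.exist_eLpNorm_sub_le ENNReal.ofReal_ne_top
      (by simpa using hp.le) hF' hδ
    set G : 𝓢(ℝ, ℂ) := hg1.toSchwartzMap hg2
    have hG : MemLp (fun x => G x) (ENNReal.ofReal p) := G.memLp _ _
    have e : ∫ x, F x * conj (F' x) = (∫ x, F x * conj (G x)) +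
        ∫ x, F x * conj (F' x - G x) := by
      rw [← integral_add (hInt hG) (hInt (g := fun x => F' x - G x) (hF'.sub hG))]
      congr 1; ext x
      rw [map_sub]; ring
    have hg3' : eLpNorm (fun x => F' x - G x) (ENNReal.ofReal p) volume ≤ ENNReal.ofReal δ := hg3
    rw [← hT, e, add_mul, ← add_assoc]
    refine (enorm_add_le _ _).trans (add_le_add ((h G).trans ?_)
      ((hHo (hF'.sub hG)).trans (mul_le_mul_right hg3' _)))
    rw [← mul_add]
    refine mul_le_mul_right ?_ _
    have : (G : ℝ → ℂ) = F' - fun x => F' x - G x := by ext x; simp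
    rw [this, ← hF'X]
    exact (eLpNorm_sub_le hF'.1 (hF'.sub hG).1 (by simpa using hp.le)).trans
      (add_le_add le_rfl hg3')
  have h2 : X ^ q ≤ K * X ^ (q - 1) := by
    refine ENNReal.le_of_forall_pos_le_add fun ε hε _ => ?_
    have hKX : K + X ≠ ∞ := ENNReal.add_ne_top.2 ⟨hK, hXt⟩
    refine (h1 (ε / ((K + X).toReal + 1)) (by positivity)).trans (add_le_add le_rfl ?_)
    rw [← ENNReal.ofReal_toReal hKX, ← ENNReal.ofReal_mul ENNReal.toReal_nonneg,
      ← ENNReal.ofReal_coe_nnreal, ENNReal.ofReal_toReal hKX]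
    refine ENNReal.ofReal_le_ofReal ?_
    rw [mul_div_left_comm]
    exact mul_le_of_le_one_right ε.2 ((div_le_one (by positivity)).2 (by linarith))
  rcases eq_or_ne X 0 with h0 | h0
  · simp [h0]
  have h3 : X ^ q = X * X ^ (q - 1) := by
    conv_lhs => rw [show q = 1 + (q - 1) by ring, ENNReal.rpow_add _ _ h0 hXt, ENNReal.rpow_one]
  rw [h3] at h2
  exact (ENNReal.mul_le_mul_iff_left (by simp [h0, hXt])
    (ENNReal.rpow_lt_top_of_nonneg hq1.le hXt).ne).1 h2

lemma fproj_eq_invF {S : Set ℝ} (hS : MeasurableSet S) (f : ℝ → ℂ) :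
    fproj S f = invF (S.indicator (fourierT f)) := by
  ext x
  rw [fproj, invF, ← integral_indicator hS]
  simp_rw [indicator_mul_left]

lemma memLp_fourierT (f : 𝓢(ℝ, ℂ)) : MemLp (fourierT f) 2 := by
  rw [fourierT_eq_fourier, ← SchwartzMap.fourier_coe]
  exact (𝓕 f : 𝓢(ℝ, ℂ)).memLp 2 volume

lemma invF_fourierT (f : 𝓢(ℝ, ℂ)) : invF (fourierT f) = f := by
  rw [fourierT_eq_fourier, invF_eq_fourierInv, ← SchwartzMap.fourier_coe,
    ← SchwartzMap.fourierInv_coe, fourierInv_fourier_eq]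

section fproj
variable (f : 𝓢(ℝ, ℂ)) {S : Set ℝ}

lemma continuous_fproj (hS : MeasurableSet S) : Continuous (fproj S f) := by
  rw [fproj_eq_invF hS]
  exact continuous_invF ((integrable_fourierT f).indicator hS)

lemma memLp_fproj (hS : MeasurableSet S) : MemLp (fproj S f) 2 := by
  rw [fproj_eq_invF hS]
  exact memLp_invF ((integrable_fourierT f).indicator hS) ((memLp_fourierT f).indicator hS)

lemma exists_norm_fproj_le (hS : MeasurableSet S) : ∃ D, ∀ x, ‖fproj S f x‖ ≤ D := by
  rw [fproj_eq_invF hS]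
  exact ⟨_, norm_invF_le _⟩

end fproj

lemma fproj_union (f : 𝓢(ℝ, ℂ)) {S T : Set ℝ} (hST : Disjoint S T) (hT : MeasurableSet T) (x : ℝ) :
    fproj (S ∪ T) f x = fproj S f x + fproj T f x := by
  have h : Integrable fun ξ => fourierT f ξ * eChar ξ x :=
    (integrable_fourierT f).mul_bdd (c := 1) (by fun_prop) (.of_forall fun ξ => by simp)
  exact setIntegral_union hST hT h.integrableOn h.integrableOn

lemma enorm_fproj_Ioc_le (f : 𝓢(ℝ, ℂ)) {a b : ℝ} (hab : a ≤ b) {V : Finset ℝ} (ha : a ∈ V)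
    (hb : b ∈ V) (x : ℝ) :
    ‖fproj (Ioc a b) f x‖ₑ ≤ 2 * V.sup fun ν => ‖fproj (Iic ν) f x‖ₑ := by
  have h := fproj_union f (S := Iic a) (T := Ioc a b) (Set.disjoint_left.2
    fun y h1 h2 => h2.1.not_ge h1) measurableSet_Ioc x
  rw [Iic_union_Ioc_eq_Iic hab] at h
  rw [← sub_eq_iff_eq_add'.2 h, two_mul]
  exact enorm_sub_le.trans (add_le_add (Finset.le_sup (f := fun ν => ‖fproj (Iic ν) f x‖ₑ) hb)
    (Finset.le_sup (f := fun ν => ‖fproj (Iic ν) f x‖ₑ) ha))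

lemma enorm_fproj_Ico_le {v : ℕ → ℝ} (hv : StrictMono v) (f : 𝓢(ℝ, ℂ)) (m n : ℕ) (x : ℝ) :
    ‖fproj (Ico (v m) (v (m + n))) f x‖ₑ ≤
      ∑ i ∈ Finset.range n, ‖fproj (Ico (v (m + i)) (v (m + i + 1))) f x‖ₑ := by
  induction n with
  | zero => simp [fproj]
  | succ n ih =>
    rw [Finset.sum_range_succ, ← add_assoc, ← Ico_union_Ico_eq_Ico (hv.monotone
      (Nat.le_add_right m n)) (hv.monotone (Nat.le_succ _)), fproj_union f
      (Ico_disjoint_Ico_same) measurableSet_Ico]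
    exact (enorm_add_le _ _).trans (add_le_add ih le_rfl)

lemma eLpNorm_ofReal {p : ℝ} (hp : 0 < p) (f : ℝ → ℂ) :
    eLpNorm f (ENNReal.ofReal p) volume = (∫⁻ x, ‖f x‖ₑ ^ p) ^ (1 / p) := by
  rw [eLpNorm_eq_lintegral_rpow_enorm_toReal (by simpa) ENNReal.ofReal_ne_top,
    ENNReal.toReal_ofReal hp.le]

/-- The Carleson–Hunt theorem in norm form. -/
lemma exists_lintegral_sup_fproj_rpow_le {p : ℝ} (hp : 1 < p) : ∃ C : ℝ, 0 < C ∧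
    ∀ (V : Finset ℝ) (f : 𝓢(ℝ, ℂ)), (∫⁻ x, (V.sup fun ν => ‖fproj (Iic ν) f x‖ₑ) ^ p) ^ (1 / p) ≤
      ENNReal.ofReal C * eLpNorm f (ENNReal.ofReal p) volume := by
  obtain ⟨C, hC, h⟩ := exists_lintegral_sup_fproj_le hp
  refine ⟨C ^ (1 / p), by positivity, fun V f => ?_⟩
  rw [eLpNorm_ofReal (by linarith), ← ENNReal.ofReal_rpow_of_pos hC,
    ← ENNReal.mul_rpow_of_nonneg _ _ (by positivity)]
  exact ENNReal.rpow_le_rpow (h V f) (by positivity)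

/-- The square function of the frequency projections onto consecutive intervals. -/
noncomputable def sqFun (v : ℕ → ℝ) (f : ℝ → ℂ) (x : ℝ) : ℝ≥0∞ :=
  ∑' k, ‖fproj (Ico (v k) (v (k + 1))) f x‖ₑ ^ 2

lemma measurable_sqFun (v : ℕ → ℝ) (f : 𝓢(ℝ, ℂ)) : Measurable (sqFun v f) :=
  Measurable.tsum fun _ =>
    ((continuous_fproj f measurableSet_Ico).measurable.enorm.pow_const 2)

lemma sum_mul_le_sqFun (v : ℕ → ℝ) (g h : ℝ → ℂ) (N a b : ℕ) (x : ℝ) :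
    ∑ j ∈ Finset.range N, ‖fproj (Ico (v (j + a)) (v (j + a + 1))) g x‖ₑ *
      ‖fproj (Ico (v (j + b)) (v (j + b + 1))) h x‖ₑ ≤
        sqFun v g x ^ (1 / 2 : ℝ) * sqFun v h x ^ (1 / 2 : ℝ) := by
  have key : ∀ (g : ℝ → ℂ) (a : ℕ), ∑ j ∈ Finset.range N,
      ‖fproj (Ico (v (j + a)) (v (j + a + 1))) g x‖ₑ ^ (2 : ℝ) ≤ sqFun v g x := fun g a => by
    simp_rw [ENNReal.rpow_two]
    exact (ENNReal.sum_le_tsum _).trans (ENNReal.tsum_comp_le_tsum_of_injective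
      (add_left_injective a) fun k => ‖fproj (Ico (v k) (v (k + 1))) g x‖ₑ ^ 2)
  exact (ENNReal.inner_le_Lp_mul_Lq _ _ _ .two_two).trans (mul_le_mul'
    (ENNReal.rpow_le_rpow (key g a) (by norm_num)) (ENNReal.rpow_le_rpow (key h b) (by norm_num)))

lemma connectedComponentIn_compl_closure_range {v : ℕ → ℝ} (hv : StrictMono v) (k : ℕ) :
    (v k + v (k + 1)) / 2 ∈ (closure (range v))ᶜ ∧
    connectedComponentIn (closure (range v))ᶜ ((v k + v (k + 1)) / 2) =
      Ioo (v k) (v (k + 1)) := by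
  have hk := hv (Nat.lt_succ_self k)
  have hsub : Ioo (v k) (v (k + 1)) ⊆ (closure (range v))ᶜ := by
    refine subset_compl_comm.1 (closure_minimal ?_ isOpen_Ioo.isClosed_compl)
    rintro _ ⟨j, rfl⟩ hj
    have h1 := hv.lt_iff_lt.1 hj.1
    have h2 := hv.lt_iff_lt.1 hj.2
    lia
  have hm : (v k + v (k + 1)) / 2 ∈ Ioo (v k) (v (k + 1)) := by
    constructor <;> simp only [Nat.succ_eq_add_one] at hk <;> linarith
  refine ⟨hsub hm, subset_antisymm (fun y hy => ?_)
    (isPreconnected_Ioo.subset_connectedComponentIn hm hsub)⟩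
  have hoc := (isPreconnected_connectedComponentIn
    (F := (closure (range v))ᶜ) (x := (v k + v (k + 1)) / 2)).ordConnected
  have hmc := mem_connectedComponentIn (hsub hm)
  have hnot : ∀ j, v j ∉ connectedComponentIn (closure (range v))ᶜ ((v k + v (k + 1)) / 2) :=
    fun j hj => connectedComponentIn_subset _ _ hj (subset_closure (mem_range_self j))
  constructor <;> by_contra! h
  · exact hnot k (hoc.out hy hmc ⟨h, hm.1.le⟩)
  · exact hnot (k + 1) (hoc.out hmc hy ⟨hm.2.le, h⟩)

lemma IsLPSeq.exists_lintegral_sqFun_le {v : ℕ → ℝ} (hv : StrictMono v) (h : IsLPSeq v) {p : ℝ}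
    (hp : 1 < p) : ∃ C : ℝ, 0 < C ∧ ∀ f : 𝓢(ℝ, ℂ), (∫⁻ x, sqFun v f x ^ (p / 2)) ^ (1 / p) ≤
      ENNReal.ofReal C * eLpNorm f (ENNReal.ofReal p) volume := by
  obtain ⟨_, _, C, hC, h⟩ := h.2.2 p hp
  refine ⟨C, hC, fun f => le_trans (ENNReal.rpow_le_rpow (lintegral_mono fun x =>
    ENNReal.rpow_le_rpow ?_ (by positivity)) (by positivity)) (h f).2⟩
  set i : ℕ → componentsOf (closure (range v))ᶜ := fun k =>
    ⟨Ioo (v k) (v (k + 1)), _, (connectedComponentIn_compl_closure_range hv k).1,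
      (connectedComponentIn_compl_closure_range hv k).2.symm⟩
  have hi : Function.Injective i := fun j k hjk => by
    have h1 : Ioo (v j) (v (j + 1)) = Ioo (v k) (v (k + 1)) := congrArg Subtype.val hjk
    have h2 := congrArg sInf h1
    rw [csInf_Ioo (hv (Nat.lt_succ_self _)), csInf_Ioo (hv (Nat.lt_succ_self _))] at h2
    exact hv.injective h2
  have e : sqFun v f x = ∑' k, (‖fproj (i k : Set ℝ) f x‖₊ : ℝ≥0∞) ^ 2 := by
    refine tsum_congr fun k => ?_
    rw [fproj, fproj, setIntegral_congr_set Ioo_ae_eq_Ico.symm]; rfl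
  rw [e]
  exact ENNReal.tsum_comp_le_tsum_of_injective hi fun ω => (‖fproj (ω : Set ℝ) f x‖₊ : ℝ≥0∞) ^ 2

lemma mink2_Ioc_Ico {a b c d : ℝ} {t : ℝ} (h1 : a + c < t) (h2 : t < b + d) (hab : a < b)
    (hcd : c < d) : -t ∈ mink2 (Ioc a b) (Ico c d) := by
  refine ⟨min b (t - c), ⟨lt_min hab (by linarith), min_le_left _ _⟩, t - min b (t - c),
    ⟨by linarith [min_le_right b (t - c)], ?_⟩, by ring⟩
  rcases min_choice b (t - c) with h | h <;> rw [h] <;> linarith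

/-- The frequency supports of the summands overlap boundedly often. -/
lemma exists_le_of_disjoint_Iuv {u v : ℕ → ℝ} (hu : StrictMono u) (hv : StrictMono v)
    (hsplit : ∃ n : ℕ, ∃ σ : ℕ → Fin n, ∀ j k : ℕ, 1 ≤ j → 1 ≤ k → j ≠ k → σ j = σ k →
      Disjoint (Iuv u v j) (Iuv u v k)) :
    ∃ n : ℕ, ∀ j, 1 ≤ j → u j + v (j + 1) ≤ u 0 + v (j + n) := by
  obtain ⟨n, σ, h⟩ := hsplit
  refine ⟨n, fun j hj => ?_⟩
  obtain ⟨a, b, hab, hσ⟩ := Fintype.exists_ne_map_eq_of_card_lt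
    (fun i : Fin (n + 1) => σ (j + i)) (by simp)
  wlog hlt : a < b generalizing a b
  · exact this b a hab.symm hσ.symm (lt_of_le_of_ne (not_lt.1 hlt) hab.symm)
  have hlt' : (a : ℕ) < b := hlt
  have hdis := h (j + a) (j + b) (by lia) (by lia) (by lia) hσ
  by_contra! hcon
  have h1 : v (j + b) ≤ v (j + n) := hv.monotone (by have := b.2; lia)
  have h2 : u j ≤ u (j + a) := hu.monotone (by lia)
  have h3 : v (j + 1) ≤ v (j + a + 1) := hv.monotone (by lia)
  have h4 : v (j + a) < v (j + b) := hv (by lia)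
  have h5 : v (j + a + 1) < v (j + b + 1) := hv (by lia)
  have h6 : u (j + a) < u (j + b) := hu (by lia)
  obtain ⟨t, ht1, ht2⟩ := exists_between (show u 0 + v (j + b) < u (j + a) + v (j + a + 1)
      by linarith)
  exact Set.disjoint_left.1 hdis (mink2_Ioc_Ico (by linarith) ht2 (hu (by lia))
    (hv (by lia))) (mink2_Ioc_Ico ht1 (by linarith) (hu (by lia)) (hv (by lia)))

lemma enorm_eChar (t x : ℝ) : ‖eChar t x‖ₑ = 1 := by
  rw [← ofReal_norm, norm_eChar, ENNReal.ofReal_one]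

lemma enorm_integral_fproj_mul_le (f g h : 𝓢(ℝ, ℂ)) {A B S : Set ℝ} (hA : MeasurableSet A)
    (hB : MeasurableSet B) (hS : MeasurableSet S) {t : ℝ}
    (hAB : ∀ ξ ∈ A, ∀ η ∈ B, η + (ξ - t) ∈ S) :
    ‖∫ x, fproj A f x * fproj B g x * eChar (-t) x * conj (h x)‖ₑ ≤
      ∫⁻ x, ‖fproj A f x‖ₑ * ‖fproj B g x‖ₑ * ‖fproj S h x‖ₑ := by
  have e : ∫ x, fproj A f x * fproj B g x * eChar (-t) x * conj (h x) =
      ∫ x, fproj A f x * (fproj B g x * conj (fproj S h x) * eChar (-t) x) := by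
    rw [fproj_eq_invF hA, fproj_eq_invF hB, fproj_eq_invF hS, ← integral_invF_localize
      ((integrable_fourierT f).indicator hA) ((integrable_fourierT g).indicator hB)
      ((memLp_fourierT g).indicator hB) (integrable_fourierT h) (memLp_fourierT h) hS
      (fun ξ η hξ hη => hAB ξ (mem_of_indicator_ne_zero hξ) η (mem_of_indicator_ne_zero hη)),
      invF_fourierT]
    exact integral_congr_ae (.of_forall fun x => by ring)
  rw [e]
  refine (enorm_integral_le_lintegral_enorm _).trans (lintegral_mono fun x => ?_)
  simp [enorm_mul, enorm_eChar, mul_assoc]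

/-- The partial sums of the paraproduct. -/
noncomputable def paraSum (u v : ℕ → ℝ) (f g : ℝ → ℂ) (N : ℕ) (x : ℝ) : ℂ :=
  ∑ j ∈ Finset.range N, fproj (Ioc (u 0) (u (j + 1))) f x * fproj (Ico (v (j + 1)) (v (j + 2))) g x

lemma sum_enorm_mul_le {u v : ℕ → ℝ} (hu : StrictMono u) (hv : StrictMono v) (n N : ℕ)
    (f g h : 𝓢(ℝ, ℂ)) (x : ℝ) :
    ∑ j ∈ Finset.range N, ‖fproj (Ioc (u 0) (u (j + 1))) f x‖ₑ *
      ‖fproj (Ico (v (j + 1)) (v (j + 2))) g x‖ₑ *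
        ‖fproj (Ico (v (j + 1)) (v (j + 1 + n))) h x‖ₑ ≤
    2 * n * (((Finset.range (N + 1)).image u).sup (fun ν => ‖fproj (Iic ν) f x‖ₑ) *
      (sqFun v g x ^ (1 / 2 : ℝ) * sqFun v h x ^ (1 / 2 : ℝ))) := by
  set M := ((Finset.range (N + 1)).image u).sup (fun ν => ‖fproj (Iic ν) f x‖ₑ)
  set Q := sqFun v g x ^ (1 / 2 : ℝ) * sqFun v h x ^ (1 / 2 : ℝ)
  calc _ ≤ ∑ j ∈ Finset.range N, 2 * M * (‖fproj (Ico (v (j + 1)) (v (j + 2))) g x‖ₑ *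
        ∑ i ∈ Finset.range n, ‖fproj (Ico (v (j + (1 + i))) (v (j + (1 + i) + 1))) h x‖ₑ) := by
        refine Finset.sum_le_sum fun j hj => ?_
        rw [mul_assoc]
        have hj := Finset.mem_range.1 hj
        refine mul_le_mul' (enorm_fproj_Ioc_le f (hu.monotone (Nat.zero_le _))
          (Finset.mem_image_of_mem _ (by simp)) (Finset.mem_image_of_mem _ (by simpa)) x)
          (mul_le_mul' le_rfl ?_)
        simp_rw [← add_assoc]
        exact enorm_fproj_Ico_le hv h (j + 1) n x
    _ = 2 * M * ∑ i ∈ Finset.range n, ∑ j ∈ Finset.range N,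
        ‖fproj (Ico (v (j + 1)) (v (j + 1 + 1))) g x‖ₑ *
          ‖fproj (Ico (v (j + (1 + i))) (v (j + (1 + i) + 1))) h x‖ₑ := by
        rw [← Finset.mul_sum, Finset.sum_comm]
        simp_rw [Finset.mul_sum]
    _ ≤ 2 * M * ∑ i ∈ Finset.range n, Q :=
        mul_le_mul' le_rfl (Finset.sum_le_sum fun i _ => sum_mul_le_sqFun v g h N 1 (1 + i) x)
    _ = _ := by
        rw [Finset.sum_const, Finset.card_range, nsmul_eq_mul]
        ring

lemma lintegral_mul_mul_le {p q r : ℝ} (hp : 0 < p) (hq : 0 < q) (hr : 0 < r)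
    (h : 1 / p + 1 / q + 1 / r = 1) {F G H : ℝ → ℝ≥0∞} (hF : AEMeasurable F)
    (hG : AEMeasurable G) (hH : AEMeasurable H) :
    ∫⁻ x, F x * (G x ^ (1 / 2 : ℝ) * H x ^ (1 / 2 : ℝ)) ≤ (∫⁻ x, F x ^ p) ^ (1 / p) *
      (∫⁻ x, G x ^ (q / 2)) ^ (1 / q) * (∫⁻ x, H x ^ (r / 2)) ^ (1 / r) := by
  have key := ENNReal.lintegral_prod_norm_pow_le (μ := volume) (Finset.univ : Finset (Fin 3))
    (f := ![fun x => F x ^ p, fun x => G x ^ (q / 2), fun x => H x ^ (r / 2)])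
    (p := ![1 / p, 1 / q, 1 / r])
    (by
      intro i _
      fin_cases i
      exacts [hF.pow_const _, hG.pow_const _, hH.pow_const _])
    (by simpa [Fin.sum_univ_three] using h)
    (by
      intro i _
      fin_cases i
      exacts [one_div_nonneg.2 hp.le, one_div_nonneg.2 hq.le, one_div_nonneg.2 hr.le])
  simp only [Fin.prod_univ_three, Matrix.cons_val] at key
  refine le_trans (lintegral_mono fun x => le_of_eq ?_) key
  simp only [← ENNReal.rpow_mul]
  rw [mul_one_div_cancel hp.ne', ENNReal.rpow_one, show q / 2 * (1 / q) = 1 / 2 by field_simp,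
    show r / 2 * (1 / r) = 1 / 2 by field_simp, mul_assoc]

lemma norm_indC_le (S : Set ℝ) (x : ℝ) : ‖indC S x‖ ≤ 1 := by
  unfold indC
  by_cases h : x ∈ S <;> simp [h]

lemma fproj_eq_integral_indC {S : Set ℝ} (hS : MeasurableSet S) (f : ℝ → ℂ) (x : ℝ) :
    fproj S f x = ∫ ξ, indC S ξ * (fourierT f ξ * eChar ξ x) := by
  rw [fproj, ← integral_indicator hS]
  refine integral_congr_ae (.of_forall fun ξ => ?_)
  by_cases h : ξ ∈ S <;> simp [indC, h]

lemma integrable_indC_mul {S : Set ℝ} (hS : MeasurableSet S) (f : 𝓢(ℝ, ℂ)) (x : ℝ) :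
    Integrable fun ξ => indC S ξ * (fourierT f ξ * eChar ξ x) :=
  ((integrable_fourierT f).mul_bdd (c := 1) (by fun_prop) (.of_forall fun ξ => by simp)).bdd_mul
    (c := 1) ((measurable_one.indicator hS).aestronglyMeasurable)
    (.of_forall (norm_indC_le S))

/-- The partial sums of the symbol `muv u v`. -/
noncomputable def muvSum (u v : ℕ → ℝ) (N : ℕ) (ξ η : ℝ) : ℂ :=
  ∑ j ∈ Finset.range N, indC (Ioc (u 0) (u (j + 1))) ξ * indC (Ico (v (j + 1)) (v (j + 2))) η

lemma exists_forall_ne_eq_zero (u : ℕ → ℝ) {v : ℕ → ℝ} (hv : StrictMono v) (ξ η : ℝ) :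
    ∃ k, ∀ j, j ≠ k →
      indC (Ioc (u 0) (u (j + 1))) ξ * indC (Ico (v (j + 1)) (v (j + 2))) η = 0 := by
  by_cases h : ∃ k, η ∈ Ico (v (k + 1)) (v (k + 2))
  · obtain ⟨k, hk⟩ := h
    refine ⟨k, fun j hj => ?_⟩
    have : η ∉ Ico (v (j + 1)) (v (j + 2)) := fun hj' => by
      have h1 := hv.lt_iff_lt.1 (hk.1.trans_lt hj'.2)
      have h2 := hv.lt_iff_lt.1 (hj'.1.trans_lt hk.2)
      lia
    simp [indC, this]
  · push Not at h
    exact ⟨0, fun j _ => by simp [indC, h j]⟩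

lemma norm_muvSum_le (u : ℕ → ℝ) {v : ℕ → ℝ} (hv : StrictMono v) (N : ℕ) (ξ η : ℝ) :
    ‖muvSum u v N ξ η‖ ≤ 1 := by
  obtain ⟨k, hk⟩ := exists_forall_ne_eq_zero u hv ξ η
  unfold muvSum
  by_cases h : k ∈ Finset.range N
  · rw [Finset.sum_eq_single_of_mem k h fun j _ hj => hk j hj, norm_mul]
    exact mul_le_one₀ (norm_indC_le _ _) (norm_nonneg _) (norm_indC_le _ _)
  · rw [Finset.sum_eq_zero fun j hj => hk j (ne_of_mem_of_not_mem hj h)]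
    simp

lemma tendsto_muvSum (u : ℕ → ℝ) {v : ℕ → ℝ} (hv : StrictMono v) (ξ η : ℝ) :
    Tendsto (fun N => muvSum u v N ξ η) atTop (𝓝 (muv u v ξ η)) := by
  obtain ⟨k, hk⟩ := exists_forall_ne_eq_zero u hv ξ η
  exact (hasSum_single k hk).summable.hasSum.tendsto_sum_nat

lemma integral_muvSum_mul (u v : ℕ → ℝ) (f : ℝ → ℂ) (g : 𝓢(ℝ, ℂ)) (N : ℕ) (x ξ : ℝ) :
    ∫ η, muvSum u v N ξ η * fourierT f ξ * fourierT g η * eChar (ξ + η) x =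
      ∑ j ∈ Finset.range N, indC (Ioc (u 0) (u (j + 1))) ξ * (fourierT f ξ * eChar ξ x) *
        fproj (Ico (v (j + 1)) (v (j + 2))) g x := by
  simp_rw [fproj_eq_integral_indC measurableSet_Ico, ← integral_const_mul]
  rw [← integral_finsetSum _ fun j _ => (integrable_indC_mul measurableSet_Ico g x).const_mul _]
  refine integral_congr_ae (.of_forall fun η => ?_)
  simp_rw [muvSum, Finset.sum_mul, eChar_add]
  exact Finset.sum_congr rfl fun j _ => by ring

lemma tendsto_paraSum (u : ℕ → ℝ) {v : ℕ → ℝ} (hv : StrictMono v) (f g : 𝓢(ℝ, ℂ)) (x : ℝ) :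
    Tendsto (fun N => paraSum u v f g N x) atTop (𝓝 (Bm (muv u v) f g x)) := by
  have hInt : ∀ N, Integrable fun ξ => ∑ j ∈ Finset.range N,
      indC (Ioc (u 0) (u (j + 1))) ξ * (fourierT f ξ * eChar ξ x) *
        fproj (Ico (v (j + 1)) (v (j + 2))) g x := fun N =>
    integrable_finsetSum _ fun j _ => (integrable_indC_mul measurableSet_Ioc f x).mul_const _
  have hbd : ∀ N ξ η, ‖muvSum u v N ξ η * fourierT f ξ * fourierT g η * eChar (ξ + η) x‖ ≤
      ‖fourierT f ξ‖ * ‖fourierT g η‖ := fun N ξ η => by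
    rw [norm_mul, norm_mul, norm_mul, norm_eChar, mul_one]
    gcongr
    exact mul_le_of_le_one_left (norm_nonneg _) (norm_muvSum_le u hv N ξ η)
  have e : (fun N => paraSum u v f g N x) = fun N => ∫ ξ, ∫ η,
      muvSum u v N ξ η * fourierT f ξ * fourierT g η * eChar (ξ + η) x := by
    ext N
    simp_rw [integral_muvSum_mul]
    rw [integral_finsetSum _ fun j _ => (integrable_indC_mul measurableSet_Ioc f x).mul_const _]
    simp_rw [integral_mul_const, ← fproj_eq_integral_indC measurableSet_Ioc]
    rfl
  rw [e]
  refine tendsto_integral_of_dominated_convergence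
    (fun ξ => ‖fourierT f ξ‖ * ∫ η, ‖fourierT g η‖) (fun N => ?_)
    ((integrable_fourierT f).norm.mul_const _) (fun N => .of_forall fun ξ => ?_)
    (.of_forall fun ξ => ?_)
  · simp_rw [integral_muvSum_mul]
    exact (hInt N).aestronglyMeasurable
  · rw [← integral_const_mul]
    exact norm_integral_le_of_norm_le ((integrable_fourierT g).norm.const_mul _)
      (.of_forall (hbd N ξ))
  · have hm : Continuous (fourierT g) := continuous_fourierT g.integrable
    refine tendsto_integral_of_dominated_convergence
      (fun η => ‖fourierT f ξ‖ * ‖fourierT g η‖) (fun N => ?_)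
      ((integrable_fourierT g).norm.const_mul _) (fun N => .of_forall (hbd N ξ))
      (.of_forall fun η => (((tendsto_muvSum u hv ξ η).mul_const _).mul_const _).mul_const _)
    have : Measurable (muvSum u v N ξ) := Finset.measurable_sum _ fun j _ =>
      (measurable_one.indicator measurableSet_Ico).const_mul _
    exact (((this.mul_const _).mul hm.measurable).mul (by fun_prop)).aestronglyMeasurable

lemma memLp_of_integrable_of_bound {F : ℝ → ℂ} (hF : Integrable F) {D : ℝ} (hD : ∀ x, ‖F x‖ ≤ D)
    {q : ℝ} (hq : 1 ≤ q) : MemLp F (ENNReal.ofReal q) := by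
  refine ⟨hF.1, ?_⟩
  rw [eLpNorm_ofReal (by linarith)]
  refine ENNReal.rpow_lt_top_of_nonneg (by positivity) (ne_of_lt ?_)
  calc ∫⁻ x, ‖F x‖ₑ ^ q ≤ ∫⁻ x, ENNReal.ofReal D ^ (q - 1) * ‖F x‖ₑ := by
        refine lintegral_mono fun x => ?_
        rw [show q = (q - 1) + 1 by ring, ENNReal.rpow_add_of_nonneg _ _ (by linarith) zero_le_one,
          ENNReal.rpow_one, add_sub_cancel_right, ← ofReal_norm]
        gcongr
        exact hD x
    _ = ENNReal.ofReal D ^ (q - 1) * ∫⁻ x, ‖F x‖ₑ := lintegral_const_mul'' _ hF.1.enorm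
    _ < ∞ := ENNReal.mul_lt_top (ENNReal.rpow_lt_top_of_nonneg (by linarith) ENNReal.ofReal_ne_top)
        hF.2

lemma memLp_fproj_mul (f g : 𝓢(ℝ, ℂ)) {A B : Set ℝ} (hA : MeasurableSet A)
    (hB : MeasurableSet B) {q : ℝ} (hq : 1 ≤ q) :
    MemLp (fun x => fproj A f x * fproj B g x) (ENNReal.ofReal q) := by
  obtain ⟨D, hD⟩ := exists_norm_fproj_le f hA
  obtain ⟨D', hD'⟩ := exists_norm_fproj_le g hB
  refine memLp_of_integrable_of_bound ((memLp_fproj f hA).integrable_mul (memLp_fproj g hB))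
    (D := D * D') (fun x => ?_) hq
  rw [Pi.mul_apply, norm_mul]
  exact mul_le_mul (hD x) (hD' x) (norm_nonneg _) ((norm_nonneg _).trans (hD x))

lemma continuous_paraSum (u v : ℕ → ℝ) (f g : 𝓢(ℝ, ℂ)) (N : ℕ) :
    Continuous (paraSum u v f g N) :=
  continuous_finsetSum _ fun _ _ =>
    (continuous_fproj f measurableSet_Ioc).mul (continuous_fproj g measurableSet_Ico)

lemma memLp_paraSum (u v : ℕ → ℝ) (f g : 𝓢(ℝ, ℂ)) (N : ℕ) {q : ℝ} (hq : 1 ≤ q) :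
    MemLp (paraSum u v f g N) (ENNReal.ofReal q) :=
  memLp_finsetSum _ fun _ _ => memLp_fproj_mul f g measurableSet_Ioc measurableSet_Ico hq

lemma enorm_integral_paraSum_le {u v : ℕ → ℝ} (hu : StrictMono u) (hv : StrictMono v) {n : ℕ}
    (hn : ∀ j, 1 ≤ j → u j + v (j + 1) ≤ u 0 + v (j + n)) (f g h : 𝓢(ℝ, ℂ)) (N : ℕ) :
    ‖∫ x, paraSum u v f g N x * eChar (-u 0) x * conj (h x)‖ₑ ≤
      2 * n * ∫⁻ x, ((Finset.range (N + 1)).image u).sup (fun ν => ‖fproj (Iic ν) f x‖ₑ) *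
        (sqFun v g x ^ (1 / 2 : ℝ) * sqFun v h x ^ (1 / 2 : ℝ)) := by
  have hInt : ∀ j ∈ Finset.range N, Integrable fun x => fproj (Ioc (u 0) (u (j + 1))) f x *
      fproj (Ico (v (j + 1)) (v (j + 2))) g x * eChar (-u 0) x * conj (h x) := fun j _ => by
    obtain ⟨D, hD⟩ := exists_norm_fproj_le f (measurableSet_Ioc (a := u 0) (b := u (j + 1)))
    have hb := ((memLp_fproj g (measurableSet_Ico (a := v (j + 1)) (b := v (j + 2)))).integrable_mul
      (h.memLp 2 volume).star).bdd_mul (c := D) ((continuous_fproj f measurableSet_Ioc).mul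
        (g := eChar (-u 0)) (by fun_prop)).aestronglyMeasurable (.of_forall fun x => by
          simpa using hD x)
    refine hb.congr (.of_forall fun x => ?_)
    simp only [Pi.mul_apply, Pi.star_apply, starRingEnd_apply]
    ring
  have hm : ∀ j, AEMeasurable fun x => ‖fproj (Ioc (u 0) (u (j + 1))) f x‖ₑ *
      ‖fproj (Ico (v (j + 1)) (v (j + 2))) g x‖ₑ *
        ‖fproj (Ico (v (j + 1)) (v (j + 1 + n))) h x‖ₑ := fun j =>
    (((continuous_fproj f measurableSet_Ioc).measurable.enorm.mul
      (continuous_fproj g measurableSet_Ico).measurable.enorm).mul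
        (continuous_fproj h measurableSet_Ico).measurable.enorm).aemeasurable
  simp_rw [paraSum, Finset.sum_mul]
  rw [integral_finsetSum _ hInt, ← lintegral_const_mul' _ _ (by finiteness)]
  refine (enorm_sum_le _ _).trans ((Finset.sum_le_sum fun j _ => enorm_integral_fproj_mul_le f g h
    measurableSet_Ioc measurableSet_Ico (measurableSet_Ico (a := v (j + 1)) (b := v (j + 1 + n)))
    fun ξ hξ η hη => ⟨by linarith [hξ.1, hη.1], ?_⟩).trans ?_)
  · linarith [hξ.2, hη.2, hn (j + 1) (by lia)]
  · rw [← lintegral_finsetSum' _ fun j _ => hm j]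
    exact lintegral_mono fun x => sum_enorm_mul_le hu hv n N f g h x

lemma exists_eLpNorm_paraSum_le {u v : ℕ → ℝ} (hu : StrictMono u) (hv : StrictMono v)
    (hsplit : ∃ n : ℕ, ∃ σ : ℕ → Fin n, ∀ j k : ℕ, 1 ≤ j → 1 ≤ k → j ≠ k → σ j = σ k →
      Disjoint (Iuv u v j) (Iuv u v k)) (hLP : IsLPSeq v) {p1 p2 p3 : ℝ} (hp1 : 1 < p1)
    (hp2 : 1 < p2) (hp3 : 1 < p3) (hsum : 1 / p1 + 1 / p2 + 1 / p3 = 1) :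
    ∃ C : ℝ, 0 < C ∧ ∀ (f g : 𝓢(ℝ, ℂ)) (N : ℕ),
      eLpNorm (paraSum u v f g N) (ENNReal.ofReal (p3 / (p3 - 1))) volume ≤
        ENNReal.ofReal C * eLpNorm f (ENNReal.ofReal p1) volume *
          eLpNorm g (ENNReal.ofReal p2) volume := by
  obtain ⟨n, hn⟩ := exists_le_of_disjoint_Iuv hu hv hsplit
  obtain ⟨C₁, hC₁, h₁⟩ := exists_lintegral_sup_fproj_rpow_le hp1
  obtain ⟨C₂, hC₂, h₂⟩ := hLP.exists_lintegral_sqFun_le hv hp2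
  obtain ⟨C₃, hC₃, h₃⟩ := hLP.exists_lintegral_sqFun_le hv hp3
  refine ⟨2 * (n + 1) * (C₁ * C₂ * C₃), by positivity, fun f g N => ?_⟩
  have hq : 1 ≤ p3 / (p3 - 1) := (one_le_div (by linarith)).2 (by linarith)
  have hc : Continuous fun x => paraSum u v f g N x * eChar (-u 0) x :=
    (continuous_paraSum u v f g N).mul (by fun_prop)
  have hnorm : ∀ᵐ x, ‖paraSum u v f g N x‖ = ‖paraSum u v f g N x * eChar (-u 0) x‖ :=
    .of_forall fun x => by simp
  rw [eLpNorm_congr_norm_ae hnorm]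
  refine eLpNorm_le_of_schwartz hp3 hc.measurable ((memLp_paraSum u v f g N hq).congr_norm
    hc.aestronglyMeasurable hnorm) ?_ fun h => ?_
  · have := (f.memLp (ENNReal.ofReal p1) volume).2.ne
    have := (g.memLp (ENNReal.ofReal p2) volume).2.ne
    finiteness
  refine (enorm_integral_paraSum_le hu hv hn f g h N).trans ?_
  have hM : Measurable fun x =>
      ((Finset.range (N + 1)).image u).sup fun ν => ‖fproj (Iic ν) f x‖ₑ := by
    have e' : (fun x => ((Finset.range (N + 1)).image u).sup fun ν => ‖fproj (Iic ν) f x‖ₑ) =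
        ((Finset.range (N + 1)).image u).sup fun ν x => ‖fproj (Iic ν) f x‖ₑ := by
      ext x
      rw [Finset.sup_apply]
    rw [e']
    exact Finset.sup_induction measurable_const (fun _ h _ h' => h.sup h')
      fun ν _ => (continuous_fproj f measurableSet_Iic).measurable.enorm
  have hH := (lintegral_mul_mul_le (zero_lt_one.trans hp1) (zero_lt_one.trans hp2)
    (zero_lt_one.trans hp3) hsum hM.aemeasurable (measurable_sqFun v g).aemeasurable
    (measurable_sqFun v h).aemeasurable).trans
      (mul_le_mul' (mul_le_mul' (h₁ _ f) (h₂ g)) (h₃ h))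
  refine (mul_le_mul' le_rfl hH).trans ?_
  have e : ENNReal.ofReal (2 * (n + 1) * (C₁ * C₂ * C₃)) =
      2 * (n + 1) * (ENNReal.ofReal C₁ * ENNReal.ofReal C₂ * ENNReal.ofReal C₃) := by
    rw [ENNReal.ofReal_mul (by positivity), ENNReal.ofReal_mul zero_le_two,
      ENNReal.ofReal_mul (by positivity), ENNReal.ofReal_mul hC₁.le,
          ENNReal.ofReal_add (by positivity) zero_le_one]
    simp
  rw [e]
  refine (mul_le_mul' (mul_le_mul' le_rfl (le_self_add (b := (1 : ℝ≥0∞)))) le_rfl).trans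
    (le_of_eq ?_)
  ring

/-- Theorem 2.2 (`v` Littlewood--Paley): the paraproduct bound for `B_{m̃_{u,v}}` extends to
`1 < p₁, p₂ < ∞`, `2 ≤ p₃ < ∞`. -/
theorem paraproduct_increasing_LP_bound (u v : ℕ → ℝ) (hu : StrictMono u) (hv : StrictMono v)
    (hsplit : ∃ n : ℕ, ∃ σ : ℕ → Fin n, ∀ j k : ℕ, 1 ≤ j → 1 ≤ k → j ≠ k → σ j = σ k →
      Disjoint (Iuv u v j) (Iuv u v k))
    (hLP : IsLPSeq v)
    (p1 p2 p3 : ℝ) (hp1 : 1 < p1) (hp2 : 1 < p2) (hp3 : 2 ≤ p3)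
    (hsum : 1 / p1 + 1 / p2 + 1 / p3 = 1) :
    ∃ C : ℝ, 0 < C ∧
      ∀ f g : SchwartzMap ℝ ℂ,
        eLpNorm (Bm (muv u v) (⇑f) (⇑g)) (ENNReal.ofReal (p3 / (p3 - 1))) volume ≤
          ENNReal.ofReal C * eLpNorm (⇑f) (ENNReal.ofReal p1) volume *
            eLpNorm (⇑g) (ENNReal.ofReal p2) volume := by
  obtain ⟨C, hC, h⟩ := exists_eLpNorm_paraSum_le hu hv hsplit hLP hp1 hp2 (by linarith) hsum
  refine ⟨C, hC, fun f g => (Lp.eLpNorm_lim_le_liminf_eLpNorm (fun N =>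
    (continuous_paraSum u v f g N).aestronglyMeasurable) _
      (.of_forall (tendsto_paraSum u hv f g))).trans ?_⟩
  exact liminf_le_of_frequently_le' (.of_forall (h f g))
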